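/- Let L be an odd indefinite lattice of rank r whose discriminant group A(L) can be generated by at most r − 3 elements. Then every odd lattice L' of rank r with the same signature as L for which there exists a group isomorphism A(L) → A(L') preserving the discriminant bilinear forms is isometric to L. -/

import Mathlib

open Matrix

/-- Componentwise coercion `ℤⁿ → ℚⁿ`. -/
def ratify {n : ℕ} (x : Fin n → ℤ) : Fin n → ℚ := fun i => (x i : ℚ)

/-- The discriminant group `A(L) = L*/L` of the lattice `ℤⁿ` with Gram matrix `G`,
presented as the cokernel `ℤⁿ/G·ℤⁿ` (multiplication by `G` identifies `L*/L` with
this cokernel when `det G ≠ 0`). -/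
def DiscGroup {n : ℕ} (G : Matrix (Fin n) (Fin n) ℤ) :=
  (Fin n → ℤ) ⧸ LinearMap.range (Matrix.mulVecLin G)

instance {n : ℕ} (G : Matrix (Fin n) (Fin n) ℤ) : AddCommGroup (DiscGroup G) :=
  inferInstanceAs (AddCommGroup ((Fin n → ℤ) ⧸ LinearMap.range (Matrix.mulVecLin G)))

instance {n : ℕ} (G : Matrix (Fin n) (Fin n) ℤ) : Module ℤ (DiscGroup G) :=
  inferInstanceAs (Module ℤ ((Fin n → ℤ) ⧸ LinearMap.range (Matrix.mulVecLin G)))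

/-- The class of `u ∈ ℤⁿ` in the discriminant group. -/
def discMk {n : ℕ} (G : Matrix (Fin n) (Fin n) ℤ) (u : Fin n → ℤ) : DiscGroup G :=
  Submodule.Quotient.mk u

/-- The discriminant bilinear form `b_L : A(L) × A(L) → ℚ/ℤ` in the cokernel
presentation: the classes of `u, v` (corresponding to `G⁻¹u, G⁻¹v ∈ L*`) pair to
`uᵀ G⁻¹ v mod ℤ`. -/
noncomputable def discBil {n : ℕ} (G : Matrix (Fin n) (Fin n) ℤ) (u v : Fin n → ℤ) :
    AddCircle (1 : ℚ) :=
  ((ratify u ⬝ᵥ ((G.map (Int.cast : ℤ → ℚ))⁻¹).mulVec (ratify v) : ℚ) : AddCircle (1 : ℚ))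

/-- `G` has signature `(p, q)`: over `ℝ` the form is congruent to a diagonal form with
`p` entries `+1` and `q` entries `−1`. -/
def HasSignature {n : ℕ} (G : Matrix (Fin n) (Fin n) ℤ) (p q : ℕ) : Prop :=
  ∃ (P : Matrix (Fin n) (Fin n) ℝ) (d : Fin n → ℝ), IsUnit P.det ∧
    (∀ i, d i = 1 ∨ d i = -1) ∧
    (Finset.univ.filter fun i => d i = 1).card = p ∧
    (Finset.univ.filter fun i => d i = -1).card = q ∧
    P.transpose * (G.map (Int.cast : ℤ → ℝ)) * P = Matrix.diagonal d

/-- Every functional becomes representable after multiplication by `d`. -/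
def DualBound {Λ : Type} [AddCommGroup Λ] (b : Λ →ₗ[ℤ] Λ →ₗ[ℤ] ℤ) (d : ℤ) : Prop :=
  ∀ φ : Λ →ₗ[ℤ] ℤ, ∃ x, ∀ y, b x y = d * φ y

section Hermite
variable {Λ : Type} [AddCommGroup Λ]

theorem exists_functional_ne_zero [Module.Free ℤ Λ] {x : Λ} (hx : x ≠ 0) :
    ∃ φ : Λ →ₗ[ℤ] ℤ, φ x ≠ 0 := by
  classical
  by_contra! h
  apply hx
  exact (Module.Free.chooseBasis ℤ Λ).ext_elem_iff.2 fun i => by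
    simpa using h ((Module.Free.chooseBasis ℤ Λ).coord i)

theorem DualBound.nondegenerate [Module.Free ℤ Λ] {b : Λ →ₗ[ℤ] Λ →ₗ[ℤ] ℤ} {d : ℤ}
    (hb : ∀ x y, b x y = b y x) (hd : d ≠ 0) (h : DualBound b d) {x : Λ}
    (hx : ∀ y, b x y = 0) : x = 0 := by
  by_contra hne
  obtain ⟨φ, hφ⟩ := exists_functional_ne_zero hne
  obtain ⟨z, hz⟩ := h φ
  have := hz x
  rw [hb, hx] at this
  exact hφ (by simpa [hd] using this.symm)

/-- A vector that is not a proper multiple takes the value `1` under some functional. -/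
theorem exists_functional_eq_one [Module.Free ℤ Λ] {v : Λ} (hv : v ≠ 0)
    (hprim : ∀ (k : ℤ) (u : Λ), v = k • u → IsUnit k) : ∃ φ : Λ →ₗ[ℤ] ℤ, φ v = 1 := by
  classical
  let ev : (Λ →ₗ[ℤ] ℤ) →ₗ[ℤ] ℤ := LinearMap.applyₗ v
  obtain ⟨g, hg⟩ := (IsPrincipalIdealRing.principal (LinearMap.range ev)).principal
  have hdvd : ∀ φ : Λ →ₗ[ℤ] ℤ, g ∣ φ v := by
    intro φ
    have : φ v ∈ LinearMap.range ev := ⟨φ, rfl⟩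
    rw [hg] at this
    obtain ⟨c, hc⟩ := Submodule.mem_span_singleton.1 this
    exact ⟨c, by rw [← hc]; simp [mul_comm]⟩
  let B := Module.Free.chooseBasis ℤ Λ
  have hdvd' : ∀ i, g ∣ B.repr v i := fun i => by simpa using hdvd (B.coord i)
  choose c hc using hdvd'
  have hg0 : g ≠ 0 := by
    rintro rfl
    apply hv
    exact B.ext_elem_iff.2 fun i => by simpa using hc i
  let f : Module.Free.ChooseBasisIndex ℤ Λ →₀ ℤ :=
    Finsupp.onFinset (B.repr v).support c (by
      intro i hi
      rw [Finsupp.mem_support_iff, hc i]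
      exact mul_ne_zero hg0 hi)
  have hvu : v = g • B.repr.symm f := by
    apply B.repr.injective
    ext i
    simp [f, hc i]
  have hu := hprim g _ hvu
  have h1 : (1 : ℤ) ∈ LinearMap.range ev := by
    rw [hg]
    exact Submodule.mem_span_singleton.2 ⟨g, by simpa using Int.isUnit_mul_self hu⟩
  exact h1

/-- The form `b(v,v) b(x,y) - b(v,x) b(v,y)`, which descends to the quotient by `v`. -/
def reducedForm (b : Λ →ₗ[ℤ] Λ →ₗ[ℤ] ℤ) (v : Λ) : Λ →ₗ[ℤ] Λ →ₗ[ℤ] ℤ :=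
  b v v • b - (b v).smulRight (b v)

theorem reducedForm_apply (b : Λ →ₗ[ℤ] Λ →ₗ[ℤ] ℤ) (v x y : Λ) :
    reducedForm b v x y = b v v * b x y - b v x * b v y := by
  simp [reducedForm]

theorem reducedForm_add_smul {b : Λ →ₗ[ℤ] Λ →ₗ[ℤ] ℤ} (hb : ∀ x y, b x y = b y x) (v x y : Λ)
    (k l : ℤ) : reducedForm b v (x + k • v) (y + l • v) = reducedForm b v x y := by
  simp only [reducedForm_apply, map_add, map_smul, LinearMap.add_apply, LinearMap.smul_apply,
    smul_eq_mul, hb x v]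
  ring

/-- The reduced form on a complement of `v`. -/
def reducedFormKer (b : Λ →ₗ[ℤ] Λ →ₗ[ℤ] ℤ) (v : Λ) (φ : Λ →ₗ[ℤ] ℤ) :
    LinearMap.ker φ →ₗ[ℤ] LinearMap.ker φ →ₗ[ℤ] ℤ :=
  (reducedForm b v).domRestrict₁₂ _ _

theorem reducedFormKer_apply (b : Λ →ₗ[ℤ] Λ →ₗ[ℤ] ℤ) (v : Λ) (φ : Λ →ₗ[ℤ] ℤ)
    (x y : LinearMap.ker φ) : reducedFormKer b v φ x y = reducedForm b v x y := rfl

theorem reducedFormKer_dualBound {b : Λ →ₗ[ℤ] Λ →ₗ[ℤ] ℤ} (hb : ∀ x y, b x y = b y x) {d : ℤ}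
    (h : DualBound b d) {v : Λ} {φ : Λ →ₗ[ℤ] ℤ} (hφ : φ v = 1) :
    DualBound (reducedFormKer b v φ) (b v v * d) := by
  intro ψ
  let pr : Λ →ₗ[ℤ] LinearMap.ker φ :=
    (LinearMap.id - φ.smulRight v).codRestrict _ (fun z => by simp [hφ])
  have hpc : ∀ y, (pr y : Λ) = y - φ y • v := fun _ => rfl
  have hpr : ∀ y : LinearMap.ker φ, pr y = y := fun y =>
    Subtype.ext (by rw [hpc, LinearMap.mem_ker.1 y.2]; simp)
  have hprv : pr v = 0 := Subtype.ext (by rw [hpc, hφ]; simp)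
  obtain ⟨x, hx⟩ := h (ψ ∘ₗ pr)
  refine ⟨pr x, fun y => ?_⟩
  have h1 : ((pr x : LinearMap.ker φ) : Λ) = x + (-φ x) • v := by simp [pr, sub_eq_add_neg]
  have h2 : (y : Λ) = y + (0 : ℤ) • v := by simp
  rw [reducedFormKer_apply, h1, h2, reducedForm_add_smul hb, reducedForm_apply, hx, hb v x, hx]
  simp [hpr, hprv]
  ring

theorem finrank_ker_functional [Module.Free ℤ Λ] [Module.Finite ℤ Λ] {n : ℕ}
    (hn : Module.finrank ℤ Λ = n + 1) {v : Λ} {φ : Λ →ₗ[ℤ] ℤ} (hφ : φ v = 1) :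
    Module.finrank ℤ (LinearMap.ker φ) = n := by
  have hs : LinearMap.range φ = ⊤ := LinearMap.range_eq_top.2 fun k => ⟨k • v, by simp [hφ]⟩
  have := Submodule.finrank_quotient_add_finrank (LinearMap.ker φ)
  rw [φ.quotKerEquivRange.finrank_eq, hs, finrank_top, Module.finrank_self] at this
  omega

theorem exists_small_residue (a t : ℤ) (ha : a ≠ 0) : ∃ k : ℤ, 2 * |t + k * a| ≤ |a| := by
  refine ⟨-round ((t : ℚ) / a), ?_⟩
  have h := abs_sub_round ((t : ℚ) / a)
  have ha' : (0 : ℚ) < |(a : ℚ)| := by positivity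
  have : |((t : ℚ) / a - round ((t : ℚ) / a)) * a| ≤ 1 / 2 * |(a : ℚ)| := by
    rw [abs_mul]; gcongr
  have h2 : ((t : ℚ) / a - round ((t : ℚ) / a)) * a = t + (-round ((t : ℚ) / a)) * a := by
    field_simp
    ring
  rw [h2] at this
  have h3 : (2 : ℚ) * |(t : ℚ) + (-round ((t : ℚ) / a)) * a| ≤ |(a : ℚ)| := by linarith
  exact_mod_cast h3

theorem reducedForm_lower_bound {b : Λ →ₗ[ℤ] Λ →ₗ[ℤ] ℤ} (hb : ∀ x y, b x y = b y x) {v : Λ}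
    (hv : b v v ≠ 0) (hmin : ∀ x, b x x ≠ 0 → |b v v| ≤ |b x x|) (y : Λ) :
    (reducedForm b v y y ≠ 0 → (b v v) ^ 2 ≤ 4 * |reducedForm b v y y|) ∧
    ((∀ x, b x x = 0 → x = 0) → (∀ k : ℤ, y + k • v ≠ 0) →
      3 * (b v v) ^ 2 ≤ 4 * |reducedForm b v y y|) := by
  obtain ⟨k, hk⟩ := exists_small_residue (b v v) (b v y) hv
  set a := b v v with ha
  set z := y + k • v with hz
  have hg : reducedForm b v y y = reducedForm b v z z := (reducedForm_add_smul hb v y y k k).symm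
  have hzv : b v z = b v y + k * a := by simp [hz, ha]
  rw [← hzv] at hk
  rw [hg, reducedForm_apply, ← ha]
  set t := b v z
  have hsq : 4 * t ^ 2 ≤ a ^ 2 := by
    have := abs_nonneg t
    nlinarith [sq_abs t, sq_abs a]
  have key : b z z ≠ 0 → 3 * a ^ 2 ≤ 4 * |a * b z z - t * t| := by
    intro h
    have h1 := hmin z h
    have h2 : a ^ 2 ≤ |a * b z z| := by
      rw [abs_mul, ← sq_abs]; nlinarith [abs_nonneg a]
    have h3 : |a * b z z| ≤ |a * b z z - t * t| + |t * t| := by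
      simpa using abs_add_le (a * b z z - t * t) (t * t)
    rw [abs_mul_self] at h3
    nlinarith
  refine ⟨fun hne => ?_, fun haniso hy => key fun h0 => hy k (haniso _ h0)⟩
  by_cases h0 : b z z = 0
  · rw [h0] at hne ⊢
    have ht : t ≠ 0 := by rintro h; simp [h] at hne
    have e1 : ∀ ε : ℤ, ε * ε = 1 → b (z + ε • v) (z + ε • v) = 2 * ε * t + a := by
      intro ε hε
      simp only [map_add, map_smul, LinearMap.add_apply, LinearMap.smul_apply, smul_eq_mul, h0,
        hb z v]
      rw [← ha]
      linear_combination a * hε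
    have hp := hmin (z + (1 : ℤ) • v)
    have hm := hmin (z + (-1 : ℤ) • v)
    rw [e1 1 (by ring)] at hp
    rw [e1 (-1) (by ring)] at hm
    have : 2 * t = a ∨ 2 * t = -a := by
      by_contra! hcon
      have hp' := hp (by omega)
      have hm' := hm (by omega)
      rcases abs_cases t with h | h <;> rcases abs_cases a with h' | h' <;>
      rcases abs_cases (2 * 1 * t + a) with h'' | h'' <;>
      rcases abs_cases (2 * (-1) * t + a) with h3 | h3 <;> omega
    have h4 : 4 * (t * t) = a ^ 2 := by rcases this with h | h <;> [rw [← h]; rw [← neg_sq, ← h]] <;> ring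
    rw [mul_zero, zero_sub, abs_neg, abs_mul_self, h4]
  · nlinarith [key h0, sq_nonneg a]

theorem exists_functional_of_min [Module.Free ℤ Λ] {b : Λ →ₗ[ℤ] Λ →ₗ[ℤ] ℤ} {v : Λ}
    (hv : b v v ≠ 0) (hmin : ∀ x, b x x ≠ 0 → |b v v| ≤ |b x x|) :
    ∃ φ : Λ →ₗ[ℤ] ℤ, φ v = 1 := by
  refine exists_functional_eq_one (by rintro rfl; simp at hv) ?_
  rintro k u rfl
  have hu : b u u ≠ 0 := by rintro h0; simp [h0] at hv
  have h1 := hmin u hu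
  simp only [map_smul, LinearMap.smul_apply, smul_eq_mul, abs_mul] at h1
  have hk : k ≠ 0 := by rintro rfl; simp at hv
  have h2 : 0 < |b u u| := abs_pos.2 hu
  have h3 : 0 < |k| := abs_pos.2 hk
  rw [Int.isUnit_iff_abs_eq]
  have h4 : |k| * |k| ≤ 1 := by nlinarith
  nlinarith

/-- A vector minimizing the nonzero values of the form. -/
theorem exists_min_value [Module.Free ℤ Λ] {b : Λ →ₗ[ℤ] Λ →ₗ[ℤ] ℤ} (hb : ∀ x y, b x y = b y x)
    {d : ℤ} (hd : d ≠ 0) (h : DualBound b d) [Nontrivial Λ] :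
    ∃ v, b v v ≠ 0 ∧ (∀ x, b x x ≠ 0 → |b v v| ≤ |b x x|) ∧ ∃ φ : Λ →ₗ[ℤ] ℤ, φ v = 1 := by
  have hex : ∃ x, b x x ≠ 0 := by
    by_contra! h0
    obtain ⟨x, hx⟩ := exists_ne (0 : Λ)
    apply hx
    refine h.nondegenerate hb hd fun y => ?_
    have := h0 (x + y)
    simp only [map_add, LinearMap.add_apply, h0 x, h0 y] at this
    have := hb x y
    omega
  obtain ⟨v, hv, hmin⟩ := WellFounded.has_min
    (InvImage.wf (fun x => (b x x).natAbs) Nat.lt_wfRel.wf) {x | b x x ≠ 0} hex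
  have hmin' : ∀ x, b x x ≠ 0 → |b v v| ≤ |b x x| := by
    intro x hx
    have := hmin x hx
    simp only [InvImage] at this
    have h2 : ¬ ((b x x).natAbs < (b v v).natAbs) := this
    rw [not_lt, ← Int.ofNat_le, Int.natCast_natAbs, Int.natCast_natAbs] at h2
    exact h2
  exact ⟨v, hv, hmin', exists_functional_of_min hv hmin'⟩

/-- Hermite's bound on the minimal nonzero value, with the sharper constant for anisotropic
forms. -/
theorem hermite_bound (c : ℤ) (n : ℕ) :
    ∀ {Λ : Type} [AddCommGroup Λ] [Module.Free ℤ Λ] [Module.Finite ℤ Λ]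
    {b : Λ →ₗ[ℤ] Λ →ₗ[ℤ] ℤ} {d : ℤ}, Module.finrank ℤ Λ = n + 1 → (∀ x y, b x y = b y x) →
    d ≠ 0 → DualBound b d → (c = 1 ∨ c = 3 ∧ ∀ x, b x x = 0 → x = 0) → ∀ v, b v v ≠ 0 →
    (∀ x, b x x ≠ 0 → |b v v| ≤ |b x x|) → c ^ n * |b v v| ≤ 4 ^ n * |d| := by
  induction n with
  | zero =>
    intro Λ _ _ _ b d hn hb hd h _ v hv hmin
    have : Nontrivial Λ := Module.nontrivial_of_finrank_pos (R := ℤ) (by omega)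
    obtain ⟨w, hw, hwmin, φ, hφ⟩ := exists_min_value hb hd h
    have hk := finrank_ker_functional hn hφ
    have : Subsingleton (LinearMap.ker φ) := Module.finrank_zero_iff.1 hk
    obtain ⟨x, hx⟩ := h φ
    have hxw : x = φ x • w := by
      have : x - φ x • w ∈ LinearMap.ker φ := by simp [hφ]
      have h0 := Subsingleton.elim (⟨_, this⟩ : LinearMap.ker φ) 0
      exact sub_eq_zero.1 (congrArg Subtype.val h0)
    have h1 := hx w
    rw [hxw, hφ] at h1
    simp only [map_smul, LinearMap.smul_apply, smul_eq_mul, mul_one] at h1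
    have h2 := hmin w hw
    rw [← h1, abs_mul]
    have h3 : φ x ≠ 0 := by rintro h0; rw [h0] at h1; simp at h1; exact hd h1.symm
    have h4 : 0 < |φ x| := abs_pos.2 h3
    simp only [pow_zero, one_mul]
    nlinarith [abs_nonneg (b w w)]
  | succ n ih =>
    intro Λ _ _ _ b d hn hb hd h hc v hv hmin
    obtain ⟨φ, hφ⟩ := exists_functional_of_min hv hmin
    have hk := finrank_ker_functional hn hφ
    have : Nontrivial (LinearMap.ker φ) := Module.nontrivial_of_finrank_pos (R := ℤ) (by omega)
    have hD := reducedFormKer_dualBound hb h hφ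
    have hgs : ∀ x y, reducedFormKer b v φ x y = reducedFormKer b v φ y x := by
      intro x y
      simp only [reducedFormKer_apply, reducedForm_apply, hb (x : Λ) y]
      ring
    have hd' : b v v * d ≠ 0 := mul_ne_zero hv hd
    obtain ⟨w, hw, hwmin, -⟩ := exists_min_value hgs hd' hD
    have hlow := reducedForm_lower_bound hb hv hmin
    have hnk : ∀ y : LinearMap.ker φ, y ≠ 0 → ∀ k : ℤ, (y : Λ) + k • v ≠ 0 := by
      intro y hy k h0
      have h1 := congrArg φ h0
      simp only [map_add, map_smul, hφ, LinearMap.mem_ker.1 y.2, map_zero, zero_add, smul_eq_mul,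
        mul_one] at h1
      rw [h1] at h0
      exact hy (Subtype.ext (by simpa using h0))
    have hb1 : c * (b v v) ^ 2 ≤ 4 * |reducedFormKer b v φ w w| := by
      rcases hc with rfl | ⟨rfl, han⟩
      · rw [one_mul]; exact (hlow w).1 hw
      · exact (hlow w).2 han (hnk w (by rintro rfl; simp at hw))
    have hih := ih hk hgs hd' hD (by
      rcases hc with rfl | ⟨rfl, han⟩
      · exact Or.inl rfl
      · refine Or.inr ⟨rfl, fun y hy => ?_⟩
        by_contra hy0
        have := (hlow y).2 han (hnk y hy0)
        rw [reducedFormKer_apply] at hy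
        rw [hy] at this
        have : 0 < b v v ^ 2 := by positivity
        simp at *
        omega) w hw hwmin
    have hc0 : 0 < c := by rcases hc with rfl | ⟨rfl, -⟩ <;> norm_num
    have h1 : c ^ n * (c * (b v v) ^ 2) ≤ c ^ n * (4 * |reducedFormKer b v φ w w|) := by gcongr
    have h2 : c ^ (n + 1) * |b v v| * |b v v| ≤ 4 ^ (n + 1) * |d| * |b v v| := by
      rw [abs_mul] at hih
      have := sq_abs (b v v)
      calc c ^ (n + 1) * |b v v| * |b v v| = c ^ n * (c * (b v v) ^ 2) := by rw [← this]; ring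
        _ ≤ 4 * (c ^ n * |reducedFormKer b v φ w w|) := by linarith
        _ ≤ 4 * (4 ^ n * (|b v v| * |d|)) := by gcongr
        _ = _ := by ring
    exact le_of_mul_le_mul_right h2 (abs_pos.2 hv)

end Hermite

section GramFinite

/-- The Gram matrix recovered from a first vector of square `a`, its products `β` with the other
basis vectors, and the reduced form `g`. -/
def borderedGram {n : ℕ} (a : ℤ) (β : Fin n → ℤ) (g : Fin n → Fin n → ℤ) :
    Fin (n + 1) → Fin (n + 1) → ℤ :=
  Fin.cons (Fin.cons a β) fun i => Fin.cons (β i) fun j => (g i j + β i * β j) / a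

/-- Hermite: up to change of basis, forms of given rank and given bound on the dual have only
finitely many Gram matrices. -/
theorem finite_gram (n : ℕ) : ∀ d : ℤ, d ≠ 0 → ∃ S : Set (Fin n → Fin n → ℤ), S.Finite ∧
    ∀ {Λ : Type} [AddCommGroup Λ] [Module.Free ℤ Λ] [Module.Finite ℤ Λ]
    {b : Λ →ₗ[ℤ] Λ →ₗ[ℤ] ℤ}, Module.finrank ℤ Λ = n → (∀ x y, b x y = b y x) → DualBound b d →
    ∃ f : Fin n → Λ, Submodule.span ℤ (Set.range f) = ⊤ ∧ (fun i j => b (f i) (f j)) ∈ S := by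
  induction n with
  | zero =>
    intro d hd
    refine ⟨Set.univ, Set.toFinite _, ?_⟩
    intro Λ _ _ _ b hn hb h
    have : Subsingleton Λ := Module.finrank_zero_iff.1 hn
    exact ⟨fun i => i.elim0, Subsingleton.elim _ _, trivial⟩
  | succ n ih =>
    intro d hd
    have ih' : ∀ a : ℤ, ∃ S : Set (Fin n → Fin n → ℤ), S.Finite ∧ (a ≠ 0 →
        ∀ {Λ : Type} [AddCommGroup Λ] [Module.Free ℤ Λ] [Module.Finite ℤ Λ]
        {b : Λ →ₗ[ℤ] Λ →ₗ[ℤ] ℤ}, Module.finrank ℤ Λ = n → (∀ x y, b x y = b y x) →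
        DualBound b (a * d) →
        ∃ f : Fin n → Λ, Submodule.span ℤ (Set.range f) = ⊤ ∧ (fun i j => b (f i) (f j)) ∈ S) := by
      intro a
      by_cases ha : a = 0
      · exact ⟨∅, Set.finite_empty, fun h => absurd ha h⟩
      · obtain ⟨S, hS, h⟩ := ih (a * d) (mul_ne_zero ha hd)
        exact ⟨S, hS, fun _ => h⟩
    choose S hSfin hS using ih'
    set C : ℤ := 4 ^ n * |d| with hC
    refine ⟨⋃ a ∈ Set.Icc (-C) C, ⋃ g ∈ S a, ⋃ β ∈ Set.Icc (0 : Fin n → ℤ) (fun _ => C),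
      {borderedGram a β g}, ?_, ?_⟩
    · exact (Set.finite_Icc _ _).biUnion fun a _ => (hSfin a).biUnion fun g _ =>
        (Set.finite_Icc _ _).biUnion fun β _ => Set.finite_singleton _
    intro Λ _ _ _ b hn hb h
    have : Nontrivial Λ := Module.nontrivial_of_finrank_pos (R := ℤ) (by omega)
    obtain ⟨v, hv, hmin, φ, hφ⟩ := exists_min_value hb hd h
    have hbound := hermite_bound 1 n hn hb hd h (Or.inl rfl) v hv hmin
    rw [one_pow, one_mul, ← hC] at hbound
    have hgs : ∀ x y, reducedFormKer b v φ x y = reducedFormKer b v φ y x := by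
      intro x y
      simp only [reducedFormKer_apply, reducedForm_apply, hb (x : Λ) y]
      ring
    obtain ⟨f, hf, hfS⟩ := hS (b v v) hv (finrank_ker_functional hn hφ) hgs
      (reducedFormKer_dualBound hb h hφ)
    set a := b v v with ha
    let F : Fin n → Λ := fun i => (f i : Λ) + (-(b v (f i) / a)) • v
    have hF : ∀ i, b v (F i) = b v (f i) % a := by
      intro i
      simp only [F, map_add, map_smul, smul_eq_mul, ← ha]
      rw [Int.emod_def]
      ring
    refine ⟨Fin.cons v F, ?_, ?_⟩
    · rw [eq_top_iff]
      intro x _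
      have hvm : v ∈ Submodule.span ℤ (Set.range (Fin.cons v F : Fin (n + 1) → Λ)) :=
        Submodule.subset_span ⟨0, rfl⟩
      have hker : ∀ y : LinearMap.ker φ,
          (y : Λ) ∈ Submodule.span ℤ (Set.range (Fin.cons v F : Fin (n + 1) → Λ)) := by
        intro y
        have hy : y ∈ Submodule.span ℤ (Set.range f) := hf ▸ Submodule.mem_top
        induction hy using Submodule.span_induction with
        | mem y hy =>
          obtain ⟨i, rfl⟩ := hy
          have h1 : (f i : Λ) = (Fin.cons v F : Fin (n + 1) → Λ) i.succ + (b v (f i) / a) • v := by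
            simp [F]
          rw [h1]
          exact add_mem (Submodule.subset_span ⟨i.succ, rfl⟩) (Submodule.smul_mem _ _ hvm)
        | zero => exact zero_mem _
        | add y z _ _ hy hz => exact add_mem hy hz
        | smul c y _ hy => exact Submodule.smul_mem _ c hy
      have h1 : x - φ x • v ∈ LinearMap.ker φ := by simp [hφ]
      have := add_mem (hker ⟨_, h1⟩) (Submodule.smul_mem _ (φ x) hvm)
      simpa using this
    · simp only [Set.mem_iUnion, Set.mem_singleton_iff]
      refine ⟨a, abs_le.1 hbound, _, hfS, fun i => b v (F i), ⟨fun i => ?_, fun i => ?_⟩, ?_⟩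
      · simp only [hF]
        exact Int.emod_nonneg _ hv
      · simp only [hF]
        exact ((Int.emod_lt_abs _ hv).le).trans hbound
      · funext i j
        refine Fin.cases ?_ (fun i => ?_) i <;> refine Fin.cases ?_ (fun j => ?_) j
        · simp [borderedGram, ha]
        · simp [borderedGram]
        · simp [borderedGram, hb _ v]
        · simp only [borderedGram, Fin.cons_succ, reducedFormKer_apply]
          rw [← reducedForm_add_smul hb v (f i) (f j) (-(b v (f i) / a)) (-(b v (f j) / a)),
            reducedForm_apply]
          change _ = (a * b (F i) (F j) - b v (F i) * b v (F j) + _) / a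
          rw [sub_add_cancel, Int.mul_ediv_cancel_left _ hv]

end GramFinite

section LowRank

theorem dualBound_one_restrict {Λ : Type} [AddCommGroup Λ] {b : Λ →ₗ[ℤ] Λ →ₗ[ℤ] ℤ}
    (hb : ∀ x y, b x y = b y x) (h : DualBound b 1) {v : Λ} {ε : ℤ} (hε : ε * b v v = 1) :
    DualBound (b.domRestrict₁₂ (LinearMap.ker (b v)) (LinearMap.ker (b v))) 1 := by
  intro ψ
  let pr : Λ →ₗ[ℤ] LinearMap.ker (b v) :=
    (LinearMap.id - (ε • b v).smulRight v).codRestrict _ (fun z => by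
      simp only [LinearMap.mem_ker, LinearMap.sub_apply, LinearMap.id_apply,
        LinearMap.smulRight_apply, LinearMap.smul_apply, map_sub, map_smul, smul_eq_mul]
      linear_combination -(b v z) * hε)
  have hpc : ∀ y, (pr y : Λ) = y - (ε * b v y) • v := fun _ => rfl
  have hpr : ∀ y : LinearMap.ker (b v), pr y = y := fun y =>
    Subtype.ext (by rw [hpc, LinearMap.mem_ker.1 y.2]; simp)
  have hprv : pr v = 0 := Subtype.ext (by rw [hpc, hε]; simp)
  obtain ⟨x, hx⟩ := h (ψ ∘ₗ pr)
  refine ⟨⟨x, ?_⟩, fun y => ?_⟩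
  · rw [LinearMap.mem_ker, hb, hx]; simp [hprv]
  · change b x y = _
    rw [hx]; simp [hpr]

/-- Indefinite unimodular forms of rank at most three are isotropic. -/
theorem isotropic_of_unimodular_of_finrank_le_three (n : ℕ) (hn3 : n ≤ 3) :
    ∀ {Λ : Type} [AddCommGroup Λ] [Module.Free ℤ Λ] [Module.Finite ℤ Λ]
    {b : Λ →ₗ[ℤ] Λ →ₗ[ℤ] ℤ}, Module.finrank ℤ Λ = n → (∀ x y, b x y = b y x) → DualBound b 1 →
    (∃ x, 0 < b x x) → (∃ x, b x x < 0) → ∃ x, x ≠ 0 ∧ b x x = 0 := by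
  have unit : ∀ {m : ℕ} {Λ : Type} [AddCommGroup Λ] [Module.Free ℤ Λ] [Module.Finite ℤ Λ]
      {b : Λ →ₗ[ℤ] Λ →ₗ[ℤ] ℤ}, m ≤ 3 → Module.finrank ℤ Λ = m → (∀ x y, b x y = b y x) →
      DualBound b 1 → (∀ x, b x x = 0 → x = 0) → Nontrivial Λ → ∃ v, b v v = 1 ∨ b v v = -1 := by
    intro m Λ _ _ _ b hm3 hm hb h han _
    obtain ⟨v, hv, hmin, -⟩ := exists_min_value hb one_ne_zero h
    have hfr := Module.finrank_pos (R := ℤ) (M := Λ)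
    obtain ⟨m, rfl⟩ : ∃ k, m = k + 1 := ⟨m - 1, by omega⟩
    have hB := hermite_bound 3 m hm hb one_ne_zero h (Or.inr ⟨rfl, han⟩) v hv hmin
    have hpos : 0 < |b v v| := abs_pos.2 hv
    refine ⟨v, ?_⟩
    have : |b v v| = 1 := by
      have : m ≤ 2 := by omega
      interval_cases m <;> simp at hB <;> omega
    exact (abs_eq zero_le_one).1 this
  induction n with
  | zero =>
    intro Λ _ _ _ b hn hb h ⟨x, hx⟩ _
    have : Subsingleton Λ := Module.finrank_zero_iff.1 hn
    rw [Subsingleton.elim x 0] at hx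
    simp at hx
  | succ n ih =>
    intro Λ _ _ _ b hn hb h hpos hneg
    by_contra! han
    have han' : ∀ x, b x x = 0 → x = 0 := fun x hx => by_contra fun h0 => han x h0 hx
    have hnt : Nontrivial Λ := Module.nontrivial_of_finrank_pos (R := ℤ) (by omega)
    obtain ⟨v, hv⟩ := unit hn3 hn hb h han' hnt
    obtain ⟨ε, hε, hε2⟩ : ∃ ε : ℤ, ε * b v v = 1 ∧ b v v = ε := by
      rcases hv with h | h <;> exact ⟨_, by rw [h]; norm_num, rfl⟩
    have hK := dualBound_one_restrict hb h hε
    set K := LinearMap.ker (b v)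
    set c := b.domRestrict₁₂ K K with hc
    have hcapp : ∀ x y : K, c x y = b x y := fun _ _ => rfl
    have hcs : ∀ x y, c x y = c y x := fun x y => hb x y
    have hφ : (ε • b v) v = 1 := hε
    have hker : LinearMap.ker (ε • b v) = K := by
      ext x
      have : ε ≠ 0 := by rintro rfl; simp at hε
      simp [K, this]
    have hrk : Module.finrank ℤ K = n := by
      rw [← hker]; exact finrank_ker_functional hn hφ
    have hεε : ε * ε = 1 := by rw [← hε, hε2]
    obtain ⟨y, hy⟩ : ∃ y : K, ε * c y y < 0 := by
      obtain ⟨x, hx⟩ : ∃ x, ε * b x x < 0 := by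
        rcases hv with h1 | h1 <;> rw [h1] at hε2 <;> rw [← hε2]
        · obtain ⟨x, hx⟩ := hneg; exact ⟨x, by omega⟩
        · obtain ⟨x, hx⟩ := hpos; exact ⟨x, by omega⟩
      refine ⟨⟨x - (ε * b v x) • v, ?_⟩, ?_⟩
      · simp only [K, LinearMap.mem_ker, map_sub, map_smul, smul_eq_mul]
        linear_combination -(b v x) * hε
      · rw [hcapp]
        simp only [map_sub, map_smul, LinearMap.sub_apply, LinearMap.smul_apply, smul_eq_mul,
          hb x v, hε2]
        have e : ε * (b x x - ε * b v x * b v x - ε * b v x * (b v x - ε * b v x * ε)) =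
          ε * b x x - (b v x) ^ 2 := by
          linear_combination (-(b v x) ^ 2 + (b v x) ^ 2 * (ε * ε)) * hεε
        rw [e]
        nlinarith [sq_nonneg (b v x)]
    have hKnt : Nontrivial K := ⟨y, 0, by rintro rfl; simp at hy⟩
    have hanK : ∀ x, c x x = 0 → x = 0 := fun x hx => Subtype.ext (han' x hx)
    have hdef : ∀ x, ε * c x x ≤ 0 := by
      by_contra! hx
      obtain ⟨x, hx⟩ := hx
      obtain ⟨z, hz, hz0⟩ : ∃ z, z ≠ 0 ∧ c z z = 0 := by
        rcases hv with h1 | h1 <;> rw [h1] at hε2 <;> rw [← hε2] at hx hy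
        · exact ih (by omega) hrk hcs hK ⟨x, by omega⟩ ⟨y, by omega⟩
        · exact ih (by omega) hrk hcs hK ⟨y, by omega⟩ ⟨x, by omega⟩
      exact hz (hanK z hz0)
    obtain ⟨w, hw⟩ := unit (by omega) hrk hcs hK hanK hKnt
    have hvw : b v w = 0 := w.2
    have hw2 : b w w = -ε := by
      have h1 := hdef w
      rw [hcapp] at h1 hw
      rcases hv with h2 | h2 <;> rw [h2] at hε2 <;> rw [← hε2] at h1 ⊢ <;> omega
    have hz := han' (v + w) (by
      simp only [map_add, LinearMap.add_apply, hb w v, hvw, hε2, hw2]; ring)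
    have := congrArg (b v) hz
    rw [map_add, hvw, map_zero, hε2] at this
    rw [add_zero] at this
    rw [this] at hε
    simp at hε

end LowRank

section Binary

theorem dualBound_of_isUnit_det {n : ℕ} {G : Matrix (Fin n) (Fin n) ℤ} (hs : G.transpose = G)
    (hG : IsUnit G.det) : DualBound (Matrix.toLinearMap₂' ℤ G) 1 := by
  intro φ
  refine ⟨G⁻¹.mulVec fun i => φ (Pi.single i 1), fun y => ?_⟩
  have h1 : (G⁻¹.mulVec fun i => φ (Pi.single i 1)) ⬝ᵥ G.mulVec y =
      (fun i => φ (Pi.single i 1)) ⬝ᵥ y := by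
    rw [Matrix.dotProduct_mulVec, ← Matrix.mulVec_transpose, hs, Matrix.mulVec_mulVec,
      Matrix.mul_nonsing_inv _ hG, Matrix.one_mulVec]
  rw [Matrix.toLinearMap₂'_apply', h1, one_mul]
  conv_rhs => rw [← Finset.univ_sum_single y, map_sum]
  refine Finset.sum_congr rfl fun i _ => ?_
  rw [show (Pi.single i (y i) : Fin n → ℤ) = y i • Pi.single i 1 by
    rw [← Pi.single_smul]; simp, map_smul]
  simp [mul_comm]

theorem exists_sq_modEq {a b c D : ℤ} {r : ℕ} (hr : r.Prime) (hD : D = b ^ 2 - a * c)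
    (hcop : IsCoprime a (2 * D)) (hrD : (r : ℤ) ≡ |a| [ZMOD 4 * D]) :
    ∃ β : ℤ, (r : ℤ) ∣ β ^ 2 - D := by
  have := Fact.mk hr
  have hodd : Odd a := by
    rcases Int.even_or_odd a with h | h
    · obtain ⟨k, hk⟩ := h
      have : (2 : ℤ) ∣ 1 := hcop.isUnit_of_dvd' ⟨k, by omega⟩ ⟨D, rfl⟩ |>.dvd
      omega
    · exact h
  have hoddr : Odd r := by
    have h4 : (r : ℤ) ≡ |a| [ZMOD 2] := hrD.of_dvd ⟨2 * D, by ring⟩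
    have h5 : Odd |a| := odd_abs.2 hodd
    rw [← Int.odd_coe_nat, Int.odd_iff]
    rw [Int.odd_iff] at h5
    rw [← h5]; exact h4
  have hodda : Odd a.natAbs := Int.natAbs_odd.2 hodd
  have hJ : jacobiSym D r = 1 := by
    rw [jacobiSym.mod_right D hoddr]
    have hm : r % (4 * D.natAbs) = a.natAbs % (4 * D.natAbs) := by
      zify
      have : (r : ℤ) ≡ |a| [ZMOD 4 * |D|] :=
        hrD.of_dvd (mul_dvd_mul_left 4 (abs_dvd_self D) |>.trans dvd_rfl)
      exact this
    rw [hm, ← jacobiSym.mod_right D hodda]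
    have hDb : D % (a.natAbs : ℤ) = b ^ 2 % (a.natAbs : ℤ) := by
      refine Int.emod_emod_of_dvd _ dvd_rfl ▸ ?_
      rw [← Int.abs_eq_natAbs, Int.emod_emod_of_dvd _ dvd_rfl]
      refine Int.emod_eq_emod_iff_emod_sub_eq_zero.2 (Int.emod_eq_zero_of_dvd ?_)
      rw [abs_dvd, hD]; exact ⟨-c, by ring⟩
    rw [jacobiSym.mod_left' hDb]
    refine jacobiSym.sq_one' ?_
    rw [← Int.isCoprime_iff_gcd_eq_one, ← Int.abs_eq_natAbs]
    have h1 : IsCoprime a D := hcop.of_mul_right_right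
    have h2 : IsCoprime a (b ^ 2) := by
      have := (IsCoprime.add_mul_left_right_iff (x := a) (y := D) (z := c)).2 h1
      rwa [show D + a * c = b ^ 2 by rw [hD]; ring] at this
    rw [IsCoprime.abs_right_iff]
    exact ((IsCoprime.pow_right_iff two_pos).1 h2).symm
  rw [← jacobiSym.legendreSym.to_jacobiSym] at hJ
  have hne : ((D : ℤ) : ZMod r) ≠ 0 := by
    intro h
    rw [(legendreSym.eq_zero_iff r D).2 h] at hJ
    omega
  obtain ⟨y, hy⟩ := (legendreSym.eq_one_iff r hne).1 hJ
  obtain ⟨β, rfl⟩ := ZMod.intCast_surjective y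
  refine ⟨β, (ZMod.intCast_zmod_eq_zero_iff_dvd _ r).1 ?_⟩
  push_cast
  rw [hy]; ring

/-- Solving two linear congruences modulo coprime moduli. -/
theorem exists_crt_two {m n : ℤ} (h : IsCoprime m n) (x y : ℤ) :
    ∃ z : ℤ, m ∣ z - x ∧ n ∣ z - y := by
  obtain ⟨u, v, huv⟩ := h
  exact ⟨x * (v * n) + y * (u * m), ⟨(y - x) * u, by linear_combination x * huv⟩,
    ⟨(x - y) * v, by linear_combination y * huv⟩⟩

/-- A binary form of nonsquare discriminant `D > 0` and leading coefficient `a` represents, up to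
squares, `± r` for any prime `r ≡ |a|` modulo `4 * D`. -/
theorem binary_represents_prime {a b c D ε : ℤ} {r : ℕ} (hr : r.Prime) (hD : D = b ^ 2 - a * c)
    (hpos : 0 < D) (hns : ¬ IsSquare D) (hcop : IsCoprime a (2 * D)) (hε : a * ε = |a|)
    (hε1 : ε * ε = 1) (hrD : (r : ℤ) ≡ |a| [ZMOD 4 * D]) (har : IsCoprime a (r : ℤ)) :
    ∃ x y s : ℤ, s ≠ 0 ∧ a * x ^ 2 + 2 * b * x * y + c * y ^ 2 = ε * r * s ^ 2 := by
  obtain ⟨β, hβ⟩ := exists_sq_modEq hr hD hcop hrD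
  have hr0 : (0 : ℤ) < r := by exact_mod_cast hr.pos
  have haD : IsCoprime a D := hcop.of_mul_right_right
  have hrD' : IsCoprime (r : ℤ) D := by
    obtain ⟨k, hk⟩ := hrD.dvd
    have : IsCoprime |a| D := haD.abs_left
    rw [show |a| = r + D * (4 * k) by linear_combination hk] at this
    exact IsCoprime.add_mul_left_left_iff.1 this
  have ha0 : a ≠ 0 := by
    rintro rfl
    exact hns ⟨b, by rw [hD]; ring⟩
  obtain ⟨u, v, huv⟩ := (IsCoprime.mul_right har haD)
  obtain ⟨p, hp1, hp2⟩ := exists_crt_two hrD' β 0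
  obtain ⟨μ, hμ1, hμ2⟩ := exists_crt_two hrD' 0 1
  rw [sub_zero] at hp2 hμ1
  obtain ⟨l, hl⟩ : ∃ l, l = u * (p - b) := ⟨_, rfl⟩
  have hlp : a * l + b = p - v * (r * D) * (p - b) := by
    rw [hl]; linear_combination (p - b) * huv
  have hq1 : (r : ℤ) ∣ (a * l + b) - β := by
    rw [hlp, sub_right_comm]
    exact dvd_sub hp1 ⟨v * D * (p - b), by ring⟩
  have hq2 : D ∣ a * l + b := by
    rw [hlp]
    exact dvd_sub hp2 ⟨v * r * (p - b), by ring⟩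
  have hR : ∀ z : ℤ, (r : ℤ) ∣ z → D ∣ z → (r : ℤ) * D ∣ z := fun z => hrD'.mul_dvd
  obtain ⟨A, hA⟩ : (r : ℤ) * D ∣ a * l ^ 2 + 2 * b * l + c := by
    refine (IsCoprime.mul_right har haD).symm.dvd_of_dvd_mul_left (y := a) ?_
    have e : a * (a * l ^ 2 + 2 * b * l + c) = (a * l + b) ^ 2 - D := by rw [hD]; ring
    rw [e]
    refine hR _ ?_ ?_
    · have := dvd_add (hq1.mul_right ((a * l + b) + β)) hβ
      rwa [show (a * l + b - β) * (a * l + b + β) + (β ^ 2 - D) = (a * l + b) ^ 2 - D by ring]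
        at this
    · exact dvd_sub (hq2.pow two_ne_zero |>.trans dvd_rfl) dvd_rfl
  obtain ⟨E, hE⟩ : (r : ℤ) * D ∣ (a * l + b) * μ :=
    hR _ (hμ1.mul_left _) (hq2.mul_right _)
  obtain ⟨C, hC⟩ : (r : ℤ) * D ∣ a * μ ^ 2 - ε * r := by
    refine hR _ (dvd_sub (Dvd.dvd.mul_left (hμ1.pow two_ne_zero) _) (dvd_mul_left _ _)) ?_
    obtain ⟨k, hk⟩ := hrD.dvd
    rw [← hε] at hk
    obtain ⟨m, hm⟩ := hμ2
    refine ⟨a * m * (μ + 1) + ε * (4 * k), ?_⟩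
    linear_combination a * (μ + 1) * hm + ε * hk - a * hε1
  set R : ℤ := r * D with hRdef
  have hRpos : 0 < R := mul_pos hr0 hpos
  let G : Matrix (Fin 3) (Fin 3) ℤ := !![A, E, a * l + b; E, C, a * μ; a * l + b, a * μ, a * R]
  have hGt : G.transpose = G := by
    ext i j; fin_cases i <;> fin_cases j <;> rfl
  have hdet : G.det = ε := by
    have h2 : R ^ 2 * G.det = (R * A) * (R * C) * (a * R) - (R * A) * R * (a * μ) ^ 2
        - (R * E) ^ 2 * (a * R) + 2 * (R * E) * R * (a * μ) * (a * l + b)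
        - R * (R * C) * (a * l + b) ^ 2 := by
      rw [Matrix.det_fin_three]
      simp [G]
      ring
    rw [← hA, ← hE, ← hC] at h2
    have h3 : R ^ 2 * G.det = R ^ 2 * ε := by
      rw [h2, hRdef, hD]; ring
    exact mul_left_cancel₀ (by positivity) h3
  have hform : ∀ y t s : ℤ, R * Matrix.toLinearMap₂' ℤ G (![y, t, s] : Fin 3 → ℤ) ![y, t, s] =
      a * (l * y + μ * t + R * s) ^ 2 + 2 * b * (l * y + μ * t + R * s) * y + c * y ^ 2
        - ε * r * t ^ 2 := by
    intro y t s
    have e : R * Matrix.toLinearMap₂' ℤ G (![y, t, s] : Fin 3 → ℤ) ![y, t, s] = (R * A) * y ^ 2 +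
        2 * (R * E) * y * t + (R * C) * t ^ 2 + 2 * R * s * ((a * l + b) * y + a * μ * t)
        + a * R ^ 2 * s ^ 2 := by
      rw [Matrix.toLinearMap₂'_apply']
      simp [G, Matrix.mulVec, dotProduct, Fin.sum_univ_three]
      ring
    rw [e, ← hA, ← hE, ← hC]
    ring
  have hsym : ∀ x y : Fin 3 → ℤ, Matrix.toLinearMap₂' ℤ G x y = Matrix.toLinearMap₂' ℤ G y x := by
    intro x y
    rw [Matrix.toLinearMap₂'_apply', Matrix.toLinearMap₂'_apply', Matrix.dotProduct_mulVec,
      ← Matrix.mulVec_transpose, hGt, dotProduct_comm]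
  have hv1 := (hform 0 0 1).trans (show _ = a * R ^ 2 by ring)
  have hv2 := (hform (R * a) 0 (-b - l * a)).trans
    (show _ = - (a * R ^ 2) * D by rw [hD]; ring)
  have hpn : (∃ x : Fin 3 → ℤ, 0 < Matrix.toLinearMap₂' ℤ G x x) ∧
      (∃ x : Fin 3 → ℤ, Matrix.toLinearMap₂' ℤ G x x < 0) := by
    have hR2 : 0 < R ^ 2 := by positivity
    rcases lt_or_gt_of_ne ha0 with h | h
    · have h3 := mul_neg_of_neg_of_pos h hR2
      exact ⟨⟨_, (pos_iff_pos_of_mul_pos (hv2.symm ▸ mul_pos (neg_pos.2 h3) hpos)).1 hRpos⟩,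
        ⟨_, neg_of_mul_neg_right (hv1.trans_lt h3) hRpos.le⟩⟩
    · have h3 := mul_pos h hR2
      exact ⟨⟨_, (pos_iff_pos_of_mul_pos (hv1.symm ▸ h3)).1 hRpos⟩,
        ⟨_, neg_of_mul_neg_right (hv2.trans_lt (mul_neg_of_neg_of_pos (neg_lt_zero.2 h3) hpos))
          hRpos.le⟩⟩
  have hunit : IsUnit G.det := by
    rw [hdet]; exact IsUnit.of_mul_eq_one _ hε1
  obtain ⟨z, hz0, hz⟩ := isotropic_of_unimodular_of_finrank_le_three 3 le_rfl
    (by simp) hsym (dualBound_of_isUnit_det hGt hunit) hpn.1 hpn.2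
  obtain ⟨y, t, s, rfl⟩ : ∃ y t s, z = ![y, t, s] :=
    ⟨z 0, z 1, z 2, by ext i; fin_cases i <;> rfl⟩
  have hf := hform y t s
  rw [hz, mul_zero] at hf
  refine ⟨l * y + μ * t + R * s, y, t, ?_, by linear_combination -hf⟩
  rintro rfl
  set x := l * y + μ * 0 + R * s with hx
  have h1 : (a * x + b * y) ^ 2 = D * y ^ 2 := by
    rw [hD]; linear_combination -a * hf
  have hy : y = 0 := by
    by_contra hy
    apply hns
    have h2 : y ∣ a * x + b * y := (Int.pow_dvd_pow_iff two_ne_zero).1 ⟨D, by rw [h1]; ring⟩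
    obtain ⟨k, hk⟩ := h2
    refine ⟨k, ?_⟩
    have : y ^ 2 * D = y ^ 2 * (k * k) := by rw [mul_comm, ← h1, hk]; ring
    exact mul_left_cancel₀ (by positivity) this
  rw [hy] at h1
  have hax : a * x = 0 := by nlinarith
  have hx0 : x = 0 := (mul_eq_zero.1 hax).resolve_left ha0
  rw [hx, hy] at hx0
  have hs : s = 0 := by
    have : R * s = 0 := by linarith
    exact (mul_eq_zero.1 this).resolve_left hRpos.ne'
  exact hz0 (by rw [hy, hs]; ext i; fin_cases i <;> rfl)
end Binary

section Plane

theorem exists_quadratic_pos {A : ℤ} (hA : 0 < A) (B C : ℤ) :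
    ∃ T : ℤ, 0 < A * T ^ 2 + B * T + C := by
  refine ⟨|B| + |C| + 1, ?_⟩
  have h1 := neg_abs_le B
  have h2 := neg_abs_le C
  have h3 := abs_nonneg B
  have h4 := abs_nonneg C
  set T := |B| + |C| + 1 with hT
  have h5 : T ^ 2 ≤ A * T ^ 2 := by nlinarith [sq_nonneg T]
  have h6 : -|B| * T ≤ B * T := by nlinarith
  have h7 : |C| ≤ |C| * T := by nlinarith
  nlinarith

theorem isCoprime_of_prime_not_dvd {x y : ℤ} (h : ∀ p : ℕ, p.Prime → (p : ℤ) ∣ x → ¬ (p : ℤ) ∣ y) :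
    IsCoprime x y := by
  rw [Int.isCoprime_iff_gcd_eq_one]
  by_contra hg
  obtain ⟨p, hp, hpg⟩ := Nat.exists_prime_and_dvd hg
  exact h p hp ((Int.natCast_dvd_natCast.2 hpg).trans (Int.gcd_dvd_left ..))
    ((Int.natCast_dvd_natCast.2 hpg).trans (Int.gcd_dvd_right ..))

theorem exists_isCoprime_add_mul {a b m : ℤ} (ha : a ≠ 0)
    (h : ∀ p : ℕ, p.Prime → (p : ℤ) ∣ a → (p : ℤ) ∣ m → ¬ (p : ℤ) ∣ b) :
    ∃ t : ℤ, IsCoprime a (b + m * t) := by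
  classical
  let S : Finset ℕ := a.natAbs.primeFactors.filter fun p : ℕ => ¬ (p : ℤ) ∣ b
  refine ⟨∏ p ∈ S, (p : ℤ), isCoprime_of_prime_not_dvd fun p hp hpa hdvd => ?_⟩
  have hp' := Nat.prime_iff_prime_int.1 hp
  by_cases hb : (p : ℤ) ∣ b
  · rcases hp'.dvd_or_dvd ((dvd_add_right hb).1 hdvd) with h1 | h1
    · exact h p hp hpa h1 hb
    · obtain ⟨r, hr, hpr⟩ := hp'.exists_mem_finset_dvd h1
      have h2 := Finset.mem_filter.1 hr
      have h3 := (Nat.prime_dvd_prime_iff_eq hp (Nat.prime_of_mem_primeFactors h2.1)).1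
        (Int.natCast_dvd_natCast.1 hpr)
      exact h2.2 (h3 ▸ hb)
  · have h1 : p ∈ S := Finset.mem_filter.2 ⟨Nat.mem_primeFactors.2
      ⟨hp, Int.natCast_dvd.1 hpa, Int.natAbs_ne_zero.2 ha⟩, hb⟩
    exact hb ((dvd_add_left ((Finset.dvd_prod_of_mem (fun p : ℕ => (p : ℤ)) h1).mul_left m)).1 hdvd)

variable {Λ : Type} [AddCommGroup Λ] [Module.Free ℤ Λ]

theorem exists_primitive_part {v : Λ} (hv : v ≠ 0) :
    ∃ (g : ℤ) (w : Λ) (φ : Λ →ₗ[ℤ] ℤ), v = g • w ∧ φ w = 1 := by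
  classical
  let ev : (Λ →ₗ[ℤ] ℤ) →ₗ[ℤ] ℤ := LinearMap.applyₗ v
  obtain ⟨g, hg⟩ := (IsPrincipalIdealRing.principal (LinearMap.range ev)).principal
  have hdvd : ∀ φ : Λ →ₗ[ℤ] ℤ, ∃ k, φ v = g * k := by
    intro φ
    have : φ v ∈ LinearMap.range ev := ⟨φ, rfl⟩
    rw [hg] at this
    obtain ⟨k, hk⟩ := Submodule.mem_span_singleton.1 this
    exact ⟨k, by rw [← hk, smul_eq_mul, mul_comm]⟩
  obtain ⟨φ, hφ⟩ : g ∈ LinearMap.range ev := hg ▸ Submodule.mem_span_singleton_self g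
  have hφ : φ v = g := hφ
  let bs := Module.Free.chooseBasis ℤ Λ
  choose k hk using fun i => hdvd (bs.coord i)
  have hg0 : g ≠ 0 := by
    rintro rfl
    obtain ⟨ψ, hψ⟩ := exists_functional_ne_zero hv
    obtain ⟨k, hk⟩ := hdvd ψ
    exact hψ (by simpa using hk)
  have hfin : (Function.support k).Finite := by
    refine (bs.repr v).hasFiniteSupport.subset fun i hi => ?_
    have := hk i
    simp only [Module.Basis.coord_apply] at this
    simp only [Function.mem_support] at hi ⊢
    rw [this]; exact mul_ne_zero hg0 hi
  let w := bs.repr.symm (Finsupp.ofSupportFinite k hfin)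
  have hvw : v = g • w := by
    refine bs.ext_elem fun i => ?_
    have := hk i
    simp only [Module.Basis.coord_apply] at this
    simp only [w, map_smul, Finsupp.smul_apply, LinearEquiv.apply_symm_apply, smul_eq_mul, this]
    rfl
  refine ⟨g, w, φ, hvw, ?_⟩
  rw [hvw, map_smul, smul_eq_mul] at hφ
  exact mul_left_cancel₀ hg0 (by rw [hφ, mul_one])

/-- Approximation of a pair of vectors by a pair spanning an indefinite plane with coprime
coefficients. -/
theorem exists_plane {b : Λ →ₗ[ℤ] Λ →ₗ[ℤ] ℤ} (hb : ∀ x y, b x y = b y x) {d s : ℤ}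
    (h : DualBound b d) (hs : s ≠ 0) (hds : d ∣ s) (hpos : ∃ x, 0 < b x x) (hneg : ∃ x, b x x < 0)
    {ε : ℤ} (hε : ε = 1 ∨ ε = -1) {w₀ z₀ : Λ}
    (hw : ∀ p : ℕ, p.Prime → (p : ℤ) ∣ s → (p : ℤ) ∣ b w₀ w₀ → ¬ (p : ℤ) ∣ b w₀ z₀) :
    ∃ (w z k l : Λ) (c : ℤ), IsCoprime c s ∧ w = c • w₀ + s • k ∧ z = z₀ + s • l ∧
      0 < ε * b w w ∧ IsCoprime (b w w) (b w z) ∧ 0 < b w z ^ 2 - b w w * b z z := by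
  obtain ⟨⟨y₁, hy₁⟩, ⟨y₂, hy₂⟩⟩ : (∃ y, 0 < ε * b y y) ∧ (∃ y, ε * b y y < 0) := by
    rcases hε with rfl | rfl
    · simpa using ⟨hpos, hneg⟩
    · simpa using ⟨hneg, hpos⟩
  have hε1 : ε * ε = 1 := by rcases hε with rfl | rfl <;> norm_num
  have hs2 : 0 < s ^ 2 := by positivity
  obtain ⟨T, hT⟩ := exists_quadratic_pos (mul_pos hs2 hy₁) (2 * s * ε * b w₀ y₁) (ε * b w₀ w₀)
  have hv : 0 < ε * b (w₀ + (s * T) • y₁) (w₀ + (s * T) • y₁) := by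
    convert hT using 1
    simp only [map_add, map_smul, LinearMap.add_apply, LinearMap.smul_apply, smul_eq_mul, hb y₁ w₀]
    ring
  set v := w₀ + (s * T) • y₁ with hvdef
  have hv0 : v ≠ 0 := by intro h0; simp [h0] at hv
  obtain ⟨g, w, φ, hvw, hφ⟩ := exists_primitive_part hv0
  have hgs : IsCoprime g s := by
    refine isCoprime_of_prime_not_dvd fun p hp hpg hps => ?_
    obtain ⟨g', rfl⟩ := hpg
    obtain ⟨s', rfl⟩ := hps
    have e : w₀ = (p : ℤ) • (g' • w - (s' * T) • y₁) := by
      rw [smul_sub, smul_smul, smul_smul, ← hvw, hvdef, ← mul_assoc, add_sub_cancel_right]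
    have e1 : ∀ x, (p : ℤ) ∣ b w₀ x := fun x => by
      rw [e, map_smul, LinearMap.smul_apply, smul_eq_mul]; exact dvd_mul_right _ _
    exact hw p hp (dvd_mul_right _ _) (e1 _) (e1 _)
  obtain ⟨c, m, hcm⟩ := hgs
  have hcs : IsCoprime c s := ⟨g, m, by rw [mul_comm g]; exact hcm⟩
  have hwk : w = c • w₀ + s • ((c * T) • y₁ + m • w) := by
    have e : c • v + (m * s) • w = w := by
      rw [hvw, smul_smul, ← add_smul, hcm, one_smul]
    rw [hvdef] at e
    conv_lhs => rw [← e]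
    module
  have ha : 0 < ε * b w w := by
    rw [hvw] at hv
    simp only [map_smul, LinearMap.smul_apply, smul_eq_mul] at hv
    have : 0 < g ^ 2 * (ε * b w w) := by linarith
    exact pos_of_mul_pos_right this (sq_nonneg g)
  obtain ⟨x₁, hx₁⟩ := h φ
  have hx₁w : b w x₁ = d := by rw [hb, hx₁, hφ, mul_one]
  have ha0 : b w w ≠ 0 := by intro h0; rw [h0] at ha; simp at ha
  obtain ⟨t, ht⟩ := exists_isCoprime_add_mul (a := b w w) (b := b w z₀) (m := s * d) ha0 (by
    intro p hp hpa hpm hpb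
    have hp' := Nat.prime_iff_prime_int.1 hp
    have hps : (p : ℤ) ∣ s := by
      rcases hp'.dvd_or_dvd hpm with h1 | h1
      · exact h1
      · exact h1.trans hds
    have hpc : ¬ (p : ℤ) ∣ c := fun hpc => hp'.not_isUnit (hcs.isUnit_of_dvd' hpc hps)
    have hmod : ∀ x, ∃ k, b w x = c * b w₀ x + s * k := fun x => by
      rw [hwk]
      exact ⟨b ((c * T) • y₁ + m • w) x, by
        simp only [map_add, map_smul, LinearMap.add_apply, LinearMap.smul_apply, smul_eq_mul]⟩
    have hred : ∀ x, (p : ℤ) ∣ b w x → (p : ℤ) ∣ b w₀ x := fun x hx => by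
      obtain ⟨k, hk⟩ := hmod x
      rw [hk] at hx
      exact (hp'.dvd_or_dvd ((dvd_add_left (hps.mul_right k)).1 hx)).resolve_left hpc
    refine hw p hp hps (hred w₀ ?_) (hred z₀ hpb)
    rw [hb]
    exact hred w hpa)
  obtain ⟨T', hT'⟩ := exists_quadratic_pos
    (A := -(ε * b w w) * (s * b w w) ^ 2 * (ε * b y₂ y₂))
    (by
      have h1 : 0 < (s * b w w) ^ 2 := by positivity
      have h2 := mul_pos ha h1
      nlinarith)
    (- b w w * (2 * (s * b w w) * b (z₀ + (s * t) • x₁) y₂))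
    (- b w w * b (z₀ + (s * t) • x₁) (z₀ + (s * t) • x₁))
  refine ⟨w, z₀ + s • (t • x₁ + (b w w * T') • y₂), _, _, c, hcs, hwk, rfl, ha, ?_, ?_⟩
  · have e : b w (z₀ + s • (t • x₁ + (b w w * T') • y₂)) =
        b w z₀ + s * d * t + b w w * (s * T' * b w y₂) := by
      simp only [map_add, map_smul, smul_eq_mul, hx₁w]; ring
    rw [e]
    exact IsCoprime.add_mul_left_right_iff.2 ht
  · have e : - b w w * b (z₀ + s • (t • x₁ + (b w w * T') • y₂))
        (z₀ + s • (t • x₁ + (b w w * T') • y₂)) =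
        -(ε * b w w) * (s * b w w) ^ 2 * (ε * b y₂ y₂) * T' ^ 2 +
        - b w w * (2 * (s * b w w) * b (z₀ + (s * t) • x₁) y₂) * T' +
        - b w w * b (z₀ + (s * t) • x₁) (z₀ + (s * t) • x₁) := by
      simp only [map_add, map_smul, LinearMap.add_apply, LinearMap.smul_apply, smul_eq_mul,
        hb y₂ z₀, hb y₂ x₁, hb x₁ z₀]
      linear_combination (b w w) * (s * b w w) ^ 2 * (b y₂ y₂) * T' ^ 2 * hε1
    rw [← e] at hT'
    nlinarith [sq_nonneg (b w (z₀ + s • (t • x₁ + (b w w * T') • y₂)))]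
end Plane

section Residues
variable {Λ : Type} [AddCommGroup Λ]

/-- The form has rank greater than `k` modulo `p`. -/
def ResidualRankGT (b : Λ →ₗ[ℤ] Λ →ₗ[ℤ] ℤ) (p k : ℕ) : Prop :=
  ∀ f : Fin k → Λ, ∃ x y, (∀ i, (p : ℤ) ∣ b x (f i)) ∧ ¬ (p : ℤ) ∣ b x y

theorem exists_vector_crt {S : Finset ℕ} (hS : ∀ p ∈ S, p.Prime) (e : ℕ) (x : ℕ → Λ) :
    ∃ y, ∀ p ∈ S, ∃ k, y = x p + ((p : ℤ) ^ e) • k := by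
  classical
  have hc : ∀ p ∈ S, ∃ c : ℤ, (∃ k, c = 1 + (p : ℤ) ^ e * k) ∧ ∀ q ∈ S, q ≠ p → (q : ℤ) ^ e ∣ c := by
    intro p hp
    have hcop : IsCoprime ((p : ℤ) ^ e) (∏ q ∈ S.erase p, (q : ℤ) ^ e) := by
      refine IsCoprime.prod_right fun q hq => IsCoprime.pow ?_
      rw [Nat.isCoprime_iff_coprime]
      exact (Nat.coprime_primes (hS p hp) (hS q (Finset.mem_of_mem_erase hq))).2
        (Finset.ne_of_mem_erase hq).symm
    obtain ⟨u, v, huv⟩ := hcop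
    refine ⟨v * ∏ q ∈ S.erase p, (q : ℤ) ^ e, ⟨-u, by linear_combination huv⟩, fun q hq hqp => ?_⟩
    exact (Finset.dvd_prod_of_mem (fun q : ℕ => (q : ℤ) ^ e) (Finset.mem_erase.2 ⟨hqp, hq⟩)).mul_left v
  choose! c hc1 hc2 using hc
  refine ⟨∑ q ∈ S, c q • x q, fun p hp => ?_⟩
  obtain ⟨k, hk⟩ := hc1 p hp
  have h2 : ∀ q ∈ S.erase p, ∃ m, c q = (p : ℤ) ^ e * m := fun q hq =>
    hc2 q (Finset.mem_of_mem_erase hq) p hp (Finset.ne_of_mem_erase hq).symm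
  choose! m hm using h2
  refine ⟨k • x p + ∑ q ∈ S.erase p, m q • x q, ?_⟩
  rw [← Finset.add_sum_erase S _ hp, hk, smul_add, Finset.smul_sum,
    Finset.sum_congr rfl fun q hq => show c q • x q = (p : ℤ) ^ e • m q • x q by
      rw [hm q hq, mul_smul]]
  module

/-- Existence of a plane with prescribed behaviour at finitely many primes. -/
theorem exists_plane_local [Module.Free ℤ Λ] {b : Λ →ₗ[ℤ] Λ →ₗ[ℤ] ℤ} (hb : ∀ x y, b x y = b y x)
    {d : ℤ} (h : DualBound b d) (hd : d ≠ 0) (hpos : ∃ x, 0 < b x x) (hneg : ∃ x, b x x < 0)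
    {S : Finset ℕ} (hS : ∀ p ∈ S, p.Prime) (hSd : ∀ p : ℕ, p.Prime → (p : ℤ) ∣ d → p ∈ S)
    {e : ℕ} (he : e ≠ 0) {w₀ z₀ : ℕ → Λ}
    (hwz : ∀ p ∈ S, (p : ℤ) ∣ b (w₀ p) (w₀ p) → ¬ (p : ℤ) ∣ b (w₀ p) (z₀ p))
    {ε : ℤ} (hε : ε = 1 ∨ ε = -1) :
    ∃ w z, 0 < ε * b w w ∧ IsCoprime (b w w) (b w z) ∧ 0 < b w z ^ 2 - b w w * b z z ∧
      ∀ p ∈ S, ∃ c : ℤ, ¬ (p : ℤ) ∣ c ∧ (p : ℤ) ^ e ∣ b w w - c ^ 2 * b (w₀ p) (w₀ p) ∧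
        (p : ℤ) ^ e ∣ (b w z ^ 2 - b w w * b z z) -
          c ^ 2 * (b (w₀ p) (z₀ p) ^ 2 - b (w₀ p) (w₀ p) * b (z₀ p) (z₀ p)) := by
  obtain ⟨w₁, hw₁⟩ := exists_vector_crt hS e w₀
  obtain ⟨z₁, hz₁⟩ := exists_vector_crt hS e z₀
  have hPe : ∀ p ∈ S, (p : ℤ) ^ e ∣ d * ∏ q ∈ S, (q : ℤ) ^ e := fun p hp =>
    (Finset.dvd_prod_of_mem (fun q : ℕ => (q : ℤ) ^ e) hp).mul_left d
  have hs : d * ∏ q ∈ S, (q : ℤ) ^ e ≠ 0 := mul_ne_zero hd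
    (Finset.prod_ne_zero_iff.2 fun q hq => pow_ne_zero _ (by exact_mod_cast (hS q hq).ne_zero))
  have hmem : ∀ p : ℕ, p.Prime → (p : ℤ) ∣ d * ∏ q ∈ S, (q : ℤ) ^ e → p ∈ S := by
    intro p hp hps
    have hp' := Nat.prime_iff_prime_int.1 hp
    rcases hp'.dvd_or_dvd hps with h1 | h1
    · exact hSd p hp h1
    · obtain ⟨q, hq, hpq⟩ := hp'.exists_mem_finset_dvd h1
      have := (Nat.prime_dvd_prime_iff_eq hp (hS q hq)).1
        (Int.natCast_dvd_natCast.1 (hp'.dvd_of_dvd_pow hpq))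
      exact this ▸ hq
  obtain ⟨w, z, k, l, c, hc, rfl, rfl, h1, h2, h3⟩ := exists_plane hb h hs (dvd_mul_right _ _) hpos
    hneg hε (w₀ := w₁) (z₀ := z₁) (by
      intro p hp hps
      have hpS := hmem p hp hps
      obtain ⟨k, hk⟩ := hw₁ p hpS
      obtain ⟨l, hl⟩ := hz₁ p hpS
      have hpe : (p : ℤ) ∣ (p : ℤ) ^ e := dvd_pow_self _ he
      have e1 : b w₁ w₁ = b (w₀ p) (w₀ p) + (p : ℤ) ^ e * (b (w₀ p) k + b k (w₀ p)
          + (p : ℤ) ^ e * b k k) := by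
        rw [hk]; simp only [map_add, map_smul, LinearMap.add_apply, LinearMap.smul_apply, smul_eq_mul]
        ring
      have e2 : b w₁ z₁ = b (w₀ p) (z₀ p) + (p : ℤ) ^ e * (b (w₀ p) l + b k (z₀ p)
          + (p : ℤ) ^ e * b k l) := by
        rw [hk, hl]
        simp only [map_add, map_smul, LinearMap.add_apply, LinearMap.smul_apply, smul_eq_mul]
        ring
      rw [e1, e2, dvd_add_left (hpe.mul_right _), dvd_add_left (hpe.mul_right _)]
      exact hwz p hpS)
  refine ⟨_, _, h1, h2, h3, fun p hp => ⟨c, fun hpc => ?_, ?_⟩⟩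
  · exact (Nat.prime_iff_prime_int.1 (hS p hp)).not_isUnit
      (hc.isUnit_of_dvd' hpc ((dvd_pow_self _ he).trans (hPe p hp)))
  · obtain ⟨s', hs'⟩ := hPe p hp
    obtain ⟨k₁, hk₁⟩ := hw₁ p hp
    obtain ⟨l₁, hl₁⟩ := hz₁ p hp
    rw [hs']
    generalize (p : ℤ) ^ e = m at *
    obtain ⟨k', hk'⟩ : ∃ k', c • w₁ + (m * s') • k = c • w₀ p + m • k' :=
      ⟨c • k₁ + s' • k, by rw [hk₁]; module⟩
    obtain ⟨l', hl'⟩ : ∃ l', z₁ + (m * s') • l = z₀ p + m • l' :=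
      ⟨l₁ + s' • l, by rw [hl₁]; module⟩
    rw [hk', hl']
    have e1 : b (c • w₀ p + m • k') (c • w₀ p + m • k') = c ^ 2 * b (w₀ p) (w₀ p) + m *
        (2 * c * b (w₀ p) k' + m * b k' k') := by
      simp only [map_add, map_smul, LinearMap.add_apply, LinearMap.smul_apply, smul_eq_mul,
        hb k' (w₀ p)]
      ring
    have e2 : b (c • w₀ p + m • k') (z₀ p + m • l') = c * b (w₀ p) (z₀ p) + m *
        (c * b (w₀ p) l' + b k' (z₀ p) + m * b k' l') := by
      simp only [map_add, map_smul, LinearMap.add_apply, LinearMap.smul_apply, smul_eq_mul]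
      ring
    have e3 : b (z₀ p + m • l') (z₀ p + m • l') = b (z₀ p) (z₀ p) + m *
        (2 * b (z₀ p) l' + m * b l' l') := by
      simp only [map_add, map_smul, LinearMap.add_apply, LinearMap.smul_apply, smul_eq_mul,
        hb l' (z₀ p)]
      ring
    rw [e1, e2, e3]
    generalize 2 * c * b (w₀ p) k' + m * b k' k' = t₁
    generalize c * b (w₀ p) l' + b k' (z₀ p) + m * b k' l' = t₂
    generalize 2 * b (z₀ p) l' + m * b l' l' = t₃
    generalize b (w₀ p) (w₀ p) = A
    generalize b (w₀ p) (z₀ p) = E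
    generalize b (z₀ p) (z₀ p) = C
    exact ⟨⟨t₁, by ring⟩, ⟨2 * c * E * t₂ + m * t₂ ^ 2 - c ^ 2 * A * t₃ - t₁ * C - m * t₁ * t₃,
      by ring⟩⟩

theorem exists_mod_projection {b : Λ →ₗ[ℤ] Λ →ₗ[ℤ] ℤ} {p k : ℕ} (hp : p.Prime) {f : Fin k → Λ}
    (hf : ∀ i, ¬ (p : ℤ) ∣ b (f i) (f i)) (hff : ∀ i j, i ≠ j → (p : ℤ) ∣ b (f i) (f j)) (y : Λ) :
    ∃ y', (∀ i, (p : ℤ) ∣ b (f i) y') ∧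
      ∀ x, (∀ i, (p : ℤ) ∣ b x (f i)) → (p : ℤ) ∣ b x y' - b x y := by
  have hinv : ∀ i, ∃ n : ℤ, (p : ℤ) ∣ n * b (f i) (f i) - 1 := by
    intro i
    obtain ⟨u, v, huv⟩ := ((Nat.prime_iff_prime_int.1 hp).coprime_iff_not_dvd.2 (hf i)).symm
    exact ⟨u, -v, by linear_combination huv⟩
  choose n hn using hinv
  refine ⟨y - ∑ i, (n i * b (f i) y) • f i, fun i => ?_, fun x hx => ?_⟩
  · rw [map_sub, map_sum, ← Finset.add_sum_erase _ _ (Finset.mem_univ i), ← sub_sub]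
    refine dvd_sub ?_ (Finset.dvd_sum fun j hj => ?_)
    · obtain ⟨m, hm⟩ := hn i
      rw [map_smul, smul_eq_mul]
      exact ⟨-(m * b (f i) y), by linear_combination -(b (f i) y) * hm⟩
    · rw [map_smul]
      exact (hff i j (Finset.ne_of_mem_erase hj).symm).mul_left _
  · rw [map_sub, map_sum, sub_sub_cancel_left, dvd_neg]
    refine Finset.dvd_sum fun j _ => ?_
    rw [map_smul]
    exact (hx j).mul_left _

theorem ResidualRankGT.exists_pair {b : Λ →ₗ[ℤ] Λ →ₗ[ℤ] ℤ} {p k : ℕ} (hr : ResidualRankGT b p k)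
    (hb : ∀ x y, b x y = b y x) (hp : p.Prime) {f : Fin k → Λ}
    (hf : ∀ i, ¬ (p : ℤ) ∣ b (f i) (f i)) (hff : ∀ i j, i ≠ j → (p : ℤ) ∣ b (f i) (f j)) :
    ∃ x y, (∀ i, (p : ℤ) ∣ b (f i) x) ∧ (∀ i, (p : ℤ) ∣ b (f i) y) ∧ ¬ (p : ℤ) ∣ b x y := by
  obtain ⟨x, y, hx, hxy⟩ := hr f
  obtain ⟨y', hy1, hy2⟩ := exists_mod_projection hp hf hff y
  exact ⟨x, y', fun i => by rw [hb]; exact hx i, hy1, fun h => hxy ((dvd_sub_right h).1 (hy2 x hx))⟩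

theorem ResidualRankGT.exists_orthogonal {b : Λ →ₗ[ℤ] Λ →ₗ[ℤ] ℤ} {p k : ℕ}
    (hr : ResidualRankGT b p k) (hb : ∀ x y, b x y = b y x) (hp : p.Prime) (hp2 : p ≠ 2)
    {f : Fin k → Λ} (hf : ∀ i, ¬ (p : ℤ) ∣ b (f i) (f i))
    (hff : ∀ i j, i ≠ j → (p : ℤ) ∣ b (f i) (f j)) :
    ∃ x, (∀ i, (p : ℤ) ∣ b (f i) x) ∧ ¬ (p : ℤ) ∣ b x x := by
  obtain ⟨x, y, hx, hy, hxy⟩ := hr.exists_pair hb hp hf hff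
  by_contra! hc
  have h1 := hc x hx
  have h2 := hc y hy
  have h3 := hc (x + y) fun i => by rw [map_add]; exact dvd_add (hx i) (hy i)
  have e : b (x + y) (x + y) = 2 * b x y + (b x x + b y y) := by
    simp only [map_add, LinearMap.add_apply, hb y x]; ring
  rw [e, dvd_add_left (dvd_add h1 h2)] at h3
  rcases (Nat.prime_iff_prime_int.1 hp).dvd_or_dvd h3 with h4 | h4
  · exact hp2 ((Nat.prime_dvd_prime_iff_eq hp Nat.prime_two).1 (by exact_mod_cast h4))
  · exact hxy h4

theorem ResidualRankGT.mono {b : Λ →ₗ[ℤ] Λ →ₗ[ℤ] ℤ} {p k j : ℕ} (hr : ResidualRankGT b p k)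
    (hj : j ≤ k) : ResidualRankGT b p j := by
  intro f
  obtain ⟨x, y, hx, hxy⟩ := hr fun i => if h : (i : ℕ) < j then f ⟨i, h⟩ else 0
  exact ⟨x, y, fun i => by simpa using hx ⟨i, i.2.trans_le hj⟩, hxy⟩

end Residues

section LocalPlanes
variable {Λ : Type} [AddCommGroup Λ] {b : Λ →ₗ[ℤ] Λ →ₗ[ℤ] ℤ}

theorem ResidualRankGT.exists_orthogonal_pair {p : ℕ} (hr : ResidualRankGT b p 1)
    (hb : ∀ x y, b x y = b y x) (hp : p.Prime) (hp2 : p ≠ 2) :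
    ∃ w z, ¬ (p : ℤ) ∣ b w w ∧ ¬ (p : ℤ) ∣ b z z ∧ (p : ℤ) ∣ b w z := by
  obtain ⟨v, -, hv⟩ := (hr.mono zero_le_one).exists_orthogonal hb hp hp2 (f := ![])
    (fun i => i.elim0) (fun i => i.elim0)
  obtain ⟨u, hu1, hu⟩ := hr.exists_orthogonal hb hp hp2 (f := fun _ => v) (fun _ => hv)
    (fun i j hij => (hij (Subsingleton.elim _ _)).elim)
  exact ⟨v, u, hv, hu, hu1 0⟩

theorem ResidualRankGT.exists_discr_not_dvd {p : ℕ} (hr : ResidualRankGT b p 1)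
    (hb : ∀ x y, b x y = b y x) (hp : p.Prime) (hp2 : p ≠ 2) :
    ∃ w z, ¬ (p : ℤ) ∣ b w w ∧ ¬ (p : ℤ) ∣ b w z ^ 2 - b w w * b z z := by
  obtain ⟨w, z, hw, hz, hwz⟩ := hr.exists_orthogonal_pair hb hp hp2
  refine ⟨w, z, hw, fun h => ?_⟩
  rw [dvd_sub_right (hwz.pow two_ne_zero)] at h
  exact ((Nat.prime_iff_prime_int.1 hp).dvd_or_dvd h).elim hw hz

theorem exists_diagonal_solution {p : ℕ} (hp : p.Prime) (hp2 : p ≠ 2) {α β : ℤ}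
    (hα : ¬ (p : ℤ) ∣ α) (hβ : ¬ (p : ℤ) ∣ β) (γ : ℤ) :
    ∃ x y : ℤ, (p : ℤ) ∣ α * x ^ 2 + β * y ^ 2 - γ := by
  have := Fact.mk hp
  have hα' : (α : ZMod p) ≠ 0 := fun h => hα ((ZMod.intCast_zmod_eq_zero_iff_dvd _ p).1 h)
  have hβ' : (β : ZMod p) ≠ 0 := fun h => hβ ((ZMod.intCast_zmod_eq_zero_iff_dvd _ p).1 h)
  open Polynomial in
  obtain ⟨x, y, hxy⟩ := FiniteField.exists_root_sum_quadratic
    (f := C (α : ZMod p) * X ^ 2 + C 0 * X + C (-γ : ZMod p))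
    (g := C (β : ZMod p) * X ^ 2 + C 0 * X + C 0)
    (degree_quadratic hα') (degree_quadratic hβ')
    (by rw [ZMod.card]; exact (hp.eq_two_or_odd).resolve_left hp2)
  obtain ⟨x, rfl⟩ := ZMod.intCast_surjective x
  obtain ⟨y, rfl⟩ := ZMod.intCast_surjective y
  refine ⟨x, y, (ZMod.intCast_zmod_eq_zero_iff_dvd _ p).1 ?_⟩
  push_cast
  simp only [Polynomial.eval_add, Polynomial.eval_mul, Polynomial.eval_C, Polynomial.eval_pow,
    Polynomial.eval_X] at hxy
  linear_combination hxy

theorem exists_int_nonsquare {p : ℕ} (hp : p.Prime) (hp2 : p ≠ 2) :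
    ∃ ν : ℤ, ∀ k : ℤ, ¬ (p : ℤ) ∣ k ^ 2 - ν := by
  have := Fact.mk hp
  obtain ⟨a, ha⟩ := FiniteField.exists_nonsquare (F := ZMod p)
    (by rwa [ringChar.eq (ZMod p) p])
  obtain ⟨ν, rfl⟩ := ZMod.intCast_surjective a
  refine ⟨ν, fun k hk => ha ⟨k, ?_⟩⟩
  have := (ZMod.intCast_zmod_eq_zero_iff_dvd _ p).2 hk
  push_cast at this
  linear_combination -this

theorem ResidualRankGT.exists_discr_nonsquare {p : ℕ} (hr : ResidualRankGT b p 2)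
    (hb : ∀ x y, b x y = b y x) (hp : p.Prime) (hp2 : p ≠ 2) :
    ∃ w z, ¬ (p : ℤ) ∣ b w w ∧ ∀ k : ℤ, ¬ (p : ℤ) ∣ k ^ 2 - (b w z ^ 2 - b w w * b z z) := by
  have hp' := Nat.prime_iff_prime_int.1 hp
  obtain ⟨w, u, hw, hu, hwu⟩ := (hr.mono one_le_two).exists_orthogonal_pair hb hp hp2
  obtain ⟨v, hv1, hv⟩ := hr.exists_orthogonal hb hp hp2 (f := ![w, u])
    (fun i => by fin_cases i <;> assumption)
    (fun i j hij => by
      fin_cases i <;> fin_cases j <;> first | exact (hij rfl).elim | simpa using hwu | skip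
      simpa [hb u w] using hwu)
  have hwv : (p : ℤ) ∣ b w v := hv1 0
  have huv : (p : ℤ) ∣ b u v := hv1 1
  obtain ⟨ν, hν⟩ := exists_int_nonsquare hp hp2
  obtain ⟨n, m, hn⟩ := ((hp'.coprime_iff_not_dvd).2 hw).symm
  obtain ⟨x, y, hxy⟩ := exists_diagonal_solution hp hp2 hu hv (-(ν * n))
  refine ⟨w, x • u + y • v, hw, fun k hk => hν k ?_⟩
  have e1 : b w (x • u + y • v) = x * b w u + y * b w v := by simp
  have e2 : b (x • u + y • v) (x • u + y • v) = b u u * x ^ 2 + b v v * y ^ 2 +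
      2 * x * y * b u v := by
    simp only [map_add, map_smul, LinearMap.add_apply, LinearMap.smul_apply, smul_eq_mul, hb v u]
    ring
  rw [e1, e2] at hk
  obtain ⟨t1, h1⟩ := hwu
  obtain ⟨t2, h2⟩ := hwv
  obtain ⟨t3, h3⟩ := huv
  obtain ⟨t4, h4⟩ := hxy
  obtain ⟨t5, h5⟩ := hk
  refine ⟨t5 + p * (x * t1 + y * t2) ^ 2 - b w w * (t4 + 2 * x * y * t3) - ν * m, ?_⟩
  rw [h1, h2, h3] at h5
  linear_combination h5 - b w w * h4 + ν * hn

theorem ResidualRankGT.two_cases (hr : ResidualRankGT b 2 2) (hb : ∀ x y, b x y = b y x) {v : Λ}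
    (hv : Odd (b v v)) :
    (∃ x y, Even (b v x) ∧ Even (b v y) ∧ Even (b x x) ∧ Even (b y y) ∧ Odd (b x y)) ∨
    ∃ x y, Even (b v x) ∧ Even (b v y) ∧ Odd (b x x) ∧ Odd (b y y) ∧ Even (b x y) := by
  have hnd : ∀ z : ℤ, ¬ ((2 : ℕ) : ℤ) ∣ z ↔ Odd z := fun z => by
    rw [← Int.not_even_iff_odd, even_iff_two_dvd]; rfl
  have hd : ∀ z : ℤ, ((2 : ℕ) : ℤ) ∣ z ↔ Even z := fun z => by
    rw [even_iff_two_dvd]; rfl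
  have hv' : ∀ f : Fin 1 → Λ, (∀ i, f i = v) → (∀ i, ¬ ((2 : ℕ) : ℤ) ∣ b (f i) (f i)) := by
    intro f hf i; rw [hf, hnd]; exact hv
  obtain ⟨x, y, hx, hy, hxy⟩ := (hr.mono one_le_two).exists_pair hb Nat.prime_two (f := fun _ => v)
    (hv' _ fun _ => rfl) (fun i j hij => (hij (Subsingleton.elim _ _)).elim)
  replace hx := (hd _).1 (hx 0)
  replace hy := (hd _).1 (hy 0)
  rw [hnd] at hxy
  have key : ∀ u, Even (b v u) → Odd (b u u) →
      (∃ x y, Even (b v x) ∧ Even (b v y) ∧ Even (b x x) ∧ Even (b y y) ∧ Odd (b x y)) ∨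
      ∃ x y, Even (b v x) ∧ Even (b v y) ∧ Odd (b x x) ∧ Odd (b y y) ∧ Even (b x y) := by
    intro u hvu hu
    obtain ⟨x, y, hx, hy, hxy⟩ := hr.exists_pair hb Nat.prime_two (f := ![v, u])
      (fun i => by fin_cases i <;> simpa only [hnd])
      (fun i j hij => by
        rw [hd]
        fin_cases i <;> fin_cases j <;> first | exact (hij rfl).elim | simpa using hvu | skip
        simpa [hb u v] using hvu)
    rw [hnd] at hxy
    have hx0 : Even (b v x) := (hd _).1 (hx 0)
    have hx1 : Even (b u x) := (hd _).1 (hx 1)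
    have hy0 : Even (b v y) := (hd _).1 (hy 0)
    have hy1 : Even (b u y) := (hd _).1 (hy 1)
    rcases Int.even_or_odd (b x x) with h1 | h1
    · rcases Int.even_or_odd (b y y) with h2 | h2
      · exact Or.inl ⟨x, y, hx0, hy0, h1, h2, hxy⟩
      · exact Or.inr ⟨u, y, hvu, hy0, hu, h2, hy1⟩
    · exact Or.inr ⟨u, x, hvu, hx0, hu, h1, hx1⟩
  rcases Int.even_or_odd (b x x) with h1 | h1
  · rcases Int.even_or_odd (b y y) with h2 | h2
    · exact Or.inl ⟨x, y, hx, hy, h1, h2, hxy⟩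
    · exact key y hy h2
  · exact key x hx h1

theorem ResidualRankGT.exists_discr_three_mod_four (hr : ResidualRankGT b 2 2)
    (hb : ∀ x y, b x y = b y x) {v : Λ} (hv : Odd (b v v)) :
    ∃ w z, Odd (b w w) ∧ (4 : ℤ) ∣ (b w z ^ 2 - b w w * b z z) - 3 := by
  have fin : ∀ w z, Odd (b w w) → (4 : ℤ) ∣ b w w - b z z → Even (b w z) →
      ∃ w z, Odd (b w w) ∧ (4 : ℤ) ∣ (b w z ^ 2 - b w w * b z z) - 3 := by
    intro w z hw ⟨m, hm⟩ ⟨j, hj⟩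
    refine ⟨w, z, hw, ?_⟩
    obtain ⟨i, hi⟩ := hw
    rw [show b z z = b w w - 4 * m by linarith, hi, hj]
    exact ⟨j ^ 2 - i ^ 2 - i - 1 + (2 * i + 1) * m, by ring⟩
  rcases hr.two_cases hb hv with ⟨x, y, hx, hy, hxx, hyy, hxy⟩ | ⟨x, y, hx, hy, hxx, hyy, hxy⟩
  · obtain ⟨i, hi⟩ := hv
    obtain ⟨x1, hx⟩ := hx
    obtain ⟨y1, hy⟩ := hy
    obtain ⟨x2, hxx⟩ := hxx
    obtain ⟨y2, hyy⟩ := hyy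
    obtain ⟨m, hxy⟩ := hxy
    have hxs : b (v + x) (v + x) = b v v + 2 * b v x + b x x := by
      simp only [map_add, LinearMap.add_apply, hb x v]; ring
    have hys : b (v + y) (v + y) = b v v + 2 * b v y + b y y := by
      simp only [map_add, LinearMap.add_apply, hb y v]; ring
    have hxys : b (v + x + y) (v + x + y) =
        b v v + 2 * b v x + 2 * b v y + b x x + b y y + 2 * b x y := by
      simp only [map_add, LinearMap.add_apply, hb x v, hb y v, hb y x]; ring
    have h1 : b (v + x) (v + y) = b v v + b v y + b v x + b x y := by
      simp only [map_add, LinearMap.add_apply, hb x v]; ring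
    have h2 : b (v + x) (v + x + y) = b v v + 2 * b v x + b v y + b x x + b x y := by
      simp only [map_add, LinearMap.add_apply, hb x v]; ring
    have h3 : b (v + y) (v + x + y) = b v v + b v x + 2 * b v y + b y y + b x y := by
      simp only [map_add, LinearMap.add_apply, hb y v, hb y x]; ring
    rcases Int.even_or_odd (x2 - y2) with h | h
    · refine fin (v + x) (v + y) ?_ ?_ ?_
      · rw [hxs, Int.odd_iff]; omega
      · rw [hxs, hys]; obtain ⟨t, ht⟩ := h; exact ⟨x1 - y1 + t, by linarith⟩
      · rw [h1, Int.even_iff]; omega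
    · rcases Int.even_or_odd x2 with h4 | h4
      · refine fin (v + x) (v + x + y) ?_ ?_ ?_
        · rw [hxs, Int.odd_iff]; omega
        · rw [hxs, hxys]; rw [Int.odd_iff] at h; rw [Int.even_iff] at h4; omega
        · rw [h2, Int.even_iff]; omega
      · refine fin (v + y) (v + x + y) ?_ ?_ ?_
        · rw [hys, Int.odd_iff]; omega
        · rw [hys, hxys]; rw [Int.odd_iff] at h h4; omega
        · rw [h3, Int.even_iff]; omega
  · by_cases h1 : (4 : ℤ) ∣ b v v - b x x
    · exact fin v x hv h1 hx
    by_cases h2 : (4 : ℤ) ∣ b v v - b y y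
    · exact fin v y hv h2 hy
    · refine fin x y hxx ?_ hxy
      rw [Int.odd_iff] at *
      omega

theorem ResidualRankGT.exists_one_mod_four (hr : ResidualRankGT b 2 2)
    (hb : ∀ x y, b x y = b y x) {v : Λ} (hv : Odd (b v v)) : ∃ w, (4 : ℤ) ∣ b w w - 1 := by
  have hsum : ∀ x y, b (x + y) (x + y) = b x x + 2 * b x y + b y y := fun x y => by
    simp only [map_add, LinearMap.add_apply, hb y x]; ring
  rcases hr.two_cases hb hv with ⟨x, y, hx, hy, hxx, hyy, hxy⟩ | ⟨x, y, hx, hy, hxx, hyy, hxy⟩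
  · by_contra! hc
    have h0 := hc v
    have h1 := hc (v + x)
    have h2 := hc (v + y)
    have h3 := hc (v + (x + y))
    rw [hsum] at h1 h2 h3
    rw [hsum, map_add] at h3
    rw [Int.odd_iff] at *
    rw [Int.even_iff] at *
    omega
  · by_contra! hc
    have h0 := hc v
    have h1 := hc x
    have h2 := hc y
    have h3 := hc (v + (x + y))
    rw [hsum, hsum, map_add] at h3
    rw [Int.odd_iff] at *
    rw [Int.even_iff] at *
    omega

end LocalPlanes

section Unimodular
variable {Λ : Type} [AddCommGroup Λ]

theorem exists_primitive_of_functionals [Module.Free ℤ Λ] [Module.Finite ℤ Λ] {k : ℕ}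
    (hk : k < Module.finrank ℤ Λ) (φ : Fin k → Λ →ₗ[ℤ] ℤ) :
    ∃ (x : Λ) (ψ : Λ →ₗ[ℤ] ℤ), ψ x = 1 ∧ ∀ i, φ i x = 0 := by
  have h1 : ¬ Function.Injective (LinearMap.pi φ) := fun hinj => by
    have := LinearMap.finrank_le_finrank_of_injective hinj
    simp at this; omega
  obtain ⟨v, hv, hv0⟩ : ∃ v, LinearMap.pi φ v = 0 ∧ v ≠ 0 := by
    by_contra! h
    exact h1 ((injective_iff_map_eq_zero _).2 h)
  obtain ⟨g, w, ψ, rfl, hψ⟩ := exists_primitive_part hv0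
  refine ⟨w, ψ, hψ, fun i => ?_⟩
  have := congrFun hv i
  simp only [LinearMap.pi_apply, map_smul, smul_eq_mul, Pi.zero_apply, mul_eq_zero] at this
  refine this.resolve_left ?_
  rintro rfl
  simp at hv0

variable {b : Λ →ₗ[ℤ] Λ →ₗ[ℤ] ℤ}

theorem exists_orthogonal_primitive [Module.Free ℤ Λ] [Module.Finite ℤ Λ] (h : DualBound b 1)
    (hb : ∀ x y, b x y = b y x) {k : ℕ} (hk : k < Module.finrank ℤ Λ) (f : Fin k → Λ) :
    ∃ x y, b x y = 1 ∧ ∀ i, b (f i) x = 0 := by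
  obtain ⟨x, ψ, hψ, hx⟩ := exists_primitive_of_functionals hk fun i => b (f i)
  obtain ⟨y, hy⟩ := h ψ
  exact ⟨x, y, by rw [hb, hy, hψ, one_mul], hx⟩

/-- The orthogonal complement of a vector, with its form. -/
abbrev orthForm (b : Λ →ₗ[ℤ] Λ →ₗ[ℤ] ℤ) (z : Λ) :
    LinearMap.ker (b z) →ₗ[ℤ] LinearMap.ker (b z) →ₗ[ℤ] ℤ :=
  b.domRestrict₁₂ (LinearMap.ker (b z)) (LinearMap.ker (b z))

theorem orthForm_dualBound (hb : ∀ x y, b x y = b y x) (h : DualBound b 1) (z : Λ) :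
    DualBound (orthForm b z) (b z z) := by
  intro φ
  let pr : Λ →ₗ[ℤ] LinearMap.ker (b z) :=
    (b z z • LinearMap.id - (b z).smulRight z).codRestrict _ (fun x => by
      simp [mul_comm])
  have hpr : ∀ x, (pr x : Λ) = b z z • x - b z x • z := fun x => rfl
  obtain ⟨y, hy⟩ := h (φ ∘ₗ pr)
  refine ⟨⟨y, ?_⟩, fun x => ?_⟩
  · rw [LinearMap.mem_ker, hb, hy]
    have : pr z = 0 := Subtype.ext (by rw [hpr, sub_self]; rfl)
    simp [this]
  · rw [LinearMap.domRestrict₁₂_apply, hy, one_mul, LinearMap.comp_apply, ← smul_eq_mul, ← map_smul]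
    congr 1
    refine Subtype.ext ?_
    rw [hpr, LinearMap.mem_ker.1 x.2, zero_smul, sub_zero]
    rfl

theorem orthForm_residualRankGT [Module.Free ℤ Λ] [Module.Finite ℤ Λ]
    (hb : ∀ x y, b x y = b y x) (h : DualBound b 1) {z y₀ : Λ} (hz : b z y₀ = 1) (p : ℕ)
    (hp : p.Prime) {k : ℕ} (hk : k + 2 < Module.finrank ℤ Λ) :
    ResidualRankGT (orthForm b z) p k := by
  intro f
  obtain ⟨x, y, hxy, hx⟩ := exists_orthogonal_primitive h hb hk
    (Fin.cons z (Fin.cons y₀ fun i => (f i : Λ)) : Fin (k + 2) → Λ)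
  have hxz : b z x = 0 := by simpa using hx 0
  have hxy₀ : b y₀ x = 0 := by simpa using hx 1
  have hxf : ∀ i, b (f i) x = 0 := fun i => by simpa using hx i.succ.succ
  refine ⟨⟨x, hxz⟩, ⟨y - b z y • y₀, by simp [hz]⟩, fun i => ?_, ?_⟩
  · rw [LinearMap.domRestrict₁₂_apply, hb, hxf]; exact dvd_zero _
  · rw [LinearMap.domRestrict₁₂_apply]
    simp only [map_sub, map_smul, hxy, hb x y₀, hxy₀]
    simpa using (Nat.prime_iff_prime_int.1 hp).not_dvd_one

theorem orthForm_residualRankGT_of_not_dvd [Module.Free ℤ Λ] [Module.Finite ℤ Λ]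
    (hb : ∀ x y, b x y = b y x) (h : DualBound b 1) {z : Λ} {p : ℕ}
    (hz : ¬ (p : ℤ) ∣ b z z) {k : ℕ} (hk : k + 1 < Module.finrank ℤ Λ) :
    ResidualRankGT (orthForm b z) p k := by
  intro f
  obtain ⟨x, y, hxy, hx⟩ := exists_orthogonal_primitive h hb hk
    (Fin.cons z fun i => (f i : Λ) : Fin (k + 1) → Λ)
  have hxz : b z x = 0 := by simpa using hx 0
  have hxf : ∀ i, b (f i) x = 0 := fun i => by simpa using hx i.succ
  refine ⟨⟨x, hxz⟩, ⟨b z z • y - b z y • z, by simp [mul_comm]⟩, fun i => ?_, ?_⟩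
  · rw [LinearMap.domRestrict₁₂_apply, hb, hxf]; exact dvd_zero _
  · rw [LinearMap.domRestrict₁₂_apply]
    simpa [hxy, hb x z, hxz] using hz

/-- The complement of the hyperbolic pair `e, x`. -/
def hypCompl (b : Λ →ₗ[ℤ] Λ →ₗ[ℤ] ℤ) (e x : Λ) : Submodule ℤ Λ :=
  LinearMap.ker (b e) ⊓ LinearMap.ker (b x)

theorem mem_hypCompl {e x y : Λ} : y ∈ hypCompl b e x ↔ b e y = 0 ∧ b x y = 0 := Iff.rfl

/-- Projection onto the complement of the hyperbolic pair `e, x`. -/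
def hypProj (b : Λ →ₗ[ℤ] Λ →ₗ[ℤ] ℤ) (e x : Λ) : Λ →ₗ[ℤ] Λ :=
  LinearMap.id - (b e).smulRight x - (b x - b x x • b e).smulRight e

theorem hypProj_apply (e x y : Λ) :
    hypProj b e x y = y - b e y • x - (b x y - b x x * b e y) • e := rfl

theorem hypProj_mem (hb : ∀ x y, b x y = b y x) {e x : Λ}
    (he : b e e = 0) (hex : b e x = 1)
    (y : Λ) : hypProj b e x y ∈ hypCompl b e x := by
  rw [mem_hypCompl, hypProj_apply]
  constructor
  · simp [he, hex]
  · simp only [map_sub, map_smul, hb x e, hex, smul_eq_mul]; ring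

abbrev hypForm (b : Λ →ₗ[ℤ] Λ →ₗ[ℤ] ℤ) (e x : Λ) :
    hypCompl b e x →ₗ[ℤ] hypCompl b e x →ₗ[ℤ] ℤ :=
  b.domRestrict₁₂ (hypCompl b e x) (hypCompl b e x)

theorem hypForm_dualBound (hb : ∀ x y, b x y = b y x) {d : ℤ} (h : DualBound b d) {e x : Λ}
    (he : b e e = 0) (hex : b e x = 1) : DualBound (hypForm b e x) d := by
  intro φ
  obtain ⟨y, hy⟩ := h (φ ∘ₗ (hypProj b e x).codRestrict _ (hypProj_mem hb he hex))
  have h0 : ∀ v, hypProj b e x v = 0 → b v y = 0 := fun v hv => by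
    rw [hb, hy, LinearMap.comp_apply, show (hypProj b e x).codRestrict _
      (hypProj_mem hb he hex) v = 0 from Subtype.ext hv, map_zero, mul_zero]
  refine ⟨⟨y, mem_hypCompl.2 ⟨h0 e ?_, h0 x ?_⟩⟩, fun w => ?_⟩
  · rw [hypProj_apply, he, hb x e, hex]; simp
  · rw [hypProj_apply, hex]; simp
  · rw [LinearMap.domRestrict₁₂_apply, hy, LinearMap.comp_apply]
    congr 2
    refine Subtype.ext ?_
    have := mem_hypCompl.1 w.2
    rw [LinearMap.codRestrict_apply, hypProj_apply, this.1, this.2]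
    simp

theorem finrank_hypCompl [Module.Free ℤ Λ] [Module.Finite ℤ Λ] (hb : ∀ x y, b x y = b y x)
    {e x : Λ} (he : b e e = 0) (hex : b e x = 1) :
    Module.finrank ℤ (hypCompl b e x) + 2 = Module.finrank ℤ Λ := by
  have hker : hypCompl b e x = LinearMap.ker ((b e).prod (b x)) := by
    rw [LinearMap.ker_prod]; rfl
  have hs : LinearMap.range ((b e).prod (b x)) = ⊤ := LinearMap.range_eq_top.2 fun ⟨s, t⟩ =>
    ⟨s • x + (t - s * b x x) • e, by
      simp [he, hex, hb x e]⟩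
  have := Submodule.finrank_quotient_add_finrank (LinearMap.ker ((b e).prod (b x)))
  rw [((b e).prod (b x)).quotKerEquivRange.finrank_eq, hs, finrank_top, ← hker] at this
  simp at this
  omega

theorem exists_mem_hypCompl (hb : ∀ x y, b x y = b y x) {e x v : Λ} (he : b e e = 0)
    (hex : b e x = 1) (hv : b e v = 0) : ∃ w : hypCompl b e x, hypForm b e x w w = b v v := by
  refine ⟨⟨_, hypProj_mem hb he hex v⟩, ?_⟩
  rw [LinearMap.domRestrict₁₂_apply]
  simp only [hypProj_apply, hv, zero_smul, mul_zero, sub_zero, map_sub, map_smul,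
    LinearMap.sub_apply, LinearMap.smul_apply, he, hb v e, smul_zero]

theorem exists_positive_orthogonal (hb : ∀ x y, b x y = b y x) {x y : Λ} (hx : 0 < b x x)
    (hy : 0 < b y y) (hxy : b x y = 0) (φ : Λ →ₗ[ℤ] ℤ) : ∃ v, 0 < b v v ∧ φ v = 0 := by
  by_cases h : φ y = 0
  · exact ⟨y, hy, h⟩
  · refine ⟨φ y • x - φ x • y, ?_, by simp [mul_comm]⟩
    have e : b (φ y • x - φ x • y) (φ y • x - φ x • y) = φ y ^ 2 * b x x + φ x ^ 2 * b y y := by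
      simp only [map_sub, map_smul, LinearMap.sub_apply, LinearMap.smul_apply, smul_eq_mul, hb y x,
        hxy]
      ring
    rw [e]
    have : 0 < φ y ^ 2 := by positivity
    nlinarith [sq_nonneg (φ x)]

/-- If `Λ ⊥ ⟨-1⟩` has an isotropic vector then so has `Λ`, by induction on the rank. -/
theorem isotropic_of_sq_norm [Module.Free ℤ Λ] [Module.Finite ℤ Λ] {n : ℕ}
    (IH : ∀ {Λ : Type} [AddCommGroup Λ] [Module.Free ℤ Λ] [Module.Finite ℤ Λ]
      {b : Λ →ₗ[ℤ] Λ →ₗ[ℤ] ℤ}, Module.finrank ℤ Λ = n → (∀ x y, b x y = b y x) → DualBound b 1 →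
      (∃ x, 0 < b x x) → (∃ x, b x x < 0) → ∃ x, x ≠ 0 ∧ b x x = 0)
    (hn : Module.finrank ℤ Λ = n + 1) (hb : ∀ x y, b x y = b y x) (h : DualBound b 1)
    {x y z X : Λ} (hx : 0 < b x x) (hy : 0 < b y y) (hxy : b x y = 0) (hz : b z z < 0)
    (hX : X ≠ 0) {T : ℤ} (hXT : b X X = T ^ 2) : ∃ x, x ≠ 0 ∧ b x x = 0 := by
  by_cases hT : T = 0
  · exact ⟨X, hX, by rw [hXT, hT]; rfl⟩
  let c : (Λ × ℤ) →ₗ[ℤ] (Λ × ℤ) →ₗ[ℤ] ℤ :=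
    b.compl₁₂ (LinearMap.fst ℤ Λ ℤ) (LinearMap.fst ℤ Λ ℤ) -
      (LinearMap.mul ℤ ℤ).compl₁₂ (LinearMap.snd ℤ Λ ℤ) (LinearMap.snd ℤ Λ ℤ)
  have hc : ∀ u v, c u v = b u.1 v.1 - u.2 * v.2 := fun u v => rfl
  have hcs : ∀ u v, c u v = c v u := fun u v => by rw [hc, hc, hb, mul_comm]
  have hcd : DualBound c 1 := by
    intro φ
    obtain ⟨y, hy⟩ := h (φ ∘ₗ LinearMap.inl ℤ Λ ℤ)
    refine ⟨(y, -φ (0, 1)), fun v => ?_⟩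
    rw [hc, hy, one_mul, one_mul]
    have : v = (v.1, 0) + v.2 • (0, 1) := by ext <;> simp
    conv_rhs => rw [this, map_add, map_smul]
    simp [mul_comm]
  have hX0 : (X, T) ≠ 0 := fun h0 => hX (congrArg Prod.fst h0)
  obtain ⟨g, e, φ, hge, hφ⟩ := exists_primitive_part hX0
  obtain ⟨f, hf⟩ := hcd φ
  have hg0 : g ≠ 0 := by rintro rfl; exact hX0 (by simpa using hge)
  have he : c e e = 0 := by
    have h1 : c (X, T) (X, T) = 0 := by rw [hc, hXT]; ring
    rw [hge] at h1
    simpa [hg0] using h1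
  have hef : c e f = 1 := by rw [hcs, hf, hφ, one_mul]
  have he2 : e.2 ≠ 0 := by
    intro h0
    have := congrArg Prod.snd hge
    exact hT (by simpa [h0] using this)
  have hrank := finrank_hypCompl hcs he hef
  rw [Module.finrank_prod, hn, Module.finrank_self] at hrank
  obtain ⟨v, hv, hve⟩ := exists_positive_orthogonal hb hx hy hxy (b e.1)
  obtain ⟨w₁, hw₁⟩ := exists_mem_hypCompl hcs he hef (v := (v, 0)) (by rw [hc]; simp [hve])
  obtain ⟨w₂, hw₂⟩ := exists_mem_hypCompl hcs he hef (v := (e.2 • z, b e.1 z))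
    (by rw [hc]; simp)
  obtain ⟨u, hu0, hu⟩ := IH (b := hypForm c e f) (by omega) (fun x y => hcs x y)
    (hypForm_dualBound hcs hcd he hef) ⟨w₁, by rw [hw₁, hc]; simpa using hv⟩
    ⟨w₂, by
      rw [hw₂, hc]
      simp only [map_smul, LinearMap.smul_apply, smul_eq_mul]
      have : 0 < e.2 ^ 2 := by positivity
      nlinarith [sq_nonneg (b e.1 z)]⟩
  have hu1 := mem_hypCompl.1 u.2
  have huu : c u u = 0 := hu
  set p : Λ × ℤ := e.2 • (u : Λ × ℤ) - (u : Λ × ℤ).2 • e with hp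
  have hp2 : p.2 = 0 := by simp [hp, mul_comm]
  have hpp : c p p = 0 := by
    simp only [hp, map_sub, map_smul, LinearMap.sub_apply, LinearMap.smul_apply, huu, he, hu1.1,
      hcs u e]
    simp
  refine ⟨p.1, fun h0 => hu0 ?_, by rw [hc, hp2] at hpp; simpa using hpp⟩
  have hp0 : p = 0 := Prod.ext h0 hp2
  have h1 : c f p = - (u : Λ × ℤ).2 := by
    simp only [hp, map_sub, map_smul, hu1.2, hcs f e, hef]; simp
  rw [hp0, map_zero] at h1
  have h2 : (u : Λ × ℤ).2 = 0 := by omega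
  rw [hp, h2, zero_smul, sub_zero] at hp0
  exact Subtype.ext ((smul_eq_zero.1 hp0).resolve_left he2)

end Unimodular

section Unimodular

theorem exists_prime_dvd_sub {a m : ℤ} (hm : m ≠ 0) (h : IsCoprime a m) (B : ℕ) :
    ∃ r : ℕ, r.Prime ∧ B < r ∧ m ∣ r - a := by
  have h' : IsCoprime a (m.natAbs : ℤ) := by
    rw [Int.natCast_natAbs]; exact (IsCoprime.abs_right_iff a m).2 h
  obtain ⟨r, hr, hp, hra⟩ :=
    Nat.forall_exists_prime_gt_and_zmodEq B (Int.natAbs_ne_zero.2 hm) h'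
  exact ⟨r, hp, hr, Int.natAbs_dvd.1 hra.symm.dvd⟩

theorem exists_linearMap_mul {M : Type} [AddCommGroup M] {c : ℤ} (f : M →ₗ[ℤ] ℤ)
    (hf : ∀ x, c ∣ f x) : ∃ g : M →ₗ[ℤ] ℤ, ∀ x, f x = c * g x := by
  refine ⟨⟨⟨fun x => f x / c, fun x y => ?_⟩, fun k x => ?_⟩, fun x => ?_⟩
  · rw [map_add, Int.add_ediv_of_dvd_left (hf x)]
  · simp only [map_smul, smul_eq_mul]
    exact Int.mul_ediv_assoc _ (hf x)
  · exact (Int.mul_ediv_cancel' (hf x)).symm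

theorem exists_bilin_mul {M : Type} [AddCommGroup M] {c : ℤ} (hc : c ≠ 0)
    (f : M →ₗ[ℤ] M →ₗ[ℤ] ℤ) (hf : ∀ x y, c ∣ f x y) :
    ∃ g : M →ₗ[ℤ] M →ₗ[ℤ] ℤ, ∀ x y, f x y = c * g x y := by
  choose g hg using fun x => exists_linearMap_mul (f x) (hf x)
  refine ⟨⟨⟨g, fun x y => ?_⟩, fun k x => ?_⟩, hg⟩
  · ext z
    refine mul_left_cancel₀ hc ?_
    rw [← hg, map_add, LinearMap.add_apply, LinearMap.add_apply, mul_add, ← hg, ← hg]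
  · ext z
    refine mul_left_cancel₀ hc ?_
    rw [← hg, map_smul]
    simp [hg, mul_left_comm]

variable {Λ : Type} [AddCommGroup Λ] {b : Λ →ₗ[ℤ] Λ →ₗ[ℤ] ℤ}

theorem exists_isotropic_of_discr_sq {w z : Λ} (hb : ∀ x y, b x y = b y x) (hw : b w w ≠ 0) {k : ℤ}
    (hk : k ≠ 0) (h : b w z ^ 2 - b w w * b z z = k ^ 2) : ∃ x, x ≠ 0 ∧ b x x = 0 := by
  refine ⟨(k - b w z) • w + b w w • z, fun h0 => ?_, ?_⟩
  · have := congrArg (b w) h0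
    simp only [map_add, map_smul, smul_eq_mul, map_zero] at this
    have : k * b w w = 0 := by linarith
    simp_all
  · simp only [map_add, map_smul, LinearMap.add_apply, LinearMap.smul_apply, smul_eq_mul, hb z w]
    linear_combination -b w w * h

theorem bilin_combo (hb : ∀ x y, b x y = b y x) (x y : ℤ) (w z : Λ) :
    b (x • w + y • z) (x • w + y • z) = b w w * x ^ 2 + 2 * b w z * x * y + b z z * y ^ 2 := by
  simp only [map_add, map_smul, LinearMap.add_apply, LinearMap.smul_apply, smul_eq_mul, hb z w]
  ring

/-- Unimodular indefinite forms of rank `n` are isotropic. -/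
def UnimodularIsotropic (n : ℕ) : Prop :=
  ∀ {Λ : Type} [AddCommGroup Λ] [Module.Free ℤ Λ] [Module.Finite ℤ Λ]
    {b : Λ →ₗ[ℤ] Λ →ₗ[ℤ] ℤ}, Module.finrank ℤ Λ = n → (∀ x y, b x y = b y x) → DualBound b 1 →
    (∃ x, 0 < b x x) → (∃ x, b x x < 0) → ∃ x, x ≠ 0 ∧ b x x = 0

variable [Module.Free ℤ Λ] [Module.Finite ℤ Λ]

theorem isotropic_of_odd_primitive {n : ℕ} (IH : UnimodularIsotropic n) (hn3 : 3 ≤ n)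
    (hn : Module.finrank ℤ Λ = n + 1) (hb : ∀ x y, b x y = b y x) (h : DualBound b 1)
    {x y z : Λ} (hx : 0 < b x x) (hy : 0 < b y y) (hxy : b x y = 0) (hz : b z z < 0)
    {u y₀ w : Λ} (hu : b u y₀ = 1) (huo : Odd (b u u)) (hu0 : 0 < b u u)
    (huw : Odd (b u w + b w w)) : ∃ x, x ≠ 0 ∧ b x x = 0 := by
  set K := orthForm b u with hK
  have hKa : ∀ x y, K x y = b x y := fun x y => rfl
  have hKs : ∀ x y, K x y = K y x := fun x y => hb x y
  have hKd : DualBound K (b u u) := orthForm_dualBound hb h u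
  have hKpos : ∃ x, 0 < K x x := by
    obtain ⟨v, hv, hv0⟩ := exists_positive_orthogonal hb hx hy hxy (b u)
    exact ⟨⟨v, hv0⟩, hv⟩
  have hKp : ∀ v : Λ, ∃ v' : LinearMap.ker (b u),
      K v' v' = b u u ^ 2 * b v v - b u u * b u v ^ 2 := fun v => by
    refine ⟨⟨b u u • v - b u v • u, by simp [mul_comm]⟩, ?_⟩
    rw [hKa]
    simp only [map_sub, map_smul, LinearMap.sub_apply, LinearMap.smul_apply, smul_eq_mul, hb v u]
    ring
  have hKneg : ∃ x, K x x < 0 := by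
    obtain ⟨v, hv⟩ := hKp z
    refine ⟨v, hv ▸ ?_⟩
    have : 0 < b u u ^ 2 := by positivity
    nlinarith [mul_nonneg hu0.le (sq_nonneg (b u z))]
  have h2u : ¬ ((2 : ℕ) : ℤ) ∣ b u u := by
    rw [Nat.cast_ofNat, ← even_iff_two_dvd, Int.not_even_iff_odd]; exact huo
  have hr2 : ResidualRankGT K 2 2 := orthForm_residualRankGT_of_not_dvd hb h h2u (by omega)
  have hrp : ∀ p : ℕ, p.Prime → ResidualRankGT K p 1 := fun p hp =>
    orthForm_residualRankGT hb h hu p hp (by omega)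
  obtain ⟨v₀, hv₀⟩ : ∃ v, Odd (K v v) := by
    obtain ⟨v, hv⟩ := hKp w
    refine ⟨v, hv ▸ ?_⟩
    have : b u u ^ 2 * b w w - b u u * b u w ^ 2 =
      b u u * (b u w + b w w) + (b u u * (b w w * (b u u - 1)) - b u u * (b u w * (b u w + 1))) := by
      ring
    rw [this]
    refine (huo.mul huw).add_even (Even.sub ?_ ?_)
    · exact ((huo.sub_odd odd_one).mul_left _).mul_left _
    · exact (Int.even_mul_succ_self _).mul_left _
  obtain ⟨w₂, hw₂⟩ := hr2.exists_one_mod_four hKs hv₀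
  have hloc : ∀ p : ℕ, ∃ w z, (p = 2 → (4 : ℤ) ∣ K w w - 1 ∧ z = 0) ∧ (p.Prime → p ≠ 2 →
      ¬ (p : ℤ) ∣ K w w ∧ ¬ (p : ℤ) ∣ K w z ^ 2 - K w w * K z z) := fun p => by
    by_cases hp2 : p = 2
    · exact ⟨w₂, 0, fun _ => ⟨hw₂, rfl⟩, fun _ h => absurd hp2 h⟩
    · by_cases hp : p.Prime
      · obtain ⟨w, z, h1⟩ := (hrp p hp).exists_discr_not_dvd hKs hp hp2
        exact ⟨w, z, fun h => absurd h hp2, fun _ _ => h1⟩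
      · exact ⟨0, 0, fun h => absurd h hp2, fun h => absurd h hp⟩
  choose w₀ z₀ hloc2 hlocp using hloc
  have h24 : ∀ {t : ℤ}, (4 : ℤ) ∣ t - 1 → ¬ (2 : ℤ) ∣ t := fun h => by omega
  obtain ⟨w', z', hpos, hcop, hD, hS⟩ := exists_plane_local hKs hKd hu0.ne' hKpos hKneg
    (S := insert 2 (b u u).natAbs.primeFactors) (e := 2) (w₀ := w₀) (z₀ := z₀) (ε := 1)
    (by
      intro p hp
      rcases Finset.mem_insert.1 hp with rfl | hp
      · exact Nat.prime_two
      · exact Nat.prime_of_mem_primeFactors hp)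
    (fun p hp hpd => Finset.mem_insert_of_mem (Nat.mem_primeFactors.2
      ⟨hp, Int.natCast_dvd.1 hpd, Int.natAbs_ne_zero.2 hu0.ne'⟩))
    two_ne_zero
    (by
      intro p hp hpw
      exfalso
      by_cases hp2 : p = 2
      · subst hp2
        exact h24 (hloc2 2 rfl).1 (by exact_mod_cast hpw)
      · exact (hlocp p (Nat.prime_of_mem_primeFactors
          ((Finset.mem_insert.1 hp).resolve_left hp2)) hp2).1 hpw)
    (Or.inl rfl)
  set a := K w' w' with ha
  set β := K w' z' with hβ
  set c := K z' z' with hc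
  set D := β ^ 2 - a * c with hDdef
  have hapos : 0 < a := by simpa using hpos
  have ha4 : (4 : ℤ) ∣ a - 1 := by
    obtain ⟨k, hk, hk1, -⟩ := hS 2 (Finset.mem_insert_self _ _)
    have h1 := (hloc2 2 rfl).1
    have hk2 : ¬ (2 : ℤ) ∣ k := by exact_mod_cast hk
    have hk4 : (4 : ℤ) ∣ k ^ 2 - 1 := by
      obtain ⟨j, hj⟩ : Odd k := by rwa [← Int.not_even_iff_odd, even_iff_two_dvd]
      exact ⟨j ^ 2 + j, by rw [hj]; ring⟩
    have h3 : a - 1 = (a - k ^ 2 * K (w₀ 2) (w₀ 2)) + k ^ 2 * (K (w₀ 2) (w₀ 2) - 1) + (k ^ 2 - 1) := by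
      ring
    rw [h3]
    exact ((by simpa using hk1 : (4 : ℤ) ∣ _).add (h1.mul_left _)).add hk4
  have hDc : IsCoprime D (b u u) := by
    refine isCoprime_of_prime_not_dvd fun p hp hpD hpu => ?_
    have hp2 : p ≠ 2 := by rintro rfl; exact h2u hpu
    obtain ⟨k, hk, -, hk1⟩ := hS p (Finset.mem_insert_of_mem (Nat.mem_primeFactors.2
      ⟨hp, Int.natCast_dvd.1 hpu, Int.natAbs_ne_zero.2 hu0.ne'⟩))
    have h1 := (hlocp p hp hp2).2
    have hpp := Nat.prime_iff_prime_int.1 hp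
    have h2 := (dvd_sub_right hpD).1 ((dvd_pow_self _ two_ne_zero).trans hk1)
    exact (hpp.dvd_or_dvd h2).elim (fun h => hk (hpp.dvd_of_dvd_pow h)) h1
  have lift : (∃ x, x ≠ 0 ∧ K x x = 0) → ∃ x, x ≠ 0 ∧ b x x = 0 := fun ⟨x, hx, hxx⟩ =>
    ⟨x, fun h0 => hx (Subtype.ext h0), hxx⟩
  by_cases hDsq : IsSquare D
  · obtain ⟨k, hk⟩ := hDsq
    refine lift (exists_isotropic_of_discr_sq hKs hapos.ne' (k := k) ?_ (by rw [sq k, ← hk]))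
    rintro rfl
    simp [hk] at hD
  have hu00 : u ≠ 0 := by rintro rfl; simp at hu0
  by_cases hcsq : IsSquare (b u u)
  · obtain ⟨k, hk⟩ := hcsq
    exact isotropic_of_sq_norm IH hn hb h hx hy hxy hz hu00 (T := k) (by rw [hk, sq])
  have haD : IsCoprime a D := by
    have : IsCoprime a (β ^ 2) := hcop.pow_right
    rw [hDdef, sub_eq_add_neg, ← mul_neg]
    exact this.add_mul_left_right _
  have h2a : IsCoprime (2 : ℤ) a := by
    obtain ⟨k, hk⟩ := ha4
    exact ⟨-2 * k, 1, by linarith⟩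
  have h4c : IsCoprime (4 * D) (b u u) := by
    refine IsCoprime.mul_left ?_ hDc
    obtain ⟨j, hj⟩ := huo
    have : IsCoprime (2 : ℤ) (b u u) := ⟨-j, 1, by rw [hj]; ring⟩
    simpa using (this.pow_left (m := 2))
  obtain ⟨r₀, hr₀1, hr₀2⟩ := exists_crt_two h4c a 1
  have hr₀ : IsCoprime r₀ (4 * D * b u u) := by
    refine IsCoprime.mul_right ?_ ?_
    · obtain ⟨k, hk⟩ := hr₀1
      rw [show r₀ = a + 4 * D * k by linarith]
      refine IsCoprime.add_mul_left_left ?_ _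
      exact IsCoprime.mul_right (by simpa using (h2a.symm.pow_right (n := 2))) haD
    · obtain ⟨k, hk⟩ := hr₀2
      exact ⟨1, -k, by linarith⟩
  obtain ⟨r, hr, har, hrr⟩ := exists_prime_dvd_sub
    (mul_ne_zero (mul_ne_zero four_ne_zero hD.ne') hu0.ne') hr₀ a.natAbs
  have hra : 4 * D ∣ (r : ℤ) - a := by
    have := (dvd_mul_right (4 * D) (b u u)).trans hrr
    have h2 := dvd_add this hr₀1
    simpa using h2
  have hr1 : 4 * b u u ∣ (r : ℤ) - 1 := by
    refine IsCoprime.mul_dvd ?_ ?_ ?_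
    · exact h4c.of_mul_left_left
    · have h1 : (4 : ℤ) ∣ (r : ℤ) - a := (dvd_mul_right _ _).trans hra
      have := dvd_add h1 ha4
      simpa using this
    · have := dvd_add ((dvd_mul_left (b u u) (4 * D)).trans hrr) hr₀2
      simpa using this
  have hcar : IsCoprime a (r : ℤ) := by
    rw [isCoprime_comm, (Nat.prime_iff_prime_int.1 hr).irreducible.coprime_iff_not_dvd]
    intro hd
    have := Nat.le_of_dvd (Int.natAbs_pos.2 hapos.ne') (Int.natCast_dvd.1 hd)
    omega
  obtain ⟨X, Y, s, hs, hXY⟩ := binary_represents_prime hr hDdef hD hDsq (ε := 1)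
    (IsCoprime.mul_right h2a.symm haD) (by rw [mul_one, abs_of_pos hapos]) (by norm_num)
    (by rw [abs_of_pos hapos]; exact ((Int.modEq_iff_dvd).2 hra).symm) hcar
  obtain ⟨t, q, s', hs', htq⟩ := binary_represents_prime (a := -1) (b := 0) (c := b u u) (ε := -1)
    (D := b u u) hr (by ring) hu0 hcsq (isCoprime_one_left.neg_left) (by norm_num) (by norm_num)
    (by simpa using ((Int.modEq_iff_dvd).2 hr1).symm) (isCoprime_one_left.neg_left)
  set v := X • w' + Y • z' with hv
  have hvv : b v v = r * s ^ 2 := by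
    have := bilin_combo hKs X Y w' z'
    rw [← hv, hKa] at this
    rw [this]
    linear_combination hXY
  have huv : b u v = 0 := v.2
  refine isotropic_of_sq_norm IH hn hb h hx hy hxy hz (X := s' • (v : Λ) + (s * q) • u)
    (T := s * t) ?_ ?_
  · intro h0
    have := congrArg (b (v : Λ)) h0
    simp only [map_add, map_smul, hb v u, huv, hvv, map_zero, smul_eq_mul, mul_zero, add_zero] at this
    have hr0 : (r : ℤ) ≠ 0 := by exact_mod_cast hr.ne_zero
    exact mul_ne_zero hs' (mul_ne_zero hr0 (pow_ne_zero 2 hs)) this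
  · rw [bilin_combo hb, hb v u, huv, hvv]
    linear_combination s ^ 2 * htq

theorem isotropic_of_odd_unimodular {n : ℕ} (IH : UnimodularIsotropic n) (hn3 : 3 ≤ n)
    (hn : Module.finrank ℤ Λ = n + 1) (hb : ∀ x y, b x y = b y x) (h : DualBound b 1)
    {x y z : Λ} (hx : 0 < b x x) (hy : 0 < b y y) (hxy : b x y = 0) (hz : b z z < 0)
    (ho : ∃ v, Odd (b v v)) : ∃ x, x ≠ 0 ∧ b x x = 0 := by
  obtain ⟨v, w, hv, hvw⟩ : ∃ v w, Odd (b v v) ∧ Odd (b v w + b w w) := by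
    obtain ⟨v, hv⟩ := ho
    by_cases hc : ∃ w, Odd (b v w + b w w)
    · obtain ⟨w, hw⟩ := hc
      exact ⟨v, w, hv, hw⟩
    simp only [not_exists, Int.not_odd_iff_even] at hc
    obtain ⟨t, w, htw, ht⟩ := exists_orthogonal_primitive h hb (k := 1) (by omega) ![v]
    have hvt : b v t = 0 := by simpa using ht 0
    refine ⟨v + t, w, ?_, ?_⟩
    · have ht2 := hc t
      rw [hvt, zero_add] at ht2
      simp only [map_add, LinearMap.add_apply, hvt, hb t v, add_zero, zero_add]
      exact hv.add_even ht2
    · rw [map_add, LinearMap.add_apply, htw, add_right_comm]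
      exact (hc w).add_one
  obtain ⟨T, hT⟩ := exists_quadratic_pos (A := 4 * b x x) (by linarith) (4 * b v x) (b v v)
  set v' := v + (2 * T) • x with hv'
  have hv'v : b v' v' = 4 * b x x * T ^ 2 + 4 * b v x * T + b v v := by
    simp only [hv', map_add, map_smul, LinearMap.add_apply, LinearMap.smul_apply, smul_eq_mul,
      hb x v]
    ring
  have hv'o : Odd (b v' v') := by
    rw [hv'v]
    refine Even.add_odd (Even.add ?_ ?_) hv
    · exact ⟨2 * b x x * T ^ 2, by ring⟩
    · exact ⟨2 * b v x * T, by ring⟩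
  have hv'w : Odd (b v' w + b w w) := by
    rw [hv', map_add, LinearMap.add_apply, add_right_comm]
    refine hvw.add_even ⟨T * b x w, ?_⟩
    simp only [map_smul, LinearMap.smul_apply, smul_eq_mul]
    ring
  rw [← hv'v] at hT
  have hv'0 : v' ≠ 0 := by intro h0; simp [h0] at hT
  obtain ⟨g, u, φ, hgu, hφ⟩ := exists_primitive_part hv'0
  obtain ⟨y₀, hy₀⟩ := h φ
  have hguu : b v' v' = g ^ 2 * b u u := by rw [hgu]; simp; ring
  have hgo : Odd g := by
    rw [hguu, Int.odd_mul, sq, Int.odd_mul] at hv'o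
    exact hv'o.1.1
  refine isotropic_of_odd_primitive IH hn3 hn hb h hx hy hxy hz (u := u) (y₀ := y₀) (w := w)
    (by rw [hb, hy₀, hφ, mul_one]) ?_ ?_ ?_
  · rw [hguu, Int.odd_mul] at hv'o
    exact hv'o.2
  · rw [hguu] at hT
    exact pos_of_mul_pos_right hT (sq_nonneg g)
  · rw [hgu] at hv'w
    simp only [map_smul, LinearMap.smul_apply, smul_eq_mul] at hv'w
    rw [Int.odd_add, Int.odd_mul] at hv'w
    rw [Int.odd_add, ← hv'w]
    tauto

/-- An even unimodular lattice of rank at least three has an odd unimodular neighbour. -/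
theorem exists_norm_four_mod_eight (hn : 3 ≤ Module.finrank ℤ Λ) (hb : ∀ x y, b x y = b y x)
    (h : DualBound b 1) (he : ∀ v, Even (b v v)) :
    ∃ u y, (8 : ℤ) ∣ b u u - 4 ∧ Odd (b u y) := by
  obtain ⟨x, y, hxy, hx4⟩ : ∃ x y, b x y = 1 ∧ (4 : ℤ) ∣ b x x := by
    obtain ⟨x, y, hxy, -⟩ := exists_orthogonal_primitive h hb (k := 0) (by omega) ![]
    obtain ⟨t, s, hts, ht⟩ := exists_orthogonal_primitive h hb (k := 2) (by omega) ![x, y]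
    have hxt : b x t = 0 := by simpa using ht 0
    have hyt : b y t = 0 := by simpa using ht 1
    by_cases h1 : (4 : ℤ) ∣ b x x
    · exact ⟨x, y, hxy, h1⟩
    by_cases h2 : (4 : ℤ) ∣ b t t
    · exact ⟨t, s, hts, h2⟩
    refine ⟨x + t, y, by rw [map_add, LinearMap.add_apply, hxy, hb t y, hyt, add_zero], ?_⟩
    obtain ⟨k, hk⟩ := he x
    obtain ⟨l, hl⟩ := he t
    simp only [map_add, LinearMap.add_apply, hxt, hb t x]
    omega
  obtain ⟨k, hk⟩ := hx4
  rcases Int.even_or_odd k with ⟨j, hj⟩ | ⟨j, hj⟩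
  · obtain ⟨l, hl⟩ := he y
    refine ⟨x + 2 • y, y, ?_, ?_⟩
    · simp only [map_add, map_nsmul, LinearMap.add_apply, LinearMap.smul_apply, nsmul_eq_mul,
        hb y x, hxy, hk, hj, hl]
      exact ⟨j + l, by push_cast; ring⟩
    · simp only [map_add, map_nsmul, LinearMap.add_apply, LinearMap.smul_apply, nsmul_eq_mul, hxy]
      exact ⟨b y y, by push_cast; ring⟩
  · refine ⟨x, y, ?_, by rw [hxy]; exact odd_one⟩
    rw [hk, hj]
    exact ⟨j, by ring⟩

/-- The lattice `{2 y + t u : y ⬝ u even}`. -/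
def evenNeighbor (b : Λ →ₗ[ℤ] Λ →ₗ[ℤ] ℤ) (u : Λ) : Submodule ℤ Λ where
  carrier := {m | ∃ (y : Λ) (t : ℤ), (2 : ℤ) ∣ b y u ∧ m = (2 : ℤ) • y + t • u}
  zero_mem' := ⟨0, 0, by simp, by simp⟩
  add_mem' := by
    rintro _ _ ⟨y, t, hy, rfl⟩ ⟨y', t', hy', rfl⟩
    refine ⟨y + y', t + t', ?_, by module⟩
    rw [map_add, LinearMap.add_apply]
    exact dvd_add hy hy'
  smul_mem' := by
    rintro c _ ⟨y, t, hy, rfl⟩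
    refine ⟨c • y, c * t, ?_, by module⟩
    rw [map_smul, LinearMap.smul_apply]
    exact hy.mul_left c

theorem isotropic_of_even_unimodular (hn : 3 ≤ Module.finrank ℤ Λ) (hb : ∀ x y, b x y = b y x)
    (h : DualBound b 1) (he : ∀ v, Even (b v v)) (hpos : ∃ x, 0 < b x x) (hneg : ∃ x, b x x < 0)
    (hodd : ∀ {Λ' : Type} [AddCommGroup Λ'] [Module.Free ℤ Λ'] [Module.Finite ℤ Λ']
      {b' : Λ' →ₗ[ℤ] Λ' →ₗ[ℤ] ℤ}, Module.finrank ℤ Λ' = Module.finrank ℤ Λ →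
      (∀ x y, b' x y = b' y x) → DualBound b' 1 → (∃ x, 0 < b' x x) → (∃ x, b' x x < 0) →
      (∃ x, Odd (b' x x)) → ∃ x, x ≠ 0 ∧ b' x x = 0) : ∃ x, x ≠ 0 ∧ b x x = 0 := by
  obtain ⟨u, y₀, hu, huy⟩ := exists_norm_four_mod_eight hn hb h he
  set M := evenNeighbor b u with hM
  have h4 : ∀ x : Λ, (4 : ℤ) • x ∈ M := fun x =>
    ⟨(2 : ℤ) • x, 0, by simp, by module⟩
  have huM : u ∈ M := ⟨0, 1, by simp, by module⟩
  have h2 : ∀ x : Λ, (2 : ℤ) ∣ b x u → (2 : ℤ) • x ∈ M := fun x hx => ⟨x, 0, hx, by module⟩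
  have hfr : Module.finrank ℤ M = Module.finrank ℤ Λ := by
    refine le_antisymm (Submodule.finrank_le M) ?_
    refine LinearMap.finrank_le_finrank_of_injective
      (f := ((4 : ℤ) • LinearMap.id : Λ →ₗ[ℤ] Λ).codRestrict M h4) fun x y hxy => ?_
    have := congrArg Subtype.val hxy
    exact smul_right_injective Λ (four_ne_zero (α := ℤ)) this
  obtain ⟨b', hb'⟩ := exists_bilin_mul (four_ne_zero (α := ℤ)) (b.domRestrict₁₂ M M) (by
    rintro ⟨_, y, t, hy, rfl⟩ ⟨_, y', t', hy', rfl⟩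
    obtain ⟨k, hk⟩ := hy
    obtain ⟨k', hk'⟩ := hy'
    obtain ⟨j, hj⟩ := hu
    have hj' : b u u = 8 * j + 4 := by linarith
    rw [LinearMap.domRestrict₁₂_apply]
    simp only [map_add, map_smul, LinearMap.add_apply, LinearMap.smul_apply, smul_eq_mul, hb u y',
      hk, hk', hj']
    exact ⟨b y y' + t' * k + t * k' + t * t' * (2 * j + 1), by ring⟩)
  have hb4 : ∀ x y : M, b x y = 4 * b' x y := hb'
  have hb4' : ∀ x, b' ⟨_, h4 x⟩ ⟨_, h4 x⟩ = 4 * b x x := fun x => by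
    have := hb4 ⟨_, h4 x⟩ ⟨_, h4 x⟩
    simp only [map_smul, LinearMap.smul_apply, smul_eq_mul] at this
    linarith
  have hdual : DualBound b' 1 := by
    intro φ
    obtain ⟨m, hm⟩ := h (φ ∘ₗ ((4 : ℤ) • LinearMap.id : Λ →ₗ[ℤ] Λ).codRestrict M h4)
    have hmφ : ∀ z : M, b m z = 4 * φ z := fun z => by
      rw [hm, one_mul, LinearMap.comp_apply, ← smul_eq_mul, ← map_smul]
      rfl
    have hm2 : ∀ y, (2 : ℤ) ∣ b y u → (2 : ℤ) ∣ b m y := fun y hy => by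
      have := hmφ ⟨_, h2 y hy⟩
      simp only [map_smul, smul_eq_mul] at this
      omega
    set t := b m y₀ with ht
    obtain ⟨ψ, hψ⟩ := exists_linearMap_mul (c := 2) (b (m - t • u)) (fun y => by
      simp only [map_sub, map_smul, LinearMap.sub_apply, LinearMap.smul_apply, smul_eq_mul]
      rcases Int.even_or_odd (b u y) with hy | hy
      · exact dvd_sub (hm2 y (by rw [hb]; exact hy.two_dvd)) (hy.two_dvd.mul_left t)
      · have h1 := hm2 (y - y₀) (by
          rw [hb, map_sub]; exact (hy.sub_odd huy).two_dvd)
        rw [map_sub] at h1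
        obtain ⟨j, hj⟩ := hy
        rw [hj, show b m y - t * (2 * j + 1) = (b m y - t) - 2 * (t * j) by ring]
        exact dvd_sub h1 (dvd_mul_right _ _))
    obtain ⟨y, hy⟩ := h ψ
    have hmy : m = (2 : ℤ) • y + t • u := by
      refine sub_eq_zero.1 (h.nondegenerate hb one_ne_zero fun z => ?_)
      have h1 := hψ z
      have h3 := hy z
      simp only [map_sub, map_add, map_smul, LinearMap.sub_apply, LinearMap.add_apply,
        LinearMap.smul_apply, smul_eq_mul] at h1 ⊢
      linarith
    have hyu : (2 : ℤ) ∣ b y u := by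
      have h1 := hmφ ⟨u, huM⟩
      rw [hmy] at h1
      simp only [map_add, map_smul, LinearMap.add_apply, LinearMap.smul_apply, smul_eq_mul] at h1
      obtain ⟨j, hj⟩ := hu
      have hj' : b u u = 8 * j + 4 := by linarith
      rw [hj'] at h1
      have : b y u = 2 * (φ ⟨u, huM⟩ - t * (2 * j + 1)) := by linarith
      exact this ▸ dvd_mul_right _ _
    refine ⟨⟨m, y, t, hyu, hmy⟩, fun z => ?_⟩
    have := hb4 ⟨m, y, t, hyu, hmy⟩ z
    simp only [hmφ] at this
    omega
  obtain ⟨x, hx0, hx⟩ := hodd (b' := b') hfr (fun x y => by have := hb x y; rw [hb4, hb4] at this; omega)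
    hdual (hpos.imp' (fun x => ⟨_, h4 x⟩) fun x hx => by rw [hb4']; omega)
    (hneg.imp' (fun x => ⟨_, h4 x⟩) fun x hx => by rw [hb4']; omega)
    ⟨⟨u, huM⟩, by
      have := hb4 ⟨u, huM⟩ ⟨u, huM⟩
      obtain ⟨j, hj⟩ := hu
      exact ⟨j, by simp only at this; omega⟩⟩
  exact ⟨x, fun h0 => hx0 (Subtype.ext h0), by rw [hb4, hx, mul_zero]⟩

/-- Indefinite unimodular lattices are isotropic. -/
theorem unimodularIsotropic (n : ℕ) : UnimodularIsotropic n := by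
  induction n with
  | zero => exact isotropic_of_unimodular_of_finrank_le_three 0 (by norm_num)
  | succ n IH =>
    by_cases hn3 : n + 1 ≤ 3
    · exact isotropic_of_unimodular_of_finrank_le_three _ hn3
    have hodd : ∀ {Λ : Type} [AddCommGroup Λ] [Module.Free ℤ Λ] [Module.Finite ℤ Λ]
        {b : Λ →ₗ[ℤ] Λ →ₗ[ℤ] ℤ}, Module.finrank ℤ Λ = n + 1 → (∀ x y, b x y = b y x) →
        DualBound b 1 → (∃ x, 0 < b x x) → (∃ x, b x x < 0) → (∃ x, Odd (b x x)) →
        ∃ x, x ≠ 0 ∧ b x x = 0 := by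
      intro Λ _ _ _ b hn hb h ⟨x, hx⟩ ⟨z, hz⟩ ho
      obtain ⟨y, y', hyy', hy⟩ := exists_orthogonal_primitive h hb (k := 1) (by omega) ![x]
      obtain ⟨t, t', htt', ht⟩ := exists_orthogonal_primitive h hb (k := 2) (by omega) ![x, y]
      have hxy : b x y = 0 := by simpa using hy 0
      have hxt : b x t = 0 := by simpa using ht 0
      have hyt : b y t = 0 := by simpa using ht 1
      rcases lt_trichotomy (b y y) 0 with hy0 | hy0 | hy0
      · rcases lt_trichotomy (b t t) 0 with ht0 | ht0 | ht0
        · obtain ⟨w, hw, hw'⟩ := isotropic_of_odd_unimodular (b := -b) (x := y) (y := t) (z := x)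
            IH (by omega) hn (fun x y => by simp [hb x y]) (fun φ => by
              obtain ⟨w, hw⟩ := h φ
              exact ⟨-w, fun v => by simpa using hw v⟩) (by simpa using hy0) (by simpa using ht0)
            (by simpa using hyt) (by simpa using hx) (ho.imp fun v hv => by simpa using hv)
          exact ⟨w, hw, by simpa using hw'⟩
        · exact ⟨t, by rintro rfl; simp at htt', ht0⟩
        · exact isotropic_of_odd_unimodular IH (by omega) hn hb h hx ht0 hxt hz ho
      · exact ⟨y, by rintro rfl; simp at hyy', hy0⟩
      · exact isotropic_of_odd_unimodular IH (by omega) hn hb h hx hy0 hxy hz ho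
    intro hn hb h hpos hneg
    refine (em _).elim (hodd hn hb h hpos hneg) fun ho => ?_
    · simp only [not_exists, Int.not_odd_iff_even] at ho
      exact isotropic_of_even_unimodular (by omega) hb h ho hpos hneg
        fun h1 => hodd (h1.trans hn)

end Unimodular

section Pell

theorem pell_dvd_sub_one {D x y : ℤ} {p k : ℕ} (hp : p.Prime) (hp2 : p ≠ 2)
    (h : x ^ 2 - D * y ^ 2 = 1) (hx : (p : ℤ) ∣ x - 1) (hy : (p : ℤ) ^ k ∣ y) :
    (p : ℤ) ^ k ∣ x - 1 := by
  have hpp := Nat.prime_iff_prime_int.1 hp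
  have h2 : ¬ (p : ℤ) ∣ 2 := fun h => hp2 ((Nat.prime_dvd_prime_iff_eq hp Nat.prime_two).1
    (by exact_mod_cast h))
  have h1 : ¬ (p : ℤ) ∣ x + 1 := fun h => h2 (by simpa using dvd_sub h hx)
  refine ((hpp.coprime_iff_not_dvd.2 h1).pow_left (m := k)).dvd_of_dvd_mul_right ?_
  rw [show (x - 1) * (x + 1) = D * y * y by linarith [h]]
  exact hy.mul_left _

/-- Powers of a solution of Pell's equation that is congruent to `1` modulo `m`. -/
theorem pell_pow {D x y m : ℤ} (h : x ^ 2 - D * y ^ 2 = 1) (hx : m ∣ x - 1) (hy : m ∣ y) (n : ℕ) :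
    ∃ X Y : ℤ, X ^ 2 - D * Y ^ 2 = 1 ∧ m ∣ X - 1 ∧ m ∣ Y ∧ m ^ 2 ∣ Y - n * y := by
  induction n with
  | zero => exact ⟨1, 0, by norm_num, by simp, by simp, by simp⟩
  | succ n ih =>
    obtain ⟨X, Y, hXY, ⟨i, hi⟩, ⟨j, hj⟩, ⟨l, hl⟩⟩ := ih
    obtain ⟨s, hs⟩ := hx
    obtain ⟨t, ht⟩ := hy
    refine ⟨X * x + D * Y * y, X * y + Y * x, ?_, ⟨i * x + s + D * Y * t, ?_⟩, ⟨X * t + j * x, ?_⟩,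
      ⟨i * t + j * s + l, ?_⟩⟩
    · linear_combination (x ^ 2 - D * y ^ 2) * hXY + h
    · linear_combination x * hi + hs + D * Y * ht
    · linear_combination X * ht + x * hj
    · push_cast
      linear_combination y * hi + Y * hs + hl + m * i * ht + m * s * hj

theorem exists_pell_congruence {D : ℤ} {p : ℕ} (hp : p.Prime) (hp2 : p ≠ 2) (hD : 0 < D)
    (hDs : ¬ IsSquare D) : ∃ k₀, ∀ k, k₀ ≤ k → ∀ κ : ℤ, ∃ x y : ℤ, x ^ 2 - D * y ^ 2 = 1 ∧
      (p : ℤ) ^ k ∣ x - 1 ∧ (p : ℤ) ^ k ∣ y ∧ (p : ℤ) ^ (k + 1) ∣ y - p ^ k * κ := by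
  have hpp := Nat.prime_iff_prime_int.1 hp
  have hp0 : (p : ℤ) ≠ 0 := hpp.ne_zero
  have h2 : ¬ (p : ℤ) ∣ 2 := fun h => hp2 ((Nat.prime_dvd_prime_iff_eq hp Nat.prime_two).1
    (by exact_mod_cast h))
  have base : ∃ k₀, 2 ≤ k₀ ∧ ∃ x y : ℤ, x ^ 2 - D * (p ^ k₀ * y) ^ 2 = 1 ∧ (p : ℤ) ∣ x - 1 ∧
      ¬ (p : ℤ) ∣ y := by
    obtain ⟨x, y, hxy, hy0⟩ := Pell.exists_of_not_isSquare (d := D * p ^ 4) (by positivity)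
      (fun ⟨r, hr⟩ => by
        have h1 : (p : ℤ) ^ 2 ∣ r := by
          rw [← Int.pow_dvd_pow_iff two_ne_zero]
          exact ⟨D, by rw [sq r, ← hr]; ring⟩
        obtain ⟨s, rfl⟩ := h1
        refine hDs ⟨s, mul_right_cancel₀ (pow_ne_zero 4 hp0) (hr.trans (by ring))⟩)
    have hx0 : x ≠ 0 := by
      rintro rfl
      have : 0 ≤ D * p ^ 4 * y ^ 2 := by positivity
      linarith
    have hY : 2 * x * p ^ 2 * y ≠ 0 := by positivity
    obtain ⟨q, hk, hq⟩ := (Int.finiteMultiplicity_iff (a := p) (b := 2 * x * p ^ 2 * y)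
      |>.2 ⟨by simpa using hp.ne_one, hY⟩).exists_eq_pow_mul_and_not_dvd
    set k := multiplicity (p : ℤ) (2 * x * p ^ 2 * y)
    refine ⟨k, ?_, x ^ 2 + D * p ^ 4 * y ^ 2, q, ?_, ?_, hq⟩
    · by_contra! hk2
      refine hq ?_
      have h1 : (p : ℤ) ^ 2 ∣ p ^ k * q := hk ▸ ⟨2 * x * y, by ring⟩
      have h3 : (p : ℤ) ^ 2 ∣ p ^ 1 * q := h1.trans (mul_dvd_mul_right (pow_dvd_pow _ (by omega)) q)
      rw [pow_succ, mul_dvd_mul_iff_left (pow_ne_zero 1 hp0)] at h3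
      exact h3
    · rw [← hk]
      linear_combination (x ^ 2 - D * p ^ 4 * y ^ 2 + 1) * hxy
    · exact ⟨2 * D * p ^ 3 * y ^ 2, by linear_combination hxy⟩
  have step : ∀ {k}, 2 ≤ k → (∃ x y : ℤ, x ^ 2 - D * (p ^ k * y) ^ 2 = 1 ∧ (p : ℤ) ∣ x - 1 ∧
      ¬ (p : ℤ) ∣ y) → ∃ x y : ℤ, x ^ 2 - D * (p ^ (k + 1) * y) ^ 2 = 1 ∧ (p : ℤ) ∣ x - 1 ∧
      ¬ (p : ℤ) ∣ y := by
    rintro k hk ⟨x, y, hxy, hx, hy⟩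
    obtain ⟨X, Y, hXY, hX, -, ⟨l, hl⟩⟩ := pell_pow hxy
      (pell_dvd_sub_one hp hp2 hxy hx (dvd_mul_right _ _)) (dvd_mul_right _ _) p
    obtain ⟨j, rfl⟩ := Nat.exists_eq_add_of_le hk
    refine ⟨X, y + p ^ (j + 1) * l, ?_, (dvd_pow_self _ (by omega)).trans hX, fun h => hy ?_⟩
    · rw [← hXY, show Y = p ^ (2 + j + 1) * (y + p ^ (j + 1) * l) by
        rw [eq_add_of_sub_eq hl]; ring]
    · exact (dvd_add_left (((dvd_pow_self _ (Nat.succ_ne_zero j))).mul_right l)).1 h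
  obtain ⟨k₀, hk₀, hbase⟩ := base
  refine ⟨k₀, fun k hk κ => ?_⟩
  obtain ⟨x, y, hxy, hx, hy⟩ : ∃ x y : ℤ, x ^ 2 - D * (p ^ k * y) ^ 2 = 1 ∧ (p : ℤ) ∣ x - 1 ∧
      ¬ (p : ℤ) ∣ y := by
    induction k, hk using Nat.le_induction with
    | base => exact hbase
    | succ k hk ih => exact step (hk₀.trans hk) ih
  obtain ⟨α, β, hαβ⟩ := hpp.coprime_iff_not_dvd.2 hy
  obtain ⟨n, hn⟩ : ∃ n : ℕ, (p : ℤ) ∣ n - β * κ := by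
    refine ⟨((β * κ) % p).toNat, ?_⟩
    rw [Int.toNat_of_nonneg (Int.emod_nonneg _ hp0)]
    exact ⟨-((β * κ) / p), by rw [Int.emod_def]; ring⟩
  obtain ⟨X, Y, hXY, hX, hY, ⟨l, hl⟩⟩ := pell_pow hxy
    (pell_dvd_sub_one hp hp2 hxy hx (dvd_mul_right _ _)) (dvd_mul_right _ _) n
  refine ⟨X, Y, hXY, hX, hY, ?_⟩
  obtain ⟨i, hi⟩ := hn
  obtain ⟨j, rfl⟩ := Nat.exists_eq_add_of_le (hk₀.trans hk)
  refine ⟨p ^ (j + 1) * l + i * y - κ * α, ?_⟩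
  linear_combination hl + p ^ (2 + j) * y * hi + p ^ (2 + j) * κ * hαβ

end Pell

section Rotation
variable {Λ : Type} [AddCommGroup Λ] {b : Λ →ₗ[ℤ] Λ →ₗ[ℤ] ℤ}

/-- The skew endomorphism attached to a pair of vectors. -/
def skewMap (b : Λ →ₗ[ℤ] Λ →ₗ[ℤ] ℤ) (u w : Λ) : Λ →ₗ[ℤ] Λ :=
  (b u).smulRight w - (b w).smulRight u

theorem skewMap_apply (u w z : Λ) : skewMap b u w z = b u z • w - b w z • u := rfl

/-- The isometry attached to a solution of Pell's equation for the discriminant of a plane. -/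
def planeRotation (b : Λ →ₗ[ℤ] Λ →ₗ[ℤ] ℤ) (u w : Λ) (x y : ℤ) : Λ →ₗ[ℤ] Λ :=
  LinearMap.id + (2 * x * y) • skewMap b u w + (2 * y ^ 2) • skewMap b u w ∘ₗ skewMap b u w

theorem planeRotation_apply (u w : Λ) (x y : ℤ) (z : Λ) : planeRotation b u w x y z =
    z + (2 * x * y) • skewMap b u w z + (2 * y ^ 2) • skewMap b u w (skewMap b u w z) := rfl

theorem planeRotation_isometry (hb : ∀ x y, b x y = b y x) {u w : Λ} {x y : ℤ}
    (h : x ^ 2 - (b u w ^ 2 - b u u * b w w) * y ^ 2 = 1) (z z' : Λ) :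
    b (planeRotation b u w x y z) (planeRotation b u w x y z') = b z z' := by
  simp only [planeRotation_apply, skewMap_apply, map_add, map_sub, map_smul, LinearMap.add_apply,
    LinearMap.sub_apply, LinearMap.smul_apply, smul_eq_mul, hb w u, hb z u, hb z w]
  linear_combination (-4 * y ^ 2 * (b u w * (b u z' * b w z + b u z * b w z') -
    b u u * b w z * b w z' - b w w * b u z * b u z')) * h

theorem planeRotation_inverse (hb : ∀ x y, b x y = b y x) {u w : Λ} {x y : ℤ}
    (h : x ^ 2 - (b u w ^ 2 - b u u * b w w) * y ^ 2 = 1) (z : Λ) :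
    planeRotation b u w x (-y) (planeRotation b u w x y z) = z := by
  simp only [planeRotation_apply, skewMap_apply, map_add, map_sub, map_smul, hb w u]
  match_scalars
  · ring
  · linear_combination (-4 * y ^ 2 * (b u z * b u w - b w z * b u u)) * h
  · linear_combination (4 * y ^ 2 * (b u z * b w w - b w z * b u w)) * h

/-- The automorphism given by `planeRotation`. -/
def planeRotationEquiv (hb : ∀ x y, b x y = b y x) {u w : Λ} {x y : ℤ}
    (h : x ^ 2 - (b u w ^ 2 - b u u * b w w) * y ^ 2 = 1) : Λ ≃ₗ[ℤ] Λ :=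
  LinearEquiv.ofLinearMap (planeRotation b u w x y) (planeRotation b u w x (-y))
    (LinearMap.ext fun z => by
      have := planeRotation_inverse (u := u) (w := w) (x := x) (y := -y) hb (by rw [neg_sq]; exact h) z
      rwa [neg_neg] at this)
    (LinearMap.ext fun z => planeRotation_inverse hb h z)

theorem planeRotationEquiv_apply (hb : ∀ x y, b x y = b y x) {u w : Λ} {x y : ℤ}
    (h : x ^ 2 - (b u w ^ 2 - b u u * b w w) * y ^ 2 = 1) (z : Λ) :
    planeRotationEquiv hb h z = planeRotation b u w x y z := rfl

/-- The existence of an automorphism congruent to the identity modulo `p ^ k` that moves `f` by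
`p ^ k a` modulo `p ^ (k + 1)`. -/
def HasTransvection (b : Λ →ₗ[ℤ] Λ →ₗ[ℤ] ℤ) (p k : ℕ) (f a : Λ) : Prop :=
  ∃ γ : Λ ≃ₗ[ℤ] Λ, (∀ x y, b (γ x) (γ y) = b x y) ∧ (∀ z, ∃ z', γ z = z + (p : ℤ) ^ k • z') ∧
    ∃ l, γ f = f + (p : ℤ) ^ k • a + (p : ℤ) ^ (k + 1) • l

theorem HasTransvection.congr {p k : ℕ} {f a : Λ} (h : HasTransvection b p k f a) (g c : Λ) :
    HasTransvection b p k (f + (p : ℤ) • g) (a + (p : ℤ) • c) := by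
  obtain ⟨γ, h1, h2, l, hl⟩ := h
  refine ⟨γ, h1, h2, ?_⟩
  obtain ⟨g', hg'⟩ := h2 g
  refine ⟨l + g' - c, ?_⟩
  rw [map_add, map_smul, hl, hg']
  module

theorem exists_functional_not_dvd [Module.Free ℤ Λ] {p : ℤ} {f : Λ} (hf : ∀ g, f ≠ p • g) :
    ∃ φ : Λ →ₗ[ℤ] ℤ, ¬ p ∣ φ f := by
  by_contra! h
  let β := Module.Free.chooseBasis ℤ Λ
  choose c hc using fun i => h (β.coord i)
  have hs : ∀ i, i ∉ (β.repr f).support → c i = 0 ∨ p = 0 := fun i hi => by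
    have := hc i
    rw [Module.Basis.coord_apply, Finsupp.notMem_support_iff.1 hi, eq_comm, mul_eq_zero] at this
    exact this.symm
  by_cases hp : p = 0
  · refine hf 0 (β.repr.injective (Finsupp.ext fun i => ?_))
    have := hc i
    simpa [hp] using this
  refine hf (∑ i ∈ (β.repr f).support, c i • β i) ?_
  conv_lhs => rw [← β.linearCombination_repr f, Finsupp.linearCombination_apply, Finsupp.sum]
  rw [Finset.smul_sum]
  refine Finset.sum_congr rfl fun i _ => ?_
  rw [smul_smul, ← hc]
  rfl

theorem hasTransvection_of_large [Module.Free ℤ Λ] (hb : ∀ x y, b x y = b y x) {d : ℤ}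
    (h : DualBound b d) (hpos : ∃ x, 0 < b x x) (hneg : ∃ x, b x x < 0) {p : ℕ} (hp : p.Prime)
    (hp2 : p ≠ 2) (hpd : ¬ (p : ℤ) ∣ d) {f a : Λ} (hf : ∀ g, f ≠ (p : ℤ) • g)
    (hff : (p : ℤ) ∣ b f f) (haf : (p : ℤ) ∣ b a f) (haa : ¬ (p : ℤ) ∣ b a a) :
    ∃ k₀, ∀ k, k₀ ≤ k → HasTransvection b p k f a := by
  have hpp := Nat.prime_iff_prime_int.1 hp
  have h2 : ¬ (p : ℤ) ∣ 2 := fun h => hp2 ((Nat.prime_dvd_prime_iff_eq hp Nat.prime_two).1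
    (by exact_mod_cast h))
  obtain ⟨xp, hxp⟩ := hpos
  obtain ⟨xn, hxn⟩ := hneg
  obtain ⟨φ, hφ⟩ := exists_functional_not_dvd hf
  obtain ⟨u₀, hu₀⟩ := h φ
  have hu₀f : ¬ (p : ℤ) ∣ b u₀ f := by
    rw [hu₀]; exact fun h => (hpp.dvd_or_dvd h).elim hpd hφ
  obtain ⟨ν, hν⟩ := exists_int_nonsquare hp hp2
  have hp0 : (p : ℤ) ≠ 0 := hpp.ne_zero
  obtain ⟨T, hT⟩ := exists_quadratic_pos (A := - (p ^ 2 * b xn xn))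
    (by have : (0 : ℤ) < p ^ 2 := by positivity
        nlinarith) (-(2 * p * b a xn)) (-b a a)
  set w := a + (p * T) • xn with hw
  have hww : b w w < 0 := by
    simp only [hw, map_add, map_smul, LinearMap.add_apply, LinearMap.smul_apply, smul_eq_mul,
      hb xn a]
    linarith
  obtain ⟨α, β, hαβ⟩ := hpp.coprime_iff_not_dvd.2
    (fun h => (hpp.dvd_or_dvd h).elim (fun h => (hpp.dvd_or_dvd h).elim h2 haa) hu₀f :
      ¬ (p : ℤ) ∣ 2 * b a a * b u₀ f)
  set s := β * (b u₀ a ^ 2 - b a a * b u₀ u₀ - ν) with hs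
  set u₁ := u₀ + s • f with hu₁
  obtain ⟨T', hT'⟩ := exists_quadratic_pos (A := p ^ 2 * b xp xp) (by positivity)
    (2 * p * b u₁ xp) (b u₁ u₁)
  set u := u₁ + (p * T') • xp with hu
  have huu : 0 < b u u := by
    simp only [hu, map_add, map_smul, LinearMap.add_apply, LinearMap.smul_apply, smul_eq_mul,
      hb xp u₁]
    linarith
  obtain ⟨i, hi⟩ := hff
  obtain ⟨j, hj⟩ := haf
  have hDν : (p : ℤ) ∣ (b u w ^ 2 - b u u * b w w) - ν := by
    obtain ⟨e₁, he₁⟩ : (p : ℤ) ∣ b u w - b u₀ a := by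
      refine ⟨s * j + T' * b xp w + T * b u₁ xn, ?_⟩
      simp only [hu, hw, hu₁, map_add, map_smul, LinearMap.add_apply, LinearMap.smul_apply,
        smul_eq_mul, hb f a, hj]
      ring
    obtain ⟨e₂, he₂⟩ : (p : ℤ) ∣ b u u - (b u₀ u₀ + 2 * s * b u₀ f) := by
      refine ⟨s ^ 2 * i + 2 * T' * b u₁ xp + p * T' ^ 2 * b xp xp, ?_⟩
      simp only [hu, hu₁, map_add, map_smul, LinearMap.add_apply, LinearMap.smul_apply,
        smul_eq_mul, hb f u₀, hb xp u₀, hb xp f, hi]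
      ring
    obtain ⟨e₃, he₃⟩ : (p : ℤ) ∣ b w w - b a a := by
      refine ⟨2 * T * b a xn + p * T ^ 2 * b xn xn, ?_⟩
      simp only [hw, map_add, map_smul, LinearMap.add_apply, LinearMap.smul_apply,
        smul_eq_mul, hb xn a]
      ring
    rw [eq_add_of_sub_eq he₁, eq_add_of_sub_eq he₂, eq_add_of_sub_eq he₃, hs]
    set R := b u₀ a ^ 2 - b a a * b u₀ u₀ - ν
    refine ⟨α * R + 2 * b u₀ a * e₁ + p * e₁ ^ 2 - e₂ * b a a -
      (b u₀ u₀ + 2 * (β * R) * b u₀ f) * e₃ - p * e₂ * e₃, ?_⟩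
    linear_combination (-R) * hαβ
  have huf : ¬ (p : ℤ) ∣ b u f := by
    intro h
    refine hu₀f ?_
    have : b u₀ f = b u f - p * (s * i + T' * b xp f) := by
      simp only [hu, hu₁, map_add, map_smul, LinearMap.add_apply, LinearMap.smul_apply,
        smul_eq_mul, hi]
      ring
    rw [this]
    exact dvd_sub h (dvd_mul_right _ _)
  have hD : 0 < b u w ^ 2 - b u u * b w w := by nlinarith [sq_nonneg (b u w)]
  obtain ⟨k₀, hk₀⟩ := exists_pell_congruence hp hp2 hD (fun ⟨r, hr⟩ => by
    refine hν r ?_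
    rwa [sq, ← hr])
  obtain ⟨α', β', hαβ'⟩ := hpp.coprime_iff_not_dvd.2
    (fun h => (hpp.dvd_or_dvd h).elim h2 huf : ¬ (p : ℤ) ∣ 2 * b u f)
  refine ⟨k₀ + 1, fun k hk => ?_⟩
  obtain ⟨x, y, hxy, ⟨x', hx'⟩, ⟨y', hy'⟩, ⟨l, hl⟩⟩ := hk₀ k (by omega) β'
  obtain ⟨m, rfl⟩ : ∃ m, k = m + 1 := ⟨k - 1, by omega⟩
  refine ⟨planeRotationEquiv hb hxy, planeRotation_isometry hb hxy, fun z =>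
    ⟨(2 * x * y') • skewMap b u w z + (2 * y * y') • skewMap b u w (skewMap b u w z), ?_⟩, ?_⟩
  · rw [planeRotationEquiv_apply, planeRotation_apply]
    match_scalars
    · ring
    · linear_combination 2 * x * hy'
    · linear_combination 2 * y * hy'
  · have hwf : b w f = p * (j + T * b xn f) := by
      simp only [hw, map_add, map_smul, LinearMap.add_apply, LinearMap.smul_apply, smul_eq_mul, hj]
      ring
    refine ⟨(-α' + 2 * l * b u f + 2 * p ^ m * x' * y' * b u f) • w + T • xn -
      (2 * x * y' * (j + T * b xn f)) • u +
      (2 * p ^ m * y' ^ 2) • skewMap b u w (skewMap b u w f), ?_⟩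
    have ha : a = w - (p * T) • xn := by rw [hw]; module
    rw [planeRotationEquiv_apply, planeRotation_apply, ha]
    generalize skewMap b u w (skewMap b u w f) = v
    rw [skewMap_apply u w f, hwf]
    clear_value u w
    match_scalars
    · ring
    · linear_combination 2 * y * b u f * hx' + 2 * b u f * hl +
        2 * p ^ (m + 1) * x' * b u f * hy' + p ^ (m + 1) * hαβ'
    · linear_combination (-2 * x * p * (j + T * b xn f)) * hy'
    · linear_combination 2 * (y + p ^ (m + 1) * y') * hy'
    · ring

end Rotation

section GoodAt
variable {Λ : Type} [AddCommGroup Λ] {b : Λ →ₗ[ℤ] Λ →ₗ[ℤ] ℤ}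

/-- All the automorphisms provided by `HasTransvection` exist for the exponent `k`. -/
def GoodAt (b : Λ →ₗ[ℤ] Λ →ₗ[ℤ] ℤ) (p k : ℕ) : Prop :=
  ∀ f a, (∀ g, f ≠ (p : ℤ) • g) → (p : ℤ) ∣ b f f → (p : ℤ) ∣ b a f → ¬ (p : ℤ) ∣ b a a →
    HasTransvection b p k f a

theorem exists_finite_representatives [Module.Free ℤ Λ] [Module.Finite ℤ Λ] {p : ℕ} (hp : p ≠ 0) :
    ∃ S : Set Λ, S.Finite ∧ ∀ x, ∃ y ∈ S, ∃ g, x = y + (p : ℤ) • g := by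
  let β := Module.Free.chooseBasis ℤ Λ
  let rep : (Module.Free.ChooseBasisIndex ℤ Λ → Fin p) → Λ := fun F => ∑ i, ((F i : ℕ) : ℤ) • β i
  have hp0 : (p : ℤ) ≠ 0 := by exact_mod_cast hp
  refine ⟨Set.range rep, Set.finite_range _, fun x => ?_⟩
  have hlt : ∀ i, ((β.repr x i) % p).toNat < p := fun i => by
    have h1 := Int.emod_nonneg (β.repr x i) hp0
    have h2 := Int.emod_lt_of_pos (β.repr x i) (by omega : (0 : ℤ) < p)
    omega
  refine ⟨_, ⟨fun i => ⟨_, hlt i⟩, rfl⟩, ∑ i, (β.repr x i / p) • β i, ?_⟩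
  conv_lhs => rw [← β.sum_repr x]
  rw [Finset.smul_sum, ← Finset.sum_add_distrib]
  refine Finset.sum_congr rfl fun i _ => ?_
  rw [smul_smul, ← add_smul, Int.toNat_of_nonneg (Int.emod_nonneg _ hp0), Int.emod_add_mul_ediv]

theorem exists_goodAt_of_large [Module.Free ℤ Λ] [Module.Finite ℤ Λ]
    (hb : ∀ x y, b x y = b y x) {d : ℤ}
    (h : DualBound b d) (hpos : ∃ x, 0 < b x x) (hneg : ∃ x, b x x < 0) {p : ℕ} (hp : p.Prime)
    (hp2 : p ≠ 2) (hpd : ¬ (p : ℤ) ∣ d) : ∃ k₀, ∀ k, k₀ ≤ k → GoodAt b p k := by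
  obtain ⟨S, hS, hrep⟩ := exists_finite_representatives (Λ := Λ) hp.ne_zero
  have key : ∀ q : Λ × Λ, ∃ k₀, ∀ k, k₀ ≤ k → (∀ g, q.1 ≠ (p : ℤ) • g) → (p : ℤ) ∣ b q.1 q.1 →
      (p : ℤ) ∣ b q.2 q.1 → ¬ (p : ℤ) ∣ b q.2 q.2 → HasTransvection b p k q.1 q.2 := by
    intro q
    by_cases hq : (∀ g, q.1 ≠ (p : ℤ) • g) ∧ (p : ℤ) ∣ b q.1 q.1 ∧ (p : ℤ) ∣ b q.2 q.1 ∧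
      ¬ (p : ℤ) ∣ b q.2 q.2
    · obtain ⟨k₀, hk₀⟩ := hasTransvection_of_large hb h hpos hneg hp hp2 hpd hq.1 hq.2.1 hq.2.2.1
        hq.2.2.2
      exact ⟨k₀, fun k hk _ _ _ _ => hk₀ k hk⟩
    · exact ⟨0, fun k _ h1 h2 h3 h4 => (hq ⟨h1, h2, h3, h4⟩).elim⟩
  choose K hK using key
  obtain ⟨k₀, hk₀⟩ := ((hS.prod hS).image K).bddAbove
  refine ⟨k₀, fun k hk f a hf hff haf haa => ?_⟩
  obtain ⟨f', hf', g, rfl⟩ := hrep f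
  obtain ⟨a', ha', c, rfl⟩ := hrep a
  simp only [map_add, map_smul, LinearMap.add_apply, LinearMap.smul_apply, smul_eq_mul] at *
  refine (hK (f', a') k ((hk₀ ⟨_, ⟨hf', ha'⟩, rfl⟩).trans hk) (fun g' hg' => hf (g' + g) ?_) ?_ ?_
    fun h => haa ?_).congr g c
  · rw [smul_add, ← hg']
  · obtain ⟨t, ht⟩ := hff
    exact ⟨t - b f' g - b g f' - p * b g g, by linear_combination ht⟩
  · obtain ⟨t, ht⟩ := haf
    exact ⟨t - b a' g - b c f' - p * b c g, by linear_combination ht⟩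
  · obtain ⟨t, ht⟩ := h
    exact ⟨t + b a' c + b c a' + p * b c c, by linear_combination ht⟩

theorem GoodAt.of_equiv {Λ' : Type} [AddCommGroup Λ'] {b' : Λ' →ₗ[ℤ] Λ' →ₗ[ℤ] ℤ}
    (e : Λ ≃ₗ[ℤ] Λ') (he : ∀ x y, b' (e x) (e y) = b x y) {p k : ℕ} (h : GoodAt b' p k) :
    GoodAt b p k := by
  intro f a hf hff haf haa
  obtain ⟨γ, h1, h2, l, hl⟩ := h (e f) (e a)
    (fun g hg => hf (e.symm g) (e.injective (by rw [hg, map_smul, e.apply_symm_apply])))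
    (by rwa [he]) (by rwa [he]) (by rwa [he])
  refine ⟨e.trans (γ.trans e.symm), fun x y => ?_, fun z => ?_, e.symm l, e.injective ?_⟩
  · rw [← he]; simp [h1, he]
  · obtain ⟨z', hz'⟩ := h2 (e z)
    exact ⟨e.symm z', e.injective (by simp [hz'])⟩
  · simp [hl]

/-- The exponent in `GoodAt` can be chosen uniformly for lattices of bounded discriminant. -/
theorem exists_uniform_goodAt (n : ℕ) {d : ℤ} (hd : d ≠ 0) {p : ℕ} (hp : p.Prime) (hp2 : p ≠ 2)
    (hpd : ¬ (p : ℤ) ∣ d) : ∃ k, 0 < k ∧ ∀ (Λ : Type) [AddCommGroup Λ] [Module.Free ℤ Λ]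
      [Module.Finite ℤ Λ] (b : Λ →ₗ[ℤ] Λ →ₗ[ℤ] ℤ), Module.finrank ℤ Λ = n →
      (∀ x y, b x y = b y x) → DualBound b d → (∃ x, 0 < b x x) → (∃ x, b x x < 0) →
      GoodAt b p k := by
  obtain ⟨S, hS, hgram⟩ := finite_gram n d hd
  have key : ∀ g : Fin n → Fin n → ℤ, ∃ k₀, ∀ k, k₀ ≤ k → ∀ (Λ : Type) [AddCommGroup Λ]
      [Module.Free ℤ Λ] [Module.Finite ℤ Λ] (b : Λ →ₗ[ℤ] Λ →ₗ[ℤ] ℤ), Module.finrank ℤ Λ = n →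
      (∀ x y, b x y = b y x) → DualBound b d → (∃ x, 0 < b x x) → (∃ x, b x x < 0) →
      ∀ f : Fin n → Λ, Submodule.span ℤ (Set.range f) = ⊤ → (fun i j => b (f i) (f j)) = g →
      GoodAt b p k := by
    intro g
    by_contra! H
    obtain ⟨-, -, Λ, i1, i2, i3, b, hn, hb, hd', hpos, hneg, f, hf, hg, -⟩ := H 0
    obtain ⟨k₀, hk₀⟩ := exists_goodAt_of_large hb hd' hpos hneg hp hp2 hpd
    obtain ⟨k, hk, Λ', i1', i2', i3', b', hn', hb', -, -, -, f', hf', hg', hbad⟩ := H k₀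
    refine hbad ?_
    let β := basisOfTopLeSpanOfCardEqFinrank f hf.ge (by simp [hn])
    let β' := basisOfTopLeSpanOfCardEqFinrank f' hf'.ge (by simp [hn'])
    refine GoodAt.of_equiv (β'.equiv β (Equiv.refl _)) (fun x y => ?_) (hk₀ k hk)
    have : b.compl₁₂ (β'.equiv β (Equiv.refl _)).toLinearMap
        (β'.equiv β (Equiv.refl _)).toLinearMap = b' := by
      refine LinearMap.BilinForm.ext_basis β' fun i j => ?_
      have := congrFun (congrFun (hg.trans hg'.symm) i) j
      have hβ : ∀ i, β i = f i := fun i => by simp [β]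
      have hβ' : ∀ i, β' i = f' i := fun i => by simp [β']
      rw [LinearMap.compl₁₂_apply]
      simp only [LinearEquiv.coe_coe, Module.Basis.equiv_apply, Equiv.refl_apply, hβ]
      rw [hβ', hβ', this]
    rw [← this]
    rfl
  choose K hK using key
  obtain ⟨k₀, hk₀⟩ := (hS.image K).bddAbove
  refine ⟨k₀ + 1, k₀.succ_pos, fun Λ _ _ _ b hn hb hd' hpos hneg => ?_⟩
  obtain ⟨f, hf, hg⟩ := hgram hn hb hd'
  exact hK _ _ ((hk₀ ⟨_, hg, rfl⟩).trans k₀.le_succ) Λ b hn hb hd' hpos hneg f hf rfl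

end GoodAt

section Lattices
variable {V W : Type} [AddCommGroup V] [Module ℚ V] [AddCommGroup W] [Module ℚ W]
  {B : V →ₗ[ℚ] V →ₗ[ℚ] ℚ} {d : ℤ} {M : Submodule ℤ V}

/-- `M` is an integral lattice in `(V, B)` whose discriminant group is annihilated by `d`. -/
structure IsLat (B : V →ₗ[ℚ] V →ₗ[ℚ] ℚ) (d : ℤ) (M : Submodule ℤ V) : Prop where
  fg : M.FG
  span : ∀ x, ∃ n : ℤ, n ≠ 0 ∧ n • x ∈ M
  int : ∀ x ∈ M, ∀ y ∈ M, ∃ k : ℤ, B x y = k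
  dual : ∀ x, (∀ y ∈ M, ∃ k : ℤ, B x y = k) → d • x ∈ M

theorem zsmul_cancel {n : ℤ} (hn : n ≠ 0) {x y : V} (h : n • x = n • y) : x = y := by
  rw [← Int.cast_smul_eq_zsmul ℚ, ← Int.cast_smul_eq_zsmul ℚ] at h
  exact smul_right_injective V (Int.cast_ne_zero.2 hn) h

/-- Linear maps on a full lattice extend to the ambient rational vector space. -/
theorem exists_rat_extension (hM : ∀ x : V, ∃ n : ℤ, n ≠ 0 ∧ n • x ∈ M) (g : M →ₗ[ℤ] W) :
    ∃ F : V →ₗ[ℚ] W, ∀ x : M, F x = g x := by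
  choose n hn hnM using hM
  have key : ∀ (x : V) (m : ℤ) (hm : m • x ∈ M),
      n x • g ⟨m • x, hm⟩ = m • g ⟨n x • x, hnM x⟩ := fun x m hm => by
    rw [← map_smul, ← map_smul]
    congr 1
    exact Subtype.ext (smul_comm _ _ _)
  have hF : ∀ (x : V) (m : ℤ) (hm : m • x ∈ M),
      m • ((n x : ℚ)⁻¹ • g ⟨n x • x, hnM x⟩) = g ⟨m • x, hm⟩ := fun x m hm => by
    rw [smul_comm, ← key x m hm, ← Int.cast_smul_eq_zsmul ℚ, inv_smul_smul₀
      (Int.cast_ne_zero.2 (hn x))]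
  let F : V →+ W :=
    { toFun := fun x => (n x : ℚ)⁻¹ • g ⟨n x • x, hnM x⟩
      map_zero' := by
        have : (⟨n 0 • 0, hnM 0⟩ : M) = 0 := Subtype.ext (smul_zero _)
        rw [this, map_zero, smul_zero]
      map_add' := fun x y => by
        have hx : (n x * n y) • x ∈ M := by
          rw [mul_comm, mul_smul]; exact M.smul_mem _ (hnM x)
        have hy : (n x * n y) • y ∈ M := by rw [mul_smul]; exact M.smul_mem _ (hnM y)
        have hxy : (n x * n y) • (x + y) ∈ M := by rw [smul_add]; exact M.add_mem hx hy
        refine zsmul_cancel (mul_ne_zero (hn x) (hn y)) ?_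
        refine (hF _ _ hxy).trans (.trans ?_ (smul_add _ _ _).symm)
        rw [hF _ _ hx, hF _ _ hy, ← map_add]
        exact congrArg g (Subtype.ext (smul_add _ _ _)) }
  refine ⟨F.toRatLinearMap, fun x => ?_⟩
  have := hF x 1 (by rw [one_smul]; exact x.2)
  rw [one_smul] at this
  refine this.trans (congrArg g (Subtype.ext (one_smul _ _)))

theorem ratLinearMap_ext (hM : ∀ x : V, ∃ n : ℤ, n ≠ 0 ∧ n • x ∈ M) {F G : V →ₗ[ℚ] W}
    (h : ∀ x ∈ M, F x = G x) : F = G := by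
  ext x
  obtain ⟨n, hn, hx⟩ := hM x
  refine zsmul_cancel hn ?_
  rw [← map_zsmul, ← map_zsmul, h _ hx]

theorem finrank_eq_of_full [Module.Finite ℤ M] (hM : ∀ x : V, ∃ n : ℤ, n ≠ 0 ∧ n • x ∈ M) :
    Module.finrank ℤ M = Module.finrank ℚ V := by
  have : IsLocalizedModule (nonZeroDivisors ℤ) M.subtype :=
    { map_units := fun s => by
        rw [Module.End.isUnit_iff]
        refine ⟨fun x y h => zsmul_cancel (nonZeroDivisors.coe_ne_zero s) h, fun y =>
          ⟨(s : ℚ)⁻¹ • y, ?_⟩⟩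
        change (s : ℤ) • ((s : ℚ)⁻¹ • y) = y
        rw [← Int.cast_smul_eq_zsmul ℚ, smul_inv_smul₀ (by simp)]
      surj := fun y => by
        obtain ⟨n, hn, hy⟩ := hM y
        exact ⟨(⟨_, hy⟩, ⟨n, mem_nonZeroDivisors_of_ne_zero hn⟩), rfl⟩
      exists_of_eq := fun {x y} h => ⟨1, by simpa using h⟩ }
  exact (IsLocalizedModule.finrank_eq (R := ℤ) (nonZeroDivisors ℤ) M.subtype le_rfl).symm.trans
    (IsLocalization.finrank_eq ℚ (nonZeroDivisors ℤ) le_rfl).symm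

/-- The integral form on a lattice. -/
noncomputable def latForm (h : IsLat B d M) : M →ₗ[ℤ] M →ₗ[ℤ] ℤ :=
  LinearMap.mk₂ ℤ (fun x y => (h.int x x.2 y y.2).choose)
    (fun x y z => Int.cast_injective (α := ℚ) (by
      push_cast
      rw [← (h.int _ (x + y).2 z z.2).choose_spec, ← (h.int x x.2 z z.2).choose_spec,
        ← (h.int y y.2 z z.2).choose_spec]
      simp))
    (fun c x y => Int.cast_injective (α := ℚ) (by
      rw [smul_eq_mul, Int.cast_mul, ← (h.int _ (c • x).2 y y.2).choose_spec,
        ← (h.int x x.2 y y.2).choose_spec]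
      simp [← Int.cast_smul_eq_zsmul ℚ]))
    (fun x y z => Int.cast_injective (α := ℚ) (by
      push_cast
      rw [← (h.int x x.2 _ (y + z).2).choose_spec, ← (h.int x x.2 y y.2).choose_spec,
        ← (h.int x x.2 z z.2).choose_spec]
      simp))
    (fun c x y => Int.cast_injective (α := ℚ) (by
      rw [smul_eq_mul, Int.cast_mul, ← (h.int x x.2 _ (c • y).2).choose_spec,
        ← (h.int x x.2 y y.2).choose_spec]
      simp [← Int.cast_smul_eq_zsmul ℚ]))

theorem latForm_apply (h : IsLat B d M) (x y : M) : (latForm h x y : ℚ) = B x y :=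
  (h.int x x.2 y y.2).choose_spec.symm

theorem latForm_symm (h : IsLat B d M) (hB : ∀ x y, B x y = B y x) (x y : M) :
    latForm h x y = latForm h y x :=
  Int.cast_injective (α := ℚ) (by rw [latForm_apply, latForm_apply, hB])

theorem latForm_dualBound [FiniteDimensional ℚ V] (h : IsLat B d M)
    (hnd : ∀ x, (∀ y, B x y = 0) → x = 0) : DualBound (latForm h) d := by
  intro φ
  obtain ⟨F, hF⟩ := exists_rat_extension h.span
    ((Int.castAddHom ℚ).toIntLinearMap ∘ₗ φ)
  have hinj : Function.Injective B := (injective_iff_map_eq_zero _).2 fun x hx =>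
    hnd x fun y => by rw [hx]; rfl
  obtain ⟨v, hv⟩ := (LinearMap.injective_iff_surjective_of_finrank_eq_finrank
    (by rw [Subspace.dual_finrank_eq] : Module.finrank ℚ V = Module.finrank ℚ (Module.Dual ℚ V))
    (f := (B : V →ₗ[ℚ] Module.Dual ℚ V))).1 hinj F
  have hv' : ∀ y : M, B v y = φ y := fun y => by rw [hv, hF]; rfl
  refine ⟨⟨d • v, h.dual v fun y hy => ⟨φ ⟨y, hy⟩, hv' ⟨y, hy⟩⟩⟩, fun y => ?_⟩
  refine Int.cast_injective (α := ℚ) ?_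
  rw [latForm_apply, Int.cast_mul, ← hv']
  simp [← Int.cast_smul_eq_zsmul ℚ]

theorem IsLat.moduleFinite (h : IsLat B d M) : Module.Finite ℤ M :=
  Module.Finite.iff_fg.2 h.fg

theorem IsLat.moduleFree (h : IsLat B d M) : Module.Free ℤ M := by
  have := h.moduleFinite
  have : Module.IsTorsionFree ℤ V := Module.IsTorsionFree.trans_faithfulSMul ℤ ℚ V
  infer_instance

theorem latForm_exists_pos (h : IsLat B d M) (hpos : ∃ x, 0 < B x x) :
    ∃ x, 0 < latForm h x x := by
  obtain ⟨x, hx⟩ := hpos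
  obtain ⟨n, hn, hxM⟩ := h.span x
  refine ⟨⟨_, hxM⟩, Int.cast_pos (R := ℚ).1 ?_⟩
  rw [latForm_apply]
  simp only [← Int.cast_smul_eq_zsmul ℚ, map_smul, LinearMap.smul_apply, smul_eq_mul, ← mul_assoc]
  have : (n : ℚ) ≠ 0 := Int.cast_ne_zero.2 hn
  exact mul_pos (mul_self_pos.2 this) hx

theorem latForm_exists_neg (h : IsLat B d M) (hneg : ∃ x, B x x < 0) :
    ∃ x, latForm h x x < 0 := by
  obtain ⟨x, hx⟩ := hneg
  obtain ⟨n, hn, hxM⟩ := h.span x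
  refine ⟨⟨_, hxM⟩, Int.cast_lt_zero (R := ℚ).1 ?_⟩
  rw [latForm_apply]
  simp only [← Int.cast_smul_eq_zsmul ℚ, map_smul, LinearMap.smul_apply, smul_eq_mul, ← mul_assoc]
  have : (n : ℚ) ≠ 0 := Int.cast_ne_zero.2 hn
  exact mul_neg_of_pos_of_neg (mul_self_pos.2 this) hx

end Lattices

section Isometry
variable {V : Type} [AddCommGroup V] [Module ℚ V] {B : V →ₗ[ℚ] V →ₗ[ℚ] ℚ} {d : ℤ}
  {M M' M'' : Submodule ℤ V}

/-- Two lattices in `(V, B)` are related by an isometry of `(V, B)`. -/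
def LatIso (B : V →ₗ[ℚ] V →ₗ[ℚ] ℚ) (M M' : Submodule ℤ V) : Prop :=
  ∃ σ : V ≃ₗ[ℚ] V, (∀ x y, B (σ x) (σ y) = B x y) ∧ ∀ x, σ x ∈ M' ↔ x ∈ M

theorem LatIso.refl (M : Submodule ℤ V) : LatIso B M M :=
  ⟨.refl ℚ V, fun _ _ => rfl, fun _ => Iff.rfl⟩

theorem LatIso.symm (h : LatIso B M M') : LatIso B M' M := by
  obtain ⟨σ, h1, h2⟩ := h
  exact ⟨σ.symm, fun x y => by simpa using (h1 (σ.symm x) (σ.symm y)).symm, fun x => by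
    simpa using (h2 (σ.symm x)).symm⟩

theorem LatIso.trans (h : LatIso B M M') (h' : LatIso B M' M'') : LatIso B M M'' := by
  obtain ⟨σ, h1, h2⟩ := h
  obtain ⟨τ, h3, h4⟩ := h'
  exact ⟨σ.trans τ, fun x y => by simp [h3, h1], fun x => by simp [h4, h2]⟩

theorem exists_isometry_extension (hM : ∀ x : V, ∃ n : ℤ, n ≠ 0 ∧ n • x ∈ M) (γ : M ≃ₗ[ℤ] M)
    (hγ : ∀ x y : M, B (γ x) (γ y) = B x y) :
    ∃ σ : V ≃ₗ[ℚ] V, (∀ x y, B (σ x) (σ y) = B x y) ∧ ∀ x : M, σ x = γ x := by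
  obtain ⟨F, hF⟩ := exists_rat_extension hM (M.subtype ∘ₗ γ.toLinearMap)
  obtain ⟨G, hG⟩ := exists_rat_extension hM (M.subtype ∘ₗ γ.symm.toLinearMap)
  have hF' : ∀ x : M, F x = γ x := hF
  have hG' : ∀ x : M, G x = γ.symm x := hG
  refine ⟨LinearEquiv.ofLinearMap F G (ratLinearMap_ext hM fun x hx => ?_)
    (ratLinearMap_ext hM fun x hx => ?_), fun x y => ?_, hF⟩
  · rw [LinearMap.comp_apply, hG' ⟨x, hx⟩, hF', γ.apply_symm_apply]; rfl
  · rw [LinearMap.comp_apply, hF' ⟨x, hx⟩, hG', γ.symm_apply_apply]; rfl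
  · have : B.compl₁₂ F F = B := by
      refine ratLinearMap_ext hM fun x hx => ratLinearMap_ext hM fun y hy => ?_
      rw [LinearMap.compl₁₂_apply, hF' ⟨x, hx⟩, hF' ⟨y, hy⟩, hγ]
    exact LinearMap.congr_fun (LinearMap.congr_fun this x) y

end Isometry

section Neighbours
variable {V : Type} [AddCommGroup V] [Module ℚ V] {B : V →ₗ[ℚ] V →ₗ[ℚ] ℚ} {d m : ℤ}
  {M M' : Submodule ℤ V} {x : V}

/-- The neighbour of `M` spanned by `x / m` and the vectors of `M` whose product with `x` is
divisible by `m`. -/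
def nb (B : V →ₗ[ℚ] V →ₗ[ℚ] ℚ) (m : ℤ) (M : Submodule ℤ V) (x : V) : Submodule ℤ V where
  carrier := {v | ∃ y ∈ M, ∃ t k : ℤ, B x y = m * k ∧ v = y + ((t : ℚ) / m) • x}
  zero_mem' := ⟨0, M.zero_mem, 0, 0, by simp, by simp⟩
  add_mem' := by
    rintro _ _ ⟨y, hy, t, k, hk, rfl⟩ ⟨y', hy', t', k', hk', rfl⟩
    refine ⟨y + y', M.add_mem hy hy', t + t', k + k', ?_, ?_⟩
    · rw [map_add, hk, hk']; push_cast; ring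
    · push_cast; module
  smul_mem' := by
    rintro c _ ⟨y, hy, t, k, hk, rfl⟩
    refine ⟨c • y, M.smul_mem c hy, c * t, c * k, ?_, ?_⟩
    · rw [map_zsmul, hk, zsmul_eq_mul]; push_cast; ring
    · rw [← Int.cast_smul_eq_zsmul ℚ, ← Int.cast_smul_eq_zsmul ℚ]; push_cast; module

theorem mem_nb_of_mem {y : V} (hy : y ∈ M) {k : ℤ} (hk : B x y = m * k) : y ∈ nb B m M x :=
  ⟨y, hy, 0, k, hk, by simp⟩

theorem div_smul_mem_nb (t : ℤ) : ((t : ℚ) / m) • x ∈ nb B m M x :=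
  ⟨0, M.zero_mem, t, 0, by simp, by simp⟩

theorem zsmul_mem_nb (hM : IsLat B d M) (hx : x ∈ M) {y : V} (hy : y ∈ M) :
    m • y ∈ nb B m M x := by
  obtain ⟨k, hk⟩ := hM.int x hx y hy
  exact mem_nb_of_mem (M.smul_mem m hy) (k := k) (by rw [map_zsmul, hk, zsmul_eq_mul])

theorem zsmul_mem_of_mem_nb (hm : m ≠ 0) (hx : x ∈ M) {v : V} (hv : v ∈ nb B m M x) :
    m • v ∈ M := by
  obtain ⟨y, hy, t, k, -, rfl⟩ := hv
  have hm' : (m : ℚ) ≠ 0 := Int.cast_ne_zero.2 hm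
  have : m • (y + ((t : ℚ) / m) • x) = m • y + t • x := by
    rw [smul_add, ← Int.cast_smul_eq_zsmul ℚ m (_ • x), smul_smul, mul_div_cancel₀ _ hm',
      Int.cast_smul_eq_zsmul]
  rw [this]
  exact M.add_mem (M.smul_mem _ hy) (M.smul_mem _ hx)

theorem isLat_nb (hB : ∀ x y, B x y = B y x) (hM : IsLat B d M) (hm : m ≠ 0) (hx : x ∈ M) {c : ℤ}
    (hc : B x x = m ^ 2 * c) {y₀ : V} (hy₀ : y₀ ∈ M) {c₀ : ℤ} (hc₀ : B x y₀ = 1 + m * c₀) :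
    IsLat B d (nb B m M x) := by
  have hm' : (m : ℚ) ≠ 0 := Int.cast_ne_zero.2 hm
  refine ⟨?_, fun v => ?_, ?_, fun v hv => ?_⟩
  · refine (hM.fg.sup (Submodule.fg_span_singleton ((1 / m : ℚ) • x))).of_le ?_
    rintro _ ⟨y, hy, t, k, -, rfl⟩
    refine add_mem (Submodule.mem_sup_left hy) (Submodule.mem_sup_right
      (Submodule.mem_span_singleton.2 ⟨t, ?_⟩))
    rw [← Int.cast_smul_eq_zsmul ℚ, smul_smul, mul_one_div]
  · obtain ⟨n, hn, hv⟩ := hM.span v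
    exact ⟨m * n, mul_ne_zero hm hn, by rw [mul_smul]; exact zsmul_mem_nb hM hx hv⟩
  · rintro _ ⟨y, hy, t, k, hk, rfl⟩ _ ⟨y', hy', t', k', hk', rfl⟩
    obtain ⟨j, hj⟩ := hM.int y hy y' hy'
    refine ⟨j + t * k' + t' * k + t * t' * c, ?_⟩
    simp only [map_add, map_smul, LinearMap.add_apply, LinearMap.smul_apply, smul_eq_mul, hB y x,
      hk, hk', hc, hj]
    push_cast
    field_simp
    ring
  · obtain ⟨s, hs⟩ := hv _ (zsmul_mem_nb (m := m) hM hx hy₀)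
    rw [map_zsmul, zsmul_eq_mul] at hs
    obtain ⟨r, hr⟩ := hv _ (div_smul_mem_nb 1)
    rw [map_smul, smul_eq_mul, Int.cast_one, one_div, inv_mul_eq_iff_eq_mul₀ hm'] at hr
    have hμ : d • (v - ((s : ℚ) / m) • x) ∈ M := by
      refine hM.dual _ fun y hy => ?_
      obtain ⟨j, hj⟩ := hM.int x hx y hy
      obtain ⟨i, hi⟩ := hv (y - j • y₀) (mem_nb_of_mem (k := -(j * c₀)) (M.sub_mem hy
        (M.smul_mem _ hy₀)) (by rw [map_sub, map_zsmul, hj, hc₀, zsmul_eq_mul]; push_cast; ring))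
      refine ⟨i, ?_⟩
      rw [map_sub, map_zsmul, zsmul_eq_mul] at hi
      simp only [map_sub, map_smul, LinearMap.sub_apply, LinearMap.smul_apply, smul_eq_mul, hj]
      field_simp
      linear_combination m * hi + j * hs
    refine ⟨_, hμ, d * s, d * (r - s * c), ?_, ?_⟩
    · simp only [map_zsmul, map_sub, map_smul, zsmul_eq_mul, smul_eq_mul, hB x v, hr, hc]
      push_cast
      field_simp
    · rw [← Int.cast_smul_eq_zsmul ℚ, ← Int.cast_smul_eq_zsmul ℚ]
      push_cast
      module

theorem nb_le_of_congr (hB : ∀ x y, B x y = B y x) (hM : IsLat B d M) (hm : m ≠ 0)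
    (hm2 : IsCoprime m 2) {x' z : V} (hx : x ∈ M) (hz : z ∈ M) {l : ℤ} (hl : IsCoprime m l)
    (h : x' = l • x + m • z) {c c' : ℤ} (hc : B x x = m ^ 2 * c) (hc' : B x' x' = m ^ 2 * c') :
    nb B m M x' ≤ nb B m M x := by
  have hm' : (m : ℚ) ≠ 0 := Int.cast_ne_zero.2 hm
  rintro _ ⟨y, hy, t, k, hk, rfl⟩
  obtain ⟨i, hi⟩ := hM.int x hx y hy
  obtain ⟨j, hj⟩ := hM.int x hx z hz
  obtain ⟨w, hw⟩ := hM.int z hz z hz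
  obtain ⟨u, hu⟩ := hM.int z hz y hy
  have hi' : m ∣ i := by
    refine hl.dvd_of_dvd_mul_left ⟨k - u, Int.cast_injective (α := ℚ) ?_⟩
    rw [h] at hk
    simp only [map_add, map_zsmul, LinearMap.add_apply, LinearMap.smul_apply, zsmul_eq_mul, hi,
      hu] at hk
    push_cast
    linear_combination hk
  have hj' : m ∣ j := by
    refine (hm2.mul_right hl).dvd_of_dvd_mul_left (mul_dvd_mul_iff_left hm |>.1
      ⟨c' - l ^ 2 * c - w, Int.cast_injective (α := ℚ) ?_⟩)
    rw [h] at hc'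
    simp only [map_add, map_zsmul, LinearMap.add_apply, LinearMap.smul_apply, zsmul_eq_mul, hc,
      hj, hw, hB z x] at hc'
    push_cast
    linear_combination hc'
  obtain ⟨i, rfl⟩ := hi'
  obtain ⟨j, rfl⟩ := hj'
  refine ⟨y + t • z, M.add_mem hy (M.smul_mem _ hz), t * l, i + t * j, ?_, ?_⟩
  · rw [map_add, map_zsmul, hi, hj, zsmul_eq_mul]; push_cast; ring
  · rw [h, ← Int.cast_smul_eq_zsmul ℚ, ← Int.cast_smul_eq_zsmul ℚ, ← Int.cast_smul_eq_zsmul ℚ]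
    push_cast
    match_scalars <;> field_simp

theorem nb_congr (hB : ∀ x y, B x y = B y x) (hM : IsLat B d M) (hm : m ≠ 0)
    (hm2 : IsCoprime m 2) {x' z : V} (hx : x ∈ M) (hz : z ∈ M) {l : ℤ} (hl : IsCoprime m l)
    (h : x' = l • x + m • z) {c c' : ℤ} (hc : B x x = m ^ 2 * c) (hc' : B x' x' = m ^ 2 * c') :
    nb B m M x' = nb B m M x := by
  refine le_antisymm (nb_le_of_congr hB hM hm hm2 hx hz hl h hc hc') ?_
  obtain ⟨a, e, hae⟩ := hl
  have hx' : x' ∈ M := h ▸ M.add_mem (M.smul_mem _ hx) (M.smul_mem _ hz)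
  refine nb_le_of_congr hB hM hm hm2 hx' (z := a • x - e • z) (M.sub_mem (M.smul_mem _ hx)
    (M.smul_mem _ hz)) (l := e) ⟨a, l, by linear_combination hae⟩ ?_ hc' hc
  rw [h]
  match_scalars
  · linear_combination -hae
  · ring

/-- The neighbour relation is symmetric. -/
theorem nb_nb (hM : IsLat B d M) (hm : m ≠ 0) {e f : V} (he : e ∈ M) (hf : f ∈ M) {c : ℤ}
    (hB : ∀ x y, B x y = B y x) (hc : IsCoprime m c) (hef : B e f = c) :
    nb B m (nb B m M e) (m • f) = M := by
  have hm' : (m : ℚ) ≠ 0 := Int.cast_ne_zero.2 hm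
  have hdiv : ∀ t : ℤ, ((t : ℚ) / m) • m • f = t • f := fun t => by
    rw [← Int.cast_smul_eq_zsmul ℚ m, smul_smul, div_mul_cancel₀ _ hm', Int.cast_smul_eq_zsmul]
  refine le_antisymm ?_ fun y hy => ?_
  · rintro _ ⟨_, ⟨y, hy, s, k, hk, rfl⟩, t, j, hj, rfl⟩
    obtain ⟨i, hi⟩ := hM.int f hf y hy
    have hs : m ∣ s := by
      refine hc.dvd_of_dvd_mul_right ⟨j - i, Int.cast_injective (α := ℚ) ?_⟩
      simp only [map_zsmul, LinearMap.smul_apply, map_add, map_smul, zsmul_eq_mul, smul_eq_mul,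
        hi, hB f e, hef] at hj
      push_cast
      field_simp at hj
      linear_combination hj
    obtain ⟨s, rfl⟩ := hs
    rw [hdiv, Int.cast_mul, mul_div_cancel_left₀ _ hm', Int.cast_smul_eq_zsmul]
    exact M.add_mem (M.add_mem hy (M.smul_mem _ he)) (M.smul_mem _ hf)
  · obtain ⟨a, b, hab⟩ := hc
    obtain ⟨i, hi⟩ := hM.int e he y hy
    obtain ⟨j, hj⟩ := hM.int f hf (y - (i * b) • f) (M.sub_mem hy (M.smul_mem _ hf))
    refine ⟨y - (i * b) • f, mem_nb_of_mem (k := i * a) (M.sub_mem hy (M.smul_mem _ hf)) ?_,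
      i * b, j, ?_, ?_⟩
    · rw [map_sub, map_zsmul, hef, hi, zsmul_eq_mul]
      push_cast
      have : (a * m + b * c : ℚ) = 1 := by exact_mod_cast hab
      linear_combination (-i : ℚ) * this
    · rw [map_zsmul, LinearMap.smul_apply, hj, zsmul_eq_mul]
    · rw [hdiv, sub_add_cancel]

theorem nb_map {σ : V ≃ₗ[ℚ] V} (h1 : ∀ x y, B (σ x) (σ y) = B x y)
    (h2 : ∀ x, σ x ∈ M' ↔ x ∈ M) (v : V) : σ v ∈ nb B m M' (σ x) ↔ v ∈ nb B m M x := by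
  constructor
  · rintro ⟨y, hy, t, k, hk, h⟩
    refine ⟨σ.symm y, by rwa [← h2, σ.apply_symm_apply], t, k, ?_, σ.injective ?_⟩
    · rw [← h1, σ.apply_symm_apply, hk]
    · rw [h, map_add, map_smul, σ.apply_symm_apply]
  · rintro ⟨y, hy, t, k, hk, rfl⟩
    exact ⟨σ y, (h2 y).2 hy, t, k, by rw [h1, hk], by rw [map_add, map_smul]⟩

end Neighbours

section Residues
variable {Λ : Type} [AddCommGroup Λ] {b : Λ →ₗ[ℤ] Λ →ₗ[ℤ] ℤ} {p : ℕ}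

theorem not_dvd_two (hp : p.Prime) (hp2 : p ≠ 2) : ¬ (p : ℤ) ∣ 2 := fun h =>
  hp2 ((Nat.prime_dvd_prime_iff_eq hp Nat.prime_two).1 (by exact_mod_cast h))

theorem exists_dvd_mul_sub (hp : p.Prime) {c : ℤ} (hc : ¬ (p : ℤ) ∣ c) (k : ℕ) (r : ℤ) :
    ∃ s, (p : ℤ) ^ k ∣ s * c - r := by
  obtain ⟨u, v, huv⟩ := ((Nat.prime_iff_prime_int.1 hp).coprime_iff_not_dvd.2 hc).pow_left (m := k)
  exact ⟨v * r, -(u * r), by linear_combination r * huv⟩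

theorem residualRankGT_of_not_dvd [Module.Free ℤ Λ] [Module.Finite ℤ Λ]
    (hb : ∀ x y, b x y = b y x) {d : ℤ} (h : DualBound b d) (hpd : ¬ (p : ℤ) ∣ d)
    {k : ℕ} (hk : k < Module.finrank ℤ Λ) : ResidualRankGT b p k := by
  intro f
  obtain ⟨x, ψ, hψ, hx⟩ := exists_primitive_of_functionals hk fun i => b (f i)
  obtain ⟨y, hy⟩ := h ψ
  exact ⟨x, y, fun i => by rw [hb, hx i]; exact dvd_zero _, by rwa [hb, hy, hψ, mul_one]⟩

/-- Hensel's lemma for isotropic vectors modulo powers of `p`. -/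
theorem exists_isotropic_lift (hb : ∀ x y, b x y = b y x) (hp : p.Prime) (hp2 : p ≠ 2) {e y : Λ}
    (he : (p : ℤ) ∣ b e e) (hy : ¬ (p : ℤ) ∣ b e y) (m : ℕ) :
    ∃ g, (p : ℤ) ^ (m + 1) ∣ b (e + (p : ℤ) • g) (e + (p : ℤ) • g) := by
  induction m with
  | zero => exact ⟨0, by simpa using he⟩
  | succ m ih =>
    obtain ⟨g, q, hq⟩ := ih
    obtain ⟨s, hs⟩ := exists_dvd_mul_sub hp (c := 2 * b (e + (p : ℤ) • g) y) (fun h => by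
      refine ((Nat.prime_iff_prime_int.1 hp).dvd_or_dvd h).elim (not_dvd_two hp hp2) fun h => hy ?_
      rw [map_add, map_smul, LinearMap.add_apply, LinearMap.smul_apply, smul_eq_mul] at h
      exact (dvd_add_left (dvd_mul_right _ _)).1 h) 1 (-q)
    obtain ⟨t, ht⟩ := hs
    refine ⟨g + ((p : ℤ) ^ m * s) • y, t + p ^ m * s ^ 2 * b y y, ?_⟩
    have : e + (p : ℤ) • (g + ((p : ℤ) ^ m * s) • y) =
        (e + (p : ℤ) • g) + ((p : ℤ) ^ (m + 1) * s) • y := by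
      rw [pow_succ]; module
    rw [this]
    generalize e + (p : ℤ) • g = e' at *
    simp only [map_add, map_smul, LinearMap.add_apply, LinearMap.smul_apply, smul_eq_mul, hb y e']
    linear_combination hq + p ^ (m + 1) * ht

theorem ResidualRankGT.exists_isotropic_pairing (hr : ResidualRankGT b p 2)
    (hb : ∀ x y, b x y = b y x) (hp : p.Prime) (hp2 : p ≠ 2) {x x' : Λ} (hx : (p : ℤ) ∣ b x x)
    (hx' : (p : ℤ) ∣ b x' x') (hxx' : ¬ (p : ℤ) ∣ b x x') (m : ℕ) :
    ∃ e, (p : ℤ) ^ m ∣ b e e ∧ ¬ (p : ℤ) ∣ b e x ∧ ¬ (p : ℤ) ∣ b e x' := by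
  have hpp := Nat.prime_iff_prime_int.1 hp
  have h2 := not_dvd_two hp hp2
  have h2x : ¬ (p : ℤ) ∣ 2 * b x x' := fun h => (hpp.dvd_or_dvd h).elim h2 hxx'
  have hadd : b (x + x') (x + x') = 2 * b x x' + (b x x + b x' x') := by
    simp only [map_add, LinearMap.add_apply, hb x' x]; ring
  have hsub : b (x - x') (x - x') = (b x x + b x' x') - 2 * b x x' := by
    simp only [map_sub, LinearMap.sub_apply, hb x' x]; ring
  have hmix : b (x + x') (x - x') = b x x - b x' x' := by
    simp only [map_sub, map_add, LinearMap.add_apply, hb x' x]; ring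
  obtain ⟨z, hz, hzz⟩ := hr.exists_orthogonal hb hp hp2 (f := ![x + x', x - x'])
    (fun i => by
      fin_cases i
      · simpa only [Fin.zero_eta, Matrix.cons_val_zero, hadd, dvd_add_left (dvd_add hx hx')]
      · simpa only [Fin.mk_one, Matrix.cons_val_one, Matrix.cons_val_zero, hsub,
          dvd_sub_right (dvd_add hx hx')])
    (fun i j hij => by
      have := dvd_sub hx hx'
      fin_cases i <;> fin_cases j
      · exact absurd rfl hij
      · change (p : ℤ) ∣ b (x + x') (x - x')
        rwa [hmix]
      · change (p : ℤ) ∣ b (x - x') (x + x')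
        rwa [hb, hmix]
      · exact absurd rfl hij)
  have h0 : (p : ℤ) ∣ b x z + b x' z := by simpa using hz 0
  have h1 : (p : ℤ) ∣ b x z - b x' z := by simpa using hz 1
  have hxz : (p : ℤ) ∣ b x z := by
    refine (hpp.dvd_or_dvd (a := 2) ?_).resolve_left h2
    have := dvd_add h0 h1
    rwa [show b x z + b x' z + (b x z - b x' z) = 2 * b x z by ring] at this
  have hx'z : (p : ℤ) ∣ b x' z := (dvd_add_right hxz).1 h0
  obtain ⟨β, hβ⟩ := exists_dvd_mul_sub hp h2x 1 (-b z z)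
  rw [pow_one] at hβ
  have hβ0 : ¬ (p : ℤ) ∣ β := fun h => hzz (by
    have := dvd_sub hβ (h.mul_right (2 * b x x'))
    rwa [show β * (2 * b x x') - -b z z - β * (2 * b x x') = b z z by ring] at this)
  obtain ⟨g, hg⟩ := exists_isotropic_lift hb hp hp2 (e := x + z + β • x') (y := x') (by
      have : b (x + z + β • x') (x + z + β • x') = (β * (2 * b x x') - -b z z) + b x x +
          β ^ 2 * b x' x' + 2 * b x z + 2 * β * b x' z := by
        simp only [map_add, map_smul, LinearMap.add_apply, LinearMap.smul_apply, smul_eq_mul,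
          hb x' x, hb z x, hb z x']
        ring
      rw [this]
      exact dvd_add (dvd_add (dvd_add (dvd_add hβ hx) (hx'.mul_left _)) (hxz.mul_left _))
        (hx'z.mul_left _))
    (fun h => hxx' (by
      have : b (x + z + β • x') x' = b x x' + (b x' z + β * b x' x') := by
        simp only [map_add, map_smul, LinearMap.add_apply, LinearMap.smul_apply, smul_eq_mul,
          hb z x']
        ring
      rw [this] at h
      exact (dvd_add_left (dvd_add hx'z (hx'.mul_left _))).1 h)) m
  refine ⟨_, (pow_dvd_pow _ m.le_succ).trans hg, fun h => ?_, fun h => hxx' ?_⟩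
  · have : b (x + z + β • x' + (p : ℤ) • g) x = β * b x x' + (b x x + b x z + p * b g x) := by
      simp only [map_add, map_smul, LinearMap.add_apply, LinearMap.smul_apply, smul_eq_mul,
        hb z x, hb x' x]
      ring
    rw [this, dvd_add_left (dvd_add (dvd_add hx hxz) (dvd_mul_right _ _))] at h
    exact (hpp.dvd_or_dvd h).elim hβ0 hxx'
  · have : b (x + z + β • x' + (p : ℤ) • g) x' =
        b x x' + (b x' z + β * b x' x' + p * b g x') := by
      simp only [map_add, map_smul, LinearMap.add_apply, LinearMap.smul_apply, smul_eq_mul,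
        hb z x']
      ring
    rwa [this, dvd_add_left (dvd_add (dvd_add hx'z (hx'.mul_left _)) (dvd_mul_right _ _))] at h

theorem exists_isotropic_intermediate (hb : ∀ x y, b x y = b y x) (hp : p.Prime) (hp2 : p ≠ 2)
    {x x' y y' : Λ} (hx : (p : ℤ) ∣ b x x) (hxx' : (p : ℤ) ∣ b x x')
    (hy : ¬ (p : ℤ) ∣ b x y) (hy' : ¬ (p : ℤ) ∣ b x' y') (m : ℕ) :
    ∃ e, (p : ℤ) ^ m ∣ b e e ∧ ¬ (p : ℤ) ∣ b x e ∧ ¬ (p : ℤ) ∣ b x' e := by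
  have hpp := Nat.prime_iff_prime_int.1 hp
  obtain ⟨z, hz, hz'⟩ : ∃ z, ¬ (p : ℤ) ∣ b x z ∧ ¬ (p : ℤ) ∣ b x' z := by
    by_cases h1 : (p : ℤ) ∣ b x' y
    · by_cases h2 : (p : ℤ) ∣ b x y'
      · exact ⟨y + y', by rwa [map_add, dvd_add_left h2], by rwa [map_add, dvd_add_right h1]⟩
      · exact ⟨y', h2, hy'⟩
    · exact ⟨y, hy, h1⟩
  obtain ⟨β, hβ⟩ := exists_dvd_mul_sub hp (c := 2 * b x z)
    (fun h => (hpp.dvd_or_dvd h).elim (not_dvd_two hp hp2) hz) 1 (-b z z)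
  rw [pow_one] at hβ
  have hxe : ∀ g, b x (z + β • x + (p : ℤ) • g) = b x z + (β * b x x + p * b x g) := fun g => by
    simp only [map_add, map_smul, smul_eq_mul]; ring
  have hxe' : ∀ g, b x' (z + β • x + (p : ℤ) • g) = b x' z + (β * b x x' + p * b x' g) :=
    fun g => by
      simp only [map_add, map_smul, smul_eq_mul, hb x' x]; ring
  obtain ⟨g, hg⟩ := exists_isotropic_lift hb hp hp2 (e := z + β • x) (y := x) (by
      have : b (z + β • x) (z + β • x) = (β * (2 * b x z) - -b z z) + β ^ 2 * b x x := by
        simp only [map_add, map_smul, LinearMap.add_apply, LinearMap.smul_apply, smul_eq_mul,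
          hb z x]
        ring
      rw [this]
      exact dvd_add hβ (hx.mul_left _))
    (fun h => hz (by
      have := hxe 0
      rw [smul_zero, add_zero] at this
      rw [hb, this, map_zero, mul_zero, add_zero] at h
      exact (dvd_add_left (hx.mul_left _)).1 h)) m
  refine ⟨_, (pow_dvd_pow _ m.le_succ).trans hg, ?_, ?_⟩
  · rwa [hxe, dvd_add_left (dvd_add (hx.mul_left _) (dvd_mul_right _ _))]
  · rwa [hxe', dvd_add_left (dvd_add (hxx'.mul_left _) (dvd_mul_right _ _))]

end Residues

section Neighbours
variable {V : Type} [AddCommGroup V] [Module ℚ V] {B : V →ₗ[ℚ] V →ₗ[ℚ] ℚ} {d : ℤ}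
  {M : Submodule ℤ V} {p : ℕ}

theorem exists_pairing_one_add {m c : ℤ} {x y : V} (hc : IsCoprime m c) (hy : y ∈ M)
    (h : B x y = c) : ∃ y₀ ∈ M, ∃ c₀ : ℤ, B x y₀ = 1 + m * c₀ := by
  obtain ⟨u, v, huv⟩ := hc
  refine ⟨v • y, M.smul_mem _ hy, -u, ?_⟩
  have : (u * m + v * c : ℚ) = 1 := by exact_mod_cast huv
  rw [map_zsmul, h, zsmul_eq_mul]
  push_cast
  linear_combination this

theorem dvd_of_cast_eq {m c k : ℤ} (h : (c : ℚ) = m * k) : m ∣ c :=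
  ⟨k, by exact_mod_cast h⟩

/-- Two `p`-neighbours of `M` are isometric, provided that a common `p ^ k`-neighbour of `M` has
enough automorphisms. -/
theorem latIso_nb_of_goodAt (hB : ∀ x y, B x y = B y x) (hM : IsLat B d M) (hp : p.Prime)
    (hp2 : p ≠ 2) {x x' e : V} (hx : x ∈ M) (hx' : x' ∈ M) (he : e ∈ M) {c c' u u' w : ℤ}
    (hc : B x x = (p : ℤ) ^ 2 * c) (hc' : B x' x' = (p : ℤ) ^ 2 * c') (hu : B e x = u)
    (hu' : B e x' = u') (hw : B x x' = w) (hpu : ¬ (p : ℤ) ∣ u) (hpu' : ¬ (p : ℤ) ∣ u')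
    (hpw : ¬ (p : ℤ) ∣ w) {k : ℕ} (hk : 0 < k) (hL : IsLat B d (nb B ((p : ℤ) ^ k) M e))
    (hgood : GoodAt (latForm hL) p k) : LatIso B (nb B p M x) (nb B p M x') := by
  have hpp := Nat.prime_iff_prime_int.1 hp
  have hp0 : (p : ℤ) ≠ 0 := hpp.ne_zero
  have hpk0 : (p : ℤ) ^ k ≠ 0 := pow_ne_zero _ hp0
  have hp0' : (p : ℚ) ≠ 0 := by exact_mod_cast hp0
  have hcop2 : IsCoprime (p : ℤ) 2 := hpp.coprime_iff_not_dvd.2 (not_dvd_two hp hp2)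
  obtain ⟨l, hl⟩ := exists_dvd_mul_sub hp hpu' k u
  have hpl : ¬ (p : ℤ) ∣ l := fun h => hpu (by
    have := dvd_sub (h.mul_right u') ((dvd_pow_self _ hk.ne').trans hl)
    rwa [sub_sub_cancel] at this)
  set L := nb B ((p : ℤ) ^ k) M e with hLdef
  have hf : (p : ℤ) ^ k • x ∈ L := zsmul_mem_nb hM he hx
  have haM : l • x' - x ∈ M := M.sub_mem (M.smul_mem _ hx') hx
  have ha : l • x' - x ∈ L := by
    obtain ⟨j, hj⟩ := hl
    refine mem_nb_of_mem haM (k := j) ?_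
    rw [map_sub, map_zsmul, hu, hu', zsmul_eq_mul]
    exact_mod_cast hj
  obtain ⟨i₀, hi₀⟩ := hM.int _ haM _ hx
  obtain ⟨γ, hγ, hγ1, q, hq⟩ := hgood ⟨_, hf⟩ ⟨_, ha⟩ (fun g hg => hpu (by
      obtain ⟨j, hj⟩ := hL.int _ (div_smul_mem_nb (B := B) (m := (p : ℤ) ^ k) (M := M) (x := e) 1)
        g g.2
      refine dvd_of_cast_eq (k := j) ?_
      have hg' : (p : ℤ) ^ k • x = (p : ℤ) • (g : V) := congrArg Subtype.val hg
      have h1 : B (((1 : ℤ) / ((p ^ k : ℤ) : ℚ)) • e) ((p : ℤ) ^ k • x) = u := by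
        rw [map_zsmul, map_smul, LinearMap.smul_apply, hu, zsmul_eq_mul, smul_eq_mul]
        push_cast
        field_simp
      rw [← h1, hg', map_zsmul, hj, zsmul_eq_mul]))
    (dvd_of_cast_eq (k := p * (p ^ (2 * k) * c)) (by
      rw [latForm_apply]
      simp only [map_zsmul, LinearMap.smul_apply, zsmul_eq_mul, hc]
      push_cast
      ring))
    ((dvd_pow_self _ hk.ne').trans (dvd_of_cast_eq (k := i₀) (by
      rw [latForm_apply]
      simp only [map_zsmul, zsmul_eq_mul, hi₀])))
    (fun h => by
      obtain ⟨j, hj⟩ := h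
      have h1 := latForm_apply hL ⟨_, ha⟩ ⟨_, ha⟩
      rw [hj] at h1
      simp only [map_sub, map_zsmul, LinearMap.sub_apply, LinearMap.smul_apply, zsmul_eq_mul, hc,
        hc', hw, hB x' x] at h1
      refine (hpp.dvd_or_dvd (dvd_of_cast_eq (c := 2 * l * w) (k := -j + l ^ 2 * p * c' + p * c)
        ?_)).elim (fun h => (hpp.dvd_or_dvd h).elim (not_dvd_two hp hp2) hpl) hpw
      push_cast at h1 ⊢
      linear_combination h1)
  obtain ⟨σ, hσ, hσγ⟩ := exists_isometry_extension hL.span γ (fun x y => by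
    rw [← latForm_apply hL, hγ, latForm_apply])
  have hσL : ∀ v, σ v ∈ L ↔ v ∈ L := fun v => by
    constructor
    · intro hv
      have h1 := hσγ (γ.symm ⟨σ v, hv⟩)
      rw [γ.apply_symm_apply] at h1
      rw [← σ.injective h1]
      exact (γ.symm ⟨σ v, hv⟩).2
    · intro hv
      rw [hσγ ⟨v, hv⟩]
      exact (γ ⟨v, hv⟩).2
  have hnbL : nb B ((p : ℤ) ^ k) L ((p : ℤ) ^ k • x) = M :=
    nb_nb hM hpk0 he hx hB ((hpp.coprime_iff_not_dvd.2 hpu).pow_left) hu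
  have hff : B ((p : ℤ) ^ k • x) ((p : ℤ) ^ k • x) = ((p ^ k : ℤ) : ℚ) ^ 2 * ((p ^ 2 * c : ℤ) : ℚ) := by
    simp only [map_zsmul, LinearMap.smul_apply, zsmul_eq_mul, hc]
    push_cast
    ring
  have hσM : ∀ v, σ v ∈ M ↔ v ∈ M := by
    obtain ⟨z, hz⟩ := hγ1 ⟨_, hf⟩
    have h1 : σ ((p : ℤ) ^ k • x) = (1 : ℤ) • ((p : ℤ) ^ k • x) + (p : ℤ) ^ k • (z : V) := by
      rw [one_smul, hσγ ⟨_, hf⟩, hz]; rfl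
    have h2 := nb_congr hB hL hpk0 hcop2.pow_left hf z.2 isCoprime_one_right h1 hff
      (by rw [hσ, hff])
    intro v
    have h4 := nb_map (m := (p : ℤ) ^ k) (x := (p : ℤ) ^ k • x) hσ hσL v
    rwa [h2, hnbL] at h4
  have hσx : σ x = l • x' + (p : ℤ) • (q : V) := by
    refine zsmul_cancel hpk0 ?_
    have h1 : σ ((p : ℤ) ^ k • x) = (p : ℤ) ^ k • x + (p : ℤ) ^ k • (l • x' - x) +
        (p : ℤ) ^ (k + 1) • (q : V) := by
      rw [hσγ ⟨_, hf⟩, hq]; rfl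
    rw [← map_zsmul, h1, pow_succ]
    module
  have hqM : (q : V) ∈ M := by
    obtain ⟨y, hy, t, j, hj, hqy⟩ := q.2
    obtain ⟨i, hi⟩ := hM.int _ hx' _ hy
    obtain ⟨s, hs⟩ := hL.int _ q.2 _ q.2
    have h1 : B x' q = i + t * u' / p ^ k := by
      rw [hqy, map_add, map_smul, hi, hB x' e, hu']
      push_cast
      rw [smul_eq_mul]
      ring
    have h2 := hσ x x
    rw [hσx] at h2
    simp only [map_add, map_zsmul, LinearMap.add_apply, LinearMap.smul_apply, zsmul_eq_mul, hB _ x',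
      hs, h1, hc, hc'] at h2
    have ht : (p : ℤ) ^ k ∣ t := by
      have hcop : IsCoprime ((p : ℤ) ^ k) (2 * l * u') :=
        (((hcop2).mul_right (hpp.coprime_iff_not_dvd.2 hpl)).mul_right
          (hpp.coprime_iff_not_dvd.2 hpu')).pow_left
      refine hcop.dvd_of_dvd_mul_left (dvd_of_cast_eq
        (k := p * c - p * l ^ 2 * c' - 2 * l * i - p * s) ?_)
      push_cast at h2 ⊢
      field_simp at h2
      linear_combination h2
    obtain ⟨t, rfl⟩ := ht
    rw [hqy, Int.cast_mul, mul_div_cancel_left₀ _ (by exact_mod_cast hpk0), Int.cast_smul_eq_zsmul]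
    exact M.add_mem hy (M.smul_mem _ he)
  have hσc : B (σ x) (σ x) = ((p : ℤ) : ℚ) ^ 2 * c := by rw [hσ, hc]
  refine ⟨σ, hσ, fun v => ?_⟩
  have h := nb_map (m := p) (x := x) hσ hσM v
  rwa [nb_congr hB hM hp0 hcop2 hx' hqM (hpp.coprime_iff_not_dvd.2 hpl) hσx hc' hσc] at h

/-- `x / p` defines a `p`-neighbour of `M`. -/
structure IsNbVec (B : V →ₗ[ℚ] V →ₗ[ℚ] ℚ) (p : ℕ) (M : Submodule ℤ V) (x : V) : Prop where
  mem : x ∈ M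
  sq : ∃ c : ℤ, B x x = ((p : ℤ) : ℚ) ^ 2 * c
  pairing : ∃ y ∈ M, ∃ u : ℤ, B x y = u ∧ ¬ (p : ℤ) ∣ u

/-- Nondegenerate indefinite rational quadratic spaces of dimension at least three. -/
structure IsIndefSpace (B : V →ₗ[ℚ] V →ₗ[ℚ] ℚ) : Prop where
  symm : ∀ x y, B x y = B y x
  nondeg : ∀ x, (∀ y, B x y = 0) → x = 0
  pos : ∃ x, 0 < B x x
  neg : ∃ x, B x x < 0
  rank : 2 < Module.finrank ℚ V

theorem IsNbVec.isLat {x : V} (hB : ∀ x y, B x y = B y x) (hM : IsLat B d M) (hp : p.Prime)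
    (hx : IsNbVec B p M x) : IsLat B d (nb B p M x) := by
  obtain ⟨c, hc⟩ := hx.sq
  obtain ⟨y, hy, u, hu, hpu⟩ := hx.pairing
  have hpp := Nat.prime_iff_prime_int.1 hp
  obtain ⟨y₀, hy₀, c₀, hc₀⟩ := exists_pairing_one_add (hpp.coprime_iff_not_dvd.2 hpu) hy hu
  exact isLat_nb hB hM hpp.ne_zero hx.mem hc hy₀ hc₀

theorem IsLat.finrank_eq [FiniteDimensional ℚ V] (hM : IsLat B d M) :
    Module.finrank ℤ M = Module.finrank ℚ V := by
  have := hM.moduleFinite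
  exact finrank_eq_of_full hM.span

theorem IsLat.exists_pairing_not_dvd [FiniteDimensional ℚ V] (hV : IsIndefSpace B)
    (hM : IsLat B d M) (hp : p.Prime) (hpd : ¬ (p : ℤ) ∣ d) {x : V} (hx : x ∈ M)
    (hxp : ∀ g ∈ M, x ≠ (p : ℤ) • g) : ∃ y ∈ M, ∃ u : ℤ, B x y = u ∧ ¬ (p : ℤ) ∣ u := by
  have := hM.moduleFinite
  have := hM.moduleFree
  obtain ⟨φ, hφ⟩ := exists_functional_not_dvd (p := p) (f := (⟨x, hx⟩ : M))
    fun g h => hxp g g.2 (congrArg Subtype.val h)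
  obtain ⟨y, hy⟩ := latForm_dualBound hM hV.nondeg φ
  refine ⟨y, y.2, _, (latForm_apply hM ⟨x, hx⟩ y).symm, ?_⟩
  rw [latForm_symm hM hV.symm, hy]
  exact fun h => ((Nat.prime_iff_prime_int.1 hp).dvd_or_dvd h).elim hpd hφ

theorem latIso_nb_of_not_dvd [FiniteDimensional ℚ V] (hV : IsIndefSpace B) (hM : IsLat B d M)
    (hd : d ≠ 0) (hp : p.Prime) (hp2 : p ≠ 2) (hpd : ¬ (p : ℤ) ∣ d) {x x' : V} {w : ℤ}
    (hx : IsNbVec B p M x) (hx' : IsNbVec B p M x') (hw : B x x' = w) (hpw : ¬ (p : ℤ) ∣ w) :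
    LatIso B (nb B p M x) (nb B p M x') := by
  have := hM.moduleFinite
  have := hM.moduleFree
  have hpp := Nat.prime_iff_prime_int.1 hp
  have hr := residualRankGT_of_not_dvd (latForm_symm hM hV.symm)
    (latForm_dualBound hM hV.nondeg) hpd (hV.rank.trans_eq hM.finrank_eq.symm)
  obtain ⟨k, hk, hgood⟩ := exists_uniform_goodAt (Module.finrank ℚ V) hd hp hp2 hpd
  obtain ⟨c, hc⟩ := hx.sq
  obtain ⟨c', hc'⟩ := hx'.sq
  have hsq : ∀ {x : V} (hx : x ∈ M) {c : ℤ}, B x x = ((p : ℤ) : ℚ) ^ 2 * c →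
      (p : ℤ) ∣ latForm hM ⟨x, hx⟩ ⟨x, hx⟩ := fun hx c hc =>
    dvd_of_cast_eq (k := p * c) (by rw [latForm_apply, hc]; push_cast; ring)
  have hcast : ∀ v v' : M, B v v' = latForm hM v v' := fun v v' => (latForm_apply hM v v').symm
  obtain ⟨e, ⟨s, hs⟩, he, he'⟩ := hr.exists_isotropic_pairing (latForm_symm hM hV.symm) hp hp2
    (hsq hx.mem hc) (hsq hx'.mem hc')
    (fun h => hpw (by
      obtain ⟨j, hj⟩ := h
      exact dvd_of_cast_eq (k := j) (by
        rw [← hw, ← Int.cast_mul, ← hj, latForm_apply]))) (2 * k)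
  obtain ⟨y₀, hy₀, c₀, hc₀⟩ := exists_pairing_one_add
    ((hpp.coprime_iff_not_dvd.2 he).pow_left (m := k)) hx.mem (hcast e ⟨x, hx.mem⟩)
  have hL := isLat_nb (m := (p : ℤ) ^ k) hV.symm hM (pow_ne_zero _ hpp.ne_zero) e.2 (c := s)
    (by rw [hcast, hs]; push_cast; ring) hy₀ hc₀
  have := hL.moduleFinite
  have := hL.moduleFree
  exact latIso_nb_of_goodAt hV.symm hM hp hp2 hx.mem hx'.mem e.2 hc hc' (hcast e ⟨x, hx.mem⟩)
    (hcast e ⟨x', hx'.mem⟩) hw he he' hpw hk hL (hgood _ _ hL.finrank_eq (latForm_symm hL hV.symm)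
      (latForm_dualBound hL hV.nondeg) (latForm_exists_pos hL hV.pos)
      (latForm_exists_neg hL hV.neg))

/-- Any two `p`-neighbours of an indefinite lattice are isometric. -/
theorem latIso_nb [FiniteDimensional ℚ V] (hV : IsIndefSpace B) (hM : IsLat B d M)
    (hd : d ≠ 0) (hp : p.Prime) (hp2 : p ≠ 2) (hpd : ¬ (p : ℤ) ∣ d) {x x' : V}
    (hx : IsNbVec B p M x) (hx' : IsNbVec B p M x') : LatIso B (nb B p M x) (nb B p M x') := by
  obtain ⟨w, hw⟩ := hM.int _ hx.mem _ hx'.mem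
  by_cases hpw : (p : ℤ) ∣ w
  swap
  · exact latIso_nb_of_not_dvd hV hM hd hp hp2 hpd hx hx' hw hpw
  obtain ⟨c, hc⟩ := hx.sq
  obtain ⟨y, hy, u, hu, hpu⟩ := hx.pairing
  obtain ⟨y', hy', u', hu', hpu'⟩ := hx'.pairing
  have hcast : ∀ v v' : M, B v v' = latForm hM v v' := fun v v' => (latForm_apply hM v v').symm
  have hdvd : ∀ {v v' : M} {i : ℤ}, B v v' = i → latForm hM v v' = i := fun {v v' i} h =>
    Int.cast_injective (α := ℚ) (by rw [latForm_apply, h])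
  obtain ⟨e, ⟨s, hs⟩, he, he'⟩ := exists_isotropic_intermediate (b := latForm hM)
    (x := ⟨x, hx.mem⟩) (x' := ⟨x', hx'.mem⟩) (y := ⟨y, hy⟩) (y' := ⟨y', hy'⟩)
    (latForm_symm hM hV.symm) hp hp2 (by
      rw [hdvd (i := p ^ 2 * c) (by rw [hc]; push_cast; ring)]
      exact (dvd_pow_self _ two_ne_zero).mul_right _) (by rwa [hdvd hw]) (by rwa [hdvd hu])
    (by rwa [hdvd hu']) 2
  have hev : IsNbVec B p M e := ⟨e.2, ⟨s, by rw [hcast, hs]; push_cast; ring⟩,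
    x, hx.mem, _, hcast e ⟨x, hx.mem⟩, by rwa [latForm_symm hM hV.symm]⟩
  exact (latIso_nb_of_not_dvd hV hM hd hp hp2 hpd hx hev (hcast ⟨x, hx.mem⟩ e) he).trans
    (latIso_nb_of_not_dvd hV hM hd hp hp2 hpd hx' hev (hcast ⟨x', hx'.mem⟩ e) he').symm

end Neighbours

set_option linter.unusedSectionVars false

section NeighbourRelation
variable {V : Type} [AddCommGroup V] [Module ℚ V] {B : V →ₗ[ℚ] V →ₗ[ℚ] ℚ} {d : ℤ}
  {M M' K K' : Submodule ℤ V} {p : ℕ}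

/-- `M'` is a `p`-neighbour of `M`. -/
def IsNb (B : V →ₗ[ℚ] V →ₗ[ℚ] ℚ) (p : ℕ) (M M' : Submodule ℤ V) : Prop :=
  ∃ x, IsNbVec B p M x ∧ nb B p M x = M'

theorem IsNb.isLat (hB : ∀ x y, B x y = B y x) (hM : IsLat B d M) (hp : p.Prime)
    (h : IsNb B p M M') : IsLat B d M' := by
  obtain ⟨x, hx, rfl⟩ := h
  exact hx.isLat hB hM hp

theorem IsNb.zsmul_mem (hM : IsLat B d M) (h : IsNb B p M M') {y : V} (hy : y ∈ M) :
    (p : ℤ) • y ∈ M' := by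
  obtain ⟨x, hx, rfl⟩ := h
  exact zsmul_mem_nb hM hx.mem hy

theorem IsNb.zsmul_mem_of_mem (hp : p.Prime) (h : IsNb B p M M') {y : V} (hy : y ∈ M') :
    (p : ℤ) • y ∈ M := by
  obtain ⟨x, hx, rfl⟩ := h
  exact zsmul_mem_of_mem_nb (by exact_mod_cast hp.ne_zero) hx.mem hy

theorem IsNb.symm (hB : ∀ x y, B x y = B y x) (hM : IsLat B d M) (hp : p.Prime)
    (h : IsNb B p M M') : IsNb B p M' M := by
  obtain ⟨x, hx, rfl⟩ := h
  obtain ⟨y, hy, u, hu, hpu⟩ := hx.pairing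
  have hpp := Nat.prime_iff_prime_int.1 hp
  have hp0 : ((p : ℤ) : ℚ) ≠ 0 := Int.cast_ne_zero.2 hpp.ne_zero
  obtain ⟨k, hk⟩ := hM.int y hy y hy
  refine ⟨(p : ℤ) • y, ⟨zsmul_mem_nb hM hx.mem hy, ⟨k, ?_⟩, ((1 : ℤ) / (p : ℤ) : ℚ) • x,
    div_smul_mem_nb 1, u, ?_, hpu⟩, nb_nb hM hpp.ne_zero hx.mem hy hB
      (hpp.coprime_iff_not_dvd.2 hpu) hu⟩
  · simp only [map_zsmul, LinearMap.smul_apply, zsmul_eq_mul, hk]; ring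
  · simp only [map_zsmul, map_smul, LinearMap.smul_apply, zsmul_eq_mul, smul_eq_mul, hB y x, hu]
    field_simp
    simp

theorem IsNb.map {σ : V ≃ₗ[ℚ] V} (h1 : ∀ x y, B (σ x) (σ y) = B x y)
    (h2 : ∀ x, σ x ∈ M' ↔ x ∈ M) {x : V} (h : IsNbVec B p M x) : IsNbVec B p M' (σ x) := by
  obtain ⟨y, hy, u, hu, hpu⟩ := h.pairing
  exact ⟨(h2 x).2 h.mem, by rw [h1]; exact h.sq, σ y, (h2 y).2 hy, u, by rw [h1, hu], hpu⟩

theorem IsNb.latIso [FiniteDimensional ℚ V] (hV : IsIndefSpace B) (hM' : IsLat B d M')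
    (hd : d ≠ 0) (hp : p.Prime) (hp2 : p ≠ 2) (hpd : ¬ (p : ℤ) ∣ d) (h : IsNb B p M K)
    (h' : IsNb B p M' K') (hMM' : LatIso B M M') : LatIso B K K' := by
  obtain ⟨x, hx, rfl⟩ := h
  obtain ⟨x', hx', rfl⟩ := h'
  obtain ⟨σ, h1, h2⟩ := hMM'
  exact .trans ⟨σ, h1, nb_map h1 h2⟩ (latIso_nb hV hM' hd hp hp2 hpd (IsNb.map h1 h2 hx) hx')

/-- The quotient `M' / (M ∩ M')` is cyclic of order `m`, and `M / (M ∩ M')` has exponent prime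
to `d`. -/
def IsCyclicOver (d m : ℤ) (M M' : Submodule ℤ V) : Prop :=
  (∃ N : ℤ, IsCoprime N d ∧ ∀ x ∈ M, N • x ∈ M') ∧
    ∃ x ∈ M', (∀ z ∈ M', ∃ t : ℤ, z - t • x ∈ M) ∧ ∀ t : ℤ, t • x ∈ M ↔ m ∣ t

theorem IsCyclicOver.eq_of_one (hM : IsLat B d M) (hM' : IsLat B d M')
    (h : IsCyclicOver d 1 M M') : M = M' := by
  obtain ⟨⟨N, hN, hNM⟩, x, -, hx, hx1⟩ := h
  have hle : M' ≤ M := fun z hz => by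
    obtain ⟨t, ht⟩ := hx z hz
    simpa using M.add_mem ht ((hx1 t).2 (one_dvd t))
  refine le_antisymm (fun y hy => ?_) hle
  obtain ⟨a, c, hac⟩ := hN
  have h1 := hM'.dual y fun z hz => hM.int y hy z (hle hz)
  have h2 := M'.add_mem (M'.smul_mem a (hNM y hy)) (M'.smul_mem c h1)
  rwa [smul_smul, smul_smul, ← add_smul, hac, one_smul] at h2

theorem IsCyclicOver.of_isUnit_mul {m u : ℤ} (hu : IsUnit u) (h : IsCyclicOver d (u * m) M M') :
    IsCyclicOver d m M M' := by
  obtain ⟨h1, x, hx, hx1, hx2⟩ := h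
  exact ⟨h1, x, hx, hx1, fun t => by rw [hx2, hu.mul_left_dvd]⟩

theorem IsCyclicOver.exists_isNb [FiniteDimensional ℚ V] (hV : IsIndefSpace B)
    (hM : IsLat B d M) (hM' : IsLat B d M') (hp : p.Prime) (hpd : ¬ (p : ℤ) ∣ d) {m : ℤ}
    (hm : m ≠ 0) (h : IsCyclicOver d (p * m) M M') :
    ∃ M₁, IsNb B p M M₁ ∧ IsCyclicOver d m M₁ M' := by
  obtain ⟨⟨N, hN, hNM⟩, x, hx, hx1, hx2⟩ := h
  have hpp := Nat.prime_iff_prime_int.1 hp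
  have hp0 : (p : ℚ) ≠ 0 := by exact_mod_cast hp.ne_zero
  have hf : ((p : ℤ) * m) • x ∈ M := (hx2 _).2 dvd_rfl
  obtain ⟨k, hk⟩ := hM'.int x hx x hx
  have hv : IsNbVec B p M (((p : ℤ) * m) • x) := by
    refine ⟨hf, ⟨m ^ 2 * k, ?_⟩, hM.exists_pairing_not_dvd hV hp hpd hf fun g hg h => ?_⟩
    · simp only [map_zsmul, LinearMap.smul_apply, zsmul_eq_mul, hk]
      push_cast
      ring
    · rw [mul_smul] at h
      rw [← zsmul_cancel hpp.ne_zero h, hx2] at hg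
      have h1 : (p : ℤ) * m ∣ 1 * m := by rwa [one_mul]
      exact hpp.not_dvd_one ((mul_dvd_mul_iff_right hm).1 h1)
  refine ⟨_, ⟨_, hv, rfl⟩, ⟨p * N, (hpp.coprime_iff_not_dvd.2 hpd).mul_left hN, fun y hy => ?_⟩, x,
    hx, fun z hz => ?_, fun t => ⟨fun ht => ?_, ?_⟩⟩
  · rw [mul_comm, mul_smul]
    exact hNM _ (zsmul_mem_of_mem_nb hpp.ne_zero hf hy)
  · obtain ⟨t, ht⟩ := hx1 z hz
    obtain ⟨j, hj⟩ := hM'.int x hx _ (M'.sub_mem hz (M'.smul_mem t hx))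
    refine ⟨t, mem_nb_of_mem ht (k := m * j) ?_⟩
    simp only [map_zsmul, LinearMap.smul_apply, zsmul_eq_mul, hj]
    push_cast
    ring
  · have h1 := zsmul_mem_of_mem_nb hpp.ne_zero hf ht
    rw [smul_smul, hx2] at h1
    exact (mul_dvd_mul_iff_left hpp.ne_zero).1 h1
  · rintro ⟨t, rfl⟩
    have := div_smul_mem_nb (B := B) (m := (p : ℤ)) (M := M) (x := ((p : ℤ) * m) • x) t
    convert this using 1
    rw [← Int.cast_smul_eq_zsmul ℚ, ← Int.cast_smul_eq_zsmul ℚ, smul_smul]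
    congr 1
    push_cast
    field_simp

theorem IsCyclicOver.latIso [FiniteDimensional ℚ V] (hV : IsIndefSpace B) (hd : d ≠ 0) {t : ℤ}
    (ht0 : t ≠ 0) (ht : IsCoprime t (2 * d)) (hM : IsLat B d M) (hM' : IsLat B d M')
    (h : IsCyclicOver d (t ^ 2) M M') : LatIso B M M' := by
  induction hn : t.natAbs using Nat.strong_induction_on generalizing t M with
  | _ n ih =>
    by_cases h1 : t.natAbs = 1
    · have : t ^ 2 = 1 := by rw [← Int.natAbs_sq, h1]; norm_num
      rw [this] at h
      rw [h.eq_of_one hM hM']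
      exact .refl _
    obtain ⟨p, hp, hpt⟩ := Nat.exists_prime_and_dvd h1
    obtain ⟨s, rfl⟩ : (p : ℤ) ∣ t := Int.natCast_dvd.2 hpt
    have hpp := Nat.prime_iff_prime_int.1 hp
    have hs0 : s ≠ 0 := right_ne_zero_of_mul ht0
    have hp2d := hpp.coprime_iff_not_dvd.1 ht.of_mul_left_left
    have hp2 : p ≠ 2 := fun h => hp2d (h ▸ dvd_mul_right _ _)
    have hpd : ¬ (p : ℤ) ∣ d := fun h => hp2d (h.mul_left _)
    rw [show ((p : ℤ) * s) ^ 2 = p * (p * s ^ 2) by ring] at h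
    obtain ⟨M₁, h1, h2⟩ := h.exists_isNb hV hM hM' hp hpd (mul_ne_zero hpp.ne_zero
      (pow_ne_zero _ hs0))
    have hM₁ := h1.isLat hV.symm hM hp
    obtain ⟨M₂, h3, h4⟩ := h2.exists_isNb hV hM₁ hM' hp hpd (pow_ne_zero _ hs0)
    refine ((h1.symm hV.symm hM hp).latIso hV hM₁ hd hp hp2 hpd h3 (.refl _)).trans
      (ih s.natAbs ?_ hs0 ht.of_mul_left_right (h3.isLat hV.symm hM₁ hp) h4 rfl)
    rw [← hn, Int.natAbs_mul, Int.natAbs_natCast]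
    exact lt_mul_of_one_lt_left (Int.natAbs_pos.2 hs0) hp.one_lt

/-- The reflection in a vector `w ∈ M` of norm `m` prime to `2 * d`. -/
theorem exists_isCyclicOver_of_norm (hB : ∀ x y, B x y = B y x) (hM : IsLat B d M) {m : ℤ}
    (hm : m ≠ 0) (hmd : IsCoprime m (2 * d)) {w y₀ : V} (hw : w ∈ M) (hy₀ : y₀ ∈ M)
    (hwm : B w w = m) (hwy : B w y₀ = d) :
    ∃ M', LatIso B M M' ∧ IsLat B d M' ∧ IsCyclicOver d m M M' := by
  have hm' : (m : ℚ) ≠ 0 := Int.cast_ne_zero.2 hm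
  have h2 : ((2 / m : ℚ) • B w) w = 2 := by
    rw [LinearMap.smul_apply, hwm, smul_eq_mul, div_mul_cancel₀ _ hm']
  let σ : V ≃ₗ[ℚ] V := Module.reflection h2
  have hσ : ∀ y, σ y = y - (2 * B w y / m) • w := fun y => by
    change Module.reflection h2 y = _
    rw [Module.reflection_apply, LinearMap.smul_apply, smul_eq_mul, div_mul_eq_mul_div]
  have hσσ : ∀ y, σ (σ y) = y := Module.involutive_reflection h2
  have hσB : ∀ x y, B (σ x) (σ y) = B x y := fun x y => by
    simp only [hσ, map_sub, map_smul, LinearMap.sub_apply, LinearMap.smul_apply, smul_eq_mul, hwm,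
      hB x w]
    field_simp
    ring
  have hd : IsCoprime m d := hmd.of_mul_right_right
  refine ⟨M.comap (σ.toLinearMap.restrictScalars ℤ), ⟨σ, hσB, fun x => ?_⟩, ⟨?_, fun x => ?_,
    fun x hx y hy => ?_, fun x hx => ?_⟩, ⟨m, hd, fun x hx => ?_⟩, σ y₀, ?_, fun z hz => ?_,
    fun t => ?_⟩
  · change σ (σ x) ∈ M ↔ _
    rw [hσσ]
  · have : M.comap (σ.toLinearMap.restrictScalars ℤ) =
        M.map (σ.toLinearMap.restrictScalars ℤ) := by
      ext x
      refine ⟨fun hx => ⟨σ x, hx, hσσ x⟩, ?_⟩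
      rintro ⟨y, hy, rfl⟩
      change σ (σ y) ∈ M
      rwa [hσσ]
    rw [this]
    exact hM.fg.map _
  · obtain ⟨n, hn, hnx⟩ := hM.span (σ x)
    exact ⟨n, hn, by change σ (n • x) ∈ M; rwa [map_zsmul]⟩
  · rw [← hσB]; exact hM.int _ hx _ hy
  · change σ (d • x) ∈ M
    rw [map_zsmul]
    refine hM.dual _ fun y hy => ?_
    rw [← hσσ y, hσB]
    exact hx _ (by change σ (σ y) ∈ M; rwa [hσσ])
  · obtain ⟨i, hi⟩ := hM.int w hw x hx
    change σ (m • x) ∈ M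
    rw [map_zsmul, hσ, hi]
    have : m • (x - (2 * (i : ℚ) / m) • w) = m • x - (2 * i) • w := by
      rw [← Int.cast_smul_eq_zsmul ℚ, ← Int.cast_smul_eq_zsmul ℚ, ← Int.cast_smul_eq_zsmul ℚ]
      push_cast
      match_scalars <;> field_simp
    rw [this]
    exact M.sub_mem (M.smul_mem _ hx) (M.smul_mem _ hw)
  · change σ (σ y₀) ∈ M
    rwa [hσσ]
  · have hz' : σ z ∈ M := hz
    obtain ⟨i, hi⟩ := hM.int w hw _ hz'
    obtain ⟨a, c, hac⟩ := hd
    refine ⟨i * c, ?_⟩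
    have : z - (i * c) • σ y₀ = (σ z - (i * c) • y₀) - (2 * (i * a)) • w := by
      rw [← hσσ z]
      generalize σ z = z' at hi
      rw [hσσ, hσ, hσ, hi, hwy]
      simp only [← Int.cast_smul_eq_zsmul ℚ]
      push_cast
      have hac' : (a * m + c * d : ℚ) = 1 := by exact_mod_cast hac
      match_scalars
      · ring
      · field_simp
        linear_combination (i : ℚ) * hac'
      · ring
    rw [this]
    exact M.sub_mem (M.sub_mem hz' (M.smul_mem _ hy₀)) (M.smul_mem _ hw)
  · have : t • σ y₀ = t • y₀ - (2 * d * t / m : ℚ) • w := by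
      rw [hσ, hwy, ← Int.cast_smul_eq_zsmul ℚ, ← Int.cast_smul_eq_zsmul ℚ]
      match_scalars <;> ring
    rw [this, M.sub_mem_iff_right (M.smul_mem _ hy₀)]
    constructor
    · intro h
      obtain ⟨k, hk⟩ := hM.int _ h _ hy₀
      rw [map_smul, LinearMap.smul_apply, hwy, smul_eq_mul] at hk
      have h3 : m ∣ (2 * d * d) * t := dvd_of_cast_eq (k := k) (by
        push_cast
        rw [← hk]
        field_simp)
      exact (hmd.mul_right hd).dvd_of_dvd_mul_left h3
    · rintro ⟨t, rfl⟩
      have : (2 * d * ((m * t : ℤ) : ℚ) / m : ℚ) • w = (2 * d * t) • w := by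
        rw [← Int.cast_smul_eq_zsmul ℚ]
        push_cast
        congr 1
        field_simp
      rw [this]
      exact M.smul_mem _ hw

theorem dvd_of_sq_dvd_mul_sq {g m s : ℤ} (hm : Squarefree m) (hg : g ≠ 0) (h : g ^ 2 ∣ m * s ^ 2) :
    g ∣ s := by
  obtain ⟨g', s', h1, h2, h3⟩ := extract_gcd g s
  have hc : IsCoprime g' s' := (gcd_isUnit_iff _ _).1 h3
  have h0 : gcd g s ≠ 0 := fun h => hg ((gcd_eq_zero_iff _ _).1 h).1
  generalize gcd g s = a at h0 h1 h2
  subst h1 h2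
  rw [mul_pow, mul_pow, mul_left_comm, mul_dvd_mul_iff_left (pow_ne_zero _ h0)] at h
  exact mul_dvd_mul_left a (hm g' (by rw [← sq]; exact hc.pow.dvd_of_dvd_mul_right h)).dvd

theorem exists_isCyclicOver_of_norm_mul_sq [FiniteDimensional ℚ V] (hV : IsIndefSpace B)
    (hM : IsLat B d M) {ε m s : ℤ} (hε : IsUnit ε) (hm : Squarefree m) (hmd : IsCoprime m (2 * d))
    (hs : s ≠ 0) (hsd : IsCoprime s (2 * d)) {v : V} (hv : v ∈ M)
    (hvm : B v v = (ε * m * s ^ 2 : ℤ)) :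
    ∃ t M', t ≠ 0 ∧ IsCoprime t (2 * d) ∧ LatIso B M M' ∧ IsLat B d M' ∧
      IsCyclicOver d (m * t ^ 2) M M' := by
  have := hM.moduleFinite
  have := hM.moduleFree
  have hm' : Squarefree (ε * m) := fun a ha => hm a (hε.dvd_mul_left.1 ha)
  have hvm' : latForm hM ⟨v, hv⟩ ⟨v, hv⟩ = ε * m * s ^ 2 :=
    Int.cast_injective (α := ℚ) (by rw [latForm_apply, hvm])
  have hv0 : (⟨v, hv⟩ : M) ≠ 0 := fun h => by
    rw [h, map_zero, eq_comm] at hvm'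
    exact mul_ne_zero hm'.ne_zero (pow_ne_zero 2 hs) hvm'
  obtain ⟨g, w, φ, hgw, hφ⟩ := exists_primitive_part hv0
  obtain ⟨y, hy⟩ := latForm_dualBound hM hV.nondeg φ
  rw [hgw] at hvm'
  simp only [map_smul, LinearMap.smul_apply, smul_eq_mul] at hvm'
  have hg0 : g ≠ 0 := by
    rintro rfl
    rw [zero_mul, eq_comm] at hvm'
    exact mul_ne_zero hm'.ne_zero (pow_ne_zero 2 hs) hvm'
  obtain ⟨t, rfl⟩ := dvd_of_sq_dvd_mul_sq hm' hg0 ⟨latForm hM w w, by rw [← hvm']; ring⟩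
  have htd := hsd.of_mul_left_right
  have ht0 := right_ne_zero_of_mul hs
  have hw : latForm hM w w = ε * m * t ^ 2 := by
    refine mul_left_cancel₀ (pow_ne_zero 2 hg0) ?_
    linear_combination hvm'
  obtain ⟨M', h1, h2, h3⟩ := exists_isCyclicOver_of_norm hV.symm hM
    (mul_ne_zero hm'.ne_zero (pow_ne_zero 2 ht0))
    (((isCoprime_mul_unit_left_left hε _ _).2 hmd).mul_left htd.pow_left) w.2 y.2
    (by rw [← latForm_apply hM, hw]) (by
      rw [hV.symm, ← latForm_apply hM, hy, hφ, mul_one])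
  rw [mul_assoc] at h3
  exact ⟨t, M', ht0, htd, h1, h2, h3.of_isUnit_mul hε⟩

/-- An `r`-neighbour of a lattice containing a vector of norm `± r s²` is isometric to it. -/
theorem latIso_of_isNb_of_norm [FiniteDimensional ℚ V] (hV : IsIndefSpace B) (hd : d ≠ 0)
    (hM : IsLat B d M) {r : ℕ} (hr : r.Prime) (hr2 : r ≠ 2) (hrd : ¬ (r : ℤ) ∣ d) {ε s : ℤ}
    (hε : IsUnit ε) (hs : s ≠ 0) (hsd : IsCoprime s (2 * d)) {v : V} (hv : v ∈ M)
    (hvm : B v v = (ε * r * s ^ 2 : ℤ)) (h : IsNb B r M K) : LatIso B M K := by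
  have hrr := Nat.prime_iff_prime_int.1 hr
  have hr2d : IsCoprime (r : ℤ) (2 * d) := (hrr.coprime_iff_not_dvd.2 (not_dvd_two hr hr2)).mul_right
    (hrr.coprime_iff_not_dvd.2 hrd)
  obtain ⟨t, M', ht, htd, h1, h2, h3⟩ := exists_isCyclicOver_of_norm_mul_sq hV hM hε
    hrr.squarefree hr2d hs hsd hv hvm
  obtain ⟨M₁, h4, h5⟩ := h3.exists_isNb hV hM h2 hr hrd (pow_ne_zero 2 ht)
  exact (h1.trans (h5.latIso hV hd ht htd (h4.isLat hV.symm hM hr) h2).symm).trans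
    (h4.latIso hV hM hd hr hr2 hrd h (.refl _))

/-- A `q`-neighbour of a lattice containing vectors of norms `± r s²` and `± q r s'²` is isometric
to it. -/
theorem latIso_of_isNb_of_norms [FiniteDimensional ℚ V] (hV : IsIndefSpace B) (hd : d ≠ 0)
    (hM : IsLat B d M) {q r : ℕ} (hq : q.Prime) (hq2 : q ≠ 2) (hqd : ¬ (q : ℤ) ∣ d)
    (hr : r.Prime) (hr2 : r ≠ 2) (hrd : ¬ (r : ℤ) ∣ d) (hqr : r ≠ q) {ε s ε' s' : ℤ}
    (hε : IsUnit ε) (hs : s ≠ 0) (hsd : IsCoprime s (2 * d))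
    (hε' : IsUnit ε') (hs' : s' ≠ 0) (hsd' : IsCoprime s' (2 * d)) {v v' : V} (hv : v ∈ M)
    (hvm : B v v = (ε * r * s ^ 2 : ℤ)) (hv' : v' ∈ M)
    (hvm' : B v' v' = (ε' * (q * r) * s' ^ 2 : ℤ)) (h : IsNb B q M K) : LatIso B M K := by
  have hqq := Nat.prime_iff_prime_int.1 hq
  have hrr := Nat.prime_iff_prime_int.1 hr
  have hq2d : IsCoprime (q : ℤ) (2 * d) := (hqq.coprime_iff_not_dvd.2 (not_dvd_two hq hq2)).mul_right
    (hqq.coprime_iff_not_dvd.2 hqd)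
  have hr2d : IsCoprime (r : ℤ) (2 * d) := (hrr.coprime_iff_not_dvd.2 (not_dvd_two hr hr2)).mul_right
    (hrr.coprime_iff_not_dvd.2 hrd)
  have hqr' : IsCoprime (q : ℤ) r := (Nat.coprime_primes hq hr).2 hqr.symm |>.isCoprime
  obtain ⟨t, M', ht, htd, h1, h2, h3⟩ := exists_isCyclicOver_of_norm_mul_sq hV hM hε'
    ((squarefree_mul_iff.2 ⟨hqr'.isRelPrime, hqq.squarefree, hrr.squarefree⟩)) (hq2d.mul_left hr2d)
    hs' hsd' hv' hvm'
  rw [mul_assoc] at h3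
  obtain ⟨M₁, h4, h5⟩ := h3.exists_isNb hV hM h2 hq hqd (mul_ne_zero hrr.ne_zero (pow_ne_zero 2 ht))
  have hM₁ := h4.isLat hV.symm hM hq
  obtain ⟨M₂, h6, h7⟩ := h5.exists_isNb hV hM₁ h2 hr hrd (pow_ne_zero 2 ht)
  have h8 : LatIso B M₁ M₂ := latIso_of_isNb_of_norm hV hd hM₁ hr hr2 hrd hε
    (mul_ne_zero hqq.ne_zero hs) (hq2d.mul_left hsd) (h4.zsmul_mem hM hv) (by
      simp only [map_zsmul, LinearMap.smul_apply, zsmul_eq_mul, hvm]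
      push_cast
      ring) h6
  exact ((h1.trans (h7.latIso hV hd ht htd (h6.isLat hV.symm hM₁ hr) h2).symm).trans h8.symm).trans
    (h4.latIso hV hM hd hq hq2 hqd h (.refl _))

end NeighbourRelation

section Norms

theorem anisotropic_of_nonsquare {p : ℕ} (hp : p.Prime) {D : ℤ}
    (hD : ∀ k : ℤ, ¬ (p : ℤ) ∣ k ^ 2 - D) {X y : ℤ} (h : (p : ℤ) ∣ X ^ 2 - D * y ^ 2) :
    (p : ℤ) ∣ X ∧ (p : ℤ) ∣ y := by
  have hpp := Nat.prime_iff_prime_int.1 hp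
  have hy : (p : ℤ) ∣ y := by
    by_contra hy
    obtain ⟨s, hs⟩ := exists_dvd_mul_sub hp hy 1 X
    rw [pow_one] at hs
    refine hD s ((hpp.dvd_or_dvd (b := y ^ 2) ?_).resolve_right fun h' => hy (hpp.dvd_of_dvd_pow h'))
    have : (s ^ 2 - D) * y ^ 2 = (s * y - X) * (s * y + X) + (X ^ 2 - D * y ^ 2) := by ring
    rw [this]
    exact dvd_add (hs.mul_right _) h
  refine ⟨hpp.dvd_of_dvd_pow (n := 2) ?_, hy⟩
  rwa [dvd_sub_left ((hy.pow two_ne_zero).mul_left D)] at h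

theorem anisotropic_of_three_mod_four {D : ℤ} (hD : (4 : ℤ) ∣ D - 3) {X y : ℤ}
    (h : (4 : ℤ) ∣ X ^ 2 - D * y ^ 2) : (2 : ℤ) ∣ X ∧ (2 : ℤ) ∣ y := by
  obtain ⟨k, hk⟩ := hD
  have h1 : (4 : ℤ) ∣ X ^ 2 + y ^ 2 := by
    have : X ^ 2 + y ^ 2 = (X ^ 2 - D * y ^ 2) + 4 * ((k + 1) * y ^ 2) := by
      linear_combination y ^ 2 * hk
    rw [this]
    exact dvd_add h (dvd_mul_right _ _)
  rcases Int.even_or_odd' X with ⟨i, rfl | rfl⟩ <;> rcases Int.even_or_odd' y with ⟨j, rfl | rfl⟩ <;>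
    ring_nf at h1 ⊢ <;> constructor <;> omega

theorem nonsquare_of_dvd_sub {p : ℕ} (hp : p.Prime) {c D D₀ : ℤ} (hc : ¬ (p : ℤ) ∣ c)
    (h : (p : ℤ) ∣ D - c ^ 2 * D₀) (hD₀ : ∀ k : ℤ, ¬ (p : ℤ) ∣ k ^ 2 - D₀) (k : ℤ) :
    ¬ (p : ℤ) ∣ k ^ 2 - D := fun hk =>
  hc (anisotropic_of_nonsquare hp hD₀ (X := k) (y := c) (by
    have : k ^ 2 - D₀ * c ^ 2 = (k ^ 2 - D) + (D - c ^ 2 * D₀) := by ring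
    rw [this]
    exact dvd_add hk h)).2

theorem exists_coprime_representation {a β c m N : ℤ}
    (han : ∀ p : ℕ, p.Prime → (p : ℤ) ∣ N → ∀ x y : ℤ,
      (p : ℤ) ^ 2 ∣ a * x ^ 2 + 2 * β * x * y + c * y ^ 2 → (p : ℤ) ∣ x ∧ (p : ℤ) ∣ y)
    {x y s : ℤ} (hs : s ≠ 0) (h : a * x ^ 2 + 2 * β * x * y + c * y ^ 2 = m * s ^ 2) :
    ∃ x y s : ℤ, s ≠ 0 ∧ IsCoprime s N ∧
      a * x ^ 2 + 2 * β * x * y + c * y ^ 2 = m * s ^ 2 := by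
  induction hn : s.natAbs using Nat.strong_induction_on generalizing x y s with
  | _ n ih =>
    by_cases hsN : IsCoprime s N
    · exact ⟨x, y, s, hs, hsN, h⟩
    obtain ⟨p, hp, hps, hpN⟩ : ∃ p : ℕ, p.Prime ∧ (p : ℤ) ∣ s ∧ (p : ℤ) ∣ N := by
      by_contra! hcon
      exact hsN (isCoprime_of_prime_not_dvd hcon)
    have hp0 : (p : ℤ) ≠ 0 := by exact_mod_cast hp.ne_zero
    obtain ⟨s, rfl⟩ := hps
    have hs0 := right_ne_zero_of_mul hs
    obtain ⟨⟨x, rfl⟩, y, rfl⟩ := han p hp hpN x y ⟨m * s ^ 2, by rw [h]; ring⟩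
    refine ih s.natAbs ?_ hs0 (x := x) (y := y) (mul_left_cancel₀ (pow_ne_zero 2 hp0) ?_) rfl
    · rw [← hn, Int.natAbs_mul, Int.natAbs_natCast]
      exact lt_mul_of_one_lt_left (Int.natAbs_pos.2 hs0) hp.one_lt
    · linear_combination h

theorem anisotropic_binary {p : ℕ} (hp : p.Prime) {a β c D : ℤ} (hD : D = β ^ 2 - a * c)
    (ha : ¬ (p : ℤ) ∣ a) (h2 : p = 2 → (4 : ℤ) ∣ D - 3)
    (hns : p ≠ 2 → ∀ k : ℤ, ¬ (p : ℤ) ∣ k ^ 2 - D) (x y : ℤ)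
    (h : (p : ℤ) ^ 2 ∣ a * x ^ 2 + 2 * β * x * y + c * y ^ 2) : (p : ℤ) ∣ x ∧ (p : ℤ) ∣ y := by
  have hpp := Nat.prime_iff_prime_int.1 hp
  have h1 : (p : ℤ) ^ 2 ∣ (a * x + β * y) ^ 2 - D * y ^ 2 := by
    have : (a * x + β * y) ^ 2 - D * y ^ 2 = a * (a * x ^ 2 + 2 * β * x * y + c * y ^ 2) := by
      rw [hD]; ring
    rw [this]
    exact h.mul_left a
  have h3 : (p : ℤ) ∣ a * x + β * y ∧ (p : ℤ) ∣ y := by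
    by_cases hp2 : p = 2
    · subst hp2
      exact anisotropic_of_three_mod_four (h2 rfl) (by simpa using h1)
    · exact anisotropic_of_nonsquare hp (hns hp2) ((dvd_pow_self _ two_ne_zero).trans h1)
  refine ⟨(hpp.dvd_or_dvd ?_).resolve_left ha, h3.2⟩
  exact (dvd_add_left (h3.2.mul_left β)).1 h3.1

variable {Λ : Type} [AddCommGroup Λ] {b : Λ →ₗ[ℤ] Λ →ₗ[ℤ] ℤ} {d : ℤ}

theorem ResidualRankGT.exists_isotropic {p : ℕ} (hr : ResidualRankGT b p 2)
    (hb : ∀ x y, b x y = b y x) (hp : p.Prime) (hp2 : p ≠ 2) :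
    ∃ e z, (p : ℤ) ∣ b e e ∧ ¬ (p : ℤ) ∣ b e z := by
  obtain ⟨w, u, hw, hu, hwu⟩ := (hr.mono one_le_two).exists_orthogonal_pair hb hp hp2
  obtain ⟨v, hv1, hv⟩ := hr.exists_orthogonal hb hp hp2 (f := ![w, u])
    (fun i => by fin_cases i <;> assumption)
    (fun i j hij => by
      fin_cases i <;> fin_cases j <;> simp_all [hb u w])
  obtain ⟨x, y, hxy⟩ := exists_diagonal_solution hp hp2 hw hu (-b v v)
  have h0 : (p : ℤ) ∣ b w v := hv1 0
  have h1 : (p : ℤ) ∣ b u v := hv1 1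
  refine ⟨x • w + y • u + v, v, ?_, fun h => hv ?_⟩
  · have : b (x • w + y • u + v) (x • w + y • u + v) = (b w w * x ^ 2 + b u u * y ^ 2 - -b v v) +
        (2 * x * y * b w u + 2 * x * b w v + 2 * y * b u v) := by
      simp only [map_add, map_smul, LinearMap.add_apply, LinearMap.smul_apply, smul_eq_mul, hb u w,
        hb v w, hb v u]
      ring
    rw [this]
    exact dvd_add hxy (dvd_add (dvd_add (hwu.mul_left _) (h0.mul_left _)) (h1.mul_left _))
  · simp only [map_add, map_smul, LinearMap.add_apply, LinearMap.smul_apply, smul_eq_mul] at h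
    exact (dvd_add_right (dvd_add (h0.mul_left x) (h1.mul_left y))).1 h

/-- Planes of discriminant `D ≡ 3 (mod 4)` that are anisotropic at the primes of `S` other
than `q`. -/
theorem exists_anisotropic_plane [Module.Free ℤ Λ] (hb : ∀ x y, b x y = b y x)
    (h : DualBound b d) (hd : d ≠ 0) (hpos : ∃ x, 0 < b x x) (hneg : ∃ x, b x x < 0)
    (hr : ∀ p : ℕ, p.Prime → ResidualRankGT b p 2) {w₂ z₂ : Λ} (hw₂ : Odd (b w₂ w₂))
    (hz₂ : (4 : ℤ) ∣ (b w₂ z₂ ^ 2 - b w₂ w₂ * b z₂ z₂) - 3) {q : ℕ} (hq2 : q ≠ 2)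
    {S : Finset ℕ} (hS : ∀ p ∈ S, p.Prime) (h2S : 2 ∈ S)
    (hSd : ∀ p : ℕ, p.Prime → (p : ℤ) ∣ d → p ∈ S) {ε : ℤ} (hε : ε = 1 ∨ ε = -1) :
    ∃ (w z : Λ) (D : ℤ), D = b w z ^ 2 - b w w * b z z ∧ 0 < ε * b w w ∧ 0 < D ∧
      IsCoprime (b w w) (2 * D) ∧ (4 : ℤ) ∣ D - 3 ∧ (4 : ℤ) ∣ b w w - b w₂ w₂ ∧
      (∀ p ∈ S, p ≠ q → ¬ (p : ℤ) ∣ b w w ∧ (p ≠ 2 → ∀ k : ℤ, ¬ (p : ℤ) ∣ k ^ 2 - D)) ∧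
      (q ∈ S → (q : ℤ) ∣ b w w ∧ ¬ (q : ℤ) ∣ D) := by
  have hloc : ∀ p : ℕ, p.Prime → ∃ w z, (p = 2 → w = w₂ ∧ z = z₂) ∧
      (p ≠ 2 → p ≠ q → ¬ (p : ℤ) ∣ b w w ∧
        ∀ k : ℤ, ¬ (p : ℤ) ∣ k ^ 2 - (b w z ^ 2 - b w w * b z z)) ∧
      (p = q → (p : ℤ) ∣ b w w ∧ ¬ (p : ℤ) ∣ b w z) := fun p hp => by
    by_cases hp2 : p = 2
    · exact ⟨w₂, z₂, fun _ => ⟨rfl, rfl⟩, fun h => (h hp2).elim, fun h => (hq2 (h ▸ hp2)).elim⟩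
    by_cases hpq : p = q
    · obtain ⟨e, z, h1, h2⟩ := (hr p hp).exists_isotropic hb hp hp2
      exact ⟨e, z, fun h => (hp2 h).elim, fun _ h => (h hpq).elim, fun _ => ⟨h1, h2⟩⟩
    · obtain ⟨w, z, h1, h2⟩ := (hr p hp).exists_discr_nonsquare hb hp hp2
      exact ⟨w, z, fun h => (hp2 h).elim, fun _ _ => ⟨h1, h2⟩, fun h => (hpq h).elim⟩
  choose! w₀ z₀ h₀2 h₀ h₀q using hloc
  obtain ⟨rfl, rfl⟩ := h₀2 2 Nat.prime_two rfl
  have hodd : ¬ ((2 : ℕ) : ℤ) ∣ b (w₀ 2) (w₀ 2) := by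
    rw [Nat.cast_two, ← even_iff_two_dvd, Int.not_even_iff_odd]; exact hw₂
  have hnd : ∀ p : ℕ, p.Prime → p ≠ q → ¬ (p : ℤ) ∣ b (w₀ p) (w₀ p) := fun p hp hpq => by
    by_cases hp2 : p = 2
    · rwa [hp2]
    · exact (h₀ p hp hp2 hpq).1
  obtain ⟨w, z, h1, h2, h3, h4⟩ := exists_plane_local hb h hd hpos hneg hS hSd two_ne_zero
    (w₀ := w₀) (z₀ := z₀) (fun p hp hpw => by
      by_cases hpq : p = q
      · exact (h₀q p (hS p hp) hpq).2
      · exact (hnd p (hS p hp) hpq hpw).elim) hε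
  have hnd' : ∀ p ∈ S, p ≠ q → ¬ (p : ℤ) ∣ b w w := fun p hp hpq hpw => by
    obtain ⟨c, hc, h5, -⟩ := h4 p hp
    have hpp := Nat.prime_iff_prime_int.1 (hS p hp)
    have h6 := (dvd_sub_right hpw).1 ((dvd_pow_self _ two_ne_zero).trans h5)
    exact (hpp.dvd_or_dvd h6).elim (fun h => hc (hpp.dvd_of_dvd_pow h)) (hnd p (hS p hp) hpq)
  have h4D : (4 : ℤ) ∣ (b w z ^ 2 - b w w * b z z) - 3 ∧ (4 : ℤ) ∣ b w w - b (w₀ 2) (w₀ 2) := by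
    obtain ⟨c, hc, ⟨i, hi⟩, ⟨j, hj⟩⟩ := h4 2 h2S
    rw [Nat.cast_two, ← even_iff_two_dvd, Int.not_even_iff_odd] at hc
    obtain ⟨k, rfl⟩ := hc
    obtain ⟨l, hl⟩ := hz₂
    norm_num at hi hj
    refine ⟨⟨j + (2 * k + 1) ^ 2 * l + 3 * (k ^ 2 + k), ?_⟩,
      ⟨i + (k ^ 2 + k) * b (w₀ 2) (w₀ 2), ?_⟩⟩
    · linear_combination hj + (2 * k + 1) ^ 2 * hl
    · linear_combination hi
  refine ⟨w, z, _, rfl, h1, h3, ?_, h4D.1, h4D.2, fun p hp hpq => ⟨hnd' p hp hpq, fun hp2 => ?_⟩,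
    fun hq => ?_⟩
  · refine IsCoprime.mul_right (IsCoprime.symm ?_) ?_
    · exact Int.prime_two.coprime_iff_not_dvd.2 (hnd' 2 h2S hq2.symm)
    · obtain ⟨u, v, huv⟩ := h2.pow_right (n := 2)
      exact ⟨u + v * b z z, v, by linear_combination huv⟩
  · obtain ⟨c, hc, -, h5⟩ := h4 p hp
    exact nonsquare_of_dvd_sub (hS p hp) hc ((dvd_pow_self _ two_ne_zero).trans h5)
      (h₀ p (hS p hp) hp2 hpq).2
  · obtain ⟨c, hc, h5, h6⟩ := h4 q hq
    obtain ⟨h7, h8⟩ := h₀q q (hS q hq) rfl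
    have hqq := Nat.prime_iff_prime_int.1 (hS q hq)
    refine ⟨(dvd_sub_left (h7.mul_left _)).1 ((dvd_pow_self _ two_ne_zero).trans h5), fun h => ?_⟩
    have h9 := (dvd_sub_right h).1 ((dvd_pow_self _ two_ne_zero).trans h6)
    refine (hqq.dvd_or_dvd h9).elim (fun h => hc (hqq.dvd_of_dvd_pow h)) fun h => ?_
    exact h8 (hqq.dvd_of_dvd_pow ((dvd_sub_left (h7.mul_right _)).1 h))

theorem exists_norms [Module.Free ℤ Λ] (hb : ∀ x y, b x y = b y x)
    (h : DualBound b d) (hd : d ≠ 0) (hpos : ∃ x, 0 < b x x) (hneg : ∃ x, b x x < 0)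
    (hr : ∀ p : ℕ, p.Prime → ResidualRankGT b p 2) (hodd : ∃ x, Odd (b x x)) {q : ℕ}
    (hq : q.Prime) (hq2 : q ≠ 2) (hqd : ¬ (q : ℤ) ∣ d) :
    ∃ r : ℕ, r.Prime ∧ r ≠ 2 ∧ ¬ (r : ℤ) ∣ d ∧ r ≠ q ∧
      (∃ (v : Λ) (s : ℤ), IsCoprime s (2 * d) ∧ s ≠ 0 ∧ b v v = r * s ^ 2) ∧
      ∃ (ε : ℤ) (v : Λ) (s : ℤ), IsUnit ε ∧ IsCoprime s (2 * d) ∧ s ≠ 0 ∧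
        b v v = ε * (q * r) * s ^ 2 := by
  obtain ⟨v₀, hv₀⟩ := hodd
  obtain ⟨w₂, z₂, hw₂, hz₂⟩ := (hr 2 Nat.prime_two).exists_discr_three_mod_four hb hv₀
  have h2d : 2 * d ≠ 0 := mul_ne_zero two_ne_zero hd
  have hqq := Nat.prime_iff_prime_int.1 hq
  have mem_primeFactors : ∀ {N : ℤ} {p : ℕ}, N ≠ 0 → p.Prime → (p : ℤ) ∣ N →
      p ∈ N.natAbs.primeFactors := fun hN hp h =>
    Nat.mem_primeFactors.2 ⟨hp, Int.natCast_dvd.1 h, Int.natAbs_ne_zero.2 hN⟩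
  obtain ⟨w, z, D, hD, ha, hD0, haD, hD3, ha2, hS, -⟩ :=
    exists_anisotropic_plane hb h hd hpos hneg hr hw₂ hz₂ hq2
      (S := (2 * d).natAbs.primeFactors) (fun p hp => Nat.prime_of_mem_primeFactors hp)
      (mem_primeFactors h2d Nat.prime_two (dvd_mul_right _ _))
      (fun p hp hpd => mem_primeFactors h2d hp (hpd.mul_left _)) (ε := 1) (Or.inl rfl)
  have hm0 : 2 * d * q * D ≠ 0 := mul_ne_zero (mul_ne_zero h2d hqq.ne_zero) hD0.ne'
  obtain ⟨ε, hε, hεq⟩ : ∃ ε : ℤ, (ε = 1 ∨ ε = -1) ∧ (4 : ℤ) ∣ q - ε := by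
    rcases hq.eq_two_or_odd with h | h
    · exact (hq2 h).elim
    · rcases (by omega : q % 4 = 1 ∨ q % 4 = 3) with h | h
      · exact ⟨1, Or.inl rfl, by omega⟩
      · exact ⟨-1, Or.inr rfl, by omega⟩
  obtain ⟨w', z', D', hD', ha', hD0', haD', hD3', ha2', hS', hSq⟩ :=
    exists_anisotropic_plane hb h hd hpos hneg hr hw₂ hz₂ hq2
      (S := (2 * d * q * D).natAbs.primeFactors) (fun p hp => Nat.prime_of_mem_primeFactors hp)
      (mem_primeFactors hm0 Nat.prime_two (((dvd_mul_right _ _).mul_right _).mul_right _))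
      (fun p hp hpd => mem_primeFactors hm0 hp (((hpd.mul_left _).mul_right _).mul_right _)) hε
  obtain ⟨⟨A, hA⟩, hqD'⟩ := hSq (mem_primeFactors hm0 hq ((dvd_mul_left _ _).mul_right _))
  rw [one_mul] at ha
  have hεε : ε * ε = 1 := by rcases hε with rfl | rfl <;> norm_num
  have hq0 : (0 : ℤ) < q := by exact_mod_cast hq.pos
  rw [hA] at ha' haD' hD'
  have hεA : 0 < ε * A := by
    have : 0 < q * (ε * A) := by linarith
    exact pos_of_mul_pos_right this hq0.le
  have hAabs : |A| = ε * A := by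
    rcases hε with rfl | rfl
    · rw [one_mul, abs_of_pos (by linarith)]
    · rw [abs_of_neg (by linarith)]; ring
  have hA0 : A ≠ 0 := right_ne_zero_of_mul hεA.ne'
  have hAD' : IsCoprime A (2 * D') := haD'.of_mul_left_right
  have nonsq : ∀ {E : ℤ}, (4 : ℤ) ∣ E - 3 → ¬ IsSquare E := by
    rintro E hE ⟨k, rfl⟩
    rcases Int.even_or_odd' k with ⟨i, rfl | rfl⟩ <;> ring_nf at hE <;> omega
  have hDD' : IsCoprime D D' := isCoprime_of_prime_not_dvd fun p hp hpD hpD' => by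
    by_cases hpq : p = q
    · exact hqD' (hpq ▸ hpD')
    by_cases hp2 : p = 2
    · subst hp2; push_cast at hpD; omega
    · exact (hS' p (mem_primeFactors hm0 hp (hpD.mul_left _)) hpq).2 hp2 0 (by simpa using hpD')
  have h4D' : IsCoprime 4 D' := by
    obtain ⟨k, hk⟩ := hD3'
    exact ⟨k + 1, -1, by linarith⟩
  obtain ⟨y, hy1, hy2⟩ := exists_crt_two (h4D'.mul_left hDD') (b w w) |A|
  have ha4 : IsCoprime (b w w) 4 := by
    have := haD.of_mul_right_left.mul_right haD.of_mul_right_left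
    norm_num at this
    exact this
  have hyD : IsCoprime y (4 * D) := by
    obtain ⟨k, hk⟩ := hy1
    rw [eq_add_of_sub_eq hk, add_comm]
    exact (ha4.mul_right haD.of_mul_right_right).add_mul_left_left k
  have hyD' : IsCoprime y D' := by
    obtain ⟨k, hk⟩ := hy2
    rw [eq_add_of_sub_eq hk, add_comm]
    exact ((IsCoprime.abs_left_iff A D').2 hAD'.of_mul_right_right).add_mul_left_left k
  obtain ⟨r, hrp, hrB, hry⟩ := exists_prime_dvd_sub
    (mul_ne_zero (mul_ne_zero four_ne_zero hD0.ne') hD0'.ne') (hyD.mul_right hyD')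
    ((b w w).natAbs + A.natAbs + d.natAbs + q + 2)
  have hrD : (4 * D) ∣ r - b w w := by
    have := dvd_add ((dvd_mul_right _ _).trans hry) hy1
    rwa [sub_add_sub_cancel] at this
  have hrD' : D' ∣ r - |A| := by
    have := dvd_add ((dvd_mul_left _ _).trans hry) hy2
    rwa [sub_add_sub_cancel] at this
  have hr4 : (4 : ℤ) ∣ r - |A| := by
    have h1 : (4 : ℤ) ∣ r - b w w := (dvd_mul_right _ _).trans hrD
    have h3 : (4 : ℤ) ∣ q * A - ε * A := by rw [← sub_mul]; exact hεq.mul_right _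
    rw [hAabs]
    rw [hA] at ha2'
    omega
  have ndvd : ∀ {x : ℤ}, x ≠ 0 → x.natAbs < r → ¬ (r : ℤ) ∣ x := fun h0 hlt h =>
    hlt.not_ge (Nat.le_of_dvd (Int.natAbs_pos.2 h0) (Int.natCast_dvd.1 h))
  have hrr := Nat.prime_iff_prime_int.1 hrp
  obtain ⟨x₁, y₁, s₁, hs₁, e₁⟩ := binary_represents_prime hrp hD hD0 (nonsq hD3) haD (ε := 1)
    (by rw [abs_of_pos ha, mul_one]) (by norm_num)
    (by rw [abs_of_pos ha]; exact (Int.modEq_iff_dvd.2 hrD).symm)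
    (hrr.coprime_iff_not_dvd.2 (ndvd ha.ne' (by omega))).symm
  have hD'' : D' = b w' z' ^ 2 - A * (q * b z' z') := by rw [hD']; ring
  obtain ⟨x₂, y₂, s₂, hs₂, e₂⟩ := binary_represents_prime hrp hD'' hD0' (nonsq hD3') hAD' (ε := ε)
    (by rw [hAabs, mul_comm]) hεε (Int.modEq_iff_dvd.2 (h4D'.mul_dvd hr4 hrD')).symm
    (hrr.coprime_iff_not_dvd.2 (ndvd hA0 (by omega))).symm
  obtain ⟨x₁, y₁, s₁, hs₁, hc₁, e₁⟩ := exists_coprime_representation (N := 2 * d)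
    (fun p hp hpd => by
      have hp1 := hS p (mem_primeFactors h2d hp hpd) fun h => by
        subst h
        exact (hqq.dvd_or_dvd hpd).elim (not_dvd_two hp hq2) hqd
      exact anisotropic_binary hp hD hp1.1 (fun _ => hD3) hp1.2) hs₁ e₁
  obtain ⟨x₂, y₂, s₂, hs₂, hc₂, e₂⟩ := exists_coprime_representation (N := 2 * d)
    (fun p hp hpd => by
      have hp1 := hS' p (mem_primeFactors hm0 hp ((hpd.mul_right _).mul_right _)) fun h => by
        subst h
        exact (hqq.dvd_or_dvd hpd).elim (not_dvd_two hp hq2) hqd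
      rw [hA] at hp1
      exact anisotropic_binary hp hD'' (fun h => hp1.1 (h.mul_left _)) (fun _ => hD3') hp1.2) hs₂ e₂
  refine ⟨r, hrp, by omega, ndvd hd (by omega), by omega, ⟨x₁ • w + y₁ • z, s₁, hc₁, hs₁, ?_⟩,
    ε, x₂ • w' + ((q : ℤ) * y₂) • z', s₂, ⟨⟨ε, ε, hεε, hεε⟩, rfl⟩, hc₂, hs₂, ?_⟩
  · rw [bilin_combo hb, e₁, one_mul]
  · rw [bilin_combo hb, hA]
    linear_combination (q : ℤ) * e₂

end Norms

set_option linter.unusedSectionVars false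

section Chain
variable {V : Type} [AddCommGroup V] [Module ℚ V] {B : V →ₗ[ℚ] V →ₗ[ℚ] ℚ} {d m : ℤ}
  {M M' K : Submodule ℤ V} {p : ℕ}

/-- The lattices `M` and `M'` agree at all primes dividing `m`. -/
def LocEq (m : ℤ) (M M' : Submodule ℤ V) : Prop :=
  ∃ N : ℤ, IsCoprime N m ∧ (∀ x ∈ M, N • x ∈ M') ∧ ∀ x ∈ M', N • x ∈ M

theorem IsNb.locEq (hM : IsLat B d M) (hp : p.Prime) (hpm : ¬ (p : ℤ) ∣ m) (h : IsNb B p M K) :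
    LocEq m M K :=
  ⟨p, (Nat.prime_iff_prime_int.1 hp).coprime_iff_not_dvd.2 hpm, fun _ hx => h.zsmul_mem hM hx,
    fun _ hx => h.zsmul_mem_of_mem hp hx⟩

theorem LocEq.symm (h : LocEq m M M') : LocEq m M' M :=
  let ⟨N, hN, h1, h2⟩ := h
  ⟨N, hN, h2, h1⟩

theorem LocEq.trans (h : LocEq m M M') (h' : LocEq m M' K) : LocEq m M K :=
  let ⟨N, hN, h1, h2⟩ := h
  let ⟨N', hN', h1', h2'⟩ := h'
  ⟨N' * N, hN'.mul_left hN, fun x hx => by rw [mul_smul]; exact h1' _ (h1 x hx),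
    fun x hx => by rw [mul_comm, mul_smul]; exact h2 _ (h2' x hx)⟩

theorem LocEq.residualRankGT (h : LocEq m M M') (hM : IsLat B d M) (hM' : IsLat B d M')
    (hp : p.Prime) (hpm : (p : ℤ) ∣ m) {k : ℕ} (hr : ResidualRankGT (latForm hM) p k) :
    ResidualRankGT (latForm hM') p k := by
  obtain ⟨N, hN, h1, h2⟩ := h
  have hpp := Nat.prime_iff_prime_int.1 hp
  have hpN : ¬ (p : ℤ) ∣ N := hpp.coprime_iff_not_dvd.1 (hN.of_isCoprime_of_dvd_right hpm).symm
  intro f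
  obtain ⟨x, y, hx, hxy⟩ := hr fun i => ⟨N • (f i : V), h2 _ (f i).2⟩
  refine ⟨⟨N • (x : V), h1 x x.2⟩, ⟨N • (y : V), h1 y y.2⟩, fun i => ?_, fun hdvd => hxy ?_⟩
  · refine (hx i).trans (dvd_of_eq (Int.cast_injective (α := ℚ) ?_))
    simp only [latForm_apply, map_zsmul, LinearMap.smul_apply]
  · have : latForm hM' ⟨N • (x : V), h1 x x.2⟩ ⟨N • (y : V), h1 y y.2⟩ =
        N * (N * latForm hM x y) := Int.cast_injective (α := ℚ) (by
      push_cast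
      simp only [latForm_apply, map_zsmul, LinearMap.smul_apply, zsmul_eq_mul])
    rw [this] at hdvd
    exact ((hpp.dvd_or_dvd hdvd).resolve_left hpN |> hpp.dvd_or_dvd).resolve_left hpN

theorem LocEq.exists_odd (h : LocEq m M M') (hM : IsLat B d M) (hM' : IsLat B d M')
    (hm : (2 : ℤ) ∣ m) (hodd : ∃ x, Odd (latForm hM x x)) : ∃ x, Odd (latForm hM' x x) := by
  obtain ⟨N, hN, h1, -⟩ := h
  obtain ⟨x, hx⟩ := hodd
  have hNodd : Odd N := by
    rw [← Int.isCoprime_two_right]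
    exact hN.of_isCoprime_of_dvd_right hm
  refine ⟨⟨N • (x : V), h1 x x.2⟩, ?_⟩
  have : latForm hM' ⟨N • (x : V), h1 x x.2⟩ ⟨N • (x : V), h1 x x.2⟩ =
      N * (N * latForm hM x x) := Int.cast_injective (α := ℚ) (by
    push_cast
    simp only [latForm_apply, map_zsmul, LinearMap.smul_apply, zsmul_eq_mul])
  rw [this]
  exact hNodd.mul (hNodd.mul hx)

theorem IsLat.residualRankGT [FiniteDimensional ℚ V] (hV : IsIndefSpace B) (hM : IsLat B d M)
    (hpd : ¬ (p : ℤ) ∣ d) : ResidualRankGT (latForm hM) p 2 := by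
  have := hM.moduleFinite
  have := hM.moduleFree
  exact residualRankGT_of_not_dvd (latForm_symm hM hV.symm) (latForm_dualBound hM hV.nondeg) hpd
    (by rw [hM.finrank_eq]; exact hV.rank)

theorem IsNb.latIso_self [FiniteDimensional ℚ V] (hV : IsIndefSpace B) (hd : d ≠ 0)
    (hM : IsLat B d M) (hr : ∀ p : ℕ, p.Prime → ResidualRankGT (latForm hM) p 2)
    (hodd : ∃ x, Odd (latForm hM x x)) (hp : p.Prime) (hp2 : p ≠ 2) (hpd : ¬ (p : ℤ) ∣ d)
    (h : IsNb B p M K) : LatIso B M K := by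
  have := hM.moduleFree
  obtain ⟨r, hrp, hr2, hrd, hrq, ⟨v, s, hs, hs0, hv⟩, ε, v', s', hε, hs', hs0', hv'⟩ :=
    exists_norms (latForm_symm hM hV.symm) (latForm_dualBound hM hV.nondeg) hd
      (latForm_exists_pos hM hV.pos) (latForm_exists_neg hM hV.neg) hr hodd hp hp2 hpd
  refine latIso_of_isNb_of_norms hV hd hM hp hp2 hpd hrp hr2 hrd hrq isUnit_one hs0 hs hε hs0' hs'
    v.2 ?_ v'.2 ?_ h
  · rw [← latForm_apply hM, hv, one_mul]
  · rw [← latForm_apply hM, hv']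

theorem exists_zsmul_mem_of_prime {N : ℤ} (hN : N ≠ 0) {y : V} (hy : y ∉ M) (hNy : N • y ∈ M) :
    ∃ (p : ℕ) (t : ℤ), p.Prime ∧ (p : ℤ) ∣ N ∧ t • y ∉ M ∧ (p : ℤ) • t • y ∈ M := by
  induction hn : N.natAbs using Nat.strong_induction_on generalizing N with
  | _ n ih =>
    by_cases h1 : N.natAbs = 1
    · refine (hy ?_).elim
      rcases Int.natAbs_eq N with h | h <;> rw [h1] at h <;> simpa [h] using hNy
    obtain ⟨p, hp, hpN⟩ := Nat.exists_prime_and_dvd h1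
    obtain ⟨k, rfl⟩ : (p : ℤ) ∣ N := Int.natCast_dvd.2 hpN
    by_cases hk : k • y ∈ M
    · have hk0 := right_ne_zero_of_mul hN
      obtain ⟨p', t, h2, h3, h4⟩ := ih k.natAbs (by
        rw [← hn, Int.natAbs_mul, Int.natAbs_natCast]
        exact lt_mul_of_one_lt_left (Int.natAbs_pos.2 hk0) hp.one_lt) hk0 hk rfl
      exact ⟨p', t, h2, h3.mul_left _, h4⟩
    · exact ⟨p, k, hp, dvd_mul_right _ _, hk, by rwa [← mul_smul]⟩

theorem LocEq.eq_of_le (h : LocEq m M M') (hdm : d ∣ m) (hM : IsLat B d M) (hM' : IsLat B d M')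
    (hle : M' ≤ M) : M = M' := by
  obtain ⟨N, hN, h1, -⟩ := h
  refine le_antisymm (fun y hy => ?_) hle
  obtain ⟨a, c, hac⟩ := hN.of_isCoprime_of_dvd_right hdm
  have h2 := hM'.dual y fun z hz => hM.int y hy z (hle hz)
  have h3 := M'.add_mem (M'.smul_mem a (h1 y hy)) (M'.smul_mem c h2)
  rwa [smul_smul, smul_smul, ← add_smul, hac, one_smul] at h3

/-- Lattices that agree at the primes dividing `2 * d` are isometric. -/
theorem LocEq.latIso [FiniteDimensional ℚ V] (hV : IsIndefSpace B) (hd : d ≠ 0)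
    (hM : IsLat B d M) (hM' : IsLat B d M')
    (hr : ∀ p : ℕ, p.Prime → (p : ℤ) ∣ d → ResidualRankGT (latForm hM) p 2)
    (hodd : ∃ x, Odd (latForm hM x x)) (h : LocEq (2 * d) M M') : LatIso B M M' := by
  have := hM'.moduleFinite
  induction hI : M.comap M'.subtype using WellFoundedGT.induction generalizing M with
  | _ I ih =>
    by_cases hle : M' ≤ M
    · rw [h.eq_of_le (dvd_mul_left _ _) hM hM' hle]
      exact .refl _
    obtain ⟨y, hy, hyM⟩ := SetLike.not_le_iff_exists.1 hle
    obtain ⟨N, hN, h1, h2⟩ := id h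
    have hN0 : N ≠ 0 := by
      rintro rfl
      have := isCoprime_zero_left.1 hN
      exact Int.prime_two.not_isUnit (isUnit_of_mul_isUnit_left this)
    obtain ⟨p, t, hp, hpN, hty, hpty⟩ := exists_zsmul_mem_of_prime hN0 hyM (h2 y hy)
    have hpp := Nat.prime_iff_prime_int.1 hp
    have hp2d : ¬ (p : ℤ) ∣ 2 * d :=
      hpp.coprime_iff_not_dvd.1 (hN.of_isCoprime_of_dvd_left hpN)
    have hp2 : p ≠ 2 := fun h => hp2d (h ▸ dvd_mul_right _ _)
    have hpd : ¬ (p : ℤ) ∣ d := fun h => hp2d (h.mul_left _)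
    have htM' : t • y ∈ M' := M'.smul_mem t hy
    obtain ⟨k, hk⟩ := hM'.int _ htM' _ htM'
    have hx : IsNbVec B p M ((p : ℤ) • t • y) := by
      refine ⟨hpty, ⟨k, ?_⟩, hM.exists_pairing_not_dvd hV hp hpd hpty fun g hg hpg => hty ?_⟩
      · rw [map_zsmul B, LinearMap.smul_apply, map_zsmul _ (p : ℤ), hk, zsmul_eq_mul, zsmul_eq_mul]
        ring
      · rw [zsmul_cancel hpp.ne_zero hpg]
        exact hg
    have hnb : IsNb B p M (nb B p M ((p : ℤ) • t • y)) := ⟨_, hx, rfl⟩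
    have hK := hnb.isLat hV.symm hM hp
    have hloc := hnb.locEq hM hp hp2d
    refine (hnb.latIso_self hV hd hM (fun p hp => ?_) hodd hp hp2 hpd).trans
      (ih _ ?_ hK (fun p hp hpd => hloc.residualRankGT hM hK hp (hpd.mul_left _) (hr p hp hpd))
        (hloc.exists_odd hM hK (dvd_mul_right _ _) hodd) (hloc.symm.trans h) rfl)
    · by_cases hpd : (p : ℤ) ∣ d
      · exact hr p hp hpd
      · exact hM.residualRankGT hV hpd
    · rw [← hI]
      refine SetLike.lt_iff_le_and_exists.2 ⟨fun z hz => ?_, ⟨t • y, htM'⟩, ?_, hty⟩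
      · obtain ⟨j, hj⟩ := hM'.int _ htM' _ z.2
        refine mem_nb_of_mem hz (k := j) ?_
        rw [Submodule.subtype_apply, map_zsmul, LinearMap.smul_apply, hj, zsmul_eq_mul]
      · have := div_smul_mem_nb (B := B) (m := (p : ℤ)) (M := M) (x := (p : ℤ) • t • y) 1
        have hp0 : ((p : ℤ) : ℚ) ≠ 0 := Int.cast_ne_zero.2 hpp.ne_zero
        rwa [← Int.cast_smul_eq_zsmul ℚ (p : ℤ) (t • y), smul_smul, Int.cast_one,
          one_div_mul_cancel hp0, one_smul, Int.cast_smul_eq_zsmul] at this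

end Chain

section Lagrangian
variable {Λ : Type} [AddCommGroup Λ] {b : Λ →ₗ[ℤ] Λ →ₗ[ℤ] ℤ} {k : ℕ}

/-- `ε b` is positive definite on a subgroup of rank `k`. -/
def DefiniteRank (b : Λ →ₗ[ℤ] Λ →ₗ[ℤ] ℤ) (ε : ℤ) (k : ℕ) : Prop :=
  ∃ f : (Fin k → ℤ) →ₗ[ℤ] Λ, ∀ c, c ≠ 0 → 0 < ε * b (f c) (f c)

theorem DefiniteRank.exists_pos {ε : ℤ} (h : DefiniteRank b ε (k + 1)) : ∃ x, 0 < ε * b x x :=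
  let ⟨f, hf⟩ := h
  ⟨f 1, hf 1 one_ne_zero⟩

theorem exists_injective_of_functional (φ : (Fin (k + 1) → ℤ) →ₗ[ℤ] ℤ) :
    ∃ g : (Fin k → ℤ) →ₗ[ℤ] (Fin (k + 1) → ℤ), Function.Injective g ∧ ∀ c, φ (g c) = 0 := by
  have hk : k ≤ Module.finrank ℤ (LinearMap.ker φ) := by
    have h1 := Submodule.finrank_quotient_add_finrank (LinearMap.ker φ)
    rw [φ.quotKerEquivRange.finrank_eq, Module.finrank_fin_fun] at h1
    have h2 := (LinearMap.range φ).finrank_le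
    rw [Module.finrank_self] at h2
    omega
  have b := Module.finBasis ℤ (LinearMap.ker φ)
  have hli := (b.linearIndependent.comp (Fin.castLE hk) (Fin.castLE_injective hk))
  refine ⟨(LinearMap.ker φ).subtype ∘ₗ Fintype.linearCombination ℤ (b ∘ Fin.castLE hk), ?_,
    fun c => (Fintype.linearCombination ℤ (b ∘ Fin.castLE hk) c).2⟩
  exact (Subtype.val_injective).comp (hli.fintypeLinearCombination_injective)

theorem DefiniteRank.hypForm {ε : ℤ} (hb : ∀ x y, b x y = b y x) {e x : Λ}
    (he : b e e = 0) (hex : b e x = 1)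
    (h : DefiniteRank b ε (k + 1)) : DefiniteRank (hypForm b e x) ε k := by
  obtain ⟨f, hf⟩ := h
  obtain ⟨g, hg, hg0⟩ := exists_injective_of_functional (b e ∘ₗ f)
  refine ⟨(hypProj b e x).codRestrict _ (hypProj_mem hb he hex) ∘ₗ f ∘ₗ g, fun c hc => ?_⟩
  have h0 : b e (f (g c)) = 0 := hg0 c
  refine (hf (g c) fun h => hc (hg (by rw [h, map_zero]))).trans_eq (congrArg _ ?_)
  rw [_root_.hypForm, LinearMap.domRestrict₁₂_apply]
  simp only [LinearMap.comp_apply, LinearMap.codRestrict_apply, hypProj_apply, h0, zero_smul,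
    mul_zero, sub_zero, map_sub, map_smul, LinearMap.sub_apply, LinearMap.smul_apply, he,
    hb (f (g c)) e, smul_zero]

/-- A unimodular lattice of signature `(n, n)` contains a Lagrangian. -/
theorem exists_lagrangian (n : ℕ) {Λ : Type} [AddCommGroup Λ] [Module.Free ℤ Λ]
    [Module.Finite ℤ Λ] {b : Λ →ₗ[ℤ] Λ →ₗ[ℤ] ℤ} (hn : Module.finrank ℤ Λ = 2 * n)
    (hb : ∀ x y, b x y = b y x) (h : DualBound b 1) (hpos : DefiniteRank b 1 n)
    (hneg : DefiniteRank b (-1) n) :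
    ∃ e f : Fin n → Λ, (∀ i j, b (e i) (e j) = 0) ∧
      ∀ i j, b (e i) (f j) = if i = j then 1 else 0 := by
  induction n generalizing Λ with
  | zero => exact ⟨Fin.elim0, Fin.elim0, fun i => i.elim0, fun i => i.elim0⟩
  | succ n ih =>
    obtain ⟨v, hv0, hv⟩ := unimodularIsotropic _ rfl hb h
      (hpos.exists_pos.imp fun x hx => by simpa using hx)
      (hneg.exists_pos.imp fun x hx => by simpa using hx)
    obtain ⟨g, e, φ, rfl, hφ⟩ := exists_primitive_part hv0
    have hg0 : g ≠ 0 := by rintro rfl; simp at hv0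
    have he : b e e = 0 := by simpa [hg0] using hv
    obtain ⟨x, hx⟩ := h φ
    have hex : b e x = 1 := by rw [hb, hx, hφ, one_mul]
    have hfin := finrank_hypCompl hb he hex
    obtain ⟨e', f', h1, h2⟩ := ih (b := hypForm b e x) (by omega) (fun y z => hb y z)
      (hypForm_dualBound hb h he hex) (hpos.hypForm hb he hex) (hneg.hypForm hb he hex)
    refine ⟨Fin.cons e fun i => e' i, Fin.cons x fun i => f' i, fun i j => ?_, fun i j => ?_⟩
    · induction i using Fin.cases with
      | zero =>
        induction j using Fin.cases with
        | zero => exact he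
        | succ j => exact (mem_hypCompl.1 (e' j).2).1
      | succ i =>
        induction j using Fin.cases with
        | zero => exact (hb _ _).trans (mem_hypCompl.1 (e' i).2).1
        | succ j => exact h1 i j
    · induction i using Fin.cases with
      | zero =>
        induction j using Fin.cases with
        | zero => simpa using hex
        | succ j => simpa [(Fin.succ_ne_zero j).symm] using (mem_hypCompl.1 (f' j).2).1
      | succ i =>
        induction j using Fin.cases with
        | zero => simpa using (hb _ _).trans (mem_hypCompl.1 (e' i).2).2
        | succ j =>
          simp only [Fin.cons_succ, Fin.succ_inj]
          exact h2 i j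

end Lagrangian

section LocalVector
variable {Λ : Type} [AddCommGroup Λ] {b : Λ →ₗ[ℤ] Λ →ₗ[ℤ] ℤ} {p : ℕ}

theorem ResidualRankGT.exists_even_pair (hb : ∀ x y, b x y = b y x) (hp : p.Prime)
    (h : ResidualRankGT b p 2) :
    ∃ x y, Even (b x x) ∧ Even (b y y) ∧ ¬ (p : ℤ) ∣ b x y := by
  have hpp := Nat.prime_iff_prime_int.1 hp
  by_cases hp2 : p = 2
  · subst hp2
    simp only [Nat.cast_ofNat, ← even_iff_two_dvd]
    by_contra! hcon
    have hadd : ∀ x y, b (x + y) (x + y) = b x x + b y y + 2 * b x y := fun x y => by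
      simp only [map_add, LinearMap.add_apply, hb y x]; ring
    have hsub : ∀ x w, Odd (b x x) → Odd (b w w) → Even (b (x - w) (x - w)) := fun x w hx hw => by
      rw [show b (x - w) (x - w) = b x x + b w w - 2 * b x w by
        simp only [map_sub, LinearMap.sub_apply, hb w x]; ring]
      exact (hx.add_odd hw).sub (even_two_mul _)
    by_cases hodd : ∃ w, Odd (b w w)
    · obtain ⟨w, hw⟩ := hodd
      obtain ⟨u, hu⟩ : ∃ u, Even (b u u) ∧ ((∃ u, Even (b u u) ∧ Odd (b u w)) → Odd (b u w)) := by
        by_cases hu : ∃ u, Even (b u u) ∧ Odd (b u w)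
        · obtain ⟨u, h1, h2⟩ := hu
          exact ⟨u, h1, fun _ => h2⟩
        · exact ⟨0, by simp, fun h => (hu h).elim⟩
      obtain ⟨x, y, hx, hxy⟩ := h ![w, u]
      have hxw : Even (b x w) := even_iff_two_dvd.2 (hx 0)
      have hxu : Even (b x u) := even_iff_two_dvd.2 (hx 1)
      rw [Nat.cast_ofNat, ← even_iff_two_dvd] at hxy
      rcases Int.even_or_odd (b x x) with hxe | hxo
      · rcases Int.even_or_odd (b y y) with hye | hyo
        · exact hxy (hcon x y hxe hye)
        · have := hcon x (y - w) hxe (hsub y w hyo hw)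
          rw [map_sub, Int.even_sub] at this
          exact hxy (this.2 hxw)
      · have h1 := hsub x w hxo hw
        have h2 := hcon (x - w) u h1 hu.1
        have h3 : Odd (b (x - w) w) := by
          rw [map_sub, LinearMap.sub_apply]
          exact hxw.sub_odd hw
        have h4 := hu.2 ⟨_, h1, h3⟩
        rw [map_sub, LinearMap.sub_apply, Int.even_sub, hb w u] at h2
        exact (Int.not_even_iff_odd.2 h4) (h2.1 hxu)
    · obtain ⟨x, y, -, hxy⟩ := h 0
      simp only [not_exists, Int.not_odd_iff_even] at hodd
      exact hxy (even_iff_two_dvd.1 (hcon x y (hodd x) (hodd y)))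
  · obtain ⟨x, y, -, hxy⟩ := h 0
    refine ⟨(2 : ℤ) • x, (2 : ℤ) • y, ?_, ?_, fun h => hxy ?_⟩
    · simp only [map_smul, LinearMap.smul_apply, smul_eq_mul]; exact even_two_mul _
    · simp only [map_smul, LinearMap.smul_apply, smul_eq_mul]; exact even_two_mul _
    · simp only [map_smul, LinearMap.smul_apply, smul_eq_mul] at h
      exact ((hpp.dvd_or_dvd h).resolve_left (not_dvd_two hp hp2) |> hpp.dvd_or_dvd).resolve_left
        (not_dvd_two hp hp2)

/-- A vector `v` of even norm in whose reflection `e` becomes a vector that pairs to a unit with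
both `e` and `e'`. -/
theorem exists_connecting_vector_local (hb : ∀ x y, b x y = b y x) (hp : p.Prime)
    {e f e' f' x y : Λ}
    (hef : ¬ (p : ℤ) ∣ b e f) (hf : Even (b f f))
    (hef' : ¬ (p : ℤ) ∣ b e' f') (hf' : Even (b f' f')) (hex : b e x = 0) (hey : b e y = 0)
    (hx : Even (b x x)) (hy : Even (b y y)) (hxy : ¬ (p : ℤ) ∣ b x y) :
    ∃ v, Even (b v v) ∧ ¬ (p : ℤ) ∣ b e v ∧
      ∀ g, b v v = 2 * g → ¬ (p : ℤ) ∣ b e v * b e' v - g * b e e' := by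
  have hpp := Nat.prime_iff_prime_int.1 hp
  obtain ⟨g, hg⟩ := even_iff_exists_two_mul.1 hf
  obtain ⟨g', hg'⟩ := even_iff_exists_two_mul.1 hf'
  obtain ⟨i, hi⟩ := even_iff_exists_two_mul.1 hx
  obtain ⟨j, hj⟩ := even_iff_exists_two_mul.1 hy
  by_contra! hcon
  have key : ∀ v g, b v v = 2 * g → ¬ (p : ℤ) ∣ b e v → (p : ℤ) ∣ b e v * b e' v - g * b e e' :=
    fun v g hv hev => by
      obtain ⟨g', hg', h⟩ := hcon v ⟨g, by rw [hv]; ring⟩ hev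
      rwa [show g = g' by omega]
  have hadd : ∀ x y, b (x + y) (x + y) = b x x + b y y + 2 * b x y := fun x y => by
    simp only [map_add, LinearMap.add_apply, hb y x]; ring
  have h1 := key f g hg hef
  by_cases hμ : (p : ℤ) ∣ b e e'
  · have h2 : (p : ℤ) ∣ b e' f :=
      (hpp.dvd_or_dvd ((dvd_sub_left (hμ.mul_left g)).1 h1)).resolve_left hef
    have h3 : (p : ℤ) ∣ b e f' := by
      by_contra h3
      have h4 := (dvd_sub_left (hμ.mul_left g')).1 (key f' g' hg' h3)
      exact (hpp.dvd_or_dvd h4).elim h3 hef'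
    have h5 : ¬ (p : ℤ) ∣ b e (f + f') := by rwa [map_add, dvd_add_left h3]
    have h6 := key (f + f') (g + g' + b f f') (by rw [hadd, hg, hg']; ring) h5
    refine (hpp.dvd_or_dvd ((dvd_sub_left (hμ.mul_left _)).1 h6)).elim h5 fun h7 => ?_
    rw [map_add, dvd_add_right h2] at h7
    exact hef' h7
  · have h2 := key (f + x) (g + i + b f x) (by rw [hadd, hg, hi]; ring)
      (by rwa [map_add, hex, add_zero])
    have h3 := key (f + y) (g + j + b f y) (by rw [hadd, hg, hj]; ring)
      (by rwa [map_add, hey, add_zero])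
    have h4 := key (f + x + y) (g + i + b f x + j + b f y + b x y)
      (by rw [hadd, hadd, hg, hi, hj, map_add, LinearMap.add_apply]; ring)
      (by rwa [map_add, map_add, hey, hex, add_zero, add_zero])
    refine (hpp.dvd_or_dvd (a := b x y) (b := b e e') ?_).elim hxy hμ
    have := dvd_sub (dvd_add h2 h3) (dvd_add h1 h4)
    simp only [map_add, hex, hey] at this
    ring_nf at this ⊢
    exact this

theorem exists_connecting_vector (hb : ∀ x y, b x y = b y x) {S : Finset ℕ}
    (hS : ∀ p ∈ S, p.Prime) (h2S : 2 ∈ S) {e f e' f' : Λ}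
    (hef : ∀ p ∈ S, ¬ (p : ℤ) ∣ b e f) (hf : Even (b f f))
    (hef' : ∀ p ∈ S, ¬ (p : ℤ) ∣ b e' f') (hf' : Even (b f' f'))
    (h : ∀ p ∈ S, ∃ x y, b e x = 0 ∧ b e y = 0 ∧ Even (b x x) ∧ Even (b y y) ∧
      ¬ (p : ℤ) ∣ b x y) :
    ∃ v g, b v v = 2 * g ∧ ∀ p ∈ S, ¬ (p : ℤ) ∣ b e v ∧
      ¬ (p : ℤ) ∣ b e v * b e' v - g * b e e' := by
  have hloc : ∀ p ∈ S, ∃ v, Even (b v v) ∧ ¬ (p : ℤ) ∣ b e v ∧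
      ∀ g, b v v = 2 * g → ¬ (p : ℤ) ∣ b e v * b e' v - g * b e e' := fun p hp => by
    obtain ⟨x, y, hx, hy, hxe, hye, hxy⟩ := h p hp
    exact exists_connecting_vector_local hb (hS p hp) (hef p hp) hf (hef' p hp) hf' hx hy hxe hye hxy
  choose! v₀ hv₀ hev₀ hq₀ using hloc
  obtain ⟨v, hv⟩ := exists_vector_crt hS 1 v₀
  have hnorm : ∀ x k (p : ℤ), b (x + p • k) (x + p • k) = b x x + 2 * (p * b x k) + p ^ 2 * b k k :=
    fun x k p => by
      simp only [map_add, map_smul, LinearMap.add_apply, LinearMap.smul_apply, smul_eq_mul, hb k x]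
      ring
  obtain ⟨g, hg⟩ : ∃ g, b v v = 2 * g := by
    obtain ⟨k, rfl⟩ := hv 2 h2S
    obtain ⟨g, hg⟩ := even_iff_exists_two_mul.1 (hv₀ 2 h2S)
    exact ⟨g + 2 * b (v₀ 2) k + 2 * b k k, by rw [pow_one, hnorm, hg]; push_cast; ring⟩
  refine ⟨v, g, hg, fun p hp => ?_⟩
  have hpp := Nat.prime_iff_prime_int.1 (hS p hp)
  obtain ⟨k, rfl⟩ := hv p hp
  rw [pow_one] at hg ⊢
  obtain ⟨g', hg'⟩ := even_iff_exists_two_mul.1 (hv₀ p hp)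
  have hgg : (p : ℤ) ∣ g - g' := by
    have h1 : 2 * (g - g') = p * (2 * b (v₀ p) k + p * b k k) := by
      rw [hnorm, hg'] at hg
      linear_combination -hg
    by_cases hp2 : p = 2
    · subst hp2
      exact ⟨b (v₀ 2) k + b k k, by push_cast at h1 ⊢; linarith⟩
    · exact (hpp.dvd_or_dvd (h1 ▸ dvd_mul_right _ _)).resolve_left (not_dvd_two (hS p hp) hp2)
  constructor
  · rw [map_add, map_smul, smul_eq_mul, dvd_add_left (dvd_mul_right _ _)]
    exact hev₀ p hp
  · intro h1
    refine hq₀ p hp g' hg' ?_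
    obtain ⟨l, hl⟩ := hgg
    have : b e (v₀ p) * b e' (v₀ p) - g' * b e e' =
        (b e (v₀ p + (p : ℤ) • k) * b e' (v₀ p + (p : ℤ) • k) - g * b e e') +
        p * (l * b e e' - b e (v₀ p) * b e' k - b e' (v₀ p) * b e k - p * (b e k * b e' k)) := by
      simp only [map_add, map_smul, smul_eq_mul]
      linear_combination (b e e') * hl
    rw [this]
    exact dvd_add h1 (dvd_mul_right _ _)

end LocalVector

set_option linter.unusedSectionVars false

section SemilocalWitt
variable {X : Type} [AddCommGroup X] [Module ℚ X] {B : X →ₗ[ℚ] X →ₗ[ℚ] ℚ} {d m : ℤ}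
  {Y : Submodule ℤ X}

/-- `τ` is an isometry that preserves `Y` at all primes dividing `m`. -/
structure IsLocIso (B : X →ₗ[ℚ] X →ₗ[ℚ] ℚ) (m : ℤ) (Y : Submodule ℤ X) (τ : X ≃ₗ[ℚ] X) : Prop where
  map_apply : ∀ x y, B (τ x) (τ y) = B x y
  zsmul_mem : ∃ N : ℤ, IsCoprime N m ∧ ∀ y ∈ Y, N • τ y ∈ Y ∧ N • τ.symm y ∈ Y

theorem IsLocIso.refl : IsLocIso B m Y (LinearEquiv.refl ℚ X) :=
  ⟨fun _ _ => rfl, 1, isCoprime_one_left, fun y hy => by simpa using hy⟩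

theorem IsLocIso.trans {τ τ' : X ≃ₗ[ℚ] X} (h : IsLocIso B m Y τ) (h' : IsLocIso B m Y τ') :
    IsLocIso B m Y (τ.trans τ') := by
  obtain ⟨h1, N, hN, h2⟩ := h
  obtain ⟨h1', N', hN', h2'⟩ := h'
  refine ⟨fun x y => ?_, N * N', hN.mul_left hN', fun y hy => ⟨?_, ?_⟩⟩
  · rw [LinearEquiv.trans_apply, LinearEquiv.trans_apply, h1', h1]
  · have := (h2' _ (h2 y hy).1).1
    rwa [map_zsmul, smul_smul, mul_comm] at this
  · have := (h2 _ (h2' y hy).2).2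
    rwa [map_zsmul, smul_smul] at this

/-- The reflection interchanging two isotropic vectors. -/
theorem exists_isLocIso_of_isotropic (hB : ∀ x y, B x y = B y x) (hY : IsLat B d Y) {c : ℤ}
    (hc : c ≠ 0) (hcm : IsCoprime c m) {u w : X} (hu : u ∈ Y) (hw : w ∈ Y) (huu : B u u = 0)
    (hww : B w w = 0) (huw : B u w = c) :
    ∃ τ, IsLocIso B m Y τ ∧ τ u = w ∧ ∀ z, B u z = 0 → B w z = 0 → τ z = z := by
  have hc0 : (c : ℚ) ≠ 0 := Int.cast_ne_zero.2 hc
  have hwu : B w u = c := by rw [hB, huw]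
  let F : X →ₗ[ℚ] X := LinearMap.id + (B (u - w)).smulRight ((c : ℚ)⁻¹ • (u - w))
  have hF : ∀ z, F z = z + (B (u - w) z * (c : ℚ)⁻¹) • (u - w) := fun z => by
    simp [F, smul_smul]
  have hss : B (u - w) (u - w) = -2 * c := by
    simp only [map_sub, LinearMap.sub_apply, huu, hww, huw, hwu]; ring
  have hBF : ∀ z, B (u - w) (F z) = -B (u - w) z := fun z => by
    rw [hF, map_add, map_smul, hss, smul_eq_mul]
    field_simp
    ring
  have hinv : Function.Involutive F := fun z => by
    rw [hF (F z), hBF, hF z, neg_mul, neg_smul, add_neg_cancel_right]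
  have hmem : ∀ y ∈ Y, c • F y ∈ Y := fun y hy => by
    obtain ⟨k, hk⟩ := hY.int _ (Y.sub_mem hu hw) y hy
    rw [hF, hk, smul_add, ← Int.cast_smul_eq_zsmul ℚ c (_ • _), smul_smul, mul_comm, mul_assoc,
      inv_mul_cancel₀ hc0, mul_one, Int.cast_smul_eq_zsmul]
    exact Y.add_mem (Y.smul_mem _ hy) (Y.smul_mem _ (Y.sub_mem hu hw))
  refine ⟨LinearEquiv.ofInvolutive F hinv, ⟨fun x y => ?_, c, hcm, fun y hy =>
    ⟨hmem y hy, hmem y hy⟩⟩, ?_, fun z hz hz' => ?_⟩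
  · change B (F x) (F y) = B x y
    rw [hF x, map_add, LinearMap.add_apply, map_smul, LinearMap.smul_apply, hBF, hF y, map_add,
      map_smul, hB x (u - w)]
    simp only [smul_eq_mul]
    ring
  · change F u = w
    rw [hF, map_sub, LinearMap.sub_apply, huu, hwu, zero_sub, neg_mul, mul_inv_cancel₀ hc0]
    simp
  · change F z = z
    rw [hF, map_sub, LinearMap.sub_apply, hz, hz']
    simp

theorem exists_isLocIso_map_isotropic (hB : ∀ x y, B x y = B y x) (hY : IsLat B d Y)
    (hm : m ≠ 0) (h2m : (2 : ℤ) ∣ m) {K : Submodule ℤ Y} {e f e' f' : K}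
    (hee : latForm hY e e = 0) (hee' : latForm hY e' e' = 0)
    (hef : IsCoprime (latForm hY e f) m) (hf : Even (latForm hY f f))
    (hef' : IsCoprime (latForm hY e' f') m) (hf' : Even (latForm hY f' f'))
    (h : ∀ p : ℕ, p.Prime → (p : ℤ) ∣ m → ∃ x y : K, latForm hY e x = 0 ∧ latForm hY e y = 0 ∧
      Even (latForm hY x x) ∧ Even (latForm hY y y) ∧ ¬ (p : ℤ) ∣ latForm hY x y) :
    ∃ τ, IsLocIso B m Y τ ∧ τ e' = (e : X) ∧
      ∀ z, (∀ x : K, B (x : X) z = 0) → τ z = z := by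
  have hmem : ∀ {p : ℕ}, p ∈ m.natAbs.primeFactors ↔ p.Prime ∧ (p : ℤ) ∣ m := fun {p} => by
    simp [Int.natCast_dvd, hm]
  have hnd : ∀ {c : ℤ}, IsCoprime c m → ∀ p ∈ m.natAbs.primeFactors, ¬ (p : ℤ) ∣ c :=
    fun hc p hp hpc => by
      rw [hmem] at hp
      exact (Nat.prime_iff_prime_int.1 hp.1).not_isUnit (hc.isUnit_of_dvd' hpc hp.2)
  have hcop : ∀ {c : ℤ}, (∀ p ∈ m.natAbs.primeFactors, ¬ (p : ℤ) ∣ c) → IsCoprime c m :=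
    fun hc => isCoprime_of_prime_not_dvd fun p hp hpc hpm => hc p (hmem.2 ⟨hp, hpm⟩) hpc
  have hne : ∀ {c : ℤ}, IsCoprime c m → c ≠ 0 := by
    rintro c hc rfl
    exact Int.prime_two.not_isUnit (isUnit_of_dvd_unit h2m (isCoprime_zero_left.1 hc))
  obtain ⟨v, g, hg, hv⟩ := exists_connecting_vector
    (b := (latForm hY).domRestrict₁₂ K K) (fun x y => latForm_symm hY hB x y)
    (S := m.natAbs.primeFactors) (fun p hp => (hmem.1 hp).1) (hmem.2 ⟨Nat.prime_two, h2m⟩)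
    (e := e) (f := f) (e' := e') (f' := f') (hnd hef) hf (hnd hef') hf'
    (fun p hp => h p (hmem.1 hp).1 (hmem.1 hp).2)
  simp only [LinearMap.domRestrict₁₂_apply] at hg hv
  have h1 := hcop fun p hp => (hv p hp).1
  have h2 := hcop fun p hp => (hv p hp).2
  have hs : ∀ x y : Y, latForm hY x y = latForm hY y x := latForm_symm hY hB
  set w : K := latForm hY e v • v - g • e with hw
  have hww : latForm hY w w = 0 := by
    simp only [hw, Submodule.coe_sub, Submodule.coe_smul, map_sub, map_smul, LinearMap.sub_apply,
      LinearMap.smul_apply, smul_eq_mul, hs v e, hee, hg]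
    ring
  have hwe : latForm hY w e = latForm hY e v * latForm hY e v := by
    simp only [hw, Submodule.coe_sub, Submodule.coe_smul, map_sub, map_smul, LinearMap.sub_apply,
      LinearMap.smul_apply, smul_eq_mul, hs v e, hee]
    ring
  have hwe' : latForm hY e' w = latForm hY e v * latForm hY e' v - g * latForm hY e e' := by
    simp only [hw, Submodule.coe_sub, Submodule.coe_smul, map_sub, map_smul, smul_eq_mul, hs e' e]
  have toB : ∀ {x y : Y} {c : ℤ}, latForm hY x y = c → B (x : X) y = c := fun {x y c} h => by
    rw [← latForm_apply hY, h]
  obtain ⟨τ, hτ, hτ1, hτ2⟩ := exists_isLocIso_of_isotropic hB hY (hne h2) h2 e'.1.2 w.1.2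
    (by simpa using toB hee') (by simpa using toB hww) (toB hwe')
  obtain ⟨τ', hτ', hτ1', hτ2'⟩ := exists_isLocIso_of_isotropic hB hY (mul_ne_zero (hne h1) (hne h1))
    (h1.mul_left h1) w.1.2 e.1.2 (by simpa using toB hww) (by simpa using toB hee) (toB hwe)
  refine ⟨τ.trans τ', hτ.trans hτ', by rw [LinearEquiv.trans_apply, hτ1, hτ1'], fun z hz => ?_⟩
  rw [LinearEquiv.trans_apply, hτ2 z (hz e') (hz w), hτ2' z (hz w) (hz e)]

/-- Semilocal Witt theorem for totally isotropic sublattices that split off. -/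
theorem exists_isLocIso_map_lagrangian (hB : ∀ x y, B x y = B y x) (hY : IsLat B d Y)
    (hm : m ≠ 0) (h2m : (2 : ℤ) ∣ m) {n : ℕ} {e f e' f' : Fin n → Y}
    (hee : ∀ i j, latForm hY (e i) (e j) = 0) (hee' : ∀ i j, latForm hY (e' i) (e' j) = 0)
    (hef : ∀ i j, latForm hY (e i) (f j) = if i = j then 1 else 0)
    (hef' : ∀ i j, latForm hY (e' i) (f' j) = if i = j then 1 else 0)
    (hf : ∀ i, Even (latForm hY (f i) (f i))) (hf' : ∀ i, Even (latForm hY (f' i) (f' i)))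
    (h : ∀ p : ℕ, p.Prime → (p : ℤ) ∣ m → ∃ x y : Y, (∀ i, latForm hY (e i) x = 0) ∧
      (∀ i, latForm hY (e i) y = 0) ∧
      Even (latForm hY x x) ∧ Even (latForm hY y y) ∧ ¬ (p : ℤ) ∣ latForm hY x y) :
    ∃ τ, IsLocIso B m Y τ ∧ ∀ i, ∃ c : ℚ, τ (e' i) = c • (e i : X) := by
  have hs : ∀ x y : Y, latForm hY x y = latForm hY y x := latForm_symm hY hB
  have key : ∀ k ≤ n, ∃ τ, IsLocIso B m Y τ ∧
      ∀ i : Fin n, (i : ℕ) < k → ∃ c : ℚ, τ (e' i) = c • (e i : X) := fun k => by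
    induction k with
    | zero => exact fun _ => ⟨_, .refl, fun i hi => (Nat.not_lt_zero _ hi).elim⟩
    | succ k ih =>
      intro hk
      obtain ⟨τ, hτ, hτe⟩ := ih (by omega)
      obtain ⟨N, hN, hNY⟩ := hτ.zsmul_mem
      set κ : Fin n := ⟨k, hk⟩ with hκ
      let K : Submodule ℤ Y := ⨅ i : {i : Fin n // (i : ℕ) < k}, LinearMap.ker (latForm hY (e i))
      have hK : ∀ {x : Y}, x ∈ K ↔ ∀ i : Fin n, (i : ℕ) < k → latForm hY (e i) x = 0 := by
        simp [K]
      have hform : ∀ x y : Y, latForm hY ⟨_, (hNY x x.2).1⟩ ⟨_, (hNY y y.2).1⟩ =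
          N ^ 2 * latForm hY x y := fun x y => Int.cast_injective (α := ℚ) (by
        push_cast
        simp only [latForm_apply, map_zsmul, LinearMap.smul_apply, zsmul_eq_mul, hτ.map_apply]
        ring)
      have hperp : ∀ x : Y, (∀ i : Fin n, (i : ℕ) < k → latForm hY (e' i) x = 0) →
          (⟨_, (hNY x x.2).1⟩ : Y) ∈ K := fun x hx => hK.2 fun i hi => by
        obtain ⟨c, hc⟩ := hτe i hi
        have hc0 : c ≠ 0 := by
          rintro rfl
          rw [zero_smul, LinearEquiv.map_eq_zero_iff] at hc
          have h1 := hef' i i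
          rw [if_pos rfl, Subtype.ext (a2 := (0 : Y)) hc, map_zero] at h1
          simp at h1
        have h2 : c * B (e i : X) (τ x) = 0 := by
          rw [← smul_eq_mul, ← LinearMap.smul_apply, ← map_smul, ← hc, hτ.map_apply,
            ← latForm_apply hY, hx i hi, Int.cast_zero]
        refine Int.cast_injective (α := ℚ) ?_
        rw [latForm_apply, map_zsmul, (mul_eq_zero.1 h2).resolve_left hc0]
        simp
      obtain ⟨τ', hτ', h1, h2⟩ := exists_isLocIso_map_isotropic hB hY hm h2m (K := K)
        (e := ⟨e κ, hK.2 fun i _ => hee i κ⟩)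
        (f := ⟨f κ, hK.2 fun i hi => by rw [hef, if_neg (by rintro rfl; simp [hκ] at hi)]⟩)
        (e' := ⟨_, hperp (e' κ) fun i _ => hee' i κ⟩)
        (f' := ⟨_, hperp (f' κ) fun i hi => by
          rw [hef', if_neg (by rintro rfl; simp [hκ] at hi)]⟩)
        (hee κ κ) (by rw [hform, hee', mul_zero])
        (by rw [hef, if_pos rfl]; exact isCoprime_one_left) (hf κ)
        (by rw [hform, hef', if_pos rfl, mul_one]; exact hN.pow_left)
        (by rw [hform]; exact (hf' κ).mul_left _)
        (fun p hp hpm => by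
          obtain ⟨x, y, hx, hy, hxy⟩ := h p hp hpm
          exact ⟨⟨x, hK.2 fun i _ => hx i⟩, ⟨y, hK.2 fun i _ => hy i⟩, hx κ, hy κ, hxy⟩)
      refine ⟨τ.trans τ', hτ.trans hτ', fun i hi => ?_⟩
      rcases Nat.lt_succ_iff_lt_or_eq.1 hi with hi | hi
      · obtain ⟨c, hc⟩ := hτe i hi
        refine ⟨c, ?_⟩
        rw [LinearEquiv.trans_apply, hc, map_smul, h2]
        intro x
        rw [← latForm_apply hY, hs, hK.1 x.2 i hi, Int.cast_zero]
      · obtain rfl : i = κ := Fin.ext hi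
        have hN0 : N ≠ 0 := by
          rintro rfl
          exact Int.prime_two.not_isUnit (isUnit_of_dvd_unit h2m (isCoprime_zero_left.1 hN))
        refine ⟨(N : ℚ)⁻¹, ?_⟩
        simp only [map_zsmul] at h1
        rw [LinearEquiv.trans_apply, ← h1, ← Int.cast_smul_eq_zsmul ℚ, smul_smul,
          inv_mul_cancel₀ (Int.cast_ne_zero.2 hN0), one_smul]
  obtain ⟨τ, hτ, h⟩ := key n le_rfl
  exact ⟨τ, hτ, fun i => h i i.2⟩

end SemilocalWitt

section Glue
variable {V V' : Type} [AddCommGroup V] [Module ℚ V] [AddCommGroup V'] [Module ℚ V']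
  {B : V →ₗ[ℚ] V →ₗ[ℚ] ℚ} {B' : V' →ₗ[ℚ] V' →ₗ[ℚ] ℚ} {d : ℤ} {L M : Submodule ℤ V}
  {L' : Submodule ℤ V'}

/-- The orthogonal sum of two bilinear forms. -/
def prodForm (B' : V' →ₗ[ℚ] V' →ₗ[ℚ] ℚ) (B : V →ₗ[ℚ] V →ₗ[ℚ] ℚ) :
    V' × V →ₗ[ℚ] V' × V →ₗ[ℚ] ℚ :=
  B'.compl₁₂ (LinearMap.fst ℚ V' V) (LinearMap.fst ℚ V' V) +
    B.compl₁₂ (LinearMap.snd ℚ V' V) (LinearMap.snd ℚ V' V)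

@[simp]
theorem prodForm_apply (x y : V' × V) : prodForm B' B x y = B' x.1 y.1 + B x.2 y.2 := rfl

theorem IsLat.mul (h : IsLat B d M) (c : ℤ) : IsLat B (c * d) M :=
  ⟨h.fg, h.span, h.int, fun x hx => by rw [mul_smul]; exact M.smul_mem _ (h.dual x hx)⟩

theorem IsLat.prod (h' : IsLat B' d L') (h : IsLat B d L) :
    IsLat (prodForm B' B) d (L'.prod L) where
  fg := h'.fg.prod h.fg
  span x := by
    obtain ⟨m, hm, hx⟩ := h'.span x.1
    obtain ⟨n, hn, hy⟩ := h.span x.2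
    refine ⟨m * n, mul_ne_zero hm hn, ?_, ?_⟩
    · rw [Prod.smul_fst, mul_comm, mul_smul]
      exact L'.smul_mem _ hx
    · rw [Prod.smul_snd, mul_smul]
      exact L.smul_mem _ hy
  int x hx y hy := by
    obtain ⟨i, hi⟩ := h'.int _ hx.1 _ hy.1
    obtain ⟨j, hj⟩ := h.int _ hx.2 _ hy.2
    exact ⟨i + j, by rw [prodForm_apply, hi, hj, Int.cast_add]⟩
  dual x hx := by
    refine ⟨h'.dual _ fun y hy => ?_, h.dual _ fun y hy => ?_⟩
    · simpa using hx (y, 0) ⟨hy, L.zero_mem⟩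
    · simpa using hx (0, y) ⟨L'.zero_mem, hy⟩

theorem IsLat.map (h : IsLat B' d L') (σ : V' ≃ₗ[ℚ] V) (hσ : ∀ x y, B (σ x) (σ y) = B' x y) :
    IsLat B d (L'.map (σ.toLinearMap.restrictScalars ℤ)) where
  fg := h.fg.map _
  span x := by
    obtain ⟨n, hn, hx⟩ := h.span (σ.symm x)
    refine ⟨n, hn, _, hx, ?_⟩
    simp
  int := by
    rintro _ ⟨x, hx, rfl⟩ _ ⟨y, hy, rfl⟩
    simpa [hσ] using h.int x hx y hy
  dual x hx := by
    refine ⟨_, h.dual (σ.symm x) fun y hy => ?_, by simp⟩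
    have := hx (σ y) ⟨y, hy, rfl⟩
    rwa [← σ.apply_symm_apply x, hσ] at this

/-- The orthogonal complement of a lagrangian subspace is totally isotropic. -/
theorem eq_zero_of_orthogonal_lagrangian [FiniteDimensional ℚ V] {n : ℕ}
    (hn : Module.finrank ℚ V = 2 * n) (hB : ∀ x y, B x y = B y x)
    (hnd : ∀ x, (∀ y, B x y = 0) → x = 0) {e f : Fin n → V} (hee : ∀ i j, B (e i) (e j) = 0)
    (hef : ∀ i j, B (e i) (f j) = if i = j then 1 else 0) {x y : V}
    (hx : ∀ i, B (e i) x = 0) (hy : ∀ i, B (e i) y = 0) : B x y = 0 := by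
  have hli : LinearIndependent ℚ e := by
    rw [Fintype.linearIndependent_iff]
    intro g hg j
    have := congrArg (fun z => B z (f j)) hg
    simpa [hef] using this
  let W := Submodule.span ℚ (Set.range e)
  have hW : Module.finrank ℚ W = n := by
    rw [finrank_span_eq_card hli, Fintype.card_fin]
  have hrefl : LinearMap.IsRefl B := fun x y h => by rw [hB, h]
  have hBn : LinearMap.BilinForm.Nondegenerate B :=
    ⟨fun x h => hnd x h, fun x h => hnd x fun y => by rw [hB]; exact h y⟩
  have hmem : ∀ z, z ∈ LinearMap.BilinForm.orthogonal B W ↔ ∀ i, B (e i) z = 0 := fun z => by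
    rw [LinearMap.BilinForm.mem_orthogonal_iff]
    refine ⟨fun h i => h _ (Submodule.subset_span ⟨i, rfl⟩), fun h w hw => ?_⟩
    induction hw using Submodule.span_induction with
    | mem w hw => obtain ⟨i, rfl⟩ := hw; exact h i
    | zero => simp
    | add v w _ _ hv hw => simp_all
    | smul c w _ hw => simp_all
  have hle : W ≤ LinearMap.BilinForm.orthogonal B W := by
    rw [Submodule.span_le]
    rintro _ ⟨i, rfl⟩
    exact (hmem _).2 fun j => hee j i
  have heq := Submodule.eq_of_le_of_finrank_eq hle (by
    rw [LinearMap.BilinForm.finrank_orthogonal hBn, hW, hn]; omega)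
  have hxW : x ∈ W := heq ▸ (hmem x).2 hx
  exact (LinearMap.BilinForm.mem_orthogonal_iff.1 ((hmem y).2 hy)) x hxW

variable [FiniteDimensional ℚ V] [FiniteDimensional ℚ V'] {N : Submodule ℤ (V' × V)} {n : ℕ}

theorem exists_dual_family_of_glue (hN : IsLat (prodForm B' (-B)) 1 N)
    (hsym : ∀ x y, prodForm B' (-B) x y = prodForm B' (-B) y x)
    (hnd : ∀ x, (∀ y, prodForm B' (-B) x y = 0) → x = 0)
    (h2 : ∀ u, ((0, u) : V' × V) ∈ N ↔ u ∈ L) (l : Module.Basis (Fin n) ℤ L) :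
    ∃ f : Fin n → N, ∀ i j, latForm hN ⟨(0, (l i : V)), (h2 _).2 (l i).2⟩ (f j) =
      if i = j then 1 else 0 := by
  have := hN.moduleFinite
  have : Module.IsTorsionFree ℤ V' := Module.IsTorsionFree.trans_faithfulSMul ℤ ℚ V'
  let q : N →ₗ[ℤ] V' := (LinearMap.fst ℤ V' V) ∘ₗ N.subtype
  have : Module.Free ℤ (LinearMap.range q) := inferInstance
  obtain ⟨s, hs⟩ := q.rangeRestrict.exists_rightInverse_of_surjective q.range_rangeRestrict
  have hs' : ∀ x : N, q (s (q.rangeRestrict x)) = q x := fun x =>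
    congrArg Subtype.val (LinearMap.congr_fun hs (q.rangeRestrict x))
  let g : N →ₗ[ℤ] L := LinearMap.codRestrict L
    ((LinearMap.snd ℤ V' V) ∘ₗ N.subtype ∘ₗ (LinearMap.id - s ∘ₗ q.rangeRestrict)) fun x => by
      rw [← h2]
      have hx := (x - s (q.rangeRestrict x)).2
      have h0 : (x - s (q.rangeRestrict x) : V' × V).1 = 0 := by
        have := hs' x
        simp only [q, LinearMap.comp_apply, Submodule.subtype_apply, LinearMap.fst_apply] at this
        rw [Prod.fst_sub, this, sub_self]
      have : ((0, (x - s (q.rangeRestrict x) : V' × V).2) : V' × V) =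
        (x - s (q.rangeRestrict x) : V' × V) := Prod.ext h0.symm rfl
      exact this ▸ hx
  have hg : ∀ i, g ⟨(0, (l i : V)), (h2 _).2 (l i).2⟩ = l i := fun i => by
    have h0 : q.rangeRestrict ⟨(0, (l i : V)), (h2 _).2 (l i).2⟩ = 0 := Subtype.ext rfl
    refine Subtype.ext ?_
    simp [g, h0]
  choose f hf using fun j => latForm_dualBound hN hnd (l.coord j ∘ₗ g)
  refine ⟨f, fun i j => ?_⟩
  rw [latForm_symm hN hsym, hf, one_mul, LinearMap.comp_apply, hg]
  simp [Finsupp.single_apply]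


theorem exists_even_shift {Y : Type} [AddCommGroup Y] {b : Y →ₗ[ℤ] Y →ₗ[ℤ] ℤ}
    (hb : ∀ x y, b x y = b y x) (x : Y) {z : Y} (hz : Odd (b z z)) :
    ∃ c : ℤ, Even (b (x + c • z) (x + c • z)) := by
  rcases Int.even_or_odd (b x x) with h | h
  · exact ⟨0, by simpa using h⟩
  · refine ⟨1, ?_⟩
    have : b (x + (1 : ℤ) • z) (x + (1 : ℤ) • z) = b x x + b z z + 2 * b x z := by
      simp only [one_smul, map_add, LinearMap.add_apply, hb z x]
      ring
    exact this ▸ (h.add_odd hz).add (even_two_mul _)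

/-- Two odd lattices that are glued to a split unimodular lattice are locally isometric. -/
theorem exists_locEq_map_of_glue (hB : ∀ x y, B x y = B y x) (hB' : ∀ x y, B' x y = B' y x)
    (hnd : ∀ x, (∀ y, B x y = 0) → x = 0) (hnd' : ∀ x, (∀ y, B' x y = 0) → x = 0)
    (hV : Module.finrank ℚ V = n) (hV' : Module.finrank ℚ V' = n) (hd : d ≠ 0)
    (hL : IsLat B d L) (hL' : IsLat B' d L') (hodd : ∃ x, Odd (latForm hL x x))
    (hodd' : ∃ x, Odd (latForm hL' x x)) (hr : ∀ p : ℕ, p.Prime → ResidualRankGT (latForm hL) p 2)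
    (hN : IsLat (prodForm B' (-B)) 1 N) (h1 : ∀ u, ((u, 0) : V' × V) ∈ N ↔ u ∈ L')
    (h2 : ∀ u, ((0, u) : V' × V) ∈ N ↔ u ∈ L) (hpos : DefiniteRank (latForm hN) 1 n)
    (hneg : DefiniteRank (latForm hN) (-1) n) :
    ∃ σ : V' ≃ₗ[ℚ] V, (∀ x y, B (σ x) (σ y) = B' x y) ∧
      LocEq (2 * d) L (L'.map (σ.toLinearMap.restrictScalars ℤ)) := by
  have hCsym : ∀ x y, prodForm B' (-B) x y = prodForm B' (-B) y x := fun x y => by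
    simp [hB x.2, hB' x.1]
  have hCnd : ∀ x, (∀ y, prodForm B' (-B) x y = 0) → x = 0 := fun x h =>
    Prod.ext (hnd' _ fun y => by simpa using h (y, 0)) (hnd _ fun y => by simpa using h (0, y))
  have hDsym : ∀ x y, prodForm (prodForm B' (-B)) B x y = prodForm (prodForm B' (-B)) B y x :=
    fun x y => by simp [hB x.2, hCsym x.1, -prodForm_apply, prodForm_apply x, prodForm_apply y]
  have hVV : Module.finrank ℚ (V' × V) = 2 * n := by
    rw [Module.finrank_prod, hV, hV', two_mul]
  have hY := IsLat.prod (show IsLat (prodForm B' (-B)) d N by simpa using hN.mul d) hL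
  have := hL.moduleFinite
  have := hL.moduleFree
  have := hN.moduleFinite
  have := hN.moduleFree
  obtain ⟨e, f, hee, hef⟩ := exists_lagrangian n (by rw [hN.finrank_eq, hVV])
    (latForm_symm hN hCsym) (latForm_dualBound hN hCnd) hpos hneg
  let l := Module.finBasisOfFinrankEq ℤ L (hL.finrank_eq.trans hV)
  obtain ⟨g, hg⟩ := exists_dual_family_of_glue hN hCsym hCnd h2 l
  obtain ⟨z, hz⟩ := hodd
  obtain ⟨z', hz'⟩ := hodd'
  let Y := N.prod L
  have hYapp : ∀ x y : Y, (latForm hY x y : ℚ) =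
    prodForm B' (-B) (x : (V' × V) × V).1 (y : (V' × V) × V).1 +
      B (x : (V' × V) × V).2 (y : (V' × V) × V).2 := latForm_apply hY
  let ι : N → Y := fun x => ⟨((x : V' × V), 0), x.2, L.zero_mem⟩
  let κ : L → Y := fun x => ⟨(0, (x : V)), N.zero_mem, x.2⟩
  let w : Y := ι ⟨(z', 0), (h1 _).2 z'.2⟩
  have hιι : ∀ x y, latForm hY (ι x) (ι y) = latForm hN x y := fun x y =>
    Int.cast_injective (α := ℚ) (by rw [hYapp, latForm_apply]; simp [ι])
  have hκκ : ∀ x y, latForm hY (κ x) (κ y) = latForm hL x y := fun x y =>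
    Int.cast_injective (α := ℚ) (by rw [hYapp, latForm_apply]; simp [κ])
  have hικ : ∀ x y, latForm hY (ι x) (κ y) = 0 := fun x y =>
    Int.cast_injective (α := ℚ) (by rw [hYapp]; simp [ι, κ])
  have hww : Odd (latForm hY w w) := by
    have : latForm hY w w = latForm hL' z' z' :=
      Int.cast_injective (α := ℚ) (by rw [hYapp, latForm_apply]; simp [w, ι])
    rwa [this]
  have hzz : Odd (latForm hY (κ z) (κ z)) := by rwa [hκκ]
  have hYs := latForm_symm hY hDsym
  choose c hc using fun i => exists_even_shift hYs (ι (f i)) hzz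
  choose c' hc' using fun i => exists_even_shift hYs (ι (g i)) hww
  let e' : Fin n → Y := fun i => ⟨((0, (l i : V)), l i), (h2 _).2 (l i).2, (l i).2⟩
  have hYadd : ∀ x y y' : Y, ∀ k : ℤ, latForm hY x (y + k • y') =
    latForm hY x y + k * latForm hY x y' := fun x y y' k => by simp
  obtain ⟨τ, hτ, hτe⟩ := exists_isLocIso_map_lagrangian (m := 2 * d) (e := fun i => ι (e i))
    (f := fun i => ι (f i) + c i • κ z) (e' := e') (f' := fun i => ι (g i) + c' i • w)
    hDsym hY (mul_ne_zero two_ne_zero hd) (dvd_mul_right _ _)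
    (fun i j => by rw [hιι, hee]) (fun i j => Int.cast_injective (α := ℚ) (by
      rw [hYapp]; simp [e']))
    (fun i j => by rw [hYadd, hιι, hικ, hef, mul_zero, add_zero])
    (fun i j => by
      have h3 : latForm hY (e' i) w = 0 := Int.cast_injective (α := ℚ) (by
        rw [hYapp]; simp [e', w, ι])
      have h4 : latForm hY (e' i) (ι (g j)) = if i = j then 1 else 0 :=
        (Int.cast_injective (α := ℚ) (by
          rw [hYapp, latForm_apply]; simp [e', ι])).trans (hg i j)
      rw [hYadd, h3, h4, mul_zero, add_zero]) hc hc'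
    (fun p hp _ => by
      obtain ⟨x, y, hx, hy, hxy⟩ := (hr p hp).exists_even_pair (latForm_symm hL hB) hp
      exact ⟨κ x, κ y, fun i => hικ _ _, fun i => hικ _ _, by rwa [hκκ], by rwa [hκκ],
        by rwa [hκκ]⟩)
  obtain ⟨hτB, k, hk, hkY⟩ := hτ
  choose r hr using hτe
  have hr' : ∀ i, τ ((0, (l i : V)), l i) = r i • ((e i : V' × V), (0 : V)) := hr
  have hr0 : ∀ i, r i ≠ 0 := fun i h0 => l.ne_zero i (Subtype.ext (by
    have := hr' i
    rw [h0, zero_smul, τ.map_eq_zero_iff] at this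
    exact congrArg Prod.snd this))
  have hbasis : ∀ {W : Type} [AddCommGroup W] [Module ℚ W] (F : V →ₗ[ℚ] W),
      (∀ i, F (l i) = 0) → F = 0 := fun F hF => ratLinearMap_ext hL.span fun x hx => by
    have : (F.restrictScalars ℤ) ∘ₗ L.subtype = 0 := l.ext fun i => hF i
    exact LinearMap.congr_fun this ⟨x, hx⟩
  have hdiag : ∀ v : V, (τ ((0, v), v)).2 = 0 := LinearMap.congr_fun
    (hbasis ((LinearMap.snd ℚ (V' × V) V) ∘ₗ τ.toLinearMap ∘ₗ
      ((LinearMap.inr ℚ V' V).prod LinearMap.id)) fun i => by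
        simp [hr'])
  have hperp : ∀ i x, B (l i) (x.2 - x.1.2) = r i * prodForm B' (-B) (e i) (τ x).1 := fun i x => by
    have := hτB ((0, (l i : V)), l i) x
    rw [hr' i, prodForm_apply, prodForm_apply] at this
    simp only [Prod.smul_fst, Prod.smul_snd, map_smul, LinearMap.smul_apply, smul_zero, map_zero,
      LinearMap.zero_apply, add_zero, smul_eq_mul] at this
    simp only [prodForm_apply, map_zero, LinearMap.zero_apply, LinearMap.neg_apply, map_sub]
      at this ⊢
    linear_combination -this
  have hperp' : ∀ v' i, prodForm B' (-B) (e i) (τ ((v', 0), 0)).1 = 0 := fun v' i => by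
    have := hperp i ((v', 0), 0)
    rw [sub_zero, map_zero, eq_comm, mul_eq_zero] at this
    exact this.resolve_left (hr0 i)
  let σ₀ : V' →ₗ[ℚ] V := (LinearMap.snd ℚ (V' × V) V) ∘ₗ τ.toLinearMap ∘ₗ
    (LinearMap.inl ℚ (V' × V) V) ∘ₗ LinearMap.inl ℚ V' V
  have hσ₀ : ∀ x y, B (σ₀ x) (σ₀ y) = B' x y := fun x y => by
    have h3 := hτB ((x, 0), 0) ((y, 0), 0)
    have h4 := eq_zero_of_orthogonal_lagrangian (f := fun i => (f i : V' × V)) hVV hCsym hCnd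
      (fun i j => by rw [← latForm_apply hN, hee, Int.cast_zero])
      (fun i j => by rw [← latForm_apply hN, hef]; simp) (hperp' x) (hperp' y)
    rw [prodForm_apply, h4, zero_add] at h3
    refine h3.trans ?_
    simp
  have hinj : Function.Injective σ₀ := (injective_iff_map_eq_zero _).2 fun x hx =>
    hnd' x fun y => by rw [← hσ₀, hx, map_zero, LinearMap.zero_apply]
  let σ := σ₀.linearEquivOfInjective hinj (hV'.trans hV.symm)
  refine ⟨σ, hσ₀, k, hk, fun x hx => ?_, ?_⟩
  · set z := τ.symm ((0, 0), x) with hz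
    have hz2 : z.2 = z.1.2 := by
      rw [← sub_eq_zero]
      refine hnd _ (LinearMap.congr_fun (hbasis (B (z.2 - z.1.2)) fun i => ?_))
      rw [hB, hperp, hz, τ.apply_symm_apply, Prod.mk_zero_zero, map_zero, mul_zero]
    have hzY : k • z ∈ N.prod L := (hkY _ ⟨N.zero_mem, hx⟩).2
    refine ⟨k • z.1.1, (h1 _).1 ?_, ?_⟩
    · have := N.sub_mem hzY.1 ((h2 _).2 hzY.2)
      convert this using 1
      ext <;> simp [hz2]
    · have h3 : (((z.1.1, 0), 0) : (V' × V) × V) = z - ((0, z.2), z.2) := by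
        ext <;> simp [hz2]
      have h4 : σ₀ z.1.1 = x := by
        change (τ ((z.1.1, 0), 0)).2 = x
        rw [h3, map_sub, Prod.snd_sub, hdiag, sub_zero, hz, τ.apply_symm_apply]
      exact (map_zsmul σ₀ k z.1.1).trans (congrArg (k • ·) h4)
  · rintro _ ⟨x, hx, rfl⟩
    exact (hkY ((x, 0), 0) ⟨(h1 x).2 hx, L.zero_mem⟩).1.2

end Glue

section Signature
variable {n : ℕ}

theorem abs_dotProduct_mulVec_sub_lt {T : Matrix (Fin n) (Fin n) ℝ} {d : Fin n → ℝ}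
    (hT : ∀ i j, |T i j - diagonal d i j| < 1 / (n + 1)) {c : Fin n → ℝ} (hc : c ≠ 0) :
    |c ⬝ᵥ T *ᵥ c - ∑ i, d i * c i ^ 2| < ∑ i, c i ^ 2 := by
  have h0 : 0 < ∑ i, c i ^ 2 := by
    obtain ⟨i, hi⟩ := Function.ne_iff.1 hc
    exact Finset.sum_pos' (fun i _ => sq_nonneg _) ⟨i, Finset.mem_univ _, (sq_pos_of_ne_zero hi)⟩
  have h1 : c ⬝ᵥ T *ᵥ c - ∑ i, d i * c i ^ 2 =
      ∑ i, ∑ j, (T i j - diagonal d i j) * (c i * c j) := by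
    simp only [sub_mul, Finset.sum_sub_distrib, dotProduct, mulVec, Finset.mul_sum]
    congr 1
    · exact Finset.sum_congr rfl fun i _ => Finset.sum_congr rfl fun j _ => by ring
    · refine Finset.sum_congr rfl fun i _ => ?_
      rw [Finset.sum_eq_single i (fun j _ hj => by rw [diagonal_apply_ne' _ hj, zero_mul])
        (by simp), diagonal_apply_eq]
      ring
  have h2 : |c ⬝ᵥ T *ᵥ c - ∑ i, d i * c i ^ 2| ≤
      ∑ i, ∑ j, 1 / ((n : ℝ) + 1) * ((c i ^ 2 + c j ^ 2) / 2) := by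
    rw [h1]
    refine (Finset.abs_sum_le_sum_abs _ _).trans (Finset.sum_le_sum fun i _ =>
      (Finset.abs_sum_le_sum_abs _ _).trans (Finset.sum_le_sum fun j _ => ?_))
    rw [abs_mul]
    refine mul_le_mul (hT i j).le ?_ (abs_nonneg _) (by positivity)
    rw [abs_le]
    constructor <;> nlinarith [sq_nonneg (c i + c j), sq_nonneg (c i - c j)]
  refine h2.trans_lt ?_
  have h3 : ∑ i, ∑ j, 1 / ((n : ℝ) + 1) * ((c i ^ 2 + c j ^ 2) / 2) =
      n / (n + 1) * ∑ i, c i ^ 2 := by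
    simp only [← Finset.mul_sum, ← Finset.sum_div, Finset.sum_add_distrib, Finset.sum_const,
      Finset.card_univ, Fintype.card_fin, nsmul_eq_mul]
    ring
  rw [h3]
  refine (mul_lt_iff_lt_one_left h0).2 ?_
  rw [div_lt_one (by positivity)]
  linarith

theorem exists_rat_matrix_approx (A P : Matrix (Fin n) (Fin n) ℝ) {ε : ℝ} (hε : 0 < ε) :
    ∃ Q : Matrix (Fin n) (Fin n) ℚ, ∀ i j,
      |((Q.map (Rat.cast : ℚ → ℝ))ᵀ * A * Q.map (Rat.cast : ℚ → ℝ)) i j - (Pᵀ * A * P) i j| < ε := by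
  have hd : DenseRange (fun (Q : Fin n → Fin n → ℚ) i j => (Q i j : ℝ)) :=
    DenseRange.piMap fun _ => DenseRange.piMap fun _ => Rat.denseRange_cast
  have hc : ∀ i j, Continuous fun Q : Fin n → Fin n → ℝ =>
      |((Matrix.of Q)ᵀ * A * Matrix.of Q) i j - (Pᵀ * A * P) i j| := fun i j => by
    simp only [Matrix.mul_apply, Matrix.transpose_apply, Matrix.of_apply]
    fun_prop
  have : {Q : Fin n → Fin n → ℝ | ∀ i j,
      |((Matrix.of Q)ᵀ * A * Matrix.of Q) i j - (Pᵀ * A * P) i j| < ε} ∈ nhds (P : _ → _ → ℝ) := by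
    refine Filter.eventually_all.2 fun i => Filter.eventually_all.2 fun j => ?_
    refine (hc i j).continuousAt.eventually_lt continuousAt_const ?_
    change |(Pᵀ * A * P) i j - (Pᵀ * A * P) i j| < ε
    simpa using hε
  obtain ⟨Q, hQ⟩ := hd.mem_nhds this
  exact ⟨Q, hQ⟩

theorem exists_int_multiple (Q : Matrix (Fin n) (Fin n) ℚ) :
    ∃ (D : ℤ) (Z : Matrix (Fin n) (Fin n) ℤ), D ≠ 0 ∧ ∀ i j, (Z i j : ℚ) = D * Q i j := by
  obtain ⟨D, hD⟩ := IsLocalization.exist_integer_multiples_of_finite (nonZeroDivisors ℤ)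
    fun ij : Fin n × Fin n => Q ij.1 ij.2
  choose Z hZ using hD
  refine ⟨D, fun i j => Z (i, j), nonZeroDivisors.coe_ne_zero D, fun i j => ?_⟩
  have := hZ (i, j)
  rwa [eq_intCast, Algebra.smul_def, eq_intCast] at this

/-- A form of signature `(p, q)` is definite on coordinate sublattices of ranks `p` and `q`. -/
theorem HasSignature.exists_definite {G : Matrix (Fin n) (Fin n) ℤ} {p q : ℕ}
    (h : HasSignature G p q) : ∃ (S : Finset (Fin n)) (Z : Matrix (Fin n) (Fin n) ℤ), S.card = p ∧
      (∀ c, c ≠ 0 → (∀ i ∉ S, c i = 0) → 0 < Z *ᵥ c ⬝ᵥ G *ᵥ (Z *ᵥ c)) ∧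
      ∀ c, c ≠ 0 → (∀ i ∈ S, c i = 0) → Z *ᵥ c ⬝ᵥ G *ᵥ (Z *ᵥ c) < 0 := by
  obtain ⟨P, d, -, hd, hp, -, hP⟩ := h
  set A : Matrix (Fin n) (Fin n) ℝ := G.map (Int.cast : ℤ → ℝ) with hA
  obtain ⟨Q, hQ⟩ := exists_rat_matrix_approx A P (ε := 1 / ((n : ℝ) + 1)) (by positivity)
  obtain ⟨D, Z, hD, hZ⟩ := exists_int_multiple Q
  rw [hP] at hQ
  have hD0 : (0 : ℝ) < (D : ℝ) ^ 2 := by positivity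
  have key : ∀ c : Fin n → ℤ, c ≠ 0 →
      |((Z *ᵥ c ⬝ᵥ G *ᵥ (Z *ᵥ c) : ℤ) : ℝ) - D ^ 2 * ∑ i, d i * (c i : ℝ) ^ 2| <
        D ^ 2 * ∑ i, (c i : ℝ) ^ 2 := fun c hc => by
    have hc' : (fun i => (c i : ℝ)) ≠ 0 := fun h => hc (funext fun i => by
      simpa using congrFun h i)
    have h1 := abs_dotProduct_mulVec_sub_lt hQ hc'
    have h2 : ((Z *ᵥ c ⬝ᵥ G *ᵥ (Z *ᵥ c) : ℤ) : ℝ) = D ^ 2 * ((fun i => (c i : ℝ)) ⬝ᵥ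
        ((Q.map (Rat.cast : ℚ → ℝ))ᵀ * A * Q.map (Rat.cast : ℚ → ℝ)) *ᵥ fun i => (c i : ℝ)) := by
      set Q' := Q.map (Rat.cast : ℚ → ℝ) with hQ'
      have hZc : (fun i => ((Z *ᵥ c) i : ℝ)) = (D : ℝ) • Q' *ᵥ fun i => (c i : ℝ) := by
        funext i
        simp only [mulVec, dotProduct, Int.cast_sum, Int.cast_mul, Pi.smul_apply, smul_eq_mul,
          Finset.mul_sum, hQ', map_apply]
        refine Finset.sum_congr rfl fun j _ => ?_
        rw [← mul_assoc]
        congr 1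
        exact_mod_cast congrArg (Rat.cast : ℚ → ℝ) (hZ i j)
      have hcast : ∀ z : Fin n → ℤ, ((z ⬝ᵥ G *ᵥ z : ℤ) : ℝ) =
          (fun i => (z i : ℝ)) ⬝ᵥ A *ᵥ fun i => (z i : ℝ) := fun z => by
        simp [dotProduct, mulVec, hA]
      rw [hcast, hZc, mulVec_smul, smul_dotProduct, dotProduct_smul, smul_smul, smul_eq_mul,
        ← sq, ← mulVec_mulVec, ← mulVec_mulVec, mulVec_transpose,
        dotProduct_comm (fun i => (c i : ℝ)), ← dotProduct_mulVec, dotProduct_comm]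
    rw [h2, ← mul_sub, abs_mul, abs_of_pos hD0]
    exact (mul_lt_mul_iff_right₀ hD0).2 h1
  refine ⟨_, Z, hp, fun c hc hcS => ?_, fun c hc hcS => ?_⟩
  · have h1 := (abs_lt.1 (key c hc)).1
    have h2 : ∑ i, d i * (c i : ℝ) ^ 2 = ∑ i, (c i : ℝ) ^ 2 := Finset.sum_congr rfl fun i _ => by
      by_cases hi : d i = 1
      · rw [hi, one_mul]
      · rw [hcS i (by simpa using hi)]; simp
    rw [h2] at h1
    exact Int.cast_pos (R := ℝ).1 (by linarith)
  · have h1 := (abs_lt.1 (key c hc)).2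
    have h2 : ∑ i, d i * (c i : ℝ) ^ 2 = -∑ i, (c i : ℝ) ^ 2 := by
      rw [← Finset.sum_neg_distrib]
      refine Finset.sum_congr rfl fun i _ => ?_
      rcases hd i with hi | hi
      · rw [hcS i (by simpa using hi)]; simp
      · rw [hi, neg_one_mul]
    rw [h2] at h1
    exact Int.cast_lt_zero (R := ℝ).1 (by linarith)

end Signature

section MatrixLattices
variable {n : ℕ}

/-- The rational bilinear form with Gram matrix `G`. -/
noncomputable def matForm (G : Matrix (Fin n) (Fin n) ℤ) :
    (Fin n → ℚ) →ₗ[ℚ] (Fin n → ℚ) →ₗ[ℚ] ℚ :=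
  Matrix.toLinearMap₂' ℚ (G.map (Int.cast : ℤ → ℚ))

/-- The standard lattice `ℤⁿ` in `ℚⁿ`. -/
def stdLat (n : ℕ) : Submodule ℤ (Fin n → ℚ) :=
  LinearMap.range ((Int.castAddHom ℚ).toIntLinearMap.compLeft (Fin n))

theorem mem_stdLat {x : Fin n → ℚ} : x ∈ stdLat n ↔ ∃ u, ratify u = x := Iff.rfl

theorem ratify_mem_stdLat (u : Fin n → ℤ) : ratify u ∈ stdLat n := ⟨u, rfl⟩

theorem ratify_injective : Function.Injective (ratify (n := n)) := fun _ _ h =>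
  funext fun i => Int.cast_injective (congrFun h i)

@[simp]
theorem ratify_add (u v : Fin n → ℤ) : ratify (u + v) = ratify u + ratify v :=
  funext fun _ => Int.cast_add _ _

@[simp]
theorem ratify_sub (u v : Fin n → ℤ) : ratify (u - v) = ratify u - ratify v :=
  funext fun _ => Int.cast_sub _ _

@[simp]
theorem ratify_smul (c : ℤ) (u : Fin n → ℤ) : ratify (c • u) = c • ratify u :=
  funext fun _ => by simp [ratify]

@[simp]
theorem ratify_zero : ratify (0 : Fin n → ℤ) = 0 := funext fun _ => Int.cast_zero

theorem ratify_mulVec (G : Matrix (Fin n) (Fin n) ℤ) (u : Fin n → ℤ) :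
    ratify (G *ᵥ u) = G.map (Int.cast : ℤ → ℚ) *ᵥ ratify u :=
  funext fun _ => by simp [ratify, mulVec, dotProduct]

theorem ratify_dotProduct (u v : Fin n → ℤ) : ratify u ⬝ᵥ ratify v = ((u ⬝ᵥ v : ℤ) : ℚ) := by
  simp [ratify, dotProduct]

variable {G : Matrix (Fin n) (Fin n) ℤ}

theorem matForm_apply (x y : Fin n → ℚ) :
    matForm G x y = x ⬝ᵥ G.map (Int.cast : ℤ → ℚ) *ᵥ y :=
  Matrix.toLinearMap₂'_apply' _ _ _

theorem matForm_ratify (u v : Fin n → ℤ) : matForm G (ratify u) (ratify v) =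
    ((u ⬝ᵥ G *ᵥ v : ℤ) : ℚ) := by
  rw [matForm_apply, ← ratify_mulVec, ratify_dotProduct]

theorem matForm_symm (hs : Gᵀ = G) (x y : Fin n → ℚ) : matForm G x y = matForm G y x := by
  rw [matForm_apply, matForm_apply, dotProduct_mulVec, ← mulVec_transpose, ← transpose_map, hs,
    dotProduct_comm]

theorem det_map_ne_zero (hdet : G.det ≠ 0) : IsUnit (G.map (Int.cast : ℤ → ℚ)).det := by
  have : (G.map (Int.cast : ℤ → ℚ)).det = G.det := ((Int.castRingHom ℚ).map_det G).symm
  rw [this, isUnit_iff_ne_zero]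
  exact Int.cast_ne_zero.2 hdet

theorem forall_dotProduct_int {x : Fin n → ℚ} (h : ∀ u, ∃ k : ℤ, ratify u ⬝ᵥ x = k) :
    ∃ u, ratify u = x := by
  choose k hk using h
  refine ⟨fun i => k (Pi.single i 1), funext fun i => ?_⟩
  have : ratify (Pi.single i 1) = Pi.single i (1 : ℚ) := by
    funext j
    by_cases h : j = i
    · subst h; simp [ratify]
    · simp [ratify, h]
  have h2 := hk (Pi.single i 1)
  rw [this, single_one_dotProduct] at h2
  exact h2.symm

theorem matForm_nondegenerate (hdet : G.det ≠ 0) (hs : Gᵀ = G) (x : Fin n → ℚ)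
    (h : ∀ y, matForm G x y = 0) : x = 0 := by
  have h1 : G.map (Int.cast : ℤ → ℚ) *ᵥ x = 0 := by
    refine dotProduct_eq_zero _ fun y => ?_
    rw [dotProduct_comm, ← matForm_apply, matForm_symm hs, h]
  have := det_map_ne_zero hdet
  rw [← one_mulVec x, ← nonsing_inv_mul _ this, ← mulVec_mulVec, h1, mulVec_zero]

/-- Integral values of `G x` detect membership in the dual of `ℤⁿ`. -/
theorem exists_mulVec_eq_ratify {x : Fin n → ℚ} (hs : Gᵀ = G)
    (h : ∀ u : Fin n → ℤ, ∃ k : ℤ, matForm G x (ratify u) = k) :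
    ∃ u, G.map (Int.cast : ℤ → ℚ) *ᵥ x = ratify u := by
  obtain ⟨u, hu⟩ := forall_dotProduct_int fun u => by
    rw [← matForm_apply, matForm_symm hs]; exact h u
  exact ⟨u, hu.symm⟩

theorem det_smul_mem_stdLat {x : Fin n → ℚ} {u : Fin n → ℤ}
    (h : G.map (Int.cast : ℤ → ℚ) *ᵥ x = ratify u) : G.det • x ∈ stdLat n := by
  refine ⟨G.adjugate *ᵥ u, ?_⟩
  have h1 : (G.map (Int.cast : ℤ → ℚ)).adjugate = G.adjugate.map (Int.cast : ℤ → ℚ) :=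
    ((Int.castRingHom ℚ).map_adjugate G).symm
  have h2 : (G.map (Int.cast : ℤ → ℚ)).det = G.det := ((Int.castRingHom ℚ).map_det G).symm
  change ratify _ = _
  rw [ratify_mulVec, ← h, ← h1, mulVec_mulVec, adjugate_mul, h2, smul_mulVec, one_mulVec,
    Int.cast_smul_eq_zsmul]

theorem stdLat_span (x : Fin n → ℚ) : ∃ m : ℤ, m ≠ 0 ∧ m • x ∈ stdLat n := by
  obtain ⟨D, hD⟩ := IsLocalization.exist_integer_multiples_of_finite (nonZeroDivisors ℤ) x
  choose Z hZ using hD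
  refine ⟨D, nonZeroDivisors.coe_ne_zero D, Z, funext fun i => ?_⟩
  exact hZ i

theorem isLat_stdLat (hs : Gᵀ = G) : IsLat (matForm G) G.det (stdLat n) where
  fg := (Submodule.fg_top _).1 (Module.finite_def.1 (Module.Finite.range _))
  span := stdLat_span
  int := by
    rintro _ ⟨u, rfl⟩ _ ⟨v, rfl⟩
    exact ⟨_, matForm_ratify u v⟩
  dual x h := by
    obtain ⟨u, hu⟩ := exists_mulVec_eq_ratify hs fun u => h _ (ratify_mem_stdLat u)
    exact det_smul_mem_stdLat hu

end MatrixLattices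

section GlueMatrix
variable {n : ℕ} {G G' : Matrix (Fin n) (Fin n) ℤ}

theorem discMk_eq_zero {u : Fin n → ℤ} : discMk G u = 0 ↔ ∃ a, G *ᵥ a = u :=
  Submodule.Quotient.mk_eq_zero _

theorem discMk_surjective (G : Matrix (Fin n) (Fin n) ℤ) : Function.Surjective (discMk G) :=
  Submodule.Quotient.mk_surjective _

theorem discMk_add (u v : Fin n → ℤ) : discMk G (u + v) = discMk G u + discMk G v := rfl

theorem discMk_sub (u v : Fin n → ℤ) : discMk G (u - v) = discMk G u - discMk G v := rfl

theorem discMk_smul (c : ℤ) (u : Fin n → ℤ) : discMk G (c • u) = c • discMk G u := rfl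

theorem discMk_zero : discMk G 0 = 0 := rfl

theorem discBil_eq_iff {u v u' v' : Fin n → ℤ} : discBil G' u' v' = discBil G u v ↔
    ∃ k : ℤ, ratify u' ⬝ᵥ (G'.map (Int.cast : ℤ → ℚ))⁻¹ *ᵥ ratify v' -
      ratify u ⬝ᵥ (G.map (Int.cast : ℤ → ℚ))⁻¹ *ᵥ ratify v = k := by
  rw [discBil, discBil, ← sub_eq_zero, ← AddCircle.coe_sub, AddCircle.coe_eq_zero_iff]
  simp [eq_comm]

theorem matForm_eq_of_mulVec (hdet : G.det ≠ 0) (hs : Gᵀ = G) {x y : Fin n → ℚ}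
    {u v : Fin n → ℤ} (hx : G.map (Int.cast : ℤ → ℚ) *ᵥ x = ratify u)
    (hy : G.map (Int.cast : ℤ → ℚ) *ᵥ y = ratify v) :
    matForm G x y = ratify u ⬝ᵥ (G.map (Int.cast : ℤ → ℚ))⁻¹ *ᵥ ratify v := by
  rw [matForm_symm hs, matForm_apply, hx, dotProduct_comm, ← hy, mulVec_mulVec,
    nonsing_inv_mul _ (det_map_ne_zero hdet), one_mulVec]

/-- The overlattice of `ℤⁿ × ℤⁿ` given by the graph of an isomorphism of discriminant groups. -/
def glueLat (φ : DiscGroup G ≃+ DiscGroup G') : Submodule ℤ ((Fin n → ℚ) × (Fin n → ℚ)) where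
  carrier := {x | ∃ u' u, G'.map (Int.cast : ℤ → ℚ) *ᵥ x.1 = ratify u' ∧
    G.map (Int.cast : ℤ → ℚ) *ᵥ x.2 = ratify u ∧ φ (discMk G u) = discMk G' u'}
  zero_mem' := ⟨0, 0, by simp, by simp, by rw [discMk_zero, discMk_zero, map_zero]⟩
  add_mem' := by
    rintro x y ⟨u', u, h1, h2, h3⟩ ⟨v', v, h1', h2', h3'⟩
    refine ⟨u' + v', u + v, ?_, ?_, ?_⟩
    · rw [Prod.fst_add, mulVec_add, h1, h1', ratify_add]
    · rw [Prod.snd_add, mulVec_add, h2, h2', ratify_add]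
    · rw [discMk_add, discMk_add, map_add, h3, h3']
  smul_mem' := by
    rintro c x ⟨u', u, h1, h2, h3⟩
    refine ⟨c • u', c • u, ?_, ?_, ?_⟩
    · rw [Prod.smul_fst, mulVec_smul, h1, ratify_smul]
    · rw [Prod.smul_snd, mulVec_smul, h2, ratify_smul]
    · rw [discMk_smul, discMk_smul, map_zsmul, h3]

theorem exists_mulVec_eq (hdet : G.det ≠ 0) (u : Fin n → ℤ) :
    ∃ x, G.map (Int.cast : ℤ → ℚ) *ᵥ x = ratify u :=
  ⟨(G.map (Int.cast : ℤ → ℚ))⁻¹ *ᵥ ratify u, by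
    rw [mulVec_mulVec, mul_nonsing_inv _ (det_map_ne_zero hdet), one_mulVec]⟩

theorem mulVec_cast_injective (hdet : G.det ≠ 0) :
    Function.Injective (G.map (Int.cast : ℤ → ℚ)).mulVec :=
  mulVec_injective_of_isUnit ((isUnit_iff_isUnit_det _).2 (det_map_ne_zero hdet))

theorem mk_zero_mem_glueLat (hdet' : G'.det ≠ 0) (φ : DiscGroup G ≃+ DiscGroup G')
    (x : Fin n → ℚ) : (x, 0) ∈ glueLat φ ↔ x ∈ stdLat n := by
  constructor
  · rintro ⟨u', u, h1, h2, h3⟩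
    obtain rfl : u = 0 := ratify_injective (by rw [← h2, mulVec_zero, ratify_zero])
    rw [discMk_zero, map_zero] at h3
    obtain ⟨a, rfl⟩ := discMk_eq_zero.1 h3.symm
    rw [ratify_mulVec] at h1
    exact ⟨a, (mulVec_cast_injective hdet' h1).symm⟩
  · rintro ⟨a, rfl⟩
    refine ⟨G' *ᵥ a, 0, (ratify_mulVec G' a).symm, by simp, ?_⟩
    rw [discMk_zero, map_zero, discMk_eq_zero.2 ⟨a, rfl⟩]

theorem zero_mk_mem_glueLat (hdet : G.det ≠ 0) (φ : DiscGroup G ≃+ DiscGroup G')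
    (x : Fin n → ℚ) : (0, x) ∈ glueLat φ ↔ x ∈ stdLat n := by
  constructor
  · rintro ⟨u', u, h1, h2, h3⟩
    obtain rfl : u' = 0 := ratify_injective (by rw [← h1, mulVec_zero, ratify_zero])
    rw [discMk_zero, φ.map_eq_zero_iff] at h3
    obtain ⟨a, rfl⟩ := discMk_eq_zero.1 h3
    rw [ratify_mulVec] at h2
    exact ⟨a, (mulVec_cast_injective hdet h2).symm⟩
  · rintro ⟨a, rfl⟩
    refine ⟨0, G *ᵥ a, by simp, (ratify_mulVec G a).symm, ?_⟩
    rw [discMk_zero, φ.map_eq_zero_iff, discMk_eq_zero.2 ⟨a, rfl⟩]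

theorem discMk_eq_of_forall (hdet : G.det ≠ 0) (hs : Gᵀ = G) {u w : Fin n → ℤ}
    (h : ∀ v, discBil G u v = discBil G w v) : discMk G u = discMk G w := by
  rw [← sub_eq_zero, ← discMk_sub, discMk_eq_zero]
  obtain ⟨x, hx⟩ := exists_mulVec_eq hdet (u - w)
  obtain ⟨a, rfl⟩ := forall_dotProduct_int (x := x) fun v => by
    obtain ⟨y, hy⟩ := exists_mulVec_eq hdet v
    obtain ⟨k, hk⟩ := discBil_eq_iff.1 (h v)
    refine ⟨k, ?_⟩
    rw [← hk, ← sub_dotProduct, ← ratify_sub, ← matForm_eq_of_mulVec hdet hs hx hy,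
      matForm_apply, hy, dotProduct_comm]
  exact ⟨a, ratify_injective (by rw [ratify_mulVec, hx])⟩

theorem isLat_glueLat (hdet : G.det ≠ 0) (hs : Gᵀ = G) (hdet' : G'.det ≠ 0) (hs' : G'ᵀ = G')
    (φ : DiscGroup G ≃+ DiscGroup G')
    (hφ : ∀ u v u' v' : Fin n → ℤ, φ (discMk G u) = discMk G' u' →
      φ (discMk G v) = discMk G' v' → discBil G' u' v' = discBil G u v) :
    IsLat (prodForm (matForm G') (-matForm G)) 1 (glueLat φ) where
  fg := by
    have hmem : ∀ x ∈ glueLat φ, (G.det * G'.det) • x ∈ (stdLat n).prod (stdLat n) := by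
      rintro x ⟨u', u, h1, h2, -⟩
      refine ⟨?_, ?_⟩
      · rw [Prod.smul_fst, mul_smul]
        exact (stdLat n).smul_mem _ (det_smul_mem_stdLat h1)
      · rw [Prod.smul_snd, mul_comm, mul_smul]
        exact (stdLat n).smul_mem _ (det_smul_mem_stdLat h2)
    have : Module.Finite ℤ ((stdLat n).prod (stdLat n)) :=
      Module.Finite.iff_fg.2 ((isLat_stdLat hs).fg.prod (isLat_stdLat hs).fg)
    let f : glueLat φ →ₗ[ℤ] (stdLat n).prod (stdLat n) := LinearMap.codRestrict _
      ((G.det * G'.det) • (glueLat φ).subtype) fun x => hmem x x.2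
    have hf : Function.Injective f := fun x y h =>
      Subtype.ext (zsmul_cancel (mul_ne_zero hdet hdet') (congrArg Subtype.val h))
    exact Module.Finite.iff_fg.1 (Module.Finite.of_injective f hf)
  span x := by
    obtain ⟨k, hk, hx⟩ := stdLat_span x.1
    obtain ⟨m, hm, hy⟩ := stdLat_span x.2
    refine ⟨k * m, mul_ne_zero hk hm, ?_⟩
    have h1 := (mk_zero_mem_glueLat hdet' φ _).2 ((stdLat n).smul_mem m hx)
    have h2 := (zero_mk_mem_glueLat hdet φ _).2 ((stdLat n).smul_mem k hy)
    convert (glueLat φ).add_mem h1 h2 using 1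
    ext <;> simp <;> ring
  int := by
    rintro x ⟨u', u, h1, h2, h3⟩ y ⟨v', v, h1', h2', h3'⟩
    obtain ⟨k, hk⟩ := discBil_eq_iff.1 (hφ u v u' v' h3 h3')
    refine ⟨k, ?_⟩
    rw [prodForm_apply, LinearMap.neg_apply, LinearMap.neg_apply,
      matForm_eq_of_mulVec hdet' hs' h1 h1', matForm_eq_of_mulVec hdet hs h2 h2', ← hk,
      sub_eq_add_neg]
  dual x h := by
    rw [one_smul]
    obtain ⟨u', hu'⟩ := exists_mulVec_eq_ratify hs' (x := x.1) fun a => by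
      simpa using h (ratify a, 0) ((mk_zero_mem_glueLat hdet' φ _).2 (ratify_mem_stdLat a))
    obtain ⟨u, hu⟩ := exists_mulVec_eq_ratify hs (x := x.2) fun a => by
      obtain ⟨k, hk⟩ := h (0, ratify a) ((zero_mk_mem_glueLat hdet φ _).2 (ratify_mem_stdLat a))
      exact ⟨-k, by simpa [neg_eq_iff_eq_neg] using hk⟩
    refine ⟨u', u, hu', hu, ?_⟩
    obtain ⟨w, hw⟩ := discMk_surjective G' (φ (discMk G u))
    rw [← hw]
    refine discMk_eq_of_forall hdet' hs' fun v' => ?_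
    obtain ⟨v, hv⟩ := discMk_surjective G (φ.symm (discMk G' v'))
    have hv' : φ (discMk G v) = discMk G' v' := by rw [hv, φ.apply_symm_apply]
    rw [hφ u v w v' hw.symm hv', eq_comm]
    obtain ⟨y', hy'⟩ := exists_mulVec_eq hdet' v'
    obtain ⟨y, hy⟩ := exists_mulVec_eq hdet v
    obtain ⟨k, hk⟩ := h (y', y) ⟨v', v, hy', hy, hv'⟩
    refine discBil_eq_iff.2 ⟨k, ?_⟩
    rw [← hk, prodForm_apply, LinearMap.neg_apply, LinearMap.neg_apply,
      matForm_eq_of_mulVec hdet' hs' hu' hy', matForm_eq_of_mulVec hdet hs hu hy, sub_eq_add_neg]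

end GlueMatrix

section Hypotheses
variable {n : ℕ} {G G' : Matrix (Fin n) (Fin n) ℤ} {d : ℤ}

theorem latForm_ratify (h : IsLat (matForm G) d (stdLat n)) (x y : stdLat n) {u v : Fin n → ℤ}
    (hu : ratify u = x) (hv : ratify v = y) : latForm h x y = u ⬝ᵥ G *ᵥ v :=
  Int.cast_injective (α := ℚ) (by rw [latForm_apply, ← hu, ← hv, matForm_ratify])

theorem exists_odd_latForm (h : IsLat (matForm G) d (stdLat n))
    (hodd : ¬ ∀ x : Fin n → ℤ, Even (x ⬝ᵥ G *ᵥ x)) : ∃ x, Odd (latForm h x x) := by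
  push Not at hodd
  obtain ⟨u, hu⟩ := hodd
  refine ⟨⟨_, ratify_mem_stdLat u⟩, ?_⟩
  rwa [latForm_ratify h _ _ rfl rfl, ← Int.not_even_iff_odd]

theorem exists_rat_of_real {s : ℝ} {x : Fin n → ℝ}
    (hx : 0 < s * (x ⬝ᵥ (G.map (Int.cast : ℤ → ℝ)) *ᵥ x)) :
    ∃ y : Fin n → ℚ, 0 < s * (matForm G y y : ℚ) := by
  have hd : DenseRange (fun (y : Fin n → ℚ) i => (y i : ℝ)) :=
    DenseRange.piMap fun _ => Rat.denseRange_cast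
  have hc : Continuous fun x : Fin n → ℝ => s * (x ⬝ᵥ (G.map (Int.cast : ℤ → ℝ)) *ᵥ x) := by
    simp only [dotProduct, mulVec]
    fun_prop
  obtain ⟨y, hy⟩ := hd.mem_nhds ((continuousAt_const.eventually_lt hc.continuousAt hx))
  refine ⟨y, lt_of_lt_of_eq hy ?_⟩
  rw [matForm_apply]
  simp [dotProduct, mulVec]

theorem isIndefSpace_matForm (hs : Gᵀ = G) (hdet : G.det ≠ 0) (hn : 3 ≤ n)
    (hindef : (∃ x : Fin n → ℝ, 0 < x ⬝ᵥ (G.map (Int.cast : ℤ → ℝ)) *ᵥ x) ∧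
      ∃ y : Fin n → ℝ, y ⬝ᵥ (G.map (Int.cast : ℤ → ℝ)) *ᵥ y < 0) :
    IsIndefSpace (matForm G) where
  symm := matForm_symm hs
  nondeg := matForm_nondegenerate hdet hs
  pos := by
    obtain ⟨x, hx⟩ := hindef.1
    obtain ⟨y, hy⟩ := exists_rat_of_real (s := 1) (by rwa [one_mul])
    exact ⟨y, by rw [one_mul] at hy; exact_mod_cast hy⟩
  neg := by
    obtain ⟨x, hx⟩ := hindef.2
    obtain ⟨y, hy⟩ := exists_rat_of_real (s := -1) (by linarith)
    exact ⟨y, by rw [neg_one_mul, neg_pos] at hy; exact_mod_cast hy⟩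
  rank := by rw [Module.finrank_fin_fun]; omega

theorem exists_generators (hgen : ∃ s : Fin (n - 3) → DiscGroup G,
    Submodule.span ℤ (Set.range s) = ⊤) : ∃ t : Fin (n - 3) → Fin n → ℤ,
      ∀ u, ∃ (c : Fin (n - 3) → ℤ) (a : Fin n → ℤ), u = ∑ i, c i • t i + G *ᵥ a := by
  obtain ⟨s, hs⟩ := hgen
  choose t ht using fun i => discMk_surjective G (s i)
  refine ⟨t, fun u => ?_⟩
  have hu : discMk G u ∈ Submodule.span ℤ (Set.range s) := hs ▸ Submodule.mem_top
  obtain ⟨c, hc⟩ := (Submodule.mem_span_range_iff_exists_fun ℤ).1 hu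
  have : discMk G (u - ∑ i, c i • t i) = 0 := by
    let D : (Fin n → ℤ) →ₗ[ℤ] DiscGroup G := Submodule.mkQ _
    have h1 : D (∑ i, c i • t i) = discMk G u := by
      rw [← hc, map_sum]
      exact Finset.sum_congr rfl fun i _ => by rw [map_smul]; exact congrArg _ (ht i)
    exact (map_sub D _ _).trans (by rw [h1]; exact sub_self _)
  obtain ⟨a, ha⟩ := discMk_eq_zero.1 this
  exact ⟨c, a, by rw [ha]; abel⟩

theorem residualRankGT_of_generators (h : IsLat (matForm G) d (stdLat n)) (hs : Gᵀ = G)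
    (hn : 3 ≤ n) (hgen : ∃ s : Fin (n - 3) → DiscGroup G, Submodule.span ℤ (Set.range s) = ⊤)
    {p : ℕ} (hp : p.Prime) : ResidualRankGT (latForm h) p 2 := by
  have : Fact p.Prime := ⟨hp⟩
  intro f
  by_contra! hcon
  choose g hg using fun i => mem_stdLat.1 (f i).2
  let red : (Fin n → ℤ) → Fin n → ZMod p := fun u i => u i
  have hred : ∀ x : Fin n → ZMod p, ∃ u, red u = x := fun x =>
    ⟨fun i => (x i).cast, funext fun i => ZMod.intCast_zmod_cast _⟩
  let Gp : Matrix (Fin n) (Fin n) (ZMod p) := G.map (Int.cast : ℤ → ZMod p)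
  have hGp : ∀ u, Gp *ᵥ red u = red (G *ᵥ u) := fun u =>
    funext fun _ => by simp [Gp, red, mulVec, dotProduct]
  have hdot : ∀ u v, red u ⬝ᵥ red v = ((u ⬝ᵥ v : ℤ) : ZMod p) := fun u v => by
    simp [red, dotProduct]
  let F : (Fin n → ZMod p) →ₗ[ZMod p] Fin 2 → ZMod p :=
    LinearMap.pi fun i => (Matrix.toLinearMap₂' (ZMod p) Gp).flip (red (g i))
  have hF : ∀ u i, F (red u) i = ((u ⬝ᵥ G *ᵥ g i : ℤ) : ZMod p) := fun u i => by
    rw [← hdot, ← hGp]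
    simp [F, Matrix.toLinearMap₂'_apply']
  have hker : LinearMap.ker F ≤ LinearMap.ker Gp.mulVecLin := fun x hx => by
    obtain ⟨u, rfl⟩ := hred x
    refine dotProduct_eq_zero _ fun y => ?_
    obtain ⟨v, rfl⟩ := hred y
    have h1 := hcon ⟨_, ratify_mem_stdLat u⟩ ⟨_, ratify_mem_stdLat v⟩ fun i => by
      rw [latForm_ratify h _ _ rfl (hg i), ← ZMod.intCast_zmod_eq_zero_iff_dvd, ← hF]
      exact congrFun hx i
    rw [latForm_ratify h _ _ rfl rfl, ← ZMod.intCast_zmod_eq_zero_iff_dvd] at h1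
    rw [mulVecLin_apply, hGp, hdot, ← h1, dotProduct_mulVec, ← mulVec_transpose, hs]
  obtain ⟨t, ht⟩ := exists_generators hgen
  have hspan : LinearMap.range Gp.mulVecLin ⊔
      Submodule.span (ZMod p) (Set.range fun i => red (t i)) = ⊤ := by
    refine eq_top_iff.2 fun x _ => ?_
    obtain ⟨u, rfl⟩ := hred x
    obtain ⟨c, a, rfl⟩ := ht u
    have : red (∑ i, c i • t i + G *ᵥ a) = Gp *ᵥ red a + ∑ i, (c i : ZMod p) • red (t i) := by
      rw [hGp, add_comm]
      funext j
      simp [red]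
    rw [this]
    exact Submodule.add_mem_sup ⟨_, rfl⟩
      (Submodule.sum_mem _ fun i _ => Submodule.smul_mem _ _ (Submodule.subset_span ⟨i, rfl⟩))
  have h1 := Submodule.finrank_add_le_finrank_add_finrank (LinearMap.range Gp.mulVecLin)
    (Submodule.span (ZMod p) (Set.range fun i => red (t i)))
  rw [hspan, finrank_top, Module.finrank_fin_fun] at h1
  have h2 := finrank_range_le_card (R := ZMod p) fun i => red (t i)
  rw [Set.finrank, Fintype.card_fin] at h2
  have h3 := LinearMap.finrank_range_add_finrank_ker F
  have h4 := LinearMap.finrank_range_add_finrank_ker Gp.mulVecLin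
  have h5 := Submodule.finrank_mono hker
  have h6 := (LinearMap.range F).finrank_le
  rw [Module.finrank_fin_fun] at h3 h4 h6
  omega

theorem definiteRank_glueLat (hdet : G.det ≠ 0) (hdet' : G'.det ≠ 0)
    {φ : DiscGroup G ≃+ DiscGroup G'}
    (hN : IsLat (prodForm (matForm G') (-matForm G)) 1 (glueLat φ)) {ε : ℤ}
    {S S' : Finset (Fin n)} (hS : S'.card = S.card) {Z Z' : Matrix (Fin n) (Fin n) ℤ}
    (hZ' : ∀ c, c ≠ 0 → (∀ i ∉ S', c i = 0) → 0 < ε * (Z' *ᵥ c ⬝ᵥ G' *ᵥ (Z' *ᵥ c)))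
    (hZ : ∀ c, c ≠ 0 → (∀ i ∈ S, c i = 0) → ε * (Z *ᵥ c ⬝ᵥ G *ᵥ (Z *ᵥ c)) < 0) :
    DefiniteRank (latForm hN) ε n := by
  classical
  let π : Equiv.Perm (Fin n) :=
    (Finset.equivOfCardEq hS : {x // x ∈ S'} ≃ {x // x ∈ S}).extendSubtype
  have hπ : ∀ i, i ∈ S' → π i ∈ S := fun i hi => Equiv.extendSubtype_mem _ i hi
  have hπ' : ∀ i, i ∉ S' → π i ∉ S := fun i hi => Equiv.extendSubtype_not_mem _ i hi
  let A : (Fin n → ℤ) →ₗ[ℤ] Fin n → ℤ :=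
    LinearMap.pi fun i => if i ∈ S' then LinearMap.proj (π i) else 0
  let A' : (Fin n → ℤ) →ₗ[ℤ] Fin n → ℤ :=
    LinearMap.pi fun i => if i ∈ S then 0 else LinearMap.proj i
  have hA : ∀ c i, A c i = if i ∈ S' then c (π i) else 0 := fun c i => by
    by_cases hi : i ∈ S' <;> simp [A, hi]
  have hA' : ∀ c i, A' c i = if i ∈ S then 0 else c i := fun c i => by
    by_cases hi : i ∈ S <;> simp [A', hi]
  let r : (Fin n → ℤ) →ₗ[ℤ] Fin n → ℚ := (Int.castAddHom ℚ).toIntLinearMap.compLeft (Fin n)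
  let f : (Fin n → ℤ) →ₗ[ℤ] glueLat φ := LinearMap.codRestrict _
    ((r ∘ₗ Z'.mulVecLin ∘ₗ A).prod (r ∘ₗ Z.mulVecLin ∘ₗ A')) fun c => by
      have h1 := (mk_zero_mem_glueLat hdet' φ _).2 (ratify_mem_stdLat (Z' *ᵥ A c))
      have h2 := (zero_mk_mem_glueLat hdet φ _).2 (ratify_mem_stdLat (Z *ᵥ A' c))
      have := (glueLat φ).add_mem h1 h2
      rwa [Prod.mk_add_mk, add_zero, zero_add] at this
  refine ⟨f, fun c hc => ?_⟩
  have hform : ε * latForm hN (f c) (f c) = ε * (Z' *ᵥ A c ⬝ᵥ G' *ᵥ (Z' *ᵥ A c)) -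
      ε * (Z *ᵥ A' c ⬝ᵥ G *ᵥ (Z *ᵥ A' c)) := by
    rw [← mul_sub]
    congr 1
    refine Int.cast_injective (α := ℚ) ?_
    rw [latForm_apply, Int.cast_sub, ← matForm_ratify, ← matForm_ratify]
    exact (sub_eq_add_neg _ _).symm
  have hAS : ∀ i ∉ S', A c i = 0 := fun i hi => by rw [hA, if_neg hi]
  have hAS' : ∀ i ∈ S, A' c i = 0 := fun i hi => by rw [hA', if_pos hi]
  rw [hform, sub_pos]
  by_cases h1 : A c = 0
  · by_cases h2 : A' c = 0
    · refine absurd (funext fun i => ?_) hc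
      by_cases hi : i ∈ S
      · have h3 : π.symm i ∈ S' := by
          by_contra h4
          exact hπ' _ h4 (by rwa [π.apply_symm_apply])
        have := congrFun h1 (π.symm i)
        rwa [hA, if_pos h3, π.apply_symm_apply] at this
      · have := congrFun h2 i
        rwa [hA', if_neg hi] at this
    · rw [h1]
      simpa using hZ _ h2 hAS'
  · by_cases h2 : A' c = 0
    · rw [h2]
      simpa using hZ' _ h1 hAS
    · exact (hZ _ h2 hAS').trans (hZ' _ h1 hAS)

theorem exists_intEquiv_of_ratEquiv (τ : (Fin n → ℚ) ≃ₗ[ℚ] (Fin n → ℚ))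
    (hτ : ∀ x y, matForm G (τ x) (τ y) = matForm G' x y)
    (hm : ∀ x, τ x ∈ stdLat n ↔ x ∈ stdLat n) :
    ∃ e : (Fin n → ℤ) ≃ₗ[ℤ] (Fin n → ℤ), ∀ x y : Fin n → ℤ,
      x ⬝ᵥ G'.mulVec y = (e x) ⬝ᵥ G.mulVec (e y) := by
  choose e he using fun u => (hm _).2 (ratify_mem_stdLat u)
  have he : ∀ u, ratify (e u) = τ (ratify u) := he
  let E : (Fin n → ℤ) →ₗ[ℤ] Fin n → ℤ :=
    { toFun := e
      map_add' := fun u v => ratify_injective (by simp [he])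
      map_smul' := fun c u => ratify_injective (by
        rw [he, ratify_smul, map_zsmul, ratify_smul, he]; rfl) }
  have hE : Function.Bijective E := by
    refine ⟨fun u v h => ratify_injective (τ.injective ?_), fun v => ?_⟩
    · rw [← he, ← he]
      exact congrArg ratify h
    · obtain ⟨u, hu⟩ := (hm (τ.symm (ratify v))).1 (by
        rw [τ.apply_symm_apply]; exact ratify_mem_stdLat v)
      refine ⟨u, ratify_injective ((he u).trans ?_)⟩
      rw [show ratify u = _ from hu, τ.apply_symm_apply]
  refine ⟨LinearEquiv.ofBijective E hE, fun x y => Int.cast_injective (α := ℚ) ?_⟩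
  rw [← matForm_ratify, ← matForm_ratify, ← hτ, ← he, ← he]
  rfl

theorem exists_isometry_of_three_le (hn : 3 ≤ n)
    (hsymm : G.transpose = G)
    (hdet : G.det ≠ 0)
    (hodd : ¬ ∀ x : Fin n → ℤ, Even (x ⬝ᵥ G.mulVec x))
    (hindef : (∃ x : Fin n → ℝ, 0 < x ⬝ᵥ (G.map (Int.cast : ℤ → ℝ)).mulVec x) ∧
      (∃ y : Fin n → ℝ, y ⬝ᵥ (G.map (Int.cast : ℤ → ℝ)).mulVec y < 0))
    (hgen : ∃ s : Fin (n - 3) → DiscGroup G, Submodule.span ℤ (Set.range s) = ⊤)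
    (hsymm' : G'.transpose = G') (hdet' : G'.det ≠ 0)
    (hodd' : ¬ ∀ x : Fin n → ℤ, Even (x ⬝ᵥ G'.mulVec x)) {p q : ℕ}
    (hsig : HasSignature G p q) (hsig' : HasSignature G' p q)
    (φ : DiscGroup G ≃+ DiscGroup G')
    (hφ : ∀ (u v : Fin n → ℤ) (u' v' : Fin n → ℤ),
          φ (discMk G u) = discMk G' u' → φ (discMk G v) = discMk G' v' →
            discBil G' u' v' = discBil G u v) :
      ∃ e : (Fin n → ℤ) ≃ₗ[ℤ] (Fin n → ℤ), ∀ x y : Fin n → ℤ,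
        x ⬝ᵥ G'.mulVec y = (e x) ⬝ᵥ G.mulVec (e y) := by
  have hV := isIndefSpace_matForm hsymm hdet hn hindef
  have hL' := (isLat_stdLat hsymm').mul G.det
  have hL : IsLat (matForm G) (G.det * G'.det) (stdLat n) :=
    mul_comm G'.det _ ▸ (isLat_stdLat hsymm).mul G'.det
  have hd := mul_ne_zero hdet hdet'
  have hN := isLat_glueLat hdet hsymm hdet' hsymm' φ hφ
  have hr : ∀ p : ℕ, p.Prime → ResidualRankGT (latForm hL) p 2 := fun p hp =>
    residualRankGT_of_generators hL hsymm hn hgen hp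
  have ho := exists_odd_latForm hL hodd
  obtain ⟨S, Z, hS, hZ1, hZ2⟩ := hsig.exists_definite
  obtain ⟨S', Z', hS', hZ1', hZ2'⟩ := hsig'.exists_definite
  obtain ⟨σ, hσ, hloc⟩ := exists_locEq_map_of_glue (n := n) (matForm_symm hsymm)
    (matForm_symm hsymm') (matForm_nondegenerate hdet hsymm) (matForm_nondegenerate hdet' hsymm')
    (Module.finrank_fin_fun ℚ) (Module.finrank_fin_fun ℚ) hd hL hL' ho
    (exists_odd_latForm hL' hodd') hr hN (mk_zero_mem_glueLat hdet' φ)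
    (zero_mk_mem_glueLat hdet φ)
    (definiteRank_glueLat hdet hdet' hN (hS'.trans hS.symm)
      (fun c hc h => by rw [one_mul]; exact hZ1' c hc h)
      (fun c hc h => by rw [one_mul]; exact hZ2 c hc h))
    (definiteRank_glueLat (S := Sᶜ) (S' := S'ᶜ) hdet hdet' hN
      (by rw [Finset.card_compl, Finset.card_compl, hS, hS'])
      (fun c hc h => by simpa using hZ2' c hc (by simpa using h))
      (fun c hc h => by simpa using hZ1 c hc (by simpa using h)))
  obtain ⟨ρ, hρ, hρm⟩ := hloc.latIso hV hd hL (hL'.map σ hσ) (fun p hp _ => hr p hp) ho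
  refine exists_intEquiv_of_ratEquiv (σ.trans ρ.symm) (fun x y => ?_) fun x => ?_
  · rw [← hσ, ← hρ]
    simp
  · rw [← hρm, LinearEquiv.trans_apply, ρ.apply_symm_apply]
    refine ⟨?_, fun h => ⟨x, h, rfl⟩⟩
    rintro ⟨y, hy, h⟩
    rwa [← σ.injective h]

end Hypotheses

section RankTwo
variable {n : ℕ} {G G' : Matrix (Fin n) (Fin n) ℤ} {p q : ℕ}

theorem HasSignature.exists_diagonal (h : HasSignature G p q) (x : Fin n → ℝ) :
    ∃ d : Fin n → ℝ, (Finset.univ.filter fun i => d i = 1).card = p ∧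
      (∀ i, d i = 1 ∨ d i = -1) ∧ ∃ y : Fin n → ℝ,
        x ⬝ᵥ (G.map (Int.cast : ℤ → ℝ)) *ᵥ x = ∑ i, d i * y i ^ 2 := by
  obtain ⟨P, d, hP, hd, hp, -, h⟩ := h
  refine ⟨d, hp, hd, P⁻¹ *ᵥ x, ?_⟩
  have h1 : P *ᵥ (P⁻¹ *ᵥ x) = x := by rw [mulVec_mulVec, mul_nonsing_inv _ hP, one_mulVec]
  set y := P⁻¹ *ᵥ x
  have h2 : y ⬝ᵥ (diagonal d) *ᵥ y = ∑ i, d i * y i ^ 2 := by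
    simp only [dotProduct, mulVec_diagonal]
    exact Finset.sum_congr rfl fun i _ => by ring
  rw [← h2, ← h, ← mulVec_mulVec, ← mulVec_mulVec, h1, dotProduct_mulVec y, vecMul_transpose, h1]

theorem HasSignature.pos (h : HasSignature G p q)
    (hpos : ∃ x : Fin n → ℝ, 0 < x ⬝ᵥ (G.map (Int.cast : ℤ → ℝ)) *ᵥ x) : 0 < p := by
  obtain ⟨x, hx⟩ := hpos
  obtain ⟨d, rfl, hd, y, hy⟩ := h.exists_diagonal x
  rw [hy] at hx
  by_contra! h0
  rw [Nat.le_zero, Finset.card_eq_zero, Finset.filter_eq_empty_iff] at h0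
  refine hx.not_ge (Finset.sum_nonpos fun i hi => ?_)
  rw [(hd i).resolve_left (h0 hi)]
  linarith [sq_nonneg (y i)]

theorem HasSignature.lt (h : HasSignature G p q)
    (hneg : ∃ x : Fin n → ℝ, x ⬝ᵥ (G.map (Int.cast : ℤ → ℝ)) *ᵥ x < 0) : p < n := by
  obtain ⟨x, hx⟩ := hneg
  obtain ⟨d, rfl, hd, y, hy⟩ := h.exists_diagonal x
  rw [hy] at hx
  by_contra! h0
  have h1 := (Finset.card_eq_iff_eq_univ _).1 ((Finset.card_le_univ _).antisymm
    ((Fintype.card_fin n).trans_le h0))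
  refine hx.not_ge (Finset.sum_nonneg fun i _ => ?_)
  have hi := Finset.mem_univ i
  rw [← h1, Finset.mem_filter] at hi
  rw [hi.2, one_mul]
  exact sq_nonneg _

theorem HasSignature.exists_pos (h : HasSignature G p q) (hp : 0 < p) :
    ∃ x : Fin n → ℤ, 0 < x ⬝ᵥ G *ᵥ x := by
  obtain ⟨S, Z, rfl, hZ, -⟩ := h.exists_definite
  obtain ⟨i, hi⟩ := Finset.card_pos.1 hp
  refine ⟨_, hZ (Pi.single i 1) (by simp) fun j hj => Pi.single_eq_of_ne ?_ _⟩
  rintro rfl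
  exact hj hi

theorem HasSignature.exists_neg (h : HasSignature G p q) (hp : p < n) :
    ∃ x : Fin n → ℤ, x ⬝ᵥ G *ᵥ x < 0 := by
  obtain ⟨S, Z, rfl, -, hZ⟩ := h.exists_definite
  obtain ⟨i, hi⟩ : ∃ i, i ∉ S := by
    by_contra! h0
    rw [Finset.eq_univ_iff_forall.2 h0, Finset.card_univ, Fintype.card_fin] at hp
    exact hp.false
  refine ⟨_, hZ (Pi.single i 1) (by simp) fun j hj => Pi.single_eq_of_ne ?_ _⟩
  rintro rfl
  exact hi hj

theorem definiteRank_one {Λ : Type} [AddCommGroup Λ] {b : Λ →ₗ[ℤ] Λ →ₗ[ℤ] ℤ} {ε : ℤ} {x : Λ}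
    (hx : 0 < ε * b x x) : DefiniteRank b ε 1 := by
  refine ⟨(LinearMap.proj 0).smulRight x, fun c hc => ?_⟩
  have h0 : c 0 ≠ 0 := fun h => hc (funext fun i => by rw [Subsingleton.elim i 0, h]; rfl)
  have : 0 < c 0 * c 0 := mul_self_pos.2 h0
  simp only [LinearMap.smulRight_apply, LinearMap.proj_apply, map_smul, LinearMap.smul_apply,
    smul_eq_mul]
  nlinarith

/-- Odd indefinite unimodular binary forms are all equivalent. -/
theorem exists_binary_normal_form {G : Matrix (Fin 2) (Fin 2) ℤ} (hs : G.transpose = G)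
    (hodd : ¬ ∀ x : Fin 2 → ℤ, Even (x ⬝ᵥ G.mulVec x)) (hu : Subsingleton (DiscGroup G))
    (hpos : ∃ x, 0 < x ⬝ᵥ G *ᵥ x) (hneg : ∃ x, x ⬝ᵥ G *ᵥ x < 0) :
    ∃ E : Matrix (Fin 2) (Fin 2) ℤ, IsUnit E.det ∧ Eᵀ * G * E = !![0, 1; 1, 1] := by
  let b : (Fin 2 → ℤ) →ₗ[ℤ] (Fin 2 → ℤ) →ₗ[ℤ] ℤ := Matrix.toLinearMap₂' ℤ G
  have hb : ∀ x y, b x y = x ⬝ᵥ G *ᵥ y := Matrix.toLinearMap₂'_apply' G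
  have hbs : ∀ x y, b x y = b y x := fun x y => by
    rw [hb, hb, dotProduct_mulVec, ← mulVec_transpose, hs, dotProduct_comm]
  have hdual : DualBound b 1 := fun φ => by
    obtain ⟨a, ha⟩ := discMk_eq_zero.1
      (Subsingleton.elim (discMk G fun i => φ (Pi.single i 1)) 0)
    refine ⟨a, fun y => ?_⟩
    rw [hbs, hb, ha, one_mul]
    conv_rhs => rw [← Finset.univ_sum_single y, map_sum]
    refine Finset.sum_congr rfl fun i _ => ?_
    rw [← smul_eq_mul, ← map_smul, ← Pi.single_smul, smul_eq_mul, mul_one]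
  obtain ⟨x, hx⟩ := hpos
  obtain ⟨y, hy⟩ := hneg
  obtain ⟨e, f, hee, hef⟩ := exists_lagrangian 1 (by simp) hbs hdual
    (definiteRank_one (x := x) (by rwa [one_mul, hb]))
    (definiteRank_one (x := y) (by rw [hb]; linarith))
  have h00 : b (e 0) (e 0) = 0 := hee 0 0
  have h01 : b (e 0) (f 0) = 1 := hef 0 0
  have hmat : ∀ u v : Fin 2 → ℤ, (Matrix.of ![u, v]) * G * (Matrix.of ![u, v])ᵀ =
      !![b u u, b u v; b v u, b v v] := fun u v => by
    ext i j
    fin_cases i <;> fin_cases j <;>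
      simp [hb, Matrix.mul_apply, dotProduct, mulVec, vecMul, Fin.sum_univ_two] <;> ring
  have key : ∀ {u v : Fin 2 → ℤ} {M : Matrix (Fin 2) (Fin 2) ℤ}, M.det = -1 →
      (Matrix.of ![u, v]) * G * (Matrix.of ![u, v])ᵀ = M →
      IsUnit ((Matrix.of ![u, v])ᵀ).det := fun {u v M} hM h => by
    have := congrArg Matrix.det h
    rw [hM, Matrix.det_mul] at this
    exact IsUnit.of_mul_eq_one (-(Matrix.of ![u, v] * G).det) (by linear_combination -this)
  have hff : Odd (b (f 0) (f 0)) := by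
    rw [← Int.not_even_iff_odd]
    intro hev
    have h1 := hmat (e 0) (f 0)
    rw [h00, h01, hbs (f 0), h01] at h1
    have h2 := key (by simp [Matrix.det_fin_two]) h1
    refine hodd fun z => ?_
    set F := (Matrix.of ![e 0, f 0])ᵀ with hF
    have hz : F *ᵥ (F⁻¹ *ᵥ z) = z := by rw [mulVec_mulVec, mul_nonsing_inv _ h2, one_mulVec]
    set c := F⁻¹ *ᵥ z
    have h3 : z ⬝ᵥ G *ᵥ z = c ⬝ᵥ (Matrix.of ![e 0, f 0] * G * F) *ᵥ c := by
      rw [← mulVec_mulVec, hz, ← mulVec_mulVec, dotProduct_mulVec c, ← mulVec_transpose, ← hF, hz]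
    obtain ⟨m, hm⟩ := hev
    rw [h3, h1, hm]
    exact ⟨c 0 * c 1 + m * c 1 ^ 2, by simp [dotProduct, mulVec, Fin.sum_univ_two]; ring⟩
  obtain ⟨k, hk⟩ := hff
  have h1 : Matrix.of ![e 0, f 0 - k • e 0] * G * (Matrix.of ![e 0, f 0 - k • e 0])ᵀ =
      !![0, 1; 1, 1] := by
    rw [hmat]
    simp only [map_sub, map_smul, LinearMap.sub_apply, LinearMap.smul_apply, h00, h01,
      hbs (f 0) (e 0), smul_eq_mul, mul_zero, sub_zero, mul_one, hk]
    congr 4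
    ring_nf
  exact ⟨_, key (by simp [Matrix.det_fin_two]) h1, by rwa [transpose_transpose]⟩

theorem exists_isometry_of_two {G G' : Matrix (Fin 2) (Fin 2) ℤ} (hs : G.transpose = G)
    (hodd : ¬ ∀ x : Fin 2 → ℤ, Even (x ⬝ᵥ G.mulVec x)) (hu : Subsingleton (DiscGroup G))
    (hs' : G'.transpose = G') (hodd' : ¬ ∀ x : Fin 2 → ℤ, Even (x ⬝ᵥ G'.mulVec x))
    (hu' : Subsingleton (DiscGroup G')) {p q : ℕ} (hp : 0 < p) (hp2 : p < 2)
    (hsig : HasSignature G p q) (hsig' : HasSignature G' p q) :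
    ∃ e : (Fin 2 → ℤ) ≃ₗ[ℤ] (Fin 2 → ℤ), ∀ x y : Fin 2 → ℤ,
      x ⬝ᵥ G'.mulVec y = (e x) ⬝ᵥ G.mulVec (e y) := by
  obtain ⟨E, hE, hEG⟩ := exists_binary_normal_form hs hodd hu (hsig.exists_pos hp)
    (hsig.exists_neg hp2)
  obtain ⟨F, hF, hFG⟩ := exists_binary_normal_form hs' hodd' hu' (hsig'.exists_pos hp)
    (hsig'.exists_neg hp2)
  have hEE := mul_nonsing_inv _ hE
  have hFF := mul_nonsing_inv _ hF
  have hEE' := nonsing_inv_mul _ hE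
  have hFF' := nonsing_inv_mul _ hF
  have h1 : (E * F⁻¹) * (F * E⁻¹) = 1 := by
    rw [Matrix.mul_assoc, ← Matrix.mul_assoc F⁻¹, hFF', Matrix.one_mul, hEE]
  have h2 : (F * E⁻¹) * (E * F⁻¹) = 1 := by
    rw [Matrix.mul_assoc, ← Matrix.mul_assoc E⁻¹, hEE', Matrix.one_mul, hFF]
  refine ⟨LinearEquiv.ofLinearMap (E * F⁻¹).mulVecLin (F * E⁻¹).mulVecLin
    (by rw [← mulVecLin_mul, h1, mulVecLin_one]) (by rw [← mulVecLin_mul, h2, mulVecLin_one]),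
    fun x y => ?_⟩
  have h3 : (E * F⁻¹)ᵀ * G * (E * F⁻¹) = G' := by
    have h4 : (E * F⁻¹)ᵀ * G * (E * F⁻¹) = (F⁻¹)ᵀ * (Eᵀ * G * E) * F⁻¹ := by
      rw [transpose_mul]
      simp only [Matrix.mul_assoc]
    have h5 : (F⁻¹)ᵀ * Fᵀ = 1 := by rw [← transpose_mul, hFF, transpose_one]
    rw [h4, hEG, ← hFG, Matrix.mul_assoc Fᵀ, ← Matrix.mul_assoc, h5, Matrix.one_mul,
      Matrix.mul_assoc, hFF, Matrix.mul_one]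
  rw [← h3, ← mulVec_mulVec, ← mulVec_mulVec, dotProduct_mulVec x, vecMul_transpose]
  rfl

end RankTwo

/-- Kneser–Nikulin uniqueness, odd case: Let `L = ℤⁿ` (of rank `r = n`)
be an odd indefinite lattice with symmetric Gram matrix `G` whose discriminant group
can be generated by at most `r − 3` elements.  Then every odd lattice `L'` of rank `r`
with the same signature as `L` admitting a group isomorphism `A(L) → A(L')` preserving
the discriminant bilinear forms is isometric to `L`. -/
theorem odd_indefinite_lattice_unique_in_genus
    {n : ℕ} (G : Matrix (Fin n) (Fin n) ℤ)
    (hsymm : G.transpose = G)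
    (hdet : G.det ≠ 0)
    (hodd : ¬ ∀ x : Fin n → ℤ, Even (x ⬝ᵥ G.mulVec x))
    (hindef : (∃ x : Fin n → ℝ, 0 < x ⬝ᵥ (G.map (Int.cast : ℤ → ℝ)).mulVec x) ∧
      (∃ y : Fin n → ℝ, y ⬝ᵥ (G.map (Int.cast : ℤ → ℝ)).mulVec y < 0))
    (hgen : ∃ s : Fin (n - 3) → DiscGroup G, Submodule.span ℤ (Set.range s) = ⊤) :
    ∀ G' : Matrix (Fin n) (Fin n) ℤ,
      G'.transpose = G' →
      G'.det ≠ 0 →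
      (¬ ∀ x : Fin n → ℤ, Even (x ⬝ᵥ G'.mulVec x)) →
      (∃ p q : ℕ, HasSignature G p q ∧ HasSignature G' p q) →
      (∃ φ : DiscGroup G ≃+ DiscGroup G',
        ∀ (u v : Fin n → ℤ) (u' v' : Fin n → ℤ),
          φ (discMk G u) = discMk G' u' → φ (discMk G v) = discMk G' v' →
            discBil G' u' v' = discBil G u v) →
      ∃ e : (Fin n → ℤ) ≃ₗ[ℤ] (Fin n → ℤ), ∀ x y : Fin n → ℤ,
        x ⬝ᵥ G'.mulVec y = (e x) ⬝ᵥ G.mulVec (e y) := by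
  intro G' hsymm' hdet' hodd' ⟨p, q, hsig, hsig'⟩ ⟨φ, hφ⟩
  have hp := hsig.pos hindef.1
  have hpn := hsig.lt hindef.2
  obtain hn | hn : n = 2 ∨ 3 ≤ n := by omega
  · subst hn
    have hu : Subsingleton (DiscGroup G) := by
      obtain ⟨s, hs⟩ := hgen
      have : IsEmpty (Fin (2 - 3)) := Fin.isEmpty
      rw [Set.range_eq_empty s, Submodule.span_empty] at hs
      exact (Submodule.subsingleton_iff ℤ).1 (subsingleton_of_bot_eq_top hs)
    exact exists_isometry_of_two hsymm hodd hu hsymm' hodd' φ.symm.toEquiv.subsingleton hp hpn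
      hsig hsig'
  · exact exists_isometry_of_three_le hn hsymm hdet hodd hindef hgen hsymm' hdet' hodd' hsig hsig'
      φ hφ
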